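/- There is a universal constant C such that for every α > 0, every x ∈ Z^4 and every r ≥ 2, the uniform spanning tree 𝔗 of Z^4 satisfies, almost surely, Var^η(|M_α(x,r)|) ≤ C · α · (r⁶/log r) · Cap(η ∩ Λ(x,3r)), where η = Γ(0,∞) is the future of the origin in 𝔗 and Var^η denotes variance conditional on η. -/

import Mathlib

open MeasureTheory Filter Set
open scoped ENNReal Classical Topology

noncomputable section

abbrev V4 : Type := Fin 4 → ℤ

/-- Nearest-neighbour adjacency in `ℤ⁴`. -/
def latAdj (x y : V4) : Prop := ∑ i, |x i - y i| = 1

/-- The vertices of the box `[-n,n]⁴`. -/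
def boxV (n : ℕ) : Finset V4 := Fintype.piFinset fun _ => Finset.Icc (-(n : ℤ)) (n : ℤ)

/-- The nearest-neighbour edges of the box `[-n,n]⁴`. -/
def boxEdges (n : ℕ) : Finset (Sym2 V4) :=
  ((boxV n ×ˢ boxV n).filter fun p => latAdj p.1 p.2).image fun p => s(p.1, p.2)

/-- `x` and `y` are connected using edges from `T`. -/
def connIn (T : Set (Sym2 V4)) (x y : V4) : Prop :=
  Relation.ReflTransGen (fun a b => s(a, b) ∈ T) x y

/-- `T` is a spanning tree of the box `[-n,n]⁴`. -/
def IsBoxSpanningTree (n : ℕ) (T : Finset (Sym2 V4)) : Prop :=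
  T ⊆ boxEdges n ∧ (∀ x ∈ boxV n, ∀ y ∈ boxV n, connIn (T : Set (Sym2 V4)) x y) ∧
    T.card + 1 = (boxV n).card

/-- The number of spanning trees of the box `[-n,n]⁴` containing a given edge set `E`. -/
def treeCount (n : ℕ) (E : Finset (Sym2 V4)) : ℕ :=
  ((boxEdges n).powerset.filter fun T => IsBoxSpanningTree n T ∧ E ⊆ T).card

/-- `𝔗` is distributed (under `P`) as the uniform spanning tree of `ℤ⁴`, i.e. as the
infinite-volume limit of the uniform spanning trees of the boxes `[-n,n]⁴` (Pemantle). -/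
def IsUST4 {Ω : Type*} [MeasurableSpace Ω] (P : Measure Ω) (𝔗 : Ω → Set (Sym2 V4)) : Prop :=
  IsProbabilityMeasure P ∧
  (∀ e : Sym2 V4, MeasurableSet {ω | e ∈ 𝔗 ω}) ∧
  ∀ E : Finset (Sym2 V4),
    Tendsto (fun n => (treeCount n E : ℝ) / (treeCount n ∅ : ℝ)) atTop
      (𝓝 (P {ω | (E : Set (Sym2 V4)) ⊆ 𝔗 ω}).toReal)

/-- The graph on `ℤ⁴` whose edges are the elements of `T`. -/
def treeGraph (T : Set (Sym2 V4)) : SimpleGraph V4 := SimpleGraph.fromEdgeSet T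

/-- The intrinsic (graph) distance in `T`. -/
def treeDist (T : Set (Sym2 V4)) (x y : V4) : ℕ := (treeGraph T).dist x y

/-- The intrinsic ball of radius `n` around `x` in `T`. -/
def treeBall (T : Set (Sym2 V4)) (x : V4) (n : ℕ) : Set V4 :=
  {y | (treeGraph T).Reachable x y ∧ treeDist T x y ≤ n}

/-- The `ℓ∞` ball of (real) radius `r` around `x` in `ℤ⁴`. -/
def boxR (x : V4) (r : ℝ) : Set V4 := {y | ∀ i, |(y i : ℝ) - (x i : ℝ)| ≤ r}


/-- The lattice neighbours of `y` in `ℤ⁴`. -/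
def latNbrs (y : V4) : Finset V4 :=
  Finset.univ.image fun p : Fin 4 × Bool =>
    Function.update y p.1 (y p.1 + if p.2 then 1 else -1)

/-- The number of `n`-step nearest-neighbour paths started at `a` whose positions at
times `1,…,n` all avoid `A`. -/
def avoidCount (A : Set V4) : ℕ → V4 → ℕ
  | 0, _ => 1
  | n + 1, a => ∑ b ∈ (latNbrs a).filter (fun b => b ∉ A), avoidCount A n b

/-- The probability that the simple random walk on `ℤ⁴` started at `a` never returns
to `A` after time zero. -/
def escProb (A : Set V4) (a : V4) : ℝ := ⨅ n : ℕ, (avoidCount A n a : ℝ) / 8 ^ n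

/-- The capacity of `A ⊆ ℤ⁴`: `Cap(A) = Σ_{a∈A} deg(a) P_a(no return to A)`. -/
def cap4 (A : Set V4) : ℝ := ∑' a : A, 8 * escProb A a

/-- The number of `n`-step nearest-neighbour paths started at `x` which visit `S` by
time `n`. -/
def hitCount (S : Set V4) : ℕ → V4 → ℕ
  | 0, x => if x ∈ S then 1 else 0
  | n + 1, x => if x ∈ S then 8 ^ (n + 1) else ∑ b ∈ latNbrs x, hitCount S n b

/-- The probability that the simple random walk on `ℤ⁴` started at `x` ever hits `S`. -/
def hitProb (S : Set V4) (x : V4) : ℝ := ⨆ n : ℕ, (hitCount S n x : ℝ) / 8 ^ n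

/-- The `ℓ∞` ball of radius `r ∈ ℕ` around `x` in `ℤ⁴`, as a set. -/
def boxSet (x : V4) (r : ℕ) : Set V4 := {y | ∀ i, |y i - x i| ≤ (r : ℤ)}

/-- The `ℓ∞` ball of radius `r ∈ ℕ` around `x` in `ℤ⁴`, as a finset. -/
def boxFinset (x : V4) (r : ℕ) : Finset V4 :=
  Fintype.piFinset fun i => Finset.Icc (x i - r) (x i + r)

/-- The vertex set of the future `Γ(x,∞)` of `x` in the tree `T`: the vertices `y` such
that every infinite self-avoiding path in `T` started at `x` passes through `y`. -/
def futureSet (T : Set (Sym2 V4)) (x : V4) : Set V4 :=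
  {y | ¬ ∃ p : ℕ → V4, Function.Injective p ∧ p 0 = x ∧
    (∀ n, s(p n, p (n + 1)) ∈ T) ∧ ∀ n, p n ≠ y}

/-- The vertex set of the path `Γ(y, 0 ∧ y)` from `y` to the meeting point `0 ∧ y` of the
futures of `y` and `0` in the tree `T`. -/
def pathToMeet (T : Set (Sym2 V4)) (y : V4) : Set V4 :=
  (futureSet T y \ futureSet T 0) ∪ {m | futureSet T m = futureSet T 0 ∩ futureSet T y}

/-- The path `Γ(y, 0 ∧ y)` (starting at `y`) is `(α,r)`-good:
`Σ_{z ∈ Λ(y,6r)} P_z(hit Γ(y,0∧y) ∩ Λ(y,6r)) ≤ α r⁴ / log r`. -/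
def isGood (T : Set (Sym2 V4)) (y : V4) (α : ℝ) (r : ℕ) : Prop :=
  ∑ z ∈ boxFinset y (6 * r), hitProb (pathToMeet T y ∩ boxSet y (6 * r)) z ≤
    α * (r : ℝ) ^ 4 / Real.log r

/-- The set `M_α(x,r)` of points `y ∈ Λ(x,3r)` whose path to `0 ∧ y` stays in `Λ(x,3r)`,
has length at most `r²/(log r)^{1/3}`, and is `(α,r)`-good. -/
def Mset (T : Set (Sym2 V4)) (α : ℝ) (x : V4) (r : ℕ) : Set V4 :=
  {y | y ∈ boxSet x (3 * r) ∧ pathToMeet T y ⊆ boxSet x (3 * r) ∧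
    ((pathToMeet T y).ncard : ℝ) - 1 ≤ (r : ℝ) ^ 2 / Real.log r ^ ((1:ℝ)/3) ∧
    isGood T y α r}

/-- The σ-algebra on subsets of `ℤ⁴` generated by the membership events. -/
def vertexSetMS : MeasurableSpace (Set V4) :=
  MeasurableSpace.generateFrom {A | ∃ v : V4, A = {S | v ∈ S}}

/-- The σ-algebra generated by the future `η = Γ(0,∞)` of the origin. -/
def futureSigma {Ω : Type*} [MeasurableSpace Ω] (𝔗 : Ω → Set (Sym2 V4)) :
    MeasurableSpace Ω :=
  MeasurableSpace.comap (fun ω => futureSet (𝔗 ω) 0) vertexSetMS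

set_option linter.unusedSectionVars false
set_option linter.unusedVariables false
set_option linter.unusedSimpArgs false
set_option linter.style.longLine false

section Forest
variable {V : Type*} [DecidableEq V]

/-- `f` is a rooted forest on `D`: every `v ∈ D` has a parent `f v ∈ nb v`, points off `D` are
fixed, and following parents always leaves `D`. -/
def IsForest (nb : V → Finset V) (D : Finset V) (f : V → V) : Prop :=
  (∀ v ∈ D, f v ∈ nb v) ∧ (∀ v ∉ D, f v = v) ∧ ∀ v, ∃ k, f^[k] v ∉ D

theorem finite_forests (nb : V → Finset V) (D : Finset V) : {f | IsForest nb D f}.Finite := by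
  refine Set.Finite.of_finite_image (f := fun (f : V → V) (v : D) => f v) ?_ ?_
  · refine Set.Finite.subset (Set.Finite.pi' fun v : D => (nb v).finite_toSet) ?_
    rintro _ ⟨f, hf, rfl⟩ v
    exact hf.1 v v.2
  · intro f hf g hg h
    funext v
    by_cases hv : v ∈ D
    · exact congrFun h ⟨v, hv⟩
    · rw [hf.2.1 v hv, hg.2.1 v hv]

def forests (nb : V → Finset V) (D : Finset V) : Finset (V → V) := (finite_forests nb D).toFinset

@[simp] theorem mem_forests {nb : V → Finset V} {D : Finset V} {f : V → V} :
    f ∈ forests nb D ↔ IsForest nb D f := by simp [forests]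

/-- The orbit of `v` under `f` meets `S`. -/
def Leads (f : V → V) (v : V) (S : Set V) : Prop := ∃ k, f^[k] v ∈ S

theorem leads_of_mem {f : V → V} {v : V} {S : Set V} (h : v ∈ S) : Leads f v S := ⟨0, h⟩

theorem leads_step {f : V → V} {v : V} {S : Set V} :
    Leads f v S ↔ v ∈ S ∨ Leads f (f v) S := by
  constructor
  · rintro ⟨k, hk⟩
    cases k with
    | zero => exact Or.inl hk
    | succ k => exact Or.inr ⟨k, hk⟩
  · rintro (h | ⟨k, hk⟩)
    · exact ⟨0, h⟩
    · exact ⟨k + 1, hk⟩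

theorem leads_mono {f : V → V} {v : V} {S T : Set V} (h : S ⊆ T) (hl : Leads f v S) :
    Leads f v T := hl.imp fun _ hk => h hk

theorem leads_iterate {f : V → V} {v : V} {S : Set V} (k : ℕ) (h : Leads f (f^[k] v) S) :
    Leads f v S := by
  obtain ⟨j, hj⟩ := h
  exact ⟨j + k, by rwa [Function.iterate_add_apply]⟩

theorem iterate_congr_of {f g : V → V} {x : V} {k : ℕ}
    (h : ∀ j < k, f (f^[j] x) = g (f^[j] x)) : g^[k] x = f^[k] x := by
  induction k with
  | zero => rfl
  | succ k ih =>
    rw [Function.iterate_succ_apply', Function.iterate_succ_apply',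
      ih fun j hj => h j (by omega), h k (by omega)]

theorem iterate_fixed {f : V → V} {x : V} (h : f x = x) (k : ℕ) : f^[k] x = x :=
  Function.iterate_fixed h k

namespace IsForest
variable {nb : V → Finset V} {D : Finset V} {f : V → V}

theorem fixed_of_notMem (hf : IsForest nb D f) {v : V} {j k : ℕ} (hj : f^[j] v ∉ D) (h : j ≤ k) :
    f^[k] v = f^[j] v := by
  obtain ⟨i, rfl⟩ := Nat.exists_eq_add_of_le' h
  rw [Function.iterate_add_apply, iterate_fixed (hf.2.1 _ hj)]

theorem not_leads_self (hf : IsForest nb D f) {v : V} (hv : v ∈ D) : ¬ Leads f (f v) {v} := by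
  rintro ⟨k, hk⟩
  have hp : f^[k + 1] v = v := hk
  obtain ⟨j, hj⟩ := hf.2.2 v
  have h1 : f^[(k + 1) * j] v = v := by
    rw [Function.iterate_mul]; exact iterate_fixed hp j
  have h2 := hf.fixed_of_notMem hj (show j ≤ (k + 1) * j by nlinarith)
  rw [h1] at h2
  exact hj (h2 ▸ hv)

/-- Detaching a vertex from its parent. -/
theorem erase (hf : IsForest nb D f) (v : V) :
    IsForest nb (D.erase v) (Function.update f v v) := by
  refine ⟨fun x hx => ?_, fun x hx => ?_, fun x => ?_⟩
  · rw [Finset.mem_erase] at hx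
    rw [Function.update_of_ne hx.1]; exact hf.1 x hx.2
  · by_cases h : x = v
    · subst h; simp
    · rw [Function.update_of_ne h]
      exact hf.2.1 x fun h' => hx (Finset.mem_erase.2 ⟨h, h'⟩)
  · by_cases h : ∃ k, f^[k] x = v
    · have := Nat.find_spec h
      refine ⟨Nat.find h, ?_⟩
      rw [iterate_congr_of (f := f), this]
      · simp
      · intro j hj
        rw [Function.update_of_ne (Nat.find_min h hj)]
    · push Not at h
      obtain ⟨k, hk⟩ := hf.2.2 x
      refine ⟨k, ?_⟩
      rw [iterate_congr_of (f := f)]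
      · exact fun h' => hk (Finset.mem_of_mem_erase h')
      · intro j _
        rw [Function.update_of_ne (h j)]

end IsForest

theorem update_iterate_of_not_leads {f : V → V} {x v w : V} (h : ¬ Leads f x {v}) (k : ℕ) :
    (Function.update f v w)^[k] x = f^[k] x := by
  refine iterate_congr_of fun j _ => ?_
  rw [Function.update_of_ne]
  exact fun h' => h ⟨j, h'⟩

theorem leads_update_of_not_leads {f : V → V} {x v w : V} (h : ¬ Leads f x {v}) {S : Set V} :
    Leads (Function.update f v w) x S ↔ Leads f x S := by
  simp only [Leads, update_iterate_of_not_leads h]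

theorem exists_first_iterate {f : V → V} {x v : V} (h : Leads f x {v}) :
    ∃ k, f^[k] x = v ∧ ∀ j < k, f^[j] x ≠ v := by
  refine ⟨Nat.find h, Nat.find_spec h, fun j hj => Nat.find_min h hj⟩

theorem leads_update_self {f : V → V} {x v w : V} (h : Leads f x {v}) :
    Leads (Function.update f v w) x {v} := by
  obtain ⟨k, hk, hj⟩ := exists_first_iterate h
  refine ⟨k, ?_⟩
  rw [iterate_congr_of (f := f)]
  · exact hk
  · intro j hj'
    rw [Function.update_of_ne (hj j hj')]

/-- Attaching an isolated root `v` to a neighbour in another tree. -/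
theorem IsForest.attach {nb : V → Finset V} {D : Finset V} {f : V → V} {v w : V} (hv : v ∈ D)
    (hf : IsForest nb (D.erase v) f) (hw : w ∈ nb v) (hl : ¬ Leads f w {v}) :
    IsForest nb D (Function.update f v w) := by
  refine ⟨fun x hx => ?_, fun x hx => ?_, fun x => ?_⟩
  · by_cases h : x = v
    · subst h; simpa using hw
    · rw [Function.update_of_ne h]; exact hf.1 x (Finset.mem_erase.2 ⟨h, hx⟩)
  · have h : x ≠ v := fun h => hx (h ▸ hv)
    rw [Function.update_of_ne h]
    exact hf.2.1 x fun h' => hx (Finset.mem_of_mem_erase h')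
  · have key : ∀ x, ¬ Leads f x {v} → ∃ k, (Function.update f v w)^[k] x ∉ D := by
      intro x h
      obtain ⟨k, hk⟩ := hf.2.2 x
      refine ⟨k, ?_⟩
      rw [update_iterate_of_not_leads h]
      exact fun h' => hk (Finset.mem_erase.2 ⟨fun h'' => h ⟨k, h''⟩, h'⟩)
    by_cases h : Leads f x {v}
    · obtain ⟨k, hk⟩ := leads_update_self (w := w) h
      obtain ⟨j, hj⟩ := key w hl
      refine ⟨j + 1 + k, ?_⟩
      rw [Function.iterate_add_apply, show (Function.update f v w)^[k] x = v from hk,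
        Function.iterate_succ_apply]
      simpa using hj
    · exact key x h

/-- Fibration of the forests on `D` over the forests on `D \ {v}`. -/
theorem sum_forests_erase {M : Type*} [AddCommMonoid M] (nb : V → Finset V) {D : Finset V} {v : V}
    (hv : v ∈ D) (F : (V → V) → M) :
    ∑ f ∈ forests nb D, F f = ∑ f ∈ forests nb (D.erase v),
      ∑ w ∈ (nb v).filter (fun w => ¬ Leads f w {v}), F (Function.update f v w) := by
  rw [Finset.sum_sigma']
  refine Finset.sum_bij' (fun f _ => ⟨Function.update f v v, f v⟩)
    (fun p _ => Function.update p.1 v p.2) ?_ ?_ ?_ ?_ ?_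
  · intro f hf
    rw [mem_forests] at hf
    simp only [Finset.mem_sigma, mem_forests, Finset.mem_filter]
    refine ⟨hf.erase v, hf.1 v hv, ?_⟩
    rw [leads_update_of_not_leads (hf.not_leads_self hv)]
    exact hf.not_leads_self hv
  · rintro ⟨f, w⟩ h
    simp only [Finset.mem_sigma, mem_forests, Finset.mem_filter] at h
    exact mem_forests.2 (h.1.attach hv h.2.1 h.2.2)
  · intro f _
    simp
  · rintro ⟨f, w⟩ h
    simp only [Finset.mem_sigma, mem_forests, Finset.mem_filter] at h
    have : f v = v := h.1.2.1 v (by simp)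
    simp only [Function.update_idem, Function.update_self, Sigma.mk.injEq, heq_eq_eq, and_true]
    nth_rw 2 [← this]
    simp
  · intro f _
    simp

/-- Number of forests on `D`. -/
def numF (nb : V → Finset V) (D : Finset V) : ℝ := (forests nb D).card

/-- Number of forests on `D` in which `v` leads to `S`. -/
def numL (nb : V → Finset V) (D : Finset V) (S : Set V) (v : V) : ℝ :=
  ((forests nb D).filter fun f => Leads f v S).card

theorem numL_eq_sum (nb : V → Finset V) (D : Finset V) (S : Set V) (v : V) :
    numL nb D S v = ∑ f ∈ forests nb D, if Leads f v S then (1 : ℝ) else 0 := by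
  simp [numL]

theorem numF_eq_sum (nb : V → Finset V) (D : Finset V) :
    numF nb D = ∑ f ∈ forests nb D, (1 : ℝ) := by
  simp [numF]

theorem numL_nonneg (nb : V → Finset V) (D : Finset V) (S : Set V) (v : V) :
    0 ≤ numL nb D S v := by simp [numL]

theorem numF_nonneg (nb : V → Finset V) (D : Finset V) : 0 ≤ numF nb D := by simp [numF]

theorem numL_le_numF (nb : V → Finset V) (D : Finset V) (S : Set V) (v : V) :
    numL nb D S v ≤ numF nb D := by
  unfold numL numF
  exact_mod_cast Finset.card_filter_le _ _

/-- `numF` in terms of the forests on `D \ {v}`. -/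
theorem numF_erase (nb : V → Finset V) {D : Finset V} {v : V} (hv : v ∈ D) :
    numF nb D = ∑ w ∈ nb v, (numF nb (D.erase v) - numL nb (D.erase v) {v} w) := by
  rw [numF_eq_sum, sum_forests_erase nb hv]
  simp_rw [numL_eq_sum, numF_eq_sum, ← Finset.sum_sub_distrib]
  rw [Finset.sum_comm]
  refine Finset.sum_congr rfl fun f _ => ?_
  rw [Finset.sum_filter]
  refine Finset.sum_congr rfl fun w _ => ?_
  split_ifs <;> simp_all

theorem leads_update_iff {f : V → V} {x v w : V} (h : ¬ Leads f w {v}) {S : Set V} (hvS : v ∉ S)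
    (hfv : f v = v) :
    Leads (Function.update f v w) x S ↔
      (Leads f x S) ∨ (Leads f x {v} ∧ Leads f w S) := by
  by_cases hx : Leads f x {v}
  · have hxS : Leads (Function.update f v w) x S ↔
        (∃ k, f^[k] x ∈ S) ∨ Leads f w S := by
      obtain ⟨k, hk, hj⟩ := exists_first_iterate hx
      have hit : ∀ i ≤ k, (Function.update f v w)^[i] x = f^[i] x := by
        intro i hi
        refine iterate_congr_of fun j hj' => ?_
        rw [Function.update_of_ne (hj j (by omega))]
      constructor
      · rintro ⟨i, hi⟩
        rcases le_or_gt i k with h1 | h1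
        · left; exact ⟨i, by rwa [hit i h1] at hi⟩
        · right
          obtain ⟨m, rfl⟩ := Nat.exists_eq_add_of_lt h1
          refine ⟨m, ?_⟩
          rw [show k + m + 1 = m + 1 + k by omega, Function.iterate_add_apply, hit k le_rfl, hk,
            Function.iterate_succ_apply, Function.update_self, update_iterate_of_not_leads h] at hi
          exact hi
      · rintro (⟨i, hi⟩ | hw)
        · rcases le_or_gt i k with h1 | h1
          · exact ⟨i, by rwa [hit i h1]⟩
          · exfalso
            obtain ⟨m, rfl⟩ := Nat.exists_eq_add_of_lt h1
            rw [show k + m + 1 = m + 1 + k by omega, Function.iterate_add_apply, hk,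
              iterate_fixed hfv] at hi
            exact hvS hi
        · refine leads_iterate k ?_
          rw [hit k le_rfl, hk, leads_step, Function.update_self]
          exact Or.inr ((leads_update_of_not_leads h).2 hw)
    rw [hxS]
    exact or_congr Iff.rfl (by simp [hx])
  · rw [leads_update_of_not_leads hx]
    simp [hx]

theorem leads_absorb {nb : V → Finset V} {D : Finset V} {f : V → V} (hf : IsForest nb D f)
    {x : V} {S T : Set V} (hS : ∀ v ∈ S, v ∉ D) (hT : ∀ v ∈ T, v ∉ D) (hST : Disjoint S T)
    (h : Leads f x S) : ¬ Leads f x T := by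
  rintro ⟨j, hj⟩
  obtain ⟨i, hi⟩ := h
  rcases le_total i j with hij | hij
  · rw [hf.fixed_of_notMem (hS _ hi) hij] at hj
    exact Set.disjoint_left.1 hST hi hj
  · rw [hf.fixed_of_notMem (hT _ hj) hij] at hi
    exact Set.disjoint_left.1 hST hi hj

/-- Harmonicity of `v ↦ numL nb D S v` in `D`. -/
theorem numL_harmonic (nb : V → Finset V) {D : Finset V} {S : Set V} (hS : ∀ v ∈ S, v ∉ D) {v : V}
    (hv : v ∈ D) :
    ∑ w ∈ nb v, (numL nb D S v - numL nb D S w) = 0 := by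
  have hvS : v ∉ S := fun h => hS v h hv
  have hSv : Disjoint S {v} := by simpa using hvS
  have key : ∀ x, numL nb D S x = ∑ f ∈ forests nb (D.erase v), ∑ w ∈ nb v,
      if ¬ Leads f w {v} ∧ (Leads f x S ∨ Leads f x {v} ∧ Leads f w S) then (1 : ℝ) else 0 := by
    intro x
    rw [numL_eq_sum, sum_forests_erase nb hv]
    refine Finset.sum_congr rfl fun f hf => ?_
    rw [Finset.sum_filter]
    refine Finset.sum_congr rfl fun w _ => ?_
    by_cases h : Leads f w {v}
    · simp [h]
    · have := leads_update_iff (x := x) h hvS ((mem_forests.1 hf).2.1 v (by simp))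
      rw [if_pos h]
      exact if_congr (by simp [h, this]) rfl rfl
  rw [Finset.sum_sub_distrib, sub_eq_zero]
  simp_rw [key]
  rw [Finset.sum_comm]
  conv_rhs => rw [Finset.sum_comm]
  refine Finset.sum_congr rfl fun f hf => ?_
  rw [mem_forests] at hf
  have hfv := hf.2.1 v (by simp)
  have h0 : ∀ w, (if ¬ Leads f w {v} ∧ (Leads f v S ∨ Leads f v {v} ∧ Leads f w S) then (1 : ℝ) else 0)
      = if Leads f w S then 1 else 0 := by
    intro w
    have h1 : ¬ Leads f v S := by
      rintro ⟨k, hk⟩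
      rw [iterate_fixed hfv] at hk; exact hvS hk
    have h2 : Leads f v {v} := leads_of_mem rfl
    have h3 : Leads f w S → ¬ Leads f w {v} := leads_absorb hf
      (fun a ha h => hS a ha (Finset.mem_of_mem_erase h)) (by simp) hSv
    by_cases h : Leads f w S <;> simp_all
  simp_rw [h0]
  have h4 : ∀ x w, (if ¬ Leads f w {v} ∧ (Leads f x S ∨ Leads f x {v} ∧ Leads f w S) then (1 : ℝ) else 0)
      = (if Leads f x S ∧ ¬ Leads f w {v} then 1 else 0)
        + if Leads f w S ∧ Leads f x {v} then 1 else 0 := by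
    intro x w
    have h3 : ∀ w, Leads f w S → ¬ Leads f w {v} := fun w => leads_absorb hf
      (fun a ha h => hS a ha (Finset.mem_of_mem_erase h)) (by simp) hSv
    have := h3 x
    have := h3 w
    by_cases h5 : Leads f w S <;> by_cases h6 : Leads f x S <;> simp_all
  simp_rw [h4, Finset.sum_add_distrib]
  conv_rhs => arg 2; rw [Finset.sum_comm]
  rw [← Finset.sum_add_distrib]
  rw [Finset.sum_comm]
  refine Finset.sum_congr rfl fun x _ => ?_
  rw [← Finset.sum_add_distrib]
  refine Finset.sum_congr rfl fun w _ => ?_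
  by_cases h5 : Leads f x S <;> by_cases h6 : Leads f w {v} <;> simp [h5, h6]

end Forest

section ForestRatio
variable {V : Type*} [DecidableEq V]

/-- `f` and `g` agree on `B`. -/
def AgreeOn (B : Finset V) (f g : V → V) : Prop := ∀ v ∈ B, f v = g v

/-- `g` is defined on `B ⊆ D` and every `g`-orbit from `B` stays in `B` until it exits `D`. -/
def ExitsIn (nb : V → Finset V) (D B : Finset V) (g : V → V) : Prop :=
  B ⊆ D ∧ (∀ v ∈ B, g v ∈ nb v) ∧ ∀ v ∈ B, ∃ k, g^[k] v ∉ D ∧ ∀ j < k, g^[j] v ∈ B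

theorem exists_first_of {p : ℕ → Prop} (h : ∃ k, p k) : ∃ k, p k ∧ ∀ j < k, ¬ p j :=
  ⟨Nat.find h, Nat.find_spec h, fun _ hj => Nat.find_min h hj⟩

theorem ExitsIn.isForest_piecewise {nb : V → Finset V} {D B : Finset V} {f g : V → V}
    (hg : ExitsIn nb D B g) (hf : IsForest nb (D \ B) f) :
    IsForest nb D (B.piecewise g f) := by
  refine ⟨fun v hv => ?_, fun v hv => ?_, fun v => ?_⟩
  · by_cases h : v ∈ B
    · simpa [h] using hg.2.1 v h
    · simpa [h] using hf.1 v (by simp [hv, h])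
  · have h : v ∉ B := fun h => hv (hg.1 h)
    simpa [h] using hf.2.1 v (by simp [hv])
  · have hB : ∀ v ∈ B, ∃ k, (B.piecewise g f)^[k] v ∉ D := by
      intro v hv
      obtain ⟨k, hk, hj⟩ := hg.2.2 v hv
      refine ⟨k, ?_⟩
      rwa [iterate_congr_of (f := g)]
      intro j hj'
      simp [hj j hj']
    by_cases h : ∃ k, f^[k] v ∈ B
    · obtain ⟨k, hk, hj⟩ := exists_first_of h
      obtain ⟨i, hi⟩ := hB _ hk
      have e : (B.piecewise g f)^[k] v = f^[k] v := by
        refine iterate_congr_of fun j hj' => ?_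
        simp [hj j hj']
      exact ⟨i + k, by rwa [Function.iterate_add_apply, e]⟩
    · push Not at h
      obtain ⟨k, hk⟩ := hf.2.2 v
      refine ⟨k, ?_⟩
      rw [iterate_congr_of (f := f)]
      · intro h'
        exact hk (by simp [h', h k])
      · intro j hj'
        simp [h j]

theorem IsForest.restrict {nb : V → Finset V} {D B : Finset V} {f : V → V}
    (hf : IsForest nb D f) : IsForest nb (D \ B) (B.piecewise id f) := by
  refine ⟨fun v hv => ?_, fun v hv => ?_, fun v => ?_⟩
  · rw [Finset.mem_sdiff] at hv
    simpa [hv.2] using hf.1 v hv.1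
  · by_cases h : v ∈ B
    · simp [h]
    · have h' : v ∉ D := fun h' => hv (by simp [h, h'])
      simpa [h] using hf.2.1 v h'
  · obtain ⟨k, hk, hj⟩ := exists_first_of (p := fun k => f^[k] v ∉ D \ B)
      ((hf.2.2 v).imp fun k hk => by simp [hk])
    refine ⟨k, ?_⟩
    rwa [iterate_congr_of (f := f)]
    intro j hj'
    have := hj j hj'
    simp only [not_not, Finset.mem_sdiff] at this
    simp [this.2]

/-- Forests on `D` with prescribed values on `B` are forests on `D \ B`. -/
theorem sum_forests_piecewise {M : Type*} [AddCommMonoid M] {nb : V → Finset V} {D B : Finset V}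
    {g : V → V} (hg : ExitsIn nb D B g) (F : (V → V) → M) :
    ∑ f ∈ (forests nb D).filter (fun f => AgreeOn B f g), F f =
      ∑ f ∈ forests nb (D \ B), F (B.piecewise g f) := by
  refine Finset.sum_bij' (fun f _ => B.piecewise id f) (fun f _ => B.piecewise g f) ?_ ?_ ?_ ?_ ?_
  · intro f hf
    rw [Finset.mem_filter, mem_forests] at hf
    exact mem_forests.2 hf.1.restrict
  · intro f hf
    rw [mem_forests] at hf
    rw [Finset.mem_filter, mem_forests]
    exact ⟨hg.isForest_piecewise hf, fun v hv => by simp [hv]⟩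
  · intro f hf
    rw [Finset.mem_filter] at hf
    funext v
    by_cases h : v ∈ B
    · simp [h, hf.2 v h]
    · simp [h]
  · intro f hf
    rw [mem_forests] at hf
    funext v
    by_cases h : v ∈ B
    · simp [h, hf.2.1 v (by simp [h])]
    · simp [h]
  · intro f hf
    rw [Finset.mem_filter] at hf
    congr 1
    funext v
    by_cases h : v ∈ B
    · simp [h, hf.2 v h]
    · simp [h]

/-- Probability that the random forest on `D` leads `v` to `S`. -/
def lpr (nb : V → Finset V) (D : Finset V) (S : Set V) (v : V) : ℝ := numL nb D S v / numF nb D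

theorem lpr_nonneg (nb : V → Finset V) (D : Finset V) (S : Set V) (v : V) : 0 ≤ lpr nb D S v :=
  div_nonneg (numL_nonneg ..) (numF_nonneg ..)

theorem lpr_le_one (nb : V → Finset V) (D : Finset V) (S : Set V) (v : V) : lpr nb D S v ≤ 1 :=
  div_le_one_of_le₀ (numL_le_numF ..) (numF_nonneg ..)

theorem numF_pos_iff {nb : V → Finset V} {D : Finset V} :
    0 < numF nb D ↔ (forests nb D).Nonempty := by
  simp [numF, Finset.card_pos]

theorem lpr_of_mem {nb : V → Finset V} {D : Finset V} (hD : 0 < numF nb D) {S : Set V} {v : V}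
    (h : v ∈ S) : lpr nb D S v = 1 := by
  rw [lpr, div_eq_one_iff_eq hD.ne']
  unfold numL numF
  rw [Finset.filter_true_of_mem fun f _ => leads_of_mem h]

theorem numL_of_notMem {nb : V → Finset V} {D : Finset V} {S : Set V} {v : V}
    (h : v ∉ S) (h' : v ∉ D) : numL nb D S v = 0 := by
  unfold numL
  rw [Finset.filter_false_of_mem]
  · simp
  · rintro f hf ⟨k, hk⟩
    rw [iterate_fixed ((mem_forests.1 hf).2.1 v h')] at hk
    exact h hk

theorem lpr_of_notMem {nb : V → Finset V} {D : Finset V} {S : Set V} {v : V}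
    (h : v ∉ S) (h' : v ∉ D) : lpr nb D S v = 0 := by
  rw [lpr, numL_of_notMem h h', zero_div]

/-- The graph Laplacian. -/
def lap (nb : V → Finset V) (u : V → ℝ) (v : V) : ℝ := ∑ w ∈ nb v, (u v - u w)

theorem lap_lpr (nb : V → Finset V) {D : Finset V} {S : Set V} (hS : ∀ v ∈ S, v ∉ D) {v : V}
    (hv : v ∈ D) : lap nb (lpr nb D S) v = 0 := by
  unfold lap lpr
  simp_rw [← sub_div]
  rw [← Finset.sum_div, numL_harmonic nb hS hv, zero_div]

theorem lap_sub (nb : V → Finset V) (u u' : V → ℝ) (v : V) :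
    lap nb (fun x => u x - u' x) v = lap nb u v - lap nb u' v := by
  unfold lap
  rw [← Finset.sum_sub_distrib]
  exact Finset.sum_congr rfl fun _ _ => by ring

theorem lap_add (nb : V → Finset V) (u u' : V → ℝ) (v : V) :
    lap nb (fun x => u x + u' x) v = lap nb u v + lap nb u' v := by
  unfold lap
  rw [← Finset.sum_add_distrib]
  exact Finset.sum_congr rfl fun _ _ => by ring

theorem lap_const_mul (nb : V → Finset V) (c : ℝ) (u : V → ℝ) (v : V) :
    lap nb (fun x => c * u x) v = c * lap nb u v := by
  unfold lap
  rw [Finset.mul_sum]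
  exact Finset.sum_congr rfl fun _ _ => by ring

theorem lap_const_sub (nb : V → Finset V) (c : ℝ) (u : V → ℝ) (v : V) :
    lap nb (fun x => c - u x) v = - lap nb u v := by
  unfold lap
  rw [← Finset.sum_neg_distrib]
  exact Finset.sum_congr rfl fun _ _ => by ring

theorem max_principle {nb : V → Finset V} {D : Finset V} (hD : 0 < numF nb D) {u : V → ℝ}
    (hu : ∀ v ∈ D, lap nb u v ≤ 0) (hb : ∀ v ∉ D, u v ≤ 0) (v : V) : u v ≤ 0 := by
  obtain ⟨f, hf⟩ := numF_pos_iff.1 hD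
  rw [mem_forests] at hf
  by_contra hv
  push Not at hv
  have hvD : v ∈ D := by
    by_contra h; exact absurd (hb v h) (not_le.2 hv)
  obtain ⟨m, hmD, hm⟩ := Finset.exists_max_image D u ⟨v, hvD⟩
  have hmpos : 0 < u m := hv.trans_le (hm v hvD)
  have hmax : ∀ x, u x ≤ u m := fun x => by
    by_cases h : x ∈ D
    · exact hm x h
    · exact (hb x h).trans hmpos.le
  have key : ∀ k, u (f^[k] m) = u m := by
    intro k
    induction k with
    | zero => rfl
    | succ k ih =>
      have hk : f^[k] m ∈ D := by
        by_contra h; have := hb _ h; linarith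
      have h1 := hu _ hk
      unfold lap at h1
      have h2 : ∀ w ∈ nb (f^[k] m), 0 ≤ u (f^[k] m) - u w := fun w _ => by
        rw [ih]; linarith [hmax w]
      have h3 := (Finset.sum_eq_zero_iff_of_nonneg h2).1 (le_antisymm h1 (Finset.sum_nonneg h2))
        _ (hf.1 _ hk)
      rw [Function.iterate_succ_apply']
      linarith
  obtain ⟨k, hk⟩ := hf.2.2 m
  have := hb _ hk
  rw [key] at this
  linarith

/-- Comparison principle. -/
theorem le_of_lap_le {nb : V → Finset V} {D : Finset V} (hD : 0 < numF nb D) {u u' : V → ℝ}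
    (hu : ∀ v ∈ D, lap nb u v ≤ lap nb u' v) (hb : ∀ v ∉ D, u v ≤ u' v) (v : V) : u v ≤ u' v := by
  have := max_principle hD (u := fun x => u x - u' x)
    (fun v hv => by rw [lap_sub]; linarith [hu v hv]) (fun v hv => by linarith [hb v hv]) v
  linarith

theorem lpr_mono {nb : V → Finset V} {D D' : Finset V} (h : D' ⊆ D) (hD' : 0 < numF nb D')
    (hD : 0 < numF nb D) {S : Set V} (hS : ∀ v ∈ S, v ∉ D) (v : V) :
    lpr nb D' S v ≤ lpr nb D S v := by
  refine le_of_lap_le hD' (fun v hv => ?_) (fun v hv => ?_) v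
  · rw [lap_lpr nb (fun v hv h' => hS v hv (h h')) hv, lap_lpr nb hS (h hv)]
  · by_cases hvS : v ∈ S
    · rw [lpr_of_mem hD hvS, lpr_of_mem hD' hvS]
    · rw [lpr_of_notMem hvS hv]; exact lpr_nonneg ..

theorem numF_restrict_pos {nb : V → Finset V} {D : Finset V} (hD : 0 < numF nb D) (B : Finset V) :
    0 < numF nb (D \ B) := by
  obtain ⟨f, hf⟩ := numF_pos_iff.1 hD
  exact numF_pos_iff.2 ⟨_, mem_forests.2 (mem_forests.1 hf).restrict⟩

theorem numF_restrict_pos' {nb : V → Finset V} {D D' : Finset V} (hD : 0 < numF nb D)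
    (h : D' ⊆ D) : 0 < numF nb D' := by
  have := numF_restrict_pos hD (D \ D')
  rwa [Finset.sdiff_sdiff_eq_self h] at this

theorem numF_erase_pos {nb : V → Finset V} {D : Finset V} (hD : 0 < numF nb D) (v : V) :
    0 < numF nb (D.erase v) := numF_restrict_pos' hD (Finset.erase_subset _ _)

theorem numF_erase' {nb : V → Finset V} {D : Finset V} (hD : 0 < numF nb D) {v : V} (hv : v ∈ D) :
    numF nb D = numF nb (D.erase v) * ∑ w ∈ nb v, (1 - lpr nb (D.erase v) {v} w) := by
  rw [numF_erase nb hv, Finset.mul_sum]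
  have := (numF_erase_pos hD v).ne'
  refine Finset.sum_congr rfl fun w _ => ?_
  unfold lpr
  field_simp

/-- Ratios `N(D \ B) / N(D)` increase with `D`. -/
theorem numF_ratio_mono {nb : V → Finset V} {D D' B : Finset V} (h : D' ⊆ D) (hB : B ⊆ D')
    (hD : 0 < numF nb D) :
    numF nb (D' \ B) * numF nb D ≤ numF nb (D \ B) * numF nb D' := by
  induction B using Finset.induction_on with
  | empty => simp [mul_comm]
  | insert u B hu ih =>
    have ih := ih fun x hx => hB (Finset.mem_insert_of_mem hx)
    have huD' : u ∈ D' := hB (Finset.mem_insert_self _ _)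
    have e : ∀ D : Finset V, D \ insert u B = (D \ B).erase u := by
      intro D; ext x; simp only [Finset.mem_sdiff, Finset.mem_insert, Finset.mem_erase]; tauto
    rw [e, e]
    have p1 := numF_restrict_pos hD B
    have p2 := numF_restrict_pos (numF_restrict_pos' hD h) B
    have e1 := numF_erase' p1 (v := u) (by simp [hu, h huD'])
    have e2 := numF_erase' p2 (v := u) (by simp [hu, huD'])
    have q1 := numF_erase_pos p1 u
    have q2 := numF_erase_pos p2 u
    set s1 := ∑ w ∈ nb u, (1 - lpr nb ((D \ B).erase u) {u} w)
    set s2 := ∑ w ∈ nb u, (1 - lpr nb ((D' \ B).erase u) {u} w)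
    have hs : s1 ≤ s2 := Finset.sum_le_sum fun w _ => by
      have := lpr_mono (nb := nb) (Finset.erase_subset_erase u (Finset.sdiff_subset_sdiff h subset_rfl))
        q2 q1 (S := {u}) (by simp) w
      linarith
    rw [e1, e2] at ih
    have hs1 : 0 < s1 := by
      rw [e1] at p1; exact pos_of_mul_pos_right p1 q1.le
    have p3 := numF_restrict_pos' hD h
    refine le_of_mul_le_mul_right ?_ hs1
    calc _ ≤ (numF nb ((D' \ B).erase u) * numF nb D) * s2 :=
          mul_le_mul_of_nonneg_left hs (by positivity)
      _ = (numF nb ((D' \ B).erase u) * s2) * numF nb D := by ring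
      _ ≤ _ := ih
      _ = _ := by ring

/-- Edges of a forest. -/
def fEdges (D : Finset V) (f : V → V) : Finset (Sym2 V) := D.image fun v => s(v, f v)

theorem mem_fEdges {D : Finset V} {f : V → V} {e : Sym2 V} :
    e ∈ fEdges D f ↔ ∃ v ∈ D, s(v, f v) = e := by simp [fEdges]

theorem mk_mem_fEdges {D : Finset V} {f : V → V} {x y : V} :
    s(x, y) ∈ fEdges D f ↔ (x ∈ D ∧ f x = y) ∨ (y ∈ D ∧ f y = x) := by
  rw [mem_fEdges]
  constructor
  · rintro ⟨v, hv, h⟩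
    rcases Sym2.eq_iff.1 h with ⟨rfl, rfl⟩ | ⟨rfl, rfl⟩
    · exact Or.inl ⟨hv, rfl⟩
    · exact Or.inr ⟨hv, rfl⟩
  · rintro (⟨h, rfl⟩ | ⟨h, rfl⟩)
    · exact ⟨x, h, rfl⟩
    · exact ⟨y, h, Sym2.eq_swap⟩

/-- Trees with vertex set `A ∋ a0` and edge set `E`, grown leaf by leaf. -/
inductive Grow (nb : V → Finset V) (a0 : V) : Finset V → Finset (Sym2 V) → Prop
  | base : Grow nb a0 {a0} ∅
  | leaf {A : Finset V} {E : Finset (Sym2 V)} {p u : V} : Grow nb a0 A E → p ∈ A → u ∉ A →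
      u ∈ nb p → Grow nb a0 (insert u A) (insert s(u, p) E)

theorem Grow.root_mem {nb : V → Finset V} {a0 : V} {A : Finset V} {E : Finset (Sym2 V)}
    (h : Grow nb a0 A E) : a0 ∈ A := by
  induction h with
  | base => simp
  | leaf _ _ _ _ ih => exact Finset.mem_insert_of_mem ih

theorem Grow.mem_of_edge {nb : V → Finset V} {a0 : V} {A : Finset V} {E : Finset (Sym2 V)}
    (h : Grow nb a0 A E) {x y : V} (hxy : s(x, y) ∈ E) : x ∈ A ∧ y ∈ A := by
  induction h with
  | base => simp at hxy
  | leaf _ hp hu _ ih =>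
    rw [Finset.mem_insert] at hxy
    rcases hxy with hxy | hxy
    · rcases Sym2.eq_iff.1 hxy with ⟨rfl, rfl⟩ | ⟨rfl, rfl⟩ <;> simp [hp]
    · exact ⟨Finset.mem_insert_of_mem (ih hxy).1, Finset.mem_insert_of_mem (ih hxy).2⟩

/-- `g` orients the tree `(A, E)` towards `a`. -/
def Orients (nb : V → Finset V) (A : Finset V) (E : Finset (Sym2 V)) (a : V) (g : V → V) : Prop :=
  IsForest nb (A.erase a) g ∧ E = fEdges (A.erase a) g ∧ ∀ v ∈ A, g v ∈ A

theorem Grow.exists_orients {nb : V → Finset V} (hsymm : ∀ x y, x ∈ nb y ↔ y ∈ nb x) {a0 : V}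
    {A : Finset V} {E : Finset (Sym2 V)} (h : Grow nb a0 A E) {a : V} (ha : a ∈ A) :
    ∃ g, Orients nb A E a g := by
  induction h generalizing a with
  | base =>
    rw [Finset.mem_singleton] at ha
    subst ha
    refine ⟨id, ⟨by simp, by simp, fun v => ⟨0, by simp⟩⟩, by simp [fEdges], by simp⟩
  | @leaf A E p u hG hp hu hup ih =>
    have hstep : ∀ a g, a ∈ A → Orients nb A E a g →
        ∃ g, Orients nb (insert u A) (insert s(u, p) E) a g := by
      rintro a g ha ⟨hg, hE, hA⟩
      have hua : u ≠ a := fun h => hu (h ▸ ha)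
      have e : (insert u A).erase a = insert u (A.erase a) := by
        rw [Finset.erase_insert_of_ne hua]
      have huA : u ∉ A.erase a := fun h => hu (Finset.mem_of_mem_erase h)
      have hpl : ¬ Leads g p {u} := by
        rintro ⟨k, hk⟩
        have : ∀ k, g^[k] p ∈ A := by
          intro k
          induction k with
          | zero => exact hp
          | succ k ih => rw [Function.iterate_succ_apply']; exact hA _ ih
        exact hu (hk ▸ this k)
      refine ⟨Function.update g u p, ?_, ?_, ?_⟩
      · rw [e]
        refine IsForest.attach (Finset.mem_insert_self _ _) ?_ ((hsymm _ _).1 hup) hpl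
        rwa [Finset.erase_insert huA]
      · rw [e, fEdges, Finset.image_insert, hE]
        simp only [Function.update_self]
        congr 1
        refine Finset.image_congr fun v hv => ?_
        have : v ≠ u := fun h => huA (h ▸ hv)
        simp [this]
      · intro v hv
        by_cases h : v = u
        · subst h; simp [hp]
        · rw [Function.update_of_ne h]
          exact Finset.mem_insert_of_mem (hA v ((Finset.mem_insert.1 hv).resolve_left h))
    by_cases hau : a = u
    · subst hau
      obtain ⟨g, hg, hE, hA⟩ := ih hp
      have e : (insert a A).erase a = A := Finset.erase_insert hu
      refine ⟨Function.update g p a, ?_, ?_, ?_⟩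
      · rw [e]
        refine IsForest.attach hp hg hup ?_
        have ha' : g a = a := hg.2.1 a fun h => hu (Finset.mem_of_mem_erase h)
        rintro ⟨k, hk⟩
        rw [iterate_fixed ha'] at hk
        exact hu (hk ▸ hp)
      · rw [e, hE]
        nth_rw 2 [← Finset.insert_erase hp]
        rw [fEdges, fEdges, Finset.image_insert]
        simp only [Function.update_self]
        rw [Sym2.eq_swap]
        congr 1
        refine Finset.image_congr fun v hv => ?_
        have : v ≠ p := fun h => by subst h; simp at hv
        simp [this]
      · intro v hv
        by_cases h : v = p
        · subst h; simp
        · rw [Function.update_of_ne h]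
          rcases Finset.mem_insert.1 hv with rfl | hv
          · rw [hg.2.1 v fun h => hu (Finset.mem_of_mem_erase h)]; simp
          · exact Finset.mem_insert_of_mem (hA v hv)
    · have ha' : a ∈ A := (Finset.mem_insert.1 ha).resolve_left hau
      obtain ⟨g, hg⟩ := ih ha'
      exact hstep a g ha' hg

theorem Orients.iterate_mem {nb : V → Finset V} {A : Finset V} {E : Finset (Sym2 V)} {a : V}
    {g : V → V} (h : Orients nb A E a g) {v : V} (hv : v ∈ A) (k : ℕ) : g^[k] v ∈ A := by
  induction k with
  | zero => exact hv
  | succ k ih => rw [Function.iterate_succ_apply']; exact h.2.2 _ ih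

/-- A forest containing the edges of an oriented tree follows the orientation, provided the sink
is not mapped back into the tree. -/
theorem Orients.eq_of_subset {nb : V → Finset V} {A D : Finset V} {E : Finset (Sym2 V)} {a : V}
    {f g : V → V} (h : Orients nb A E a g) (hE : E ⊆ fEdges D f)
    (ha : a ∈ D → f a ∉ A) {v : V} (hv : v ∈ A) (hva : v ≠ a) : f v = g v ∧ v ∈ D := by
  have key : ∀ k v, v ∈ A → v ≠ a → g^[k] v ∉ A.erase a → f v = g v ∧ v ∈ D := by
    intro k
    induction k with
    | zero => intro v hv hva hk; exact absurd (Finset.mem_erase.2 ⟨hva, hv⟩) hk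
    | succ k ih =>
      intro v hv hva hk
      rw [Function.iterate_succ_apply] at hk
      have hvA : v ∈ A.erase a := Finset.mem_erase.2 ⟨hva, hv⟩
      have he : s(v, g v) ∈ E := by
        rw [h.2.1]; exact mem_fEdges.2 ⟨v, hvA, rfl⟩
      rcases mk_mem_fEdges.1 (hE he) with h1 | h1
      · exact ⟨h1.2, h1.1⟩
      · exfalso
        by_cases hga : g v = a
        · rw [hga] at h1
          exact ha h1.1 (h1.2 ▸ hv)
        · have := (ih (g v) (h.2.2 v hv) hga hk).1
          rw [h1.2] at this
          exact h.1.not_leads_self hvA ⟨1, this.symm⟩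
  obtain ⟨k, hk⟩ := h.1.2.2 v
  exact key k v hv hva hk

theorem Orients.leads {nb : V → Finset V} {A : Finset V} {E : Finset (Sym2 V)} {a : V}
    {g : V → V} (h : Orients nb A E a g) {v : V} (hv : v ∈ A) :
    ∃ k, g^[k] v = a ∧ ∀ j < k, g^[j] v ∈ A.erase a := by
  obtain ⟨k, hk, hj⟩ := exists_first_of (h.1.2.2 v)
  refine ⟨k, ?_, fun j hj' => by simpa using hj j hj'⟩
  by_contra hne
  exact hk (Finset.mem_erase.2 ⟨hne, h.iterate_mem hv k⟩)

theorem Orients.exitsIn {nb : V → Finset V} {A D : Finset V} {E : Finset (Sym2 V)} {a : V}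
    {g : V → V} (h : Orients nb A E a g) (hA : A.erase a ⊆ D) (ha : a ∉ D) :
    ExitsIn nb D (A.erase a) g := by
  refine ⟨hA, h.1.1, fun v hv => ?_⟩
  obtain ⟨k, hk, hj⟩ := h.leads (Finset.mem_of_mem_erase hv)
  exact ⟨k, by rwa [hk], hj⟩

/-- Rooted cylinder count. -/
theorem card_rooted_cylinder {nb : V → Finset V} (hsymm : ∀ x y, x ∈ nb y ↔ y ∈ nb x) {a0 : V}
    {A D : Finset V} {E : Finset (Sym2 V)} (hG : Grow nb a0 A E) (hA : A.erase a0 ⊆ D)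
    (ha : a0 ∉ D) :
    (((forests nb D).filter fun f => E ⊆ fEdges D f).card : ℝ) = numF nb (D \ A) := by
  obtain ⟨g, hg⟩ := hG.exists_orients hsymm hG.root_mem
  have h1 : (forests nb D).filter (fun f => E ⊆ fEdges D f) =
      (forests nb D).filter (fun f => AgreeOn (A.erase a0) f g) := by
    refine Finset.filter_congr fun f _ => ?_
    constructor
    · intro h v hv
      rw [Finset.mem_erase] at hv
      exact (hg.eq_of_subset h (fun h => absurd h ha) hv.2 hv.1).1
    · intro h
      rw [hg.2.1]
      intro e he
      obtain ⟨v, hv, rfl⟩ := mem_fEdges.1 he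
      exact mem_fEdges.2 ⟨v, hA hv, by rw [h v hv]⟩
  rw [h1, Finset.card_eq_sum_ones, sum_forests_piecewise (hg.exitsIn hA ha)]
  have : D \ A.erase a0 = D \ A := by
    ext x; simp only [Finset.mem_sdiff, Finset.mem_erase]
    by_cases h : x = a0
    · subst h; simp [ha]
    · simp [h]
  rw [this, ← Finset.card_eq_sum_ones]; rfl

/-- Unrooted cylinder count. -/
theorem card_cylinder {nb : V → Finset V} (hsymm : ∀ x y, x ∈ nb y ↔ y ∈ nb x) {a0 : V}
    {A D : Finset V} {E : Finset (Sym2 V)} (hG : Grow nb a0 A E) (hA : A ⊆ D) :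
    (((forests nb D).filter fun f => E ⊆ fEdges D f).card : ℝ) =
      ∑ a ∈ A, ∑ w ∈ nb a, (numF nb (D \ A) - numL nb (D \ A) A w) := by
  choose! g hg using fun a (ha : a ∈ A) => hG.exists_orients hsymm ha
  have h1 : (forests nb D).filter (fun f => E ⊆ fEdges D f) =
      A.biUnion fun a => (forests nb D).filter
        fun f => AgreeOn (A.erase a) f (g a) ∧ ¬ Leads f (f a) A := by
    ext f
    simp only [Finset.mem_filter, Finset.mem_biUnion, mem_forests]
    constructor
    · rintro ⟨hf, hE⟩
      obtain ⟨k, hk⟩ := hf.2.2 a0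
      have hfin : ∀ j, f^[j] a0 ∈ A → j ≤ k := fun j hj => by
        by_contra hjk
        rw [hf.fixed_of_notMem hk (by omega : k ≤ j)] at hj
        exact hk (hA hj)
      obtain ⟨m, hm, hmax⟩ := Nat.findGreatest_eq_iff (P := fun j => f^[j] a0 ∈ A) (k := k).1 rfl
        |>.2
        |> fun h => (⟨Nat.findGreatest (fun j => f^[j] a0 ∈ A) k,
            Nat.findGreatest_spec (P := fun j => f^[j] a0 ∈ A) (Nat.zero_le k) hG.root_mem,
            fun j hj => Nat.le_findGreatest (hfin j hj) hj⟩ :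
            ∃ m, f^[m] a0 ∈ A ∧ ∀ j, f^[j] a0 ∈ A → j ≤ m)
      have hl : ¬ Leads f (f (f^[m] a0)) A := by
        rintro ⟨i, hi⟩
        rw [← Function.iterate_succ_apply' f, ← Function.iterate_add_apply] at hi
        have := hmax _ hi
        omega
      refine ⟨_, hm, hf, fun v hv => ?_, hl⟩
      rw [Finset.mem_erase] at hv
      exact ((hg _ hm).eq_of_subset hE (fun _ h => hl ⟨0, h⟩) hv.2 hv.1).1
    · rintro ⟨a, ha, hf, hfa, -⟩
      refine ⟨hf, ?_⟩
      rw [(hg a ha).2.1]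
      intro e he
      obtain ⟨v, hv, rfl⟩ := mem_fEdges.1 he
      exact mem_fEdges.2 ⟨v, hA (Finset.mem_of_mem_erase hv), by rw [hfa v hv]⟩
  rw [h1, Finset.card_biUnion]
  · push_cast
    refine Finset.sum_congr rfl fun a ha => ?_
    have haD := hA ha
    have hga := hg a ha
    have hD : (D.erase a) \ (A.erase a) = D \ A := by
      ext x; simp only [Finset.mem_sdiff, Finset.mem_erase]
      by_cases h : x = a
      · subst h; simp [ha]
      · simp [h]
    have hex := hga.exitsIn (D := D.erase a) (Finset.erase_subset_erase a hA) (by simp)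
    rw [Finset.card_eq_sum_ones, Finset.sum_filter, sum_forests_erase nb haD]
    have h2 : ∀ f ∈ forests nb (D.erase a),
        (∑ w ∈ (nb a).filter (fun w => ¬ Leads f w {a}),
          if AgreeOn (A.erase a) (Function.update f a w) (g a) ∧
            ¬ Leads (Function.update f a w) (Function.update f a w a) A then 1 else 0)
        = if AgreeOn (A.erase a) f (g a) then
          ((nb a).filter fun w => ¬ Leads f w A).card else 0 := by
      intro f hf
      rw [← Finset.sum_filter, ← Finset.card_eq_sum_ones, Finset.filter_filter]
      have e1 : ∀ w, AgreeOn (A.erase a) (Function.update f a w) (g a) ↔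
          AgreeOn (A.erase a) f (g a) := fun w => by
        refine forall₂_congr fun v hv => ?_
        rw [Function.update_of_ne (Finset.ne_of_mem_erase hv)]
      split_ifs with h
      · congr 1
        refine Finset.filter_congr fun w _ => ?_
        rw [e1, Function.update_self]
        have e2 : ¬ Leads f w A → ¬ Leads f w {a} := fun h' h'' =>
          h' (leads_mono (by simpa using ha) h'')
        constructor
        · rintro ⟨h3, -, h4⟩
          rwa [leads_update_of_not_leads h3] at h4
        · intro h3
          exact ⟨e2 h3, h, by rwa [leads_update_of_not_leads (e2 h3)]⟩
      · rw [Finset.card_eq_zero, Finset.filter_eq_empty_iff]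
        intro w _
        rw [e1]
        tauto
    rw [Finset.sum_congr rfl h2, ← Finset.sum_filter, sum_forests_piecewise hex, hD]
    have h3 : ∀ f ∈ forests nb (D \ A), ∀ w,
        Leads ((A.erase a).piecewise (g a) f) w A ↔ Leads f w A := by
      intro f hf w
      have : ∀ f' f'' : V → V, (∀ x ∉ A, f' x = f'' x) → Leads f' w A → Leads f'' w A := by
        intro f' f'' hff hl
        obtain ⟨k, hk, hj⟩ := exists_first_of hl
        refine ⟨k, ?_⟩
        rwa [iterate_congr_of (f := f')]
        intro j hj'
        exact hff _ (hj j hj')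
      have hff : ∀ x ∉ A, ((A.erase a).piecewise (g a) f) x = f x := fun x hx => by
        simp [hx]
      exact ⟨this _ _ hff, this _ _ fun x hx => (hff x hx).symm⟩
    have h4 : ∀ f ∈ forests nb (D \ A),
        ((nb a).filter fun w => ¬ Leads ((A.erase a).piecewise (g a) f) w A).card
        = ∑ w ∈ nb a, if ¬ Leads f w A then 1 else 0 := by
      intro f hf
      simp_rw [h3 f hf]
      rw [Finset.card_filter]
    rw [Finset.sum_congr rfl h4]
    push_cast
    rw [Finset.sum_comm]
    refine Finset.sum_congr rfl fun w _ => ?_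
    rw [numF_eq_sum, numL_eq_sum, ← Finset.sum_sub_distrib]
    refine Finset.sum_congr rfl fun f _ => ?_
    split_ifs <;> simp_all
  · intro a ha b hb hab
    rw [Function.onFun, Finset.disjoint_left]
    rintro f hf hf'
    rw [Finset.mem_filter] at hf hf'
    apply hf'.2.2
    rw [hf.2.1 b (Finset.mem_erase.2 ⟨hab.symm, hb⟩)]
    exact ⟨0, (hg a ha).2.2 b hb⟩

end ForestRatio

section Green
variable {V : Type*} [DecidableEq V]

/-- Symmetric neighbourhood structure. -/
def SymNb (nb : V → Finset V) : Prop := ∀ x y, x ∈ nb y ↔ y ∈ nb x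

theorem sum_nb_swap {nb : V → Finset V} (hs : SymNb nb) {K W : Finset V} (hKW : K ⊆ W)
    (hnb : ∀ v ∈ K, nb v ⊆ W) {F : V → V → ℝ} (hF : ∀ v w, v ∉ K → w ∉ K → F v w = 0) :
    ∑ v ∈ W, ∑ w ∈ nb v, F v w = ∑ v ∈ W, ∑ w ∈ nb v, F w v := by
  have h : ∀ G : V → V → ℝ, (∀ v w, v ∉ K → w ∉ K → G v w = 0) →
      ∑ v ∈ W, ∑ w ∈ nb v, G v w = ∑ v ∈ W, ∑ w ∈ W, if w ∈ nb v then G v w else 0 := by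
    intro G hG
    refine Finset.sum_congr rfl fun v hv => ?_
    rw [← Finset.sum_filter]
    symm
    refine Finset.sum_subset (fun w hw => (Finset.mem_filter.1 hw).2) fun w hw hw' => ?_
    have hwW : w ∉ W := fun h => hw' (Finset.mem_filter.2 ⟨h, hw⟩)
    exact hG v w (fun h => hwW (hnb v h hw)) fun h => hwW (hKW h)
  rw [h F hF, h (fun v w => F w v) fun v w a b => hF w v b a, Finset.sum_comm]
  refine Finset.sum_congr rfl fun v _ => Finset.sum_congr rfl fun w _ => ?_
  exact if_congr (hs v w) rfl rfl

/-- Dirichlet form. -/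
def dform (nb : V → Finset V) (W : Finset V) (φ χ : V → ℝ) : ℝ :=
  (1 / 2) * ∑ v ∈ W, ∑ w ∈ nb v, (φ v - φ w) * (χ v - χ w)

theorem dform_comm (nb : V → Finset V) (W : Finset V) (φ χ : V → ℝ) :
    dform nb W φ χ = dform nb W χ φ := by
  unfold dform
  simp_rw [mul_comm]

theorem sum_mul_lap {nb : V → Finset V} (hs : SymNb nb) {K W : Finset V} (hKW : K ⊆ W)
    (hnb : ∀ v ∈ K, nb v ⊆ W) {φ : V → ℝ} (hφ : ∀ v ∉ K, φ v = 0) (χ : V → ℝ) :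
    ∑ v ∈ K, φ v * lap nb χ v = dform nb W φ χ := by
  have h1 : ∑ v ∈ K, φ v * lap nb χ v = ∑ v ∈ W, ∑ w ∈ nb v, φ v * (χ v - χ w) := by
    unfold lap
    simp_rw [Finset.mul_sum]
    refine Finset.sum_subset hKW fun v _ hv => ?_
    simp [hφ v hv]
  have h2 := sum_nb_swap hs hKW hnb (F := fun v w => φ v * (χ v - χ w) + φ w * (χ v - χ w))
    fun v w a b => by simp [hφ v a, hφ w b]
  simp only [Finset.sum_add_distrib] at h2
  have h3 : ∑ v ∈ W, ∑ w ∈ nb v, φ w * (χ w - χ v) = - ∑ v ∈ W, ∑ w ∈ nb v, φ w * (χ v - χ w) := by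
    simp_rw [← Finset.sum_neg_distrib]
    exact Finset.sum_congr rfl fun v _ => Finset.sum_congr rfl fun w _ => by ring
  have h4 : ∑ v ∈ W, ∑ w ∈ nb v, φ v * (χ w - χ v) = - ∑ v ∈ W, ∑ w ∈ nb v, φ v * (χ v - χ w) := by
    simp_rw [← Finset.sum_neg_distrib]
    exact Finset.sum_congr rfl fun v _ => Finset.sum_congr rfl fun w _ => by ring
  rw [h3, h4] at h2
  have h5 : ∑ v ∈ W, ∑ w ∈ nb v, (φ v - φ w) * (χ v - χ w) =
      ∑ v ∈ W, ∑ w ∈ nb v, φ v * (χ v - χ w) - ∑ v ∈ W, ∑ w ∈ nb v, φ w * (χ v - χ w) := by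
    simp_rw [← Finset.sum_sub_distrib]
    exact Finset.sum_congr rfl fun v _ => Finset.sum_congr rfl fun w _ => by ring
  rw [h1, dform, h5]
  linarith

/-- A finite set containing `K` and the neighbours of its points. -/
def nbhd (nb : V → Finset V) (K : Finset V) : Finset V := K ∪ K.biUnion nb

theorem subset_nbhd (nb : V → Finset V) (K : Finset V) : K ⊆ nbhd nb K := Finset.subset_union_left

theorem nb_subset_nbhd (nb : V → Finset V) (K : Finset V) : ∀ v ∈ K, nb v ⊆ nbhd nb K :=
  fun _ hv => (Finset.subset_biUnion_of_mem nb hv).trans Finset.subset_union_right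

theorem sum_mul_lap_comm {nb : V → Finset V} (hs : SymNb nb) {K : Finset V} {φ χ : V → ℝ}
    (hφ : ∀ v ∉ K, φ v = 0) (hχ : ∀ v ∉ K, χ v = 0) :
    ∑ v ∈ K, φ v * lap nb χ v = ∑ v ∈ K, χ v * lap nb φ v := by
  rw [sum_mul_lap hs (subset_nbhd nb K) (nb_subset_nbhd nb K) hφ,
    sum_mul_lap hs (subset_nbhd nb K) (nb_subset_nbhd nb K) hχ, dform_comm]

/-- Hardy-type inequality. -/
theorem hardy {nb : V → Finset V} (hs : SymNb nb) {K : Finset V} {φ ψ : V → ℝ}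
    (hφ : ∀ v ∉ K, φ v = 0) (hψ : ∀ v, 0 < ψ v) :
    ∑ v ∈ K, φ v ^ 2 * (lap nb ψ v / ψ v) ≤ ∑ v ∈ K, φ v * lap nb φ v := by
  set W := nbhd nb K
  have hswap := sum_nb_swap hs (subset_nbhd nb K) (nb_subset_nbhd nb K)
    (F := fun v w => φ v ^ 2 * ψ w / ψ v - φ v * φ w)
    fun v w a b => by simp [hφ v a]
  have h1 : ∑ v ∈ K, φ v * lap nb φ v - ∑ v ∈ K, φ v ^ 2 * (lap nb ψ v / ψ v) =
      ∑ v ∈ W, ∑ w ∈ nb v, (φ v ^ 2 * ψ w / ψ v - φ v * φ w) := by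
    rw [← Finset.sum_sub_distrib]
    rw [← Finset.sum_subset (subset_nbhd nb K) fun v _ hv => by simp [hφ v hv]]
    refine Finset.sum_congr rfl fun v _ => ?_
    unfold lap
    rw [Finset.sum_div, Finset.mul_sum, Finset.mul_sum, ← Finset.sum_sub_distrib]
    refine Finset.sum_congr rfl fun w _ => ?_
    have := (hψ v).ne'
    field_simp
    ring
  have h2 : 0 ≤ ∑ v ∈ W, ∑ w ∈ nb v, (φ v ^ 2 * ψ w / ψ v - φ v * φ w) +
      ∑ v ∈ W, ∑ w ∈ nb v, (φ w ^ 2 * ψ v / ψ w - φ w * φ v) := by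
    simp_rw [← Finset.sum_add_distrib]
    refine Finset.sum_nonneg fun v _ => Finset.sum_nonneg fun w _ => ?_
    have hv := hψ v
    have hw := hψ w
    have : φ v ^ 2 * ψ w / ψ v - φ v * φ w + (φ w ^ 2 * ψ v / ψ w - φ w * φ v) =
        (φ v * ψ w - φ w * ψ v) ^ 2 / (ψ v * ψ w) := by
      field_simp
      ring
    rw [this]
    positivity
  rw [← hswap] at h2
  linarith

theorem energy_mono {nb nb' : V → Finset V} (hs : SymNb nb) (hs' : SymNb nb')
    (h : ∀ v, nb' v ⊆ nb v) {K : Finset V} {φ : V → ℝ} (hφ : ∀ v ∉ K, φ v = 0) :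
    ∑ v ∈ K, φ v * lap nb' φ v ≤ ∑ v ∈ K, φ v * lap nb φ v := by
  have hn := nb_subset_nbhd nb K
  rw [sum_mul_lap hs (subset_nbhd nb K) hn hφ,
    sum_mul_lap hs' (subset_nbhd nb K) (fun v hv => (h v).trans (hn v hv)) hφ]
  unfold dform
  refine mul_le_mul_of_nonneg_left (Finset.sum_le_sum fun v _ => ?_) (by norm_num)
  exact Finset.sum_le_sum_of_subset_of_nonneg (h v) fun w _ _ => mul_self_nonneg _

end Green

section Lattice

/-- The neighbour of `y` in direction `±e_i`. -/
def nxt (y : V4) (p : Fin 4 × Bool) : V4 := Function.update y p.1 (y p.1 + if p.2 then 1 else -1)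

theorem nxt_injective (y : V4) : Function.Injective (nxt y) := by
  rintro ⟨i, s⟩ ⟨j, t⟩ h
  have hi := congrFun h i
  have hj := congrFun h j
  by_cases hij : i = j
  · subst hij
    simp only [nxt, Function.update_self] at hi
    cases s <;> cases t <;> simp at hi ⊢
  · simp only [nxt, Function.update_self, Function.update_of_ne hij] at hi
    cases s <;> simp at hi

theorem latNbrs_eq (y : V4) : latNbrs y = Finset.univ.image (nxt y) := rfl

theorem mem_latNbrs {x y : V4} : x ∈ latNbrs y ↔ ∃ p, nxt y p = x := by
  simp [latNbrs_eq]

theorem nxt_mem (y : V4) (p : Fin 4 × Bool) : nxt y p ∈ latNbrs y := mem_latNbrs.2 ⟨p, rfl⟩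

theorem sum_latNbrs {M : Type*} [AddCommMonoid M] (y : V4) (F : V4 → M) :
    ∑ w ∈ latNbrs y, F w = ∑ p, F (nxt y p) := by
  rw [latNbrs_eq, Finset.sum_image fun _ _ _ _ h => nxt_injective y h]

theorem card_latNbrs (y : V4) : (latNbrs y).card = 8 := by
  rw [Finset.card_eq_sum_ones, sum_latNbrs]; rfl

theorem nxt_nxt (y : V4) (i : Fin 4) (s : Bool) : nxt (nxt y (i, s)) (i, !s) = y := by
  funext j
  by_cases h : j = i
  · subst h; cases s <;> simp [nxt]
  · simp [nxt, h]

theorem symNb_latNbrs : SymNb latNbrs := by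
  have : ∀ x y, x ∈ latNbrs y → y ∈ latNbrs x := by
    intro x y h
    obtain ⟨⟨i, s⟩, rfl⟩ := mem_latNbrs.1 h
    exact mem_latNbrs.2 ⟨(i, !s), nxt_nxt y i s⟩
  exact fun x y => ⟨this x y, this y x⟩

theorem ne_of_mem_latNbrs {x y : V4} (h : x ∈ latNbrs y) : x ≠ y := by
  obtain ⟨⟨i, s⟩, rfl⟩ := mem_latNbrs.1 h
  intro h
  have := congrFun h i
  cases s <;> simp [nxt] at this

theorem latAdj_iff {x y : V4} : latAdj x y ↔ y ∈ latNbrs x := by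
  rw [mem_latNbrs]
  constructor
  · intro h
    unfold latAdj at h
    have hex : ∃ i, x i ≠ y i := by
      by_contra hc
      push Not at hc
      simp [hc] at h
    obtain ⟨i, hi⟩ := hex
    rw [← Finset.add_sum_erase _ _ (Finset.mem_univ i)] at h
    have h1 : 0 ≤ ∑ j ∈ Finset.univ.erase i, |x j - y j| := Finset.sum_nonneg fun _ _ => abs_nonneg _
    have h2 : 1 ≤ |x i - y i| := Int.one_le_abs (sub_ne_zero.2 hi)
    have h3 : |x i - y i| = 1 := by linarith
    have h4 : ∑ j ∈ Finset.univ.erase i, |x j - y j| = 0 := by linarith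
    rw [Finset.sum_eq_zero_iff_of_nonneg fun _ _ => abs_nonneg _] at h4
    have h5 : ∀ j, j ≠ i → x j = y j := fun j hj => by
      have := h4 j (by simp [hj])
      rwa [abs_eq_zero, sub_eq_zero] at this
    rcases (abs_eq (by norm_num : (0:ℤ) ≤ 1)).1 h3 with h6 | h6
    · refine ⟨(i, false), ?_⟩
      funext j
      by_cases h : j = i
      · subst h; simp [nxt]; linarith
      · simp [nxt, h, h5 j h]
    · refine ⟨(i, true), ?_⟩
      funext j
      by_cases h : j = i
      · subst h; simp [nxt]; linarith
      · simp [nxt, h, h5 j h]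
  · rintro ⟨⟨i, s⟩, rfl⟩
    unfold latAdj
    rw [Finset.sum_eq_single i]
    · cases s <;> simp [nxt]
    · intro j _ hj
      simp [nxt, hj]
    · simp

theorem numF_lat_pos (D : Finset V4) : 0 < numF latNbrs D := by
  refine numF_pos_iff.2 ⟨fun v => if v ∈ D then nxt v (0, true) else v, mem_forests.2 ⟨?_, ?_, ?_⟩⟩
  · intro v hv
    simpa [hv] using nxt_mem v _
  · intro v hv
    simp [hv]
  · intro v
    set f : V4 → V4 := fun v => if v ∈ D then nxt v (0, true) else v
    by_contra hc
    push Not at hc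
    have hk : ∀ k : ℕ, (f^[k] v) 0 = v 0 + k := by
      intro k
      induction k with
      | zero => simp
      | succ k ih =>
        rw [Function.iterate_succ_apply']
        have : f (f^[k] v) = nxt (f^[k] v) (0, true) := if_pos (hc k)
        rw [this]
        simp [nxt, ih]
        ring
    have hinj : Function.Injective fun k : ℕ => f^[k] v := by
      intro a b hab
      have := congrFun hab 0
      simp only [hk] at this
      exact_mod_cast add_left_cancel this
    exact Set.infinite_range_of_injective hinj
      (D.finite_toSet.subset (by rintro _ ⟨k, rfl⟩; exact hc k))

/-- Squared Euclidean distance. -/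
def sqd (c x : V4) : ℝ := ∑ i, ((x i : ℝ) - c i) ^ 2

theorem sqd_nonneg (c x : V4) : 0 ≤ sqd c x := Finset.sum_nonneg fun _ _ => sq_nonneg _

/-- The superharmonic function `1 / (|x - c|² + A)`. -/
def psi (A : ℝ) (c x : V4) : ℝ := 1 / (sqd c x + A)

theorem psi_pos {A : ℝ} (hA : 0 < A) (c x : V4) : 0 < psi A c x := by
  have := sqd_nonneg c x
  unfold psi; positivity

theorem sqd_nxt (c x : V4) (i : Fin 4) (s : Bool) :
    sqd c (nxt x (i, s)) = sqd c x + 1 + (if s then 1 else -1) * (2 * ((x i : ℝ) - c i)) := by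
  unfold sqd
  rw [← Finset.add_sum_erase _ _ (Finset.mem_univ i), ← Finset.add_sum_erase _ (fun i => ((x i : ℝ) - c i) ^ 2) (Finset.mem_univ i)]
  have : ∑ j ∈ Finset.univ.erase i, (((nxt x (i, s)) j : ℝ) - c j) ^ 2 =
      ∑ j ∈ Finset.univ.erase i, ((x j : ℝ) - c j) ^ 2 := by
    refine Finset.sum_congr rfl fun j hj => ?_
    have : j ≠ i := Finset.ne_of_mem_erase hj
    simp [nxt, this]
  rw [this]
  cases s <;> simp [nxt] <;> ring

theorem psi_term {Q y : ℝ} {t : ℝ} (hy : t ^ 2 = y) (hQ : 17 ≤ Q) (h1 : 0 ≤ y) (h2 : y ≤ Q) :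
    1 / (Q + 2 * t) + 1 / (Q - 2 * t) ≤ (2 / Q) * (1 + 4 * y / Q ^ 2 + 21 * y / Q ^ 3) := by
  have hQ0 : 0 < Q := by linarith
  have h4 : 0 < Q ^ 2 - 4 * y := by nlinarith
  have hp : (Q + 2 * t) * (Q - 2 * t) = Q ^ 2 - 4 * y := by rw [← hy]; ring
  have ha : Q + 2 * t ≠ 0 := fun h => by rw [h, zero_mul] at hp; linarith
  have hb : Q - 2 * t ≠ 0 := fun h => by rw [h, mul_zero] at hp; linarith
  have e : 1 / (Q + 2 * t) + 1 / (Q - 2 * t) = 2 * Q / (Q ^ 2 - 4 * y) := by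
    rw [← hp]; field_simp; ring
  rw [e, div_le_iff₀ h4]
  have e2 : 2 / Q * (1 + 4 * y / Q ^ 2 + 21 * y / Q ^ 3) * (Q ^ 2 - 4 * y) =
      2 * Q + (2 * y / Q ^ 4) * (21 * Q ^ 2 - 84 * y - 16 * y * Q) := by
    field_simp; ring
  rw [e2]
  have : 0 ≤ 21 * Q ^ 2 - 84 * y - 16 * y * Q := by nlinarith
  have : 0 ≤ (2 * y / Q ^ 4) * (21 * Q ^ 2 - 84 * y - 16 * y * Q) := by positivity
  linarith

theorem lap_psi {A : ℝ} (hA : 16 ≤ A) (c x : V4) :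
    4 * A / (sqd c x + A + 1) ^ 3 ≤ lap latNbrs (psi A c) x := by
  have h0 := sqd_nonneg c x
  set q := sqd c x + A with hq
  have hQ : 17 ≤ q + 1 := by linarith
  have hterm : ∀ i : Fin 4, psi A c (nxt x (i, true)) + psi A c (nxt x (i, false)) ≤
      (2 / (q + 1)) * (1 + 4 * ((x i : ℝ) - c i) ^ 2 / (q + 1) ^ 2 + 21 * ((x i : ℝ) - c i) ^ 2 / (q + 1) ^ 3) := by
    intro i
    have hle : ((x i : ℝ) - c i) ^ 2 ≤ sqd c x :=
      Finset.single_le_sum (f := fun i => ((x i : ℝ) - c i) ^ 2) (fun _ _ => sq_nonneg _) (Finset.mem_univ i)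
    have := psi_term (t := (x i : ℝ) - c i) rfl hQ (sq_nonneg _) (by linarith)
    refine le_trans (le_of_eq ?_) this
    unfold psi
    rw [sqd_nxt, sqd_nxt]
    simp only [if_true]
    congr 2 <;> simp [hq] <;> ring
  unfold lap
  rw [sum_latNbrs, Fintype.sum_prod_type]
  have h1 : ∑ i : Fin 4, ∑ s : Bool, (psi A c x - psi A c (nxt x (i, s))) ≥
      ∑ i : Fin 4, (2 / q - (2 / (q + 1)) * (1 + 4 * ((x i : ℝ) - c i) ^ 2 / (q + 1) ^ 2 + 21 * ((x i : ℝ) - c i) ^ 2 / (q + 1) ^ 3)) := by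
    refine Finset.sum_le_sum fun i _ => ?_
    rw [Fintype.sum_bool]
    have e : psi A c x = 1 / q := rfl
    rw [e]
    have := hterm i
    have e2 : (2 : ℝ) / q = 1 / q + 1 / q := by ring
    linarith
  refine le_trans ?_ h1
  have h2 : ∑ i : Fin 4, (2 / q - (2 / (q + 1)) * (1 + 4 * ((x i : ℝ) - c i) ^ 2 / (q + 1) ^ 2 + 21 * ((x i : ℝ) - c i) ^ 2 / (q + 1) ^ 3))
      = 8 / q - (2 / (q + 1)) * (4 + (4 / (q + 1) ^ 2 + 21 / (q + 1) ^ 3) * sqd c x) := by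
    unfold sqd
    simp only [Fin.sum_univ_four]
    ring
  rw [h2]
  have hs : sqd c x = q - A := by rw [hq]; ring
  rw [hs]
  have hq0 : 0 < q := by linarith
  rw [← sub_nonneg]
  have : 8 / q - 2 / (q + 1) * (4 + (4 / (q + 1) ^ 2 + 21 / (q + 1) ^ 3) * (q - A)) - 4 * A / (q + 1) ^ 3
      = (8 * (q+1) ^ 4 - 8 * q * (q+1)^3 - 8 * q * (q - A) * (q+1) - 42 * q * (q - A) - 4 * A * q * (q+1)) / (q * (q + 1) ^ 4) := by
    field_simp; ring
  rw [this]
  apply div_nonneg _ (by positivity)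
  have : 8 * (q+1) ^ 4 - 8 * q * (q+1)^3 - 8 * q * (q - A) * (q+1) - 42 * q * (q - A) - 4 * A * q * (q+1)
    = (4 * A - 26) * q ^ 2 + (46 * A + 24) * q + 8 := by ring
  rw [this]
  have : 0 ≤ (4 * A - 26) * q ^ 2 := mul_nonneg (by linarith) (sq_nonneg _)
  nlinarith

theorem lap_psi_nonneg {A : ℝ} (hA : 16 ≤ A) (c x : V4) : 0 ≤ lap latNbrs (psi A c) x :=
  le_trans (by have := sqd_nonneg c x; positivity) (lap_psi hA c x)

end Lattice

section HalfSpace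

/-- Signed coordinate. -/
def ell (p : Fin 4 × Bool) (v : V4) : ℤ := (if p.2 then 1 else -1) * v p.1

/-- The graph of the half space `{ell p ≥ R + 1}` with the edges from `X ⊆ {ell p = R}`. -/
def nbH (p : Fin 4 × Bool) (R : ℤ) (X : Finset V4) (v : V4) : Finset V4 :=
  (latNbrs v).filter fun w => (R + 1 ≤ ell p v ∧ R + 1 ≤ ell p w) ∨ (v ∈ X ∧ w = nxt v p) ∨
    (w ∈ X ∧ v = nxt w p)

theorem mem_nbH {p : Fin 4 × Bool} {R : ℤ} {X : Finset V4} {v w : V4} :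
    w ∈ nbH p R X v ↔ w ∈ latNbrs v ∧ ((R + 1 ≤ ell p v ∧ R + 1 ≤ ell p w) ∨
      (v ∈ X ∧ w = nxt v p) ∨ (w ∈ X ∧ v = nxt w p)) := by
  simp [nbH]

theorem symNb_nbH (p : Fin 4 × Bool) (R : ℤ) (X : Finset V4) : SymNb (nbH p R X) := by
  intro x y
  rw [mem_nbH, mem_nbH, symNb_latNbrs x y]
  refine and_congr Iff.rfl ?_
  constructor
  · rintro (⟨h, h'⟩ | h | h)
    exacts [Or.inl ⟨h', h⟩, Or.inr (Or.inr h), Or.inr (Or.inl h)]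
  · rintro (⟨h, h'⟩ | h | h)
    exacts [Or.inl ⟨h', h⟩, Or.inr (Or.inr h), Or.inr (Or.inl h)]

theorem ell_nxt (p : Fin 4 × Bool) (v : V4) : ell p (nxt v p) = ell p v + 1 := by
  obtain ⟨i, s⟩ := p
  cases s <;> simp [ell, nxt]; ring

theorem ell_nxt_not (p : Fin 4 × Bool) (v : V4) : ell p (nxt v (p.1, !p.2)) = ell p v - 1 := by
  obtain ⟨i, s⟩ := p
  cases s
  · simp [ell, nxt]; ring
  · simp [ell, nxt]; ring

theorem ell_nxt_of_ne {p q : Fin 4 × Bool} (h : q.1 ≠ p.1) (v : V4) :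
    ell p (nxt v q) = ell p v := by
  simp [ell, nxt, h.symm]

theorem sqd_nxt_ell (p : Fin 4 × Bool) (c v : V4) :
    sqd c (nxt v p) = sqd c v + 1 + 2 * ((ell p v : ℝ) - ell p c) := by
  obtain ⟨i, s⟩ := p
  rw [sqd_nxt]
  cases s <;> simp [ell] <;> ring

theorem sqd_nxt_not_ell (p : Fin 4 × Bool) (c v : V4) :
    sqd c (nxt v (p.1, !p.2)) = sqd c v + 1 - 2 * ((ell p v : ℝ) - ell p c) := by
  obtain ⟨i, s⟩ := p
  rw [sqd_nxt]
  cases s <;> (simp [ell]; ring)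

theorem psi_le_of_sqd_le {A : ℝ} (hA : 0 < A) {c x y : V4} (h : sqd c x ≤ sqd c y) :
    psi A c y ≤ psi A c x := by
  unfold psi
  have := sqd_nonneg c x
  exact one_div_le_one_div_of_le (by positivity) (by linarith)

theorem lap_nbH_psi_nonneg {p : Fin 4 × Bool} {R : ℤ} {X : Finset V4} (hX : ∀ e ∈ X, ell p e = R)
    {e : V4} (he : e ∈ X) (v : V4) : 0 ≤ lap (nbH p R X) (psi 16 e) v := by
  by_cases hv : R + 1 ≤ ell p v
  · refine (lap_psi_nonneg le_rfl e v).trans ?_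
    unfold lap
    have hsub : nbH p R X v ⊆ latNbrs v := Finset.filter_subset _ _
    rw [← Finset.sum_sdiff hsub]
    have : ∑ w ∈ latNbrs v \ nbH p R X v, (psi 16 e v - psi 16 e w) ≤ 0 := by
      refine Finset.sum_nonpos fun w hw => ?_
      rw [Finset.mem_sdiff, mem_nbH] at hw
      obtain ⟨q, rfl⟩ := mem_latNbrs.1 hw.1
      have hlt : ¬ R + 1 ≤ ell p (nxt v q) := fun h => hw.2 ⟨hw.1, Or.inl ⟨hv, h⟩⟩
      have hq1 : q.1 = p.1 := by
        by_contra hne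
        exact hlt (by rwa [ell_nxt_of_ne hne])
      have hq : q = (p.1, !p.2) := by
        obtain ⟨i, s⟩ := q
        simp only at hq1
        subst hq1
        by_cases hs : s = p.2
        · exfalso
          apply hlt
          subst hs
          rw [show ((p.1, p.2) : Fin 4 × Bool) = p from rfl, ell_nxt]
          omega
        · simp only [Prod.mk.injEq, true_and]
          cases s <;> cases h : p.2 <;> simp_all
      rw [hq, sub_nonpos]
      refine psi_le_of_sqd_le (by norm_num) ?_
      rw [sqd_nxt_not_ell, hX e he]
      have : (R : ℝ) + 1 ≤ ell p v := by exact_mod_cast hv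
      linarith
    linarith
  · unfold lap
    refine Finset.sum_nonneg fun w hw => ?_
    rw [mem_nbH] at hw
    rcases hw.2 with h | ⟨h, rfl⟩ | ⟨h, rfl⟩
    · exact absurd h.1 hv
    · rw [sub_nonneg]
      refine psi_le_of_sqd_le (by norm_num) ?_
      rw [sqd_nxt_ell, hX e he, hX v h]
      linarith
    · exact absurd (by rw [ell_nxt, hX w h]) hv

theorem lap_nbH_psi_self {p : Fin 4 × Bool} {R : ℤ} {X : Finset V4} (hX : ∀ e ∈ X, ell p e = R)
    {e : V4} (he : e ∈ X) : lap (nbH p R X) (psi 16 e) e = 1 / (16 * 17) := by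
  have : nbH p R X e = {nxt e p} := by
    ext w
    rw [mem_nbH, Finset.mem_singleton]
    constructor
    · rintro ⟨-, h | h | ⟨h, h'⟩⟩
      · have := hX e he; omega
      · exact h.2
      · have h1 := hX e he
        rw [h', ell_nxt, hX w h] at h1
        omega
    · rintro rfl
      exact ⟨nxt_mem _ _, Or.inr (Or.inl ⟨he, rfl⟩)⟩
  rw [lap, this, Finset.sum_singleton]
  unfold psi
  rw [sqd_nxt_ell]
  simp [sqd]
  norm_num

theorem lap_sum {V : Type*} [DecidableEq V] {ι : Type*} (nb : V → Finset V) (s : Finset ι) (u : ι → V → ℝ) (v : V) :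
    lap nb (fun x => ∑ i ∈ s, u i x) v = ∑ i ∈ s, lap nb (u i) v := by
  unfold lap
  rw [Finset.sum_comm]
  simp_rw [Finset.sum_sub_distrib]

/-- Energy lower bound for functions equal to `1` on points `X` of a hyperplane, in any graph
containing the half space beyond `X`. -/
theorem halfspace_energy {p : Fin 4 × Bool} {R : ℤ} {X : Finset V4} (hX : ∀ e ∈ X, ell p e = R)
    (hne : X.Nonempty) {nb : V4 → Finset V4} (hs : SymNb nb) (hnb : ∀ v, nbH p R X v ⊆ nb v)
    {K : Finset V4} {φ : V4 → ℝ} (hφ : ∀ v ∉ K, φ v = 0) (h1 : ∀ e ∈ X, φ e = 1) :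
    ∑ e ∈ X, (1 / (16 * 17)) / (∑ e' ∈ X, psi 16 e' e) ≤ ∑ v ∈ K, φ v * lap nb φ v := by
  refine le_trans ?_ (energy_mono hs (symNb_nbH p R X) hnb hφ)
  have hpos : ∀ v, 0 < ∑ e' ∈ X, psi 16 e' v := fun v =>
    Finset.sum_pos (fun e _ => psi_pos (by norm_num) e v) hne
  refine le_trans ?_ (hardy (symNb_nbH p R X) (ψ := fun v => ∑ e' ∈ X, psi 16 e' v) hφ hpos)
  have hXK : X ⊆ K := fun e he => by
    by_contra h
    have := hφ e h
    rw [h1 e he] at this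
    norm_num at this
  have hnn : ∀ v, 0 ≤ lap (nbH p R X) (fun v => ∑ e' ∈ X, psi 16 e' v) v := fun v => by
    rw [lap_sum]
    exact Finset.sum_nonneg fun e he => lap_nbH_psi_nonneg hX he v
  refine le_trans (Finset.sum_le_sum fun e he => ?_)
    (Finset.sum_le_sum_of_subset_of_nonneg hXK fun v _ _ =>
      mul_nonneg (sq_nonneg _) (div_nonneg (hnn v) (hpos v).le))
  rw [h1 e he, one_pow, one_mul]
  refine div_le_div_of_nonneg_right ?_ (hpos e).le
  rw [lap_sum, ← lap_nbH_psi_self hX he]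
  exact Finset.single_le_sum (f := fun e' => lap (nbH p R X) (psi 16 e') e)
    (fun e' he' => lap_nbH_psi_nonneg hX he' e) he

theorem sqd_lt_card (c : V4) (ρ : ℕ) (X : Finset V4) :
    (X.filter fun e => sqd c e < (ρ : ℝ) ^ 2).card ≤ (2 * ρ + 1) ^ 4 := by
  have : X.filter (fun e => sqd c e < (ρ : ℝ) ^ 2) ⊆ boxFinset c ρ := by
    intro e he
    rw [Finset.mem_filter] at he
    refine Fintype.mem_piFinset.2 fun i => ?_
    have h1 : ((e i : ℝ) - c i) ^ 2 ≤ sqd c e :=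
      Finset.single_le_sum (f := fun i => ((e i : ℝ) - c i) ^ 2) (fun _ _ => sq_nonneg _) (Finset.mem_univ i)
    have h2 := abs_le_of_sq_le_sq' (h1.trans he.2.le) (by positivity)
    rw [Finset.mem_Icc]
    have h3 : -(ρ : ℤ) ≤ e i - c i := by exact_mod_cast h2.1
    have h4 : e i - c i ≤ (ρ : ℤ) := by exact_mod_cast h2.2
    constructor <;> omega
  refine (Finset.card_le_card this).trans ?_
  unfold boxFinset
  rw [Fintype.card_piFinset]
  simp only [Int.card_Icc]
  have : ∀ i, (c i + ρ + 1 - (c i - ρ)).toNat = 2 * ρ + 1 := fun i => by omega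
  simp [this]

theorem sqd_comm (c x : V4) : sqd c x = sqd x c := by
  unfold sqd
  exact Finset.sum_congr rfl fun i _ => by ring

/-- The lower bound in `halfspace_energy` tends to infinity with the number of points. -/
theorem halfspace_bound (M : ℝ) : ∃ k0 : ℕ, ∀ X : Finset V4, k0 ≤ X.card →
    M ≤ ∑ e ∈ X, (1 / (16 * 17)) / (∑ e' ∈ X, psi 16 e' e) := by
  obtain ⟨ρ, hρ⟩ := exists_nat_ge (max 1 (16 * 17 * 2 * M))
  have hρ1 : (1 : ℝ) ≤ ρ := (le_max_left _ _).trans hρ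
  have hρM : 16 * 17 * 2 * M ≤ ρ := (le_max_right _ _).trans hρ
  refine ⟨ρ ^ 2 * (2 * ρ + 1) ^ 4 + 1, fun X hX => ?_⟩
  have hk : ((ρ : ℝ)) ^ 2 * (2 * ρ + 1) ^ 4 ≤ X.card := by
    have : ρ ^ 2 * (2 * ρ + 1) ^ 4 ≤ X.card := by omega
    exact_mod_cast this
  have hk1 : (1 : ℝ) ≤ X.card := by
    have : 1 ≤ X.card := by omega
    exact_mod_cast this
  have hψ : ∀ e ∈ X, ∑ e' ∈ X, psi 16 e' e ≤ 2 * X.card / ρ ^ 2 := by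
    intro e _
    rw [← Finset.sum_filter_add_sum_filter_not X fun e' => sqd e e' < (ρ : ℝ) ^ 2]
    have a : ∑ e' ∈ X.filter (fun e' => sqd e e' < (ρ : ℝ) ^ 2), psi 16 e' e ≤ (2 * ρ + 1) ^ 4 := by
      refine (Finset.sum_le_card_nsmul _ _ 1 fun e' _ => ?_).trans ?_
      · unfold psi
        have := sqd_nonneg e' e
        rw [div_le_one (by positivity)]; linarith
      · rw [nsmul_eq_mul, mul_one]
        exact_mod_cast sqd_lt_card e ρ X
    have b : ∑ e' ∈ X.filter (fun e' => ¬ sqd e e' < (ρ : ℝ) ^ 2), psi 16 e' e ≤ X.card / ρ ^ 2 := by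
      refine (Finset.sum_le_card_nsmul _ _ (1 / (ρ : ℝ) ^ 2) fun e' he' => ?_).trans ?_
      · unfold psi
        rw [Finset.mem_filter, not_lt, sqd_comm] at he'
        exact one_div_le_one_div_of_le (by positivity) (by linarith)
      · rw [nsmul_eq_mul, mul_one_div]
        refine div_le_div_of_nonneg_right ?_ (by positivity)
        exact_mod_cast Finset.card_filter_le _ _
    have c : ((2 * ρ + 1) ^ 4 : ℝ) ≤ X.card / ρ ^ 2 := by
      rw [le_div_iff₀ (by positivity)]
      linarith
    calc _ ≤ _ := add_le_add a b
      _ ≤ X.card / ρ ^ 2 + X.card / (ρ : ℝ) ^ 2 := by linarith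
      _ = _ := by ring
  have hne : X.Nonempty := Finset.card_pos.1 (by omega)
  calc M ≤ X.card • ((1 / (16 * 17)) / (2 * X.card / (ρ : ℝ) ^ 2)) := by
        rw [nsmul_eq_mul]
        have : (X.card : ℝ) * ((1 / (16 * 17)) / (2 * X.card / (ρ : ℝ) ^ 2)) = ρ ^ 2 / (16 * 17 * 2) := by
          field_simp
        rw [this, le_div_iff₀ (by norm_num)]
        nlinarith
    _ ≤ _ := by
        refine Finset.card_nsmul_le_sum _ _ _ fun e he => ?_
        refine div_le_div_of_nonneg_left (by norm_num) ?_ (hψ e he)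
        exact Finset.sum_pos (fun e' _ => psi_pos (by norm_num) e' e) hne

end HalfSpace

section Hit

theorem hitCount_le (S : Set V4) (n : ℕ) (x : V4) : hitCount S n x ≤ 8 ^ n := by
  induction n generalizing x with
  | zero => simp only [hitCount]; split_ifs <;> simp
  | succ n ih =>
    simp only [hitCount]
    split_ifs
    · exact le_rfl
    · refine (Finset.sum_le_card_nsmul _ _ _ fun b _ => ih b).trans ?_
      rw [card_latNbrs, smul_eq_mul, pow_succ, mul_comm]

theorem hitCount_of_mem {S : Set V4} {x : V4} (h : x ∈ S) (n : ℕ) : hitCount S n x = 8 ^ n := by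
  cases n <;> simp [hitCount, h]

theorem hitCount_succ_of_notMem {S : Set V4} {x : V4} (h : x ∉ S) (n : ℕ) :
    hitCount S (n + 1) x = ∑ b ∈ latNbrs x, hitCount S n b := by
  simp [hitCount, h]

/-- The probability of hitting `S` within `n` steps. -/
def hitN (S : Set V4) (n : ℕ) (x : V4) : ℝ := (hitCount S n x : ℝ) / 8 ^ n

theorem hitN_le_one (S : Set V4) (n : ℕ) (x : V4) : hitN S n x ≤ 1 :=
  div_le_one_of_le₀ (by exact_mod_cast hitCount_le S n x) (by positivity)

theorem hitN_nonneg (S : Set V4) (n : ℕ) (x : V4) : 0 ≤ hitN S n x := by unfold hitN; positivity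

theorem hitN_of_mem {S : Set V4} {x : V4} (h : x ∈ S) (n : ℕ) : hitN S n x = 1 := by
  simp [hitN, hitCount_of_mem h]

theorem hitN_succ_of_notMem {S : Set V4} {x : V4} (h : x ∉ S) (n : ℕ) :
    hitN S (n + 1) x = (1 / 8) * ∑ b ∈ latNbrs x, hitN S n b := by
  unfold hitN
  rw [hitCount_succ_of_notMem h, ← Finset.sum_div, pow_succ]
  push_cast
  field_simp

theorem hitN_mono (S : Set V4) (x : V4) : Monotone fun n => hitN S n x := by
  refine monotone_nat_of_le_succ fun n => ?_
  induction n generalizing x with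
  | zero =>
    by_cases h : x ∈ S
    · rw [hitN_of_mem h, hitN_of_mem h]
    · refine le_trans (le_of_eq ?_) (hitN_nonneg S _ x)
      simp [hitN, hitCount, h]
  | succ n ih =>
    by_cases h : x ∈ S
    · rw [hitN_of_mem h, hitN_of_mem h]
    · rw [hitN_succ_of_notMem h, hitN_succ_of_notMem h]
      gcongr with b
      exact ih b

theorem bddAbove_hitN (S : Set V4) (x : V4) : BddAbove (range fun n => hitN S n x) :=
  ⟨1, by rintro _ ⟨n, rfl⟩; exact hitN_le_one S n x⟩

theorem tendsto_hitN (S : Set V4) (x : V4) :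
    Tendsto (fun n => hitN S n x) atTop (𝓝 (hitProb S x)) :=
  tendsto_atTop_ciSup (hitN_mono S x) (bddAbove_hitN S x)

theorem hitN_le_hitProb (S : Set V4) (n : ℕ) (x : V4) : hitN S n x ≤ hitProb S x :=
  le_ciSup (bddAbove_hitN S x) n

theorem hitProb_le_of {S : Set V4} {x : V4} {c : ℝ} (h : ∀ n, hitN S n x ≤ c) : hitProb S x ≤ c :=
  ciSup_le h

theorem hitProb_le_one (S : Set V4) (x : V4) : hitProb S x ≤ 1 :=
  hitProb_le_of fun n => hitN_le_one S n x

theorem hitProb_nonneg (S : Set V4) (x : V4) : 0 ≤ hitProb S x :=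
  (hitN_nonneg S 0 x).trans (hitN_le_hitProb S 0 x)

theorem hitProb_of_mem {S : Set V4} {x : V4} (h : x ∈ S) : hitProb S x = 1 :=
  le_antisymm (hitProb_le_one S x) (by rw [← hitN_of_mem h 0]; exact hitN_le_hitProb S 0 x)

theorem lap_lat (u : V4 → ℝ) (x : V4) : lap latNbrs u x = 8 * u x - ∑ b ∈ latNbrs x, u b := by
  unfold lap
  rw [Finset.sum_sub_distrib, Finset.sum_const, card_latNbrs]
  simp

theorem lap_hitProb {S : Set V4} {x : V4} (h : x ∉ S) : lap latNbrs (hitProb S) x = 0 := by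
  rw [lap_lat, sub_eq_zero]
  have h1 := (tendsto_add_atTop_iff_nat 1).2 (tendsto_hitN S x)
  simp_rw [hitN_succ_of_notMem h] at h1
  have h2 : Tendsto (fun n => (1 / 8 : ℝ) * ∑ b ∈ latNbrs x, hitN S n b) atTop
      (𝓝 ((1 / 8) * ∑ b ∈ latNbrs x, hitProb S b)) :=
    (tendsto_finsetSum _ fun b _ => tendsto_hitN S b).const_mul _
  have := tendsto_nhds_unique h1 h2
  linarith

theorem hitProb_le_super {S : Set V4} {s : V4 → ℝ} (h0 : ∀ x, 0 ≤ s x) (h1 : ∀ x ∈ S, 1 ≤ s x)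
    (hs : ∀ x ∉ S, 0 ≤ lap latNbrs s x) (x : V4) : hitProb S x ≤ s x := by
  refine hitProb_le_of fun n => ?_
  induction n generalizing x with
  | zero =>
    by_cases h : x ∈ S
    · exact (hitN_le_one ..).trans (h1 x h)
    · simpa [hitN, hitCount, h] using h0 x
  | succ n ih =>
    by_cases h : x ∈ S
    · exact (hitN_le_one ..).trans (h1 x h)
    · rw [hitN_succ_of_notMem h]
      have := hs x h
      rw [lap_lat] at this
      have h2 : ∑ b ∈ latNbrs x, hitN S n b ≤ ∑ b ∈ latNbrs x, s b :=
        Finset.sum_le_sum fun b _ => ih b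
      linarith

theorem hitProb_mono {S T : Set V4} (h : S ⊆ T) (x : V4) : hitProb S x ≤ hitProb T x := by
  refine hitProb_le_super (hitProb_nonneg T) (fun x hx => (hitProb_of_mem (h hx)).ge) (fun x hx => ?_) x
  by_cases hT : x ∈ T
  · rw [lap_lat, hitProb_of_mem hT, sub_nonneg]
    refine (Finset.sum_le_card_nsmul _ _ 1 fun b _ => hitProb_le_one T b).trans ?_
    rw [card_latNbrs]; norm_num
  · rw [lap_hitProb hT]

theorem avoidCount_add_hitCount {A : Set V4} {x : V4} (h : x ∉ A) (n : ℕ) :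
    avoidCount A n x + hitCount A n x = 8 ^ n := by
  induction n generalizing x with
  | zero => simp [avoidCount, hitCount, h]
  | succ n ih =>
    rw [hitCount_succ_of_notMem h, avoidCount,
      ← Finset.sum_filter_add_sum_filter_not (latNbrs x) (fun b => b ∉ A) fun b => hitCount A n b,
      ← add_assoc, ← Finset.sum_add_distrib,
      Finset.sum_congr rfl fun b hb => ih (Finset.mem_filter.1 hb).2]
    have : ∑ b ∈ (latNbrs x).filter (fun b => ¬ b ∉ A), hitCount A n b =
        ∑ b ∈ (latNbrs x).filter (fun b => ¬ b ∉ A), 8 ^ n :=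
      Finset.sum_congr rfl fun b hb => hitCount_of_mem (not_not.1 (Finset.mem_filter.1 hb).2) n
    rw [this, Finset.sum_filter_add_sum_filter_not, Finset.sum_const, card_latNbrs, smul_eq_mul,
      pow_succ, mul_comm]

theorem avoid_succ (A : Set V4) (n : ℕ) (a : V4) :
    (avoidCount A (n + 1) a : ℝ) / 8 ^ (n + 1) = (1 / 8) * ∑ b ∈ latNbrs a, (1 - hitN A n b) := by
  rw [avoidCount, ← Finset.sum_filter_add_sum_filter_not (latNbrs a) (fun b => b ∉ A)
    fun b => 1 - hitN A n b]
  have h2 : ∑ b ∈ (latNbrs a).filter (fun b => ¬ b ∉ A), (1 - hitN A n b) = 0 :=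
    Finset.sum_eq_zero fun b hb => by
      rw [hitN_of_mem (not_not.1 (Finset.mem_filter.1 hb).2), sub_self]
  rw [h2, add_zero, Finset.mul_sum]
  push_cast
  rw [Finset.sum_div]
  refine Finset.sum_congr rfl fun b hb => ?_
  have := avoidCount_add_hitCount (Finset.mem_filter.1 hb).2 n
  have h3 : (avoidCount A n b : ℝ) = 8 ^ n - hitCount A n b := by
    rw [eq_sub_iff_add_eq]; exact_mod_cast this
  rw [h3, hitN, pow_succ]
  field_simp

theorem escProb_eq (A : Set V4) {a : V4} (ha : a ∈ A) :
    8 * escProb A a = lap latNbrs (hitProb A) a := by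
  have h1 : Tendsto (fun n => (avoidCount A (n + 1) a : ℝ) / 8 ^ (n + 1)) atTop
      (𝓝 ((1 / 8) * ∑ b ∈ latNbrs a, (1 - hitProb A b))) := by
    simp_rw [avoid_succ]
    exact (tendsto_finsetSum _ fun b _ => (tendsto_hitN A b).const_sub 1).const_mul _
  have hanti : Antitone fun n => (avoidCount A n a : ℝ) / 8 ^ n := by
    refine antitone_nat_of_succ_le fun n => ?_
    cases n with
    | zero =>
      rw [avoid_succ]
      simp only [avoidCount]
      have : ∑ b ∈ latNbrs a, (1 - hitN A 0 b) ≤ 8 := by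
        refine (Finset.sum_le_card_nsmul _ _ 1 fun b _ => by linarith [hitN_nonneg A 0 b]).trans ?_
        rw [card_latNbrs]; norm_num
      simp only [Nat.cast_one, pow_zero, div_one]
      linarith
    | succ n =>
      rw [avoid_succ, avoid_succ]
      have : ∑ b ∈ latNbrs a, (1 - hitN A (n + 1) b) ≤ ∑ b ∈ latNbrs a, (1 - hitN A n b) :=
        Finset.sum_le_sum fun b _ => by linarith [hitN_mono A b (Nat.le_succ n)]
      linarith
  have h2 : Tendsto (fun n => (avoidCount A n a : ℝ) / 8 ^ n) atTop (𝓝 (escProb A a)) :=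
    tendsto_atTop_ciInf hanti ⟨0, by rintro _ ⟨n, rfl⟩; positivity⟩
  have h3 := tendsto_nhds_unique ((tendsto_add_atTop_iff_nat 1).2 h2) h1
  rw [h3, lap, hitProb_of_mem ha]
  ring

theorem cap4_nonneg (A : Set V4) : 0 ≤ cap4 A :=
  tsum_nonneg fun a => mul_nonneg (by norm_num)
    (Real.iInf_nonneg fun n => by positivity)

theorem cap4_eq (A : Finset V4) : cap4 A = ∑ a ∈ A, lap latNbrs (hitProb A) a := by
  unfold cap4
  rw [← Finset.sum_coe_sort A fun a => lap latNbrs (hitProb A) a]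
  rw [tsum_fintype]
  exact Finset.sum_congr rfl fun a _ => escProb_eq _ a.2

theorem lpr_le_hitProb {D : Finset V4} {S : Set V4} (h : ∀ v ∈ S, v ∉ D) (x : V4) :
    lpr latNbrs D S x ≤ hitProb S x := by
  refine le_of_lap_le (numF_lat_pos D) (fun v hv => ?_) (fun v hv => ?_) x
  · rw [lap_lpr _ h hv, lap_hitProb fun hS => h v hS hv]
  · by_cases hS : v ∈ S
    · rw [lpr_of_mem (numF_lat_pos D) hS, hitProb_of_mem hS]
    · rw [lpr_of_notMem hS hv]; exact hitProb_nonneg S v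

theorem tendsto_lpr {D : ℕ → Finset V4} {S : Set V4} (h : ∀ n, ∀ v ∈ S, v ∉ D n)
    (hD : ∀ v ∉ S, ∀ᶠ n in atTop, v ∈ D n) (x : V4) :
    Tendsto (fun n => lpr latNbrs (D n) S x) atTop (𝓝 (hitProb S x)) := by
  have key : ∀ m x, ∀ᶠ n in atTop, hitN S m x ≤ lpr latNbrs (D n) S x := by
    intro m
    induction m with
    | zero =>
      intro x
      refine Eventually.of_forall fun n => ?_
      by_cases hx : x ∈ S
      · rw [lpr_of_mem (numF_lat_pos _) hx]; exact hitN_le_one ..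
      · refine le_trans (le_of_eq ?_) (lpr_nonneg ..)
        simp [hitN, hitCount, hx]
    | succ m ih =>
      intro x
      by_cases hx : x ∈ S
      · refine Eventually.of_forall fun n => ?_
        rw [lpr_of_mem (numF_lat_pos _) hx]; exact hitN_le_one ..
      · have h1 : ∀ᶠ n in atTop, ∀ b ∈ latNbrs x, hitN S m b ≤ lpr latNbrs (D n) S b :=
          (Finset.eventually_all _).2 fun b _ => ih b
        filter_upwards [h1, hD x hx] with n hn hxn
        rw [hitN_succ_of_notMem hx]
        have := lap_lpr latNbrs (h n) hxn
        rw [lap_lat] at this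
        have h2 := Finset.sum_le_sum hn
        linarith
  rw [tendsto_order]
  constructor
  · intro a ha
    obtain ⟨m, hm⟩ := exists_lt_of_lt_ciSup ha
    filter_upwards [key m x] with n hn
    exact lt_of_lt_of_le hm hn
  · intro a ha
    exact Eventually.of_forall fun n => (lpr_le_hitProb (h n) x).trans_lt ha

theorem mem_boxV {n : ℕ} {x : V4} : x ∈ boxV n ↔ ∀ i, |x i| ≤ n := by
  simp [boxV, Fintype.mem_piFinset, abs_le]

theorem boxV_mono {m n : ℕ} (h : m ≤ n) : boxV m ⊆ boxV n := fun x hx => by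
  rw [mem_boxV] at hx ⊢
  exact fun i => (hx i).trans (by exact_mod_cast h)

theorem exists_mem_boxV (x : V4) : ∃ n, x ∈ boxV n := by
  refine ⟨∑ i, (x i).natAbs, mem_boxV.2 fun i => ?_⟩
  rw [Int.abs_eq_natAbs]
  exact_mod_cast Finset.single_le_sum (f := fun i => (x i).natAbs) (fun _ _ => Nat.zero_le _) (Finset.mem_univ i)

theorem eventually_mem_boxV (x : V4) : ∀ᶠ n in atTop, x ∈ boxV n := by
  obtain ⟨m, hm⟩ := exists_mem_boxV x
  filter_upwards [eventually_ge_atTop m] with n hn using boxV_mono hn hm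

theorem eventually_subset_boxV (A : Finset V4) : ∀ᶠ n in atTop, A ⊆ boxV n :=
  (Finset.eventually_all A).2 fun x _ => eventually_mem_boxV x

theorem mem_boxFinset {x y : V4} {r : ℕ} : y ∈ boxFinset x r ↔ y ∈ boxSet x r := by
  simp only [boxFinset, Fintype.mem_piFinset, Finset.mem_Icc, boxSet, Set.mem_ofPred_eq, abs_le]
  refine forall_congr' fun i => ?_
  constructor <;> rintro ⟨a, b⟩ <;> constructor <;> linarith

/-- Expected occupation bound: the total hitting probability of `S` from a box of radius `3r`
is at most `C r²` times the capacity. -/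
theorem sum_hitProb_le_cap {x : V4} {r : ℕ} (hr : 1 ≤ r) {S : Finset V4} :
    ∑ y ∈ boxFinset x (3 * r), hitProb S y ≤ (53 ^ 3 / 1024) * r ^ 2 * cap4 S := by
  have hr' : (1 : ℝ) ≤ r := by exact_mod_cast hr
  set A : ℝ := 16 * r ^ 2 with hA
  have hA16 : 16 ≤ A := by nlinarith
  set κ : ℝ := 4 * A / (53 * r ^ 2) ^ 3 with hκ
  have hκ0 : 0 < κ := by positivity
  have hlap : ∀ y ∈ boxFinset x (3 * r), κ ≤ lap latNbrs (psi A x) y := by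
    intro y hy
    refine le_trans ?_ (lap_psi hA16 x y)
    have h0 := sqd_nonneg x y
    refine div_le_div_of_nonneg_left (by positivity) (by positivity) ?_
    refine pow_le_pow_left₀ (by positivity) ?_ 3
    have : sqd x y ≤ ∑ i : Fin 4, 9 * (r : ℝ) ^ 2 := by
      refine Finset.sum_le_sum fun i _ => ?_
      have := mem_boxFinset.1 hy i
      have h2 : |(y i : ℝ) - x i| ≤ 3 * r := by exact_mod_cast this
      rw [← sq_abs]
      nlinarith [abs_nonneg ((y i : ℝ) - x i)]
    simp at this
    nlinarith
  have hn : ∀ᶠ n in atTop, κ * ∑ y ∈ boxFinset x (3 * r), lpr latNbrs (boxV n \ S) S y ≤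
      (1 / A) * ∑ a ∈ S, lap latNbrs (lpr latNbrs (boxV n \ S) S) a := by
    filter_upwards [eventually_subset_boxV S, eventually_subset_boxV (boxFinset x (3 * r))] with n h1 h2
    set H := lpr latNbrs (boxV n \ S) S with hH
    have hS : ∀ v ∈ (S : Set V4), v ∉ boxV n \ S := fun v hv => by simp [Finset.mem_coe.1 hv]
    have hHs : ∀ v ∉ boxV n, H v = 0 := fun v hv => lpr_of_notMem (fun h => hv (h1 h)) (by simp [hv])
    have hψs : ∀ v ∉ boxV n, (if v ∈ boxV n then psi A x v else 0) = 0 := fun v hv => by simp [hv]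
    have e1 := sum_mul_lap_comm symNb_latNbrs hHs hψs
    have e2 : ∑ v ∈ boxV n, H v * lap latNbrs (psi A x) v ≤
        ∑ v ∈ boxV n, H v * lap latNbrs (fun v => if v ∈ boxV n then psi A x v else 0) v := by
      refine Finset.sum_le_sum fun v hv => mul_le_mul_of_nonneg_left ?_ (lpr_nonneg ..)
      unfold lap
      refine Finset.sum_le_sum fun w _ => ?_
      simp only [hv, if_true]
      have := (psi_pos (A := A) (by positivity) x w).le
      split_ifs <;> linarith
    have e3 : κ * ∑ y ∈ boxFinset x (3 * r), H y ≤ ∑ v ∈ boxV n, H v * lap latNbrs (psi A x) v := by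
      refine le_trans ?_ (Finset.sum_le_sum_of_subset_of_nonneg h2 fun v _ _ =>
        mul_nonneg (lpr_nonneg ..) (lap_psi_nonneg hA16 x v))
      rw [Finset.mul_sum]
      refine Finset.sum_le_sum fun y hy => ?_
      rw [mul_comm]
      exact mul_le_mul_of_nonneg_left (hlap y hy) (lpr_nonneg ..)
    refine (e3.trans e2).trans ?_
    rw [e1, Finset.mul_sum, ← Finset.sum_subset h1]
    · refine Finset.sum_le_sum fun a ha => ?_
      simp only [h1 ha, if_true]
      refine mul_le_mul_of_nonneg_right ?_ ?_
      · unfold psi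
        have := sqd_nonneg x a
        exact one_div_le_one_div_of_le (by positivity) (by linarith)
      · unfold lap
        refine Finset.sum_nonneg fun w _ => ?_
        rw [hH, lpr_of_mem (numF_lat_pos _) (Finset.mem_coe.2 ha), sub_nonneg]
        exact lpr_le_one ..
    · intro v hv hvS
      rw [lap_lpr latNbrs hS (by simp [hv, hvS]), mul_zero]
  have hlim : ∀ y, Tendsto (fun n => lpr latNbrs (boxV n \ S) S y) atTop (𝓝 (hitProb S y)) := by
    refine tendsto_lpr (fun n v hv => by simp [Finset.mem_coe.1 hv]) fun v hv => ?_
    filter_upwards [eventually_mem_boxV v] with n hn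
    simp only [Finset.mem_sdiff, hn, true_and]
    exact hv
  have l1 : Tendsto (fun n => κ * ∑ y ∈ boxFinset x (3 * r), lpr latNbrs (boxV n \ S) S y) atTop
      (𝓝 (κ * ∑ y ∈ boxFinset x (3 * r), hitProb S y)) :=
    (tendsto_finsetSum _ fun y _ => hlim y).const_mul _
  have l2 : Tendsto (fun n => (1 / A) * ∑ a ∈ S, lap latNbrs (lpr latNbrs (boxV n \ S) S) a) atTop
      (𝓝 ((1 / A) * ∑ a ∈ S, lap latNbrs (hitProb S) a)) := by
    refine (tendsto_finsetSum _ fun a _ => ?_).const_mul _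
    exact tendsto_finsetSum _ fun w _ => (hlim a).sub (hlim w)
  have := le_of_tendsto_of_tendsto l1 l2 hn
  rw [← cap4_eq, ← le_div_iff₀' hκ0] at this
  refine this.trans (le_of_eq ?_)
  rw [hκ, hA]
  field_simp
  ring

end Hit

section OneEnd

/-- The lattice without the edges between `A` and the rest of `{ell p ≤ R}`. -/
def nbCut (p : Fin 4 × Bool) (R : ℤ) (A : Finset V4) (v : V4) : Finset V4 :=
  (latNbrs v).filter fun w => ¬ (v ∈ A ∧ w ∉ A ∧ ell p w ≤ R) ∧ ¬ (w ∈ A ∧ v ∉ A ∧ ell p v ≤ R)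

theorem mem_nbCut {p : Fin 4 × Bool} {R : ℤ} {A : Finset V4} {v w : V4} :
    w ∈ nbCut p R A v ↔ w ∈ latNbrs v ∧
      ¬ (v ∈ A ∧ w ∉ A ∧ ell p w ≤ R) ∧ ¬ (w ∈ A ∧ v ∉ A ∧ ell p v ≤ R) := by
  simp only [nbCut, Finset.mem_filter]

theorem symNb_nbCut (p : Fin 4 × Bool) (R : ℤ) (A : Finset V4) : SymNb (nbCut p R A) := by
  intro x y
  rw [mem_nbCut, mem_nbCut, symNb_latNbrs x y]
  exact and_congr Iff.rfl and_comm

theorem nbH_subset_nbCut {p : Fin 4 × Bool} {R : ℤ} {A X : Finset V4} (hA : ∀ v ∈ A, ell p v ≤ R)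
    (hXA : X ⊆ A) (hX : ∀ e ∈ X, ell p e = R) (v : V4) : nbH p R X v ⊆ nbCut p R A v := by
  intro w hw
  rw [mem_nbH] at hw
  obtain ⟨h1, h2⟩ := hw
  rw [mem_nbCut]
  refine ⟨h1, ?_, ?_⟩
  · rintro ⟨hv, hw, hl⟩
    rcases h2 with h | ⟨h, rfl⟩ | ⟨h, rfl⟩
    · linarith [hA v hv]
    · rw [ell_nxt, hX _ h] at hl; linarith
    · exact hw (hXA h)
  · rintro ⟨hw, hv, hl⟩
    rcases h2 with h | ⟨h, rfl⟩ | ⟨h, rfl⟩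
    · linarith [hA w hw]
    · exact hv (hXA h)
    · rw [ell_nxt, hX _ h] at hl; linarith

/-- Energy form of the total escape count. -/
theorem energy_eq_charge {V : Type*} [DecidableEq V] {nb : V → Finset V} {D A : Finset V}
    (hAD : Disjoint D A) (hD : 0 < numF nb D) :
    ∑ v ∈ A ∪ D, lpr nb D A v * lap nb (lpr nb D A) v =
      ∑ a ∈ A, ∑ w ∈ nb a, (1 - lpr nb D A w) := by
  have hA : ∀ v ∈ (A : Set V), v ∉ D := fun v hv h => Finset.disjoint_left.1 hAD h hv
  rw [Finset.sum_union hAD.symm, Finset.sum_eq_zero (s := D), add_zero]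
  · refine Finset.sum_congr rfl fun a ha => ?_
    have : lpr nb D A a = 1 := lpr_of_mem hD ha
    rw [lap, this, one_mul]
  · intro v hv
    rw [lap_lpr nb hA hv, mul_zero]

theorem lpr_zero_off {V : Type*} [DecidableEq V] {nb : V → Finset V} {D A : Finset V} :
    ∀ v ∉ A ∪ D, lpr nb D A v = 0 := fun v hv => by
  rw [Finset.mem_union, not_or] at hv
  exact lpr_of_notMem (fun h => hv.1 h) hv.2

/-- A single vertex with its half space escapes with positive probability. -/
theorem numF_erase_le {nb : V4 → Finset V4} (hs : SymNb nb) {p : Fin 4 × Bool} {D : Finset V4}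
    {w : V4} (hw : w ∈ D) (hnb : ∀ v, nbH p (ell p w) {w} v ⊆ nb v) :
    numF nb (D.erase w) ≤ 17 * numF nb D := by
  rcases (numF_nonneg nb (D.erase w)).eq_or_lt with h0 | h0
  · rw [← h0]; linarith [numF_nonneg nb D]
  · have hE : numF nb D = numF nb (D.erase w) *
        ∑ y ∈ nb w, (1 - lpr nb (D.erase w) ({w} : Finset V4) y) := by
      rw [numF_erase nb hw, Finset.mul_sum]
      refine Finset.sum_congr rfl fun y _ => ?_
      rw [lpr, Finset.coe_singleton]
      field_simp
    have hd : Disjoint (D.erase w) {w} := by simp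
    have h1 := halfspace_energy (p := p) (R := ell p w) (X := {w}) (by simp) (by simp) hs hnb
      (K := {w} ∪ D.erase w) (φ := lpr nb (D.erase w) ({w} : Finset V4)) lpr_zero_off
      (fun e he => lpr_of_mem h0 he)
    rw [energy_eq_charge hd h0] at h1
    simp only [Finset.sum_singleton] at h1
    have h2 : psi 16 w w = 1 / 16 := by simp [psi, sqd]
    rw [h2] at h1
    rw [hE]
    have h3 : (1 : ℝ) / 17 ≤ ∑ y ∈ nb w, (1 - lpr nb (D.erase w) ({w} : Finset V4) y) := by
      refine le_trans (le_of_eq ?_) h1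
      norm_num
    nlinarith

theorem numF_le_card_mul {V : Type*} [DecidableEq V] (nb : V → Finset V) {D : Finset V} {v : V}
    (hv : v ∈ D) : numF nb D ≤ (nb v).card * numF nb (D.erase v) := by
  rw [numF_erase nb hv, ← nsmul_eq_mul]
  exact Finset.sum_le_card_nsmul _ _ _ fun w _ => by
    linarith [numL_nonneg nb (D.erase v) {v} w]

/-- Removing one edge. -/
def delEdge {V : Type*} [DecidableEq V] (nb : V → Finset V) (e w : V) (v : V) : Finset V :=
  (nb v).filter fun y => ¬ (v = e ∧ y = w) ∧ ¬ (v = w ∧ y = e)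

theorem mem_delEdge {V : Type*} [DecidableEq V] {nb : V → Finset V} {e w v y : V} :
    y ∈ delEdge nb e w v ↔ y ∈ nb v ∧ ¬ (v = e ∧ y = w) ∧ ¬ (v = w ∧ y = e) := by
  simp only [delEdge, Finset.mem_filter]

theorem symNb_delEdge {V : Type*} [DecidableEq V] {nb : V → Finset V} (hs : SymNb nb) (e w : V) :
    SymNb (delEdge nb e w) := by
  intro x y
  rw [mem_delEdge, mem_delEdge, hs x y]
  refine and_congr Iff.rfl ?_
  rw [and_comm (a := ¬(y = e ∧ x = w)), and_comm (a := y = e), and_comm (a := y = w)]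

theorem isForest_congr_nb {V : Type*} {nb nb' : V → Finset V} {D : Finset V} {f : V → V}
    (h : ∀ v ∈ D, f v ∈ nb v → f v ∈ nb' v) (hf : IsForest nb D f) : IsForest nb' D f :=
  ⟨fun v hv => h v hv (hf.1 v hv), hf.2.1, hf.2.2⟩

theorem numF_mono_nb {V : Type*} [DecidableEq V] {nb nb' : V → Finset V} {D : Finset V}
    (h : ∀ v ∈ D, nb v ⊆ nb' v) : numF nb D ≤ numF nb' D := by
  unfold numF
  refine Nat.cast_le.2 (Finset.card_le_card fun f hf => ?_)
  rw [mem_forests] at hf ⊢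
  exact isForest_congr_nb (fun v hv hm => h v hv hm) hf

theorem numF_le_delEdge {nb : V4 → Finset V4} (hs : SymNb nb) {p : Fin 4 × Bool} {R : ℤ}
    {D : Finset V4} {e : V4} (he : ell p e = R) (heD : e ∉ D)
    (hnb : ∀ X : Finset V4, (∀ v ∈ X, ell p v = R + 1) → ∀ v, nbH p (R + 1) X v ⊆ nb v) :
    numF nb D ≤ 18 * numF (delEdge nb e (nxt e p)) D := by
  set w := nxt e p with hw
  have hlw : ell p w = R + 1 := by rw [hw, ell_nxt, he]
  have hew : e ≠ w := fun h => by rw [h] at he; linarith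
  by_cases hwD : w ∈ D
  · have hsplit : numF nb D ≤ numF (delEdge nb e w) D +
        (((forests nb D).filter fun f => AgreeOn {w} f (fun _ => e)).card : ℝ) := by
      unfold numF
      norm_cast
      rw [← Finset.card_filter_add_card_filter_not (s := forests nb D)
        (fun f => AgreeOn {w} f (fun _ => e)), add_comm]
      refine Nat.add_le_add_right (Finset.card_le_card fun f hf => ?_) _
      rw [Finset.mem_filter, mem_forests] at hf
      rw [mem_forests]
      refine isForest_congr_nb (fun v hv hm => ?_) hf.1
      rw [mem_delEdge]
      refine ⟨hm, fun h => heD (h.1 ▸ hv), fun h => hf.2 fun y hy => ?_⟩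
      rw [Finset.mem_singleton] at hy
      rw [hy, ← h.1]; exact h.2
    have hcard : (((forests nb D).filter fun f => AgreeOn {w} f (fun _ => e)).card : ℝ) ≤
        numF (delEdge nb e w) (D.erase w) := by
      by_cases hwe : e ∈ nb w
      · have hex : ExitsIn nb D {w} (fun _ => e) := by
          refine ⟨by simpa using hwD, fun v hv => ?_, fun v hv => ⟨1, by simpa using heD, ?_⟩⟩
          · rw [Finset.mem_singleton] at hv; rw [hv]; exact hwe
          · intro j hj
            have : j = 0 := by omega
            subst this; simpa using hv
        have := sum_forests_piecewise hex (fun _ => (1 : ℝ))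
        rw [Finset.sum_const, Finset.sum_const, nsmul_eq_mul, mul_one, nsmul_eq_mul, mul_one] at this
        rw [this, Finset.sdiff_singleton_eq_erase]
        unfold numF
        refine Nat.cast_le.2 (Finset.card_le_card fun f hf => ?_)
        rw [mem_forests] at hf ⊢
        refine isForest_congr_nb (fun v hv hm => ?_) hf
        rw [mem_delEdge]
        rw [Finset.mem_erase] at hv
        exact ⟨hm, fun h => heD (h.1 ▸ hv.2), fun h => hv.1 h.1⟩
      · have : (forests nb D).filter (fun f => AgreeOn {w} f (fun _ => e)) = ∅ := by
          rw [Finset.filter_eq_empty_iff]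
          intro f hf h
          rw [mem_forests] at hf
          have h1 := hf.1 w hwD
          rw [h w (by simp)] at h1
          exact hwe h1
        rw [this]; simpa using numF_nonneg _ _
    have h17 : numF (delEdge nb e w) (D.erase w) ≤ 17 * numF (delEdge nb e w) D := by
      refine numF_erase_le (symNb_delEdge hs e w) (p := p) hwD fun v y hy => ?_
      rw [hlw] at hy
      rw [mem_delEdge]
      refine ⟨hnb {w} (by simpa using hlw) v hy, ?_, ?_⟩
      · rintro ⟨rfl, rfl⟩
        rw [mem_nbH] at hy
        rcases hy.2 with h | ⟨h, _⟩ | ⟨h, h'⟩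
        · linarith [h.1]
        · exact hew (by simpa using h)
        · have := ell_nxt p w
          rw [← h'] at this
          linarith
      · rintro ⟨rfl, rfl⟩
        rw [mem_nbH] at hy
        rcases hy.2 with h | ⟨h, h'⟩ | ⟨h, h'⟩
        · linarith [h.2]
        · have := ell_nxt p w
          rw [← h'] at this
          linarith
        · exact hew (by simpa using h)
    linarith
  · have : numF nb D ≤ numF (delEdge nb e w) D := by
      unfold numF
      refine Nat.cast_le.2 (Finset.card_le_card fun f hf => ?_)
      rw [mem_forests] at hf ⊢
      refine isForest_congr_nb (fun v hv hm => ?_) hf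
      rw [mem_delEdge]
      exact ⟨hm, fun h => heD (h.1 ▸ hv), fun h => hwD (h.1 ▸ hv)⟩
    linarith [numF_nonneg (delEdge nb e w) D]

/-- Removing the edges from `X` in direction `p`. -/
def delUp (p : Fin 4 × Bool) (nb : V4 → Finset V4) (X : Finset V4) (v : V4) : Finset V4 :=
  (nb v).filter fun y => ¬ (v ∈ X ∧ y = nxt v p) ∧ ¬ (y ∈ X ∧ v = nxt y p)

theorem mem_delUp {p : Fin 4 × Bool} {nb : V4 → Finset V4} {X : Finset V4} {v y : V4} :
    y ∈ delUp p nb X v ↔ y ∈ nb v ∧ ¬ (v ∈ X ∧ y = nxt v p) ∧ ¬ (y ∈ X ∧ v = nxt y p) := by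
  simp only [delUp, Finset.mem_filter]

theorem symNb_delUp {p : Fin 4 × Bool} {nb : V4 → Finset V4} (hs : SymNb nb) (X : Finset V4) :
    SymNb (delUp p nb X) := by
  intro x y
  rw [mem_delUp, mem_delUp, hs x y]
  exact and_congr Iff.rfl and_comm

theorem nbH_subset_delUp {p : Fin 4 × Bool} {R : ℤ} {nb : V4 → Finset V4} {X : Finset V4}
    (hX : ∀ e ∈ X, ell p e = R)
    (hnb : ∀ X : Finset V4, (∀ v ∈ X, ell p v = R + 1) → ∀ v, nbH p (R + 1) X v ⊆ nb v) :
    ∀ Y : Finset V4, (∀ v ∈ Y, ell p v = R + 1) → ∀ v, nbH p (R + 1) Y v ⊆ delUp p nb X v := by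
  intro Y hY v y hy
  rw [mem_delUp]
  refine ⟨hnb Y hY v hy, ?_, ?_⟩
  · rintro ⟨h1, -⟩
    rw [mem_nbH] at hy
    have := hX v h1
    rcases hy.2 with h | ⟨h, _⟩ | ⟨h, h'⟩
    · linarith [h.1]
    · linarith [hY v h]
    · have h3 := ell_nxt p y
      rw [← h'] at h3
      linarith [hY y h]
  · rintro ⟨h1, -⟩
    rw [mem_nbH] at hy
    have := hX y h1
    rcases hy.2 with h | ⟨h, h'⟩ | ⟨h, h'⟩
    · linarith [h.2]
    · have h3 := ell_nxt p v
      rw [← h'] at h3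
      linarith [hY v h]
    · linarith [hY y h]

theorem numF_le_delUp {nb : V4 → Finset V4} (hs : SymNb nb) {p : Fin 4 × Bool} {R : ℤ}
    {D : Finset V4}
    (hnb : ∀ X : Finset V4, (∀ v ∈ X, ell p v = R + 1) → ∀ v, nbH p (R + 1) X v ⊆ nb v)
    (X : Finset V4) (hX : ∀ e ∈ X, ell p e = R) (hXD : Disjoint X D) :
    numF nb D ≤ 18 ^ X.card * numF (delUp p nb X) D := by
  induction X using Finset.induction_on with
  | empty =>
    have : delUp p nb ∅ = nb := by
      funext v; ext y; rw [mem_delUp]; simp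
    rw [this]; simp
  | insert e X he ih =>
    have hX' : ∀ e ∈ X, ell p e = R := fun e' he' => hX e' (Finset.mem_insert_of_mem he')
    have h1 := ih hX' (Finset.disjoint_of_subset_left (Finset.subset_insert _ _) hXD)
    have h2 := numF_le_delEdge (symNb_delUp hs X) (p := p) (R := R) (D := D)
      (hX e (Finset.mem_insert_self _ _))
      (Finset.disjoint_left.1 hXD (Finset.mem_insert_self _ _)) (nbH_subset_delUp hX' hnb)
    have h3 : numF (delEdge (delUp p nb X) e (nxt e p)) D ≤ numF (delUp p nb (insert e X)) D := by
      refine numF_mono_nb fun v _ y hy => ?_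
      rw [mem_delEdge, mem_delUp] at hy
      rw [mem_delUp]
      obtain ⟨⟨h0, h1, h2⟩, h3, h4⟩ := hy
      refine ⟨h0, ?_, ?_⟩
      · rintro ⟨hv, rfl⟩
        rcases Finset.mem_insert.1 hv with rfl | hv
        · exact h3 ⟨rfl, rfl⟩
        · exact h1 ⟨hv, rfl⟩
      · rintro ⟨hv, rfl⟩
        rcases Finset.mem_insert.1 hv with rfl | hv
        · exact h4 ⟨rfl, rfl⟩
        · exact h2 ⟨hv, rfl⟩
    rw [Finset.card_insert_of_notMem he, pow_succ]
    have h18 : (0 : ℝ) ≤ 18 ^ X.card := by positivity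
    calc numF nb D ≤ 18 ^ X.card * numF (delUp p nb X) D := h1
      _ ≤ 18 ^ X.card * (18 * numF (delUp p nb (insert e X)) D) :=
        mul_le_mul_of_nonneg_left (by linarith) h18
      _ = _ := by ring

/-- A finite set whose elements lead to `a0` inside the set is grown from `a0`. -/
theorem grow_of_leads {V : Type*} [DecidableEq V] {nb : V → Finset V} (hs : SymNb nb) {a0 : V}
    {f : V → V} {D : Finset V} (hf : IsForest nb D f) (ha : a0 ∉ D) {A : Finset V} (ha0 : a0 ∈ A)
    (hAD : A.erase a0 ⊆ D) (hA : ∀ v ∈ A.erase a0, f v ∈ A) :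
    Grow nb a0 A (fEdges (A.erase a0) f) := by
  induction hn : A.card using Nat.strong_induction_on generalizing A with
  | _ n ih =>
    by_cases hE : A.erase a0 = ∅
    · have : A = {a0} := by
        rw [← Finset.insert_erase ha0, hE]; rfl
      rw [hE, this]
      simpa [fEdges] using Grow.base
    · -- a vertex without preimages in `A`
      have hex : ∃ u ∈ A.erase a0, ∀ v ∈ A.erase a0, f v ≠ u := by
        by_contra hcon
        push Not at hcon
        obtain ⟨u0, hu0⟩ := Finset.nonempty_iff_ne_empty.2 hE
        choose! h hh1 hh2 using hcon
        have hsur : Set.SurjOn f (A.erase a0 : Finset V) (A.erase a0 : Finset V) :=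
          fun u hu => ⟨h u, hh1 u hu, hh2 u hu⟩
        have hmaps : ∀ v ∈ A.erase a0, f v ∈ A.erase a0 := by
          intro v hv
          have hinj : Function.Injective fun u : (A.erase a0 : Finset V) =>
              (⟨h u, hh1 u u.2⟩ : (A.erase a0 : Finset V)) := by
            intro u u' huu
            have h3 : h u = h u' := congrArg Subtype.val huu
            apply Subtype.ext
            rw [← hh2 u u.2, ← hh2 u' u'.2, h3]
          obtain ⟨u, hu⟩ := (Finite.injective_iff_surjective.1 hinj) ⟨v, hv⟩
          have h4 : h u = v := congrArg Subtype.val hu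
          rw [← h4, hh2 u u.2]; exact u.2
        have hit : ∀ k, f^[k] u0 ∈ A.erase a0 := by
          intro k
          induction k with
          | zero => exact hu0
          | succ k ihk => rw [Function.iterate_succ_apply']; exact hmaps _ ihk
        obtain ⟨k, hk⟩ := hf.2.2 u0
        exact hk (hAD (hit k))
      obtain ⟨u, hu, hu2⟩ := hex
      obtain ⟨hua, huA⟩ := Finset.mem_erase.1 hu
      have hfu : f u ≠ u := fun h => hu2 u hu h
      have hlt : (A.erase u).card < n := by rw [← hn]; exact Finset.card_erase_lt_of_mem huA
      have hsub : (A.erase u).erase a0 ⊆ A.erase a0 :=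
        Finset.erase_subset_erase _ (Finset.erase_subset _ _)
      have hg := ih _ hlt (A := A.erase u) (Finset.mem_erase.2 ⟨Ne.symm hua, ha0⟩)
        (hsub.trans hAD)
        (fun v hv => Finset.mem_erase.2 ⟨hu2 v (hsub hv), hA v (hsub hv)⟩) rfl
      have hfin := Grow.leaf (p := f u) (u := u) hg (Finset.mem_erase.2 ⟨hfu, hA u hu⟩) (by simp)
        ((hs _ _).1 (hf.1 u (hAD hu)))
      rw [Finset.insert_erase huA] at hfin
      convert hfin using 1
      rw [← Finset.insert_erase hu, fEdges, Finset.image_insert, Finset.erase_right_comm]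
      rfl

end OneEnd

section HalfComp

theorem abs_ell_sub_le {p : Fin 4 × Bool} {v w : V4} (h : w ∈ latNbrs v) :
    ell p w ≤ ell p v + 1 ∧ ell p v ≤ ell p w + 1 ∧
      (ell p w = ell p v + 1 → w = nxt v p) := by
  obtain ⟨q, rfl⟩ := mem_latNbrs.1 h
  by_cases hq : q.1 = p.1
  · by_cases hb : q.2 = p.2
    · have : q = p := Prod.ext hq hb
      subst this
      rw [ell_nxt]
      exact ⟨le_rfl, by linarith, fun _ => rfl⟩
    · have : q = (p.1, !p.2) := Prod.ext hq (by
        cases h1 : q.2 <;> cases h2 : p.2 <;> simp_all)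
      rw [this, ell_nxt_not]
      exact ⟨by linarith, by linarith, fun h => by linarith⟩
  · rw [ell_nxt_of_ne hq]
    exact ⟨by linarith, by linarith, fun h => by linarith⟩

theorem Grow.mono_nb {V : Type*} [DecidableEq V] {nb nb' : V → Finset V} {a0 : V} {A : Finset V}
    {E : Finset (Sym2 V)} (h : Grow nb a0 A E)
    (hm : ∀ u ∈ A, ∀ v ∈ A, u ∈ nb v → u ∈ nb' v) : Grow nb' a0 A E := by
  induction h with
  | base => exact Grow.base
  | leaf hG hp hu hup ih =>
    exact Grow.leaf (ih fun a ha b hb => hm a (Finset.mem_insert_of_mem ha) b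
      (Finset.mem_insert_of_mem hb)) hp hu
      (hm _ (Finset.mem_insert_self _ _) _ (Finset.mem_insert_of_mem hp) hup)

theorem mem_of_leads {nb : V4 → Finset V4} {D : Finset V4} {f : V4 → V4} (hf : IsForest nb D f)
    {x v : V4} {k : ℕ} (h : f^[k] v = x) (hv : v ≠ x) : v ∈ D := by
  by_contra hD
  exact hv (by rw [← h, iterate_fixed (hf.2.1 v hD)])

/-- The part of the tree above `x` connected to `x` inside `{ell p ≤ R}`. -/
def hcomp (p : Fin 4 × Bool) (R : ℤ) (D : Finset V4) (x : V4) (f : V4 → V4) : Finset V4 :=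
  D.filter fun v => ∃ k, f^[k] v = x ∧ ∀ j ≤ k, ell p (f^[j] v) ≤ R

theorem mem_hcomp {p : Fin 4 × Bool} {R : ℤ} {D : Finset V4} {x : V4} {f : V4 → V4} {v : V4} :
    v ∈ hcomp p R D x f ↔ v ∈ D ∧ ∃ k, f^[k] v = x ∧ ∀ j ≤ k, ell p (f^[j] v) ≤ R := by
  simp only [hcomp, Finset.mem_filter]

/-- The edges of `hcomp`. -/
def hedges (p : Fin 4 × Bool) (R : ℤ) (D : Finset V4) (x : V4) (f : V4 → V4) :
    Finset (Sym2 V4) := fEdges ((hcomp p R D x f).erase x) f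

/-- Some vertex above `x` reaches the level `R`. -/
def Reaches (p : Fin 4 × Bool) (x : V4) (R : ℤ) (f : V4 → V4) : Prop :=
  ∃ v, Leads f v {x} ∧ R ≤ ell p v

/-- The possible values of `(hcomp, hedges)`. -/
structure HalfClass (p : Fin 4 × Bool) (R : ℤ) (D : Finset V4) (x : V4) (A : Finset V4)
    (E : Finset (Sym2 V4)) : Prop where
  root : x ∈ A
  sub : A ⊆ D
  level : ∀ v ∈ A, ell p v ≤ R
  grow : Grow latNbrs x A E

variable {p : Fin 4 × Bool} {R : ℤ} {D : Finset V4} {x : V4} {f : V4 → V4}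
  {A A' : Finset V4} {E E' : Finset (Sym2 V4)}

theorem hcomp_closed (hf : IsForest latNbrs (D.erase x) f) (hx : x ∈ D) :
    ∀ v ∈ (hcomp p R D x f).erase x, f v ∈ hcomp p R D x f := by
  intro v hv
  obtain ⟨hvx, hv⟩ := Finset.mem_erase.1 hv
  rw [mem_hcomp] at hv ⊢
  obtain ⟨hvD, k, hk, hj⟩ := hv
  cases k with
  | zero => exact absurd hk hvx
  | succ k =>
    have hk' : f^[k] (f v) = x := hk
    refine ⟨?_, k, hk', fun j hjk => hj (j + 1) (by omega)⟩
    by_cases h : f v = x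
    · rw [h]; exact hx
    · exact (Finset.mem_erase.1 (mem_of_leads hf hk' h)).2

theorem halfClass_hcomp (hf : IsForest latNbrs (D.erase x) f) (hx : x ∈ D) (hR : ell p x ≤ R) :
    HalfClass p R D x (hcomp p R D x f) (hedges p R D x f) := by
  have hroot : x ∈ hcomp p R D x f := mem_hcomp.2 ⟨hx, 0, rfl, fun j hj => by
    obtain rfl : j = 0 := by omega
    exact hR⟩
  refine ⟨hroot, Finset.filter_subset _ _, fun v hv => ?_, ?_⟩
  · obtain ⟨-, k, -, h⟩ := mem_hcomp.1 hv
    exact h 0 (Nat.zero_le _)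
  · exact grow_of_leads symNb_latNbrs hf (by simp) hroot
      (Finset.erase_subset_erase _ (Finset.filter_subset _ _)) (hcomp_closed hf hx)

theorem HalfClass.erase_sdiff (h : HalfClass p R D x A E) : D.erase x \ A = D \ A := by
  ext v
  simp only [Finset.mem_sdiff, Finset.mem_erase]
  exact ⟨fun hv => ⟨hv.1.2, hv.2⟩, fun hv => ⟨⟨fun h' => hv.2 (h' ▸ h.root), hv.1⟩, hv.2⟩⟩

theorem HalfClass.growCut (h : HalfClass p R D x A E) : Grow (nbCut p R A) x A E := by
  refine h.grow.mono_nb fun u hu v hv huv => ?_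
  rw [mem_nbCut]
  exact ⟨huv, fun h' => h'.2.1 hu, fun h' => h'.2.1 hv⟩

theorem HalfClass.card_le (h : HalfClass p R D x A E) (hx : x ∈ D) (hR : ell p x ≤ R) :
    (((forests latNbrs (D.erase x)).filter fun f =>
      (hcomp p R D x f, hedges p R D x f) = (A, E)).card : ℝ) ≤ numF (nbCut p R A) (D \ A) := by
  rw [← h.erase_sdiff, ← card_rooted_cylinder (symNb_nbCut p R A) h.growCut
    (Finset.erase_subset_erase _ h.sub) (by simp)]
  refine Nat.cast_le.2 (Finset.card_le_card fun f hf => ?_)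
  rw [Finset.mem_filter, mem_forests] at hf ⊢
  obtain ⟨hf, hk⟩ := hf
  rw [Prod.mk.injEq] at hk
  obtain ⟨rfl, rfl⟩ := hk
  refine ⟨isForest_congr_nb (fun v hv hm => ?_) hf, ?_⟩
  · rw [mem_nbCut]
    refine ⟨hm, fun h' => h'.2.1 (hcomp_closed hf hx v
      (Finset.mem_erase.2 ⟨(Finset.mem_erase.1 hv).1, h'.1⟩)), fun h' => h'.2.1 ?_⟩
    obtain ⟨-, k, hk, hj⟩ := mem_hcomp.1 h'.1
    refine mem_hcomp.2 ⟨(Finset.mem_erase.1 hv).2, k + 1, hk, fun j hjk => ?_⟩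
    cases j with
    | zero => exact h'.2.2
    | succ j => exact hj j (by omega)
  · exact Finset.image_subset_image (Finset.erase_subset_erase _ h.sub)

/-- Trees in which the class edges are present and `A` is not extended below level `R`. -/
def cutTrees (p : Fin 4 × Bool) (R : ℤ) (D A : Finset V4) (E : Finset (Sym2 V4)) :
    Finset (V4 → V4) := (forests (nbCut p R A) D).filter fun f => E ⊆ fEdges D f

theorem cutTrees_subset : cutTrees p R D A E ⊆ forests latNbrs D := fun f hf => by
  rw [cutTrees, Finset.mem_filter, mem_forests] at hf
  rw [mem_forests]
  exact isForest_congr_nb (fun v _ hm => (mem_nbCut.1 hm).1) hf.1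

theorem HalfClass.subset_of_cutTrees (h : HalfClass p R D x A E) (h' : HalfClass p R D x A' E')
    (hf : f ∈ cutTrees p R D A E) (hf' : f ∈ cutTrees p R D A' E') : A ⊆ A' := by
  rw [cutTrees, Finset.mem_filter, mem_forests] at hf hf'
  have key : ∀ (B : Finset V4) (F : Finset (Sym2 V4)), Grow latNbrs x B F → F ⊆ fEdges D f →
      (∀ v ∈ B, ell p v ≤ R) → B ⊆ A' := by
    intro B F hG
    induction hG with
    | base => intro _ _; simpa using h'.root
    | @leaf B F q u hG hq hu huq ih =>
      intro hF hl
      have hB := ih ((Finset.subset_insert _ _).trans hF)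
        fun v hv => hl v (Finset.mem_insert_of_mem hv)
      refine Finset.insert_subset ?_ hB
      by_contra hu'
      have hlu := hl u (Finset.mem_insert_self _ _)
      rcases mk_mem_fEdges.1 (hF (Finset.mem_insert_self _ _)) with ⟨h1, h2⟩ | ⟨h1, h2⟩
      · have := mem_nbCut.1 (hf'.1.1 u h1)
        rw [h2] at this
        exact this.2.2 ⟨hB hq, hu', hlu⟩
      · have := mem_nbCut.1 (hf'.1.1 q h1)
        rw [h2] at this
        exact this.2.1 ⟨hB hq, hu', hlu⟩
  exact key A E h.grow hf.2 h.level

theorem HalfClass.eq_of_cutTrees (h : HalfClass p R D x A E) (h' : HalfClass p R D x A' E')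
    (hf : f ∈ cutTrees p R D A E) (hf' : f ∈ cutTrees p R D A' E') : A = A' ∧ E = E' := by
  have hA : A = A' := (h.subset_of_cutTrees h' hf hf').antisymm (h'.subset_of_cutTrees h hf' hf)
  subst hA
  refine ⟨rfl, ?_⟩
  rw [cutTrees, Finset.mem_filter, mem_forests] at hf hf'
  have hex : ∃ k, f^[k] x ∉ A := (hf.1.2.2 x).imp fun k hk hA => hk (h.sub hA)
  obtain ⟨k, hk, hmin⟩ := exists_first_of hex
  cases k with
  | zero => exact absurd h.root hk
  | succ k =>
    set a := f^[k] x with ha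
    have haA : a ∈ A := not_not.1 (hmin k (Nat.lt_succ_self k))
    have hfa : f a ∉ A := by rwa [Function.iterate_succ_apply'] at hk
    obtain ⟨g, hg⟩ := h.grow.exists_orients symNb_latNbrs haA
    obtain ⟨g', hg'⟩ := h'.grow.exists_orients symNb_latNbrs haA
    have e1 : E = fEdges (A.erase a) f := by
      rw [hg.2.1]
      exact Finset.image_congr fun v hv => by
        have hv := Finset.mem_erase.1 hv
        rw [(hg.eq_of_subset hf.2 (fun _ => hfa) hv.2 hv.1).1]
    have e2 : E' = fEdges (A.erase a) f := by
      rw [hg'.2.1]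
      exact Finset.image_congr fun v hv => by
        have hv := Finset.mem_erase.1 hv
        rw [(hg'.eq_of_subset hf'.2 (fun _ => hfa) hv.2 hv.1).1]
    rw [e1, e2]

/-- The vertices of `A` at level `R`. -/
def topOf (p : Fin 4 × Bool) (R : ℤ) (A : Finset V4) : Finset V4 := A.filter fun v => ell p v = R

theorem mem_topOf {v : V4} : v ∈ topOf p R A ↔ v ∈ A ∧ ell p v = R := by
  simp only [topOf, Finset.mem_filter]

theorem HalfClass.le_card_cutTrees (h : HalfClass p R D x A E) {M : ℝ} (hM : 0 < M)
    (hX : M ≤ ∑ e ∈ topOf p R A, (1 / (16 * 17)) / (∑ e' ∈ topOf p R A, psi 16 e' e)) :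
    numF (nbCut p R A) (D \ A) * M ≤ (cutTrees p R D A E).card := by
  rw [cutTrees, card_cylinder (symNb_nbCut p R A) h.growCut h.sub]
  rcases (numF_nonneg (nbCut p R A) (D \ A)).eq_or_lt with h0 | h0
  · rw [← h0, zero_mul]
    refine Finset.sum_nonneg fun a _ => Finset.sum_nonneg fun w _ => ?_
    have := numL_le_numF (nbCut p R A) (D \ A) A w
    linarith
  · have hne : (topOf p R A).Nonempty := by
      by_contra hne
      rw [Finset.not_nonempty_iff_eq_empty] at hne
      rw [hne] at hX
      simp only [Finset.sum_empty] at hX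
      linarith
    have h1 := hX.trans (halfspace_energy (p := p) (R := R) (X := topOf p R A)
      (fun e he => (mem_topOf.1 he).2) hne (symNb_nbCut p R A)
      (nbH_subset_nbCut h.level (Finset.filter_subset _ _) fun e he => (mem_topOf.1 he).2)
      (K := A ∪ D \ A) (φ := lpr (nbCut p R A) (D \ A) A) lpr_zero_off
      (fun e he => lpr_of_mem h0 (mem_topOf.1 he).1))
    rw [energy_eq_charge Finset.sdiff_disjoint h0] at h1
    refine (mul_le_mul_of_nonneg_left h1 h0.le).trans (le_of_eq ?_)
    simp only [Finset.mul_sum]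
    refine Finset.sum_congr rfl fun a _ => Finset.sum_congr rfl fun w _ => ?_
    rw [lpr]
    field_simp

theorem HalfClass.key_of_closed (h : HalfClass p R D x A E)
    (hf : IsForest (delUp p (nbCut p R A) (topOf p R A)) (D.erase x) f)
    (hE : E ⊆ fEdges (D.erase x) f) :
    hcomp p R D x f = A ∧ hedges p R D x f = E ∧ ¬ Reaches p x (R + 1) f := by
  obtain ⟨g, hg⟩ := h.grow.exists_orients symNb_latNbrs h.root
  have hfg : ∀ v ∈ A, v ≠ x → f v = g v := fun v hv hvx =>
    (hg.eq_of_subset hE (fun h => absurd h (by simp)) hv hvx).1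
  have hEf : E = fEdges (A.erase x) f := by
    rw [hg.2.1]
    exact Finset.image_congr fun v hv => by
      have hv := Finset.mem_erase.1 hv
      rw [hfg v hv.2 hv.1]
  have hback : ∀ k v, f^[k] v = x → v ∈ A := by
    intro k
    induction k with
    | zero => intro v hv; rw [show v = x from hv]; exact h.root
    | succ k ih =>
      intro v hv
      by_contra hvA
      have hvx : v ≠ x := fun h' => hvA (h' ▸ h.root)
      have hfv := ih (f v) hv
      have hm := mem_delUp.1 (hf.1 v (mem_of_leads hf hv hvx))
      have hc := mem_nbCut.1 hm.1
      have hlt : R < ell p v := by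
        by_contra hle
        exact hc.2.2 ⟨hfv, hvA, not_lt.1 hle⟩
      have hadj := abs_ell_sub_le (p := p) ((symNb_latNbrs _ _).1 hc.1)
      have hl := h.level _ hfv
      have htop : ell p (f v) = R := by linarith [hadj.1]
      exact hm.2.2 ⟨mem_topOf.2 ⟨hfv, htop⟩, hadj.2.2 (by linarith [hadj.1])⟩
  have hcomp_eq : hcomp p R D x f = A := by
    ext v
    rw [mem_hcomp]
    constructor
    · rintro ⟨-, k, hk, -⟩
      exact hback k v hk
    · intro hv
      obtain ⟨k, hk, hj⟩ := hg.leads hv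
      have hit : ∀ j ≤ k, f^[j] v = g^[j] v := fun j hjk =>
        iterate_congr_of fun i hi => by
          have := Finset.mem_erase.1 (hj i (by omega))
          exact (hfg _ this.2 this.1).symm
      refine ⟨h.sub hv, k, by rw [hit k le_rfl, hk], fun j hjk => ?_⟩
      rw [hit j hjk]
      exact h.level _ (hg.iterate_mem hv j)
  refine ⟨hcomp_eq, by rw [hedges, hcomp_eq, hEf], ?_⟩
  rintro ⟨v, ⟨k, hk⟩, hl⟩
  linarith [h.level v (hback k v hk)]

theorem HalfClass.le_closed (h : HalfClass p R D x A E) :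
    numF (nbCut p R A) (D \ A) ≤ 18 ^ (topOf p R A).card *
      (((forests latNbrs (D.erase x)).filter fun f =>
        (hcomp p R D x f, hedges p R D x f) = (A, E) ∧ ¬ Reaches p x (R + 1) f).card : ℝ) := by
  have hnb : ∀ X : Finset V4, (∀ v ∈ X, ell p v = R + 1) →
      ∀ v, nbH p (R + 1) X v ⊆ nbCut p R A v := by
    intro X hX v w hw
    obtain ⟨h1, h2⟩ := mem_nbH.1 hw
    have hnA : ∀ y, R < ell p y → y ∉ A := fun y hy hA => absurd (h.level y hA) (not_le.2 hy)
    have hboth : R < ell p v ∧ R < ell p w := by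
      rcases h2 with h | ⟨h, rfl⟩ | ⟨h, rfl⟩
      · constructor <;> linarith [h.1, h.2]
      · rw [ell_nxt, hX _ h]; constructor <;> linarith
      · rw [ell_nxt, hX _ h]; constructor <;> linarith
    rw [mem_nbCut]
    exact ⟨h1, fun h' => hnA v hboth.1 h'.1, fun h' => hnA w hboth.2 h'.1⟩
  have hXD : Disjoint (topOf p R A) (D \ A) := by
    rw [Finset.disjoint_left]
    intro v hv hv'
    exact (Finset.mem_sdiff.1 hv').2 (mem_topOf.1 hv).1
  refine (numF_le_delUp (symNb_nbCut p R A) hnb (topOf p R A) (fun e he => (mem_topOf.1 he).2)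
    hXD).trans (mul_le_mul_of_nonneg_left ?_ (by positivity))
  have hgrow : Grow (delUp p (nbCut p R A) (topOf p R A)) x A E := by
    refine h.growCut.mono_nb fun u hu v hv huv => ?_
    rw [mem_delUp]
    refine ⟨huv, ?_, ?_⟩
    · rintro ⟨h1, rfl⟩
      have := h.level _ hu
      rw [ell_nxt, (mem_topOf.1 h1).2] at this
      linarith
    · rintro ⟨h1, rfl⟩
      have := h.level _ hv
      rw [ell_nxt, (mem_topOf.1 h1).2] at this
      linarith
  rw [← h.erase_sdiff, ← card_rooted_cylinder (symNb_delUp (symNb_nbCut p R A) _) hgrow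
    (Finset.erase_subset_erase _ h.sub) (by simp)]
  refine Nat.cast_le.2 (Finset.card_le_card fun f hf => ?_)
  rw [Finset.mem_filter, mem_forests] at hf ⊢
  obtain ⟨h1, h2, h3⟩ := h.key_of_closed hf.1 hf.2
  refine ⟨isForest_congr_nb (fun v _ hm => (mem_nbCut.1 (mem_delUp.1 hm).1).1) hf.1, ?_, h3⟩
  rw [h1, h2]

theorem exists_top_of_reaches (hf : IsForest latNbrs (D.erase x) f) (hx : x ∈ D)
    (hR : ell p x ≤ R) (h : Reaches p x R f) : (topOf p R (hcomp p R D x f)).Nonempty := by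
  obtain ⟨v, ⟨k, hk⟩, hl⟩ := h
  have hk : f^[k] v = x := hk
  induction k using Nat.strong_induction_on generalizing v with
  | _ k ih =>
    by_cases hex : ∃ j, 1 ≤ j ∧ j ≤ k ∧ R ≤ ell p (f^[j] v)
    · obtain ⟨j, h1, h2, h3⟩ := hex
      refine ih (k - j) (by omega) (f^[j] v) h3 ?_ ?_
      · rw [← Function.iterate_add_apply, Nat.sub_add_cancel h2]; exact hk
      · rw [← Function.iterate_add_apply, Nat.sub_add_cancel h2]; exact hk
    · push Not at hex
      have hvR : ell p v = R := by
        refine le_antisymm ?_ hl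
        by_cases hvx : v = x
        · rw [hvx]; exact hR
        · have hvD := mem_of_leads hf hk hvx
          have hk1 : 1 ≤ k := by
            by_contra h0
            obtain rfl : k = 0 := by omega
            exact hvx hk
          have h1 := hex 1 le_rfl hk1
          have h2 := (abs_ell_sub_le (p := p) (hf.1 v hvD)).2.1
          rw [Function.iterate_one] at h1
          linarith
      refine ⟨v, mem_topOf.2 ⟨mem_hcomp.2 ⟨?_, k, hk, fun j hj => ?_⟩, hvR⟩⟩
      · by_cases hvx : v = x
        · rw [hvx]; exact hx
        · exact (Finset.mem_erase.1 (mem_of_leads hf hk hvx)).2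
      · cases j with
        | zero => exact hvR.le
        | succ j => exact (hex (j + 1) (by omega) hj).le

theorem reaches_of_top (h : (topOf p R (hcomp p R D x f)).Nonempty) : Reaches p x R f := by
  obtain ⟨v, hv⟩ := h
  obtain ⟨hv, hl⟩ := mem_topOf.1 hv
  obtain ⟨-, k, hk, -⟩ := mem_hcomp.1 hv
  exact ⟨v, ⟨k, hk⟩, hl.ge⟩

end HalfComp

section EscapeBound

variable {p : Fin 4 × Bool} {R : ℤ} {D : Finset V4} {x : V4}

/-- Number of forests (rooted at `x` and at infinity) in which `x` is reached from level `R`. -/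
def reachCount (p : Fin 4 × Bool) (R : ℤ) (D : Finset V4) (x : V4) : ℝ :=
  ((forests latNbrs (D.erase x)).filter fun f => Reaches p x R f).card

/-- The key of a forest. -/
def hkey (p : Fin 4 × Bool) (R : ℤ) (D : Finset V4) (x : V4) (f : V4 → V4) :
    Finset V4 × Finset (Sym2 V4) := (hcomp p R D x f, hedges p R D x f)

theorem sum_many_exits (hx : x ∈ D) (hR : ell p x ≤ R) {M : ℝ} (hM : 0 < M) {k0 : ℕ}
    (hk0 : ∀ X : Finset V4, k0 ≤ X.card →
      M ≤ ∑ e ∈ X, (1 / (16 * 17)) / (∑ e' ∈ X, psi 16 e' e)) :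
    (((forests latNbrs (D.erase x)).filter fun f =>
      k0 ≤ (topOf p R (hcomp p R D x f)).card).card : ℝ) * M ≤ numF latNbrs D := by
  set S := (forests latNbrs (D.erase x)).filter fun f =>
      k0 ≤ (topOf p R (hcomp p R D x f)).card with hS
  have hcls : ∀ κ ∈ S.image (hkey p R D x), HalfClass p R D x κ.1 κ.2 ∧
      k0 ≤ (topOf p R κ.1).card := by
    intro κ hκ
    obtain ⟨f, hf, rfl⟩ := Finset.mem_image.1 hκ
    rw [hS, Finset.mem_filter, mem_forests] at hf
    exact ⟨halfClass_hcomp hf.1 hx hR, hf.2⟩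
  rw [Finset.card_eq_sum_card_image (hkey p R D x) S, Nat.cast_sum, Finset.sum_mul]
  have h1 : ∀ κ ∈ S.image (hkey p R D x),
      ((S.filter fun f => hkey p R D x f = κ).card : ℝ) * M ≤ (cutTrees p R D κ.1 κ.2).card := by
    intro κ hκ
    obtain ⟨h, hk⟩ := hcls κ hκ
    refine le_trans (mul_le_mul_of_nonneg_right (le_trans ?_ (h.card_le hx hR)) hM.le)
      (h.le_card_cutTrees hM (hk0 _ hk))
    refine Nat.cast_le.2 (Finset.card_le_card fun f hf => ?_)
    rw [Finset.mem_filter] at hf ⊢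
    exact ⟨(Finset.mem_filter.1 hf.1).1, hf.2⟩
  refine (Finset.sum_le_sum h1).trans ?_
  rw [← Nat.cast_sum, ← Finset.card_biUnion]
  · refine Nat.cast_le.2 (Finset.card_le_card ?_)
    exact Finset.biUnion_subset.2 fun κ _ => cutTrees_subset
  · intro κ hκ κ' hκ' hne
    rw [Function.onFun, Finset.disjoint_left]
    intro f hf hf'
    obtain ⟨h1, h2⟩ := (hcls κ hκ).1.eq_of_cutTrees (hcls κ' hκ').1 hf hf'
    exact hne (Prod.ext h1 h2)

theorem sum_few_exits (hx : x ∈ D) (hR : ell p x ≤ R) (k0 : ℕ) :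
    (((forests latNbrs (D.erase x)).filter fun f =>
      Reaches p x R f ∧ ¬ k0 ≤ (topOf p R (hcomp p R D x f)).card).card : ℝ) ≤
      18 ^ k0 * (reachCount p R D x - reachCount p (R + 1) D x) := by
  set S := (forests latNbrs (D.erase x)).filter fun f =>
      Reaches p x R f ∧ ¬ k0 ≤ (topOf p R (hcomp p R D x f)).card with hS
  set G := fun κ : Finset V4 × Finset (Sym2 V4) => (forests latNbrs (D.erase x)).filter fun f =>
        hkey p R D x f = κ ∧ ¬ Reaches p x (R + 1) f with hG
  have h1 : ∀ κ ∈ S.image (hkey p R D x),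
      ((S.filter fun f => hkey p R D x f = κ).card : ℝ) ≤ 18 ^ k0 * (G κ).card := by
    intro κ hκ
    obtain ⟨f, hf, rfl⟩ := Finset.mem_image.1 hκ
    rw [hS, Finset.mem_filter, mem_forests] at hf
    have h := halfClass_hcomp hf.1 hx hR
    refine le_trans (le_trans ?_ (h.card_le hx hR)) (h.le_closed.trans ?_)
    · refine Nat.cast_le.2 (Finset.card_le_card fun f hf => ?_)
      rw [Finset.mem_filter] at hf ⊢
      exact ⟨(Finset.mem_filter.1 hf.1).1, hf.2⟩
    · refine mul_le_mul_of_nonneg_right (pow_le_pow_right₀ (by norm_num) ?_) (Nat.cast_nonneg _)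
      exact (not_le.1 hf.2.2).le
  rw [Finset.card_eq_sum_card_image (hkey p R D x) S, Nat.cast_sum]
  refine (Finset.sum_le_sum h1).trans ?_
  rw [← Finset.mul_sum]
  refine mul_le_mul_of_nonneg_left ?_ (by positivity)
  rw [← Nat.cast_sum, ← Finset.card_biUnion, le_sub_iff_add_le, reachCount, reachCount]
  · rw [← Nat.cast_add, ← Finset.card_union_of_disjoint]
    · refine Nat.cast_le.2 (Finset.card_le_card fun f hf => ?_)
      rw [Finset.mem_filter]
      rcases Finset.mem_union.1 hf with hf | hf
      · obtain ⟨κ, hκ, hf⟩ := Finset.mem_biUnion.1 hf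
        obtain ⟨f', hf', rfl⟩ := Finset.mem_image.1 hκ
        rw [hG, Finset.mem_filter] at hf
        rw [hS, Finset.mem_filter, mem_forests] at hf'
        refine ⟨hf.1, reaches_of_top (D := D) ?_⟩
        have := congrArg Prod.fst hf.2.1
        simp only [hkey] at this
        rw [this]
        exact exists_top_of_reaches hf'.1 hx hR hf'.2.1
      · rw [Finset.mem_filter] at hf
        obtain ⟨v, h1, h2⟩ := hf.2
        exact ⟨hf.1, v, h1, by linarith⟩
    · rw [Finset.disjoint_left]
      intro f hf hf'
      obtain ⟨κ, hκ, hf⟩ := Finset.mem_biUnion.1 hf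
      rw [hG, Finset.mem_filter] at hf
      exact hf.2.2 (Finset.mem_filter.1 hf').2
  · intro κ hκ κ' hκ' hne
    rw [Function.onFun, Finset.disjoint_left]
    intro f hf hf'
    rw [hG, Finset.mem_filter] at hf hf'
    exact hne (hf.2.1.symm.trans hf'.2.1)

theorem reachCount_step (hx : x ∈ D) (hR : ell p x ≤ R) {M : ℝ} (hM : 0 < M) {k0 : ℕ}
    (hk0 : ∀ X : Finset V4, k0 ≤ X.card →
      M ≤ ∑ e ∈ X, (1 / (16 * 17)) / (∑ e' ∈ X, psi 16 e' e)) :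
    reachCount p R D x ≤ 8 * numF latNbrs (D.erase x) / M +
      18 ^ k0 * (reachCount p R D x - reachCount p (R + 1) D x) := by
  have h1 := sum_many_exits hx hR hM hk0
  have h2 := sum_few_exits (p := p) hx hR k0
  have h3 : numF latNbrs D ≤ 8 * numF latNbrs (D.erase x) := by
    have := numF_le_card_mul latNbrs hx
    rwa [card_latNbrs] at this
  have h4 : reachCount p R D x ≤ (((forests latNbrs (D.erase x)).filter fun f =>
      k0 ≤ (topOf p R (hcomp p R D x f)).card).card : ℝ) +
      (((forests latNbrs (D.erase x)).filter fun f =>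
      Reaches p x R f ∧ ¬ k0 ≤ (topOf p R (hcomp p R D x f)).card).card : ℝ) := by
    rw [reachCount, ← Nat.cast_add]
    refine Nat.cast_le.2 ((Finset.card_le_card fun f hf => ?_).trans (Finset.card_union_le _ _))
    rw [Finset.mem_filter] at hf
    rw [Finset.mem_union, Finset.mem_filter, Finset.mem_filter]
    by_cases h : k0 ≤ (topOf p R (hcomp p R D x f)).card
    · exact Or.inl ⟨hf.1, h⟩
    · exact Or.inr ⟨hf.1, hf.2, h⟩
  have h5 : (((forests latNbrs (D.erase x)).filter fun f =>
      k0 ≤ (topOf p R (hcomp p R D x f)).card).card : ℝ) ≤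
        8 * numF latNbrs (D.erase x) / M := by
    rw [le_div_iff₀ hM]
    exact h1.trans h3
  linarith

theorem reachCount_anti {R R' : ℤ} (h : R ≤ R') : reachCount p R' D x ≤ reachCount p R D x := by
  refine Nat.cast_le.2 (Finset.card_le_card fun f hf => ?_)
  rw [Finset.mem_filter] at hf ⊢
  obtain ⟨v, h1, h2⟩ := hf.2
  exact ⟨hf.1, v, h1, by linarith⟩

/-- Uniform one-endedness in the direction `p`. -/
theorem exists_reachCount_le {ε : ℝ} (hε : 0 < ε) : ∃ J : ℕ, ∀ (p : Fin 4 × Bool) (D : Finset V4),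
    ∀ x ∈ D, reachCount p (ell p x + J) D x ≤ ε * numF latNbrs (D.erase x) := by
  have hM : (0 : ℝ) < 16 / ε := by positivity
  obtain ⟨k0, hk0⟩ := halfspace_bound (16 / ε)
  obtain ⟨J, hJ⟩ := exists_nat_gt (2 * 18 ^ k0 / ε)
  refine ⟨J, fun p D x hx => ?_⟩
  by_contra hcon
  push Not at hcon
  set N := numF latNbrs (D.erase x) with hN
  have hN0 : 0 < N := numF_lat_pos _
  have hstep : ∀ j : ℕ, j ≤ J →
      reachCount p (ell p x + j) D x ≤ N - j * (ε / 2 / 18 ^ k0 * N) := by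
    intro j
    induction j with
    | zero =>
      intro _
      simp only [Nat.cast_zero, zero_mul, sub_zero]
      exact Nat.cast_le.2 (Finset.card_filter_le _ _)
    | succ j ih =>
      intro hj
      have h1 := ih (by omega)
      have h2 := reachCount_step (p := p) (R := ell p x + j) hx (by omega) hM hk0
      have h3 : ε * N < reachCount p (ell p x + j) D x :=
        hcon.trans_le (reachCount_anti (by omega))
      have h4 : 8 * N / (16 / ε) = ε / 2 * N := by field_simp; ring
      rw [h4] at h2
      have h5 : ε / 2 * N ≤ 18 ^ k0 *
          (reachCount p (ell p x + j) D x - reachCount p (ell p x + j + 1) D x) := by linarith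
      have h6 : ε / 2 / 18 ^ k0 * N ≤
          reachCount p (ell p x + j) D x - reachCount p (ell p x + j + 1) D x := by
        rw [div_mul_eq_mul_div, div_le_iff₀ (by positivity)]
        linarith
      have h7 : ell p x + ((j + 1 : ℕ) : ℤ) = ell p x + j + 1 := by push_cast; ring
      rw [h7]
      push_cast
      linarith
  have h1 := hstep J le_rfl
  have h2 : 0 ≤ reachCount p (ell p x + J) D x := Nat.cast_nonneg _
  have h3 : (1 : ℝ) < J * (ε / 2 / 18 ^ k0) := by
    rw [div_lt_iff₀ hε] at hJ
    rw [div_div, ← mul_div_assoc, lt_div_iff₀ (by positivity)]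
    linarith
  nlinarith

theorem exists_ell_of_notMem_boxV {n : ℕ} {v : V4} (h : v ∉ boxV n) :
    ∃ p : Fin 4 × Bool, (n : ℤ) < ell p v := by
  rw [mem_boxV] at h
  push Not at h
  obtain ⟨i, hi⟩ := h
  rcases lt_abs.1 hi with hi | hi
  · exact ⟨(i, true), by simpa [ell] using hi⟩
  · exact ⟨(i, false), by simpa [ell] using hi⟩

theorem ell_le_of_mem_boxV {n : ℕ} {v : V4} (h : v ∈ boxV n) (p : Fin 4 × Bool) :
    ell p v ≤ n := by
  have := abs_le.1 (mem_boxV.1 h p.1)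
  unfold ell
  split_ifs
  · linarith [this.2]
  · linarith [this.1]

/-- Some vertex outside `boxV R` has its orbit passing through `x`. -/
def FarAbove (R : ℕ) (x : V4) (f : V4 → V4) : Prop := ∃ z, z ∉ boxV R ∧ Leads f z {x}

theorem farAbove_anti {R R' : ℕ} (h : R ≤ R') {x : V4} {f : V4 → V4} (hf : FarAbove R' x f) :
    FarAbove R x f := by
  obtain ⟨z, hz, h1⟩ := hf
  exact ⟨z, fun hz' => hz (boxV_mono h hz'), h1⟩

/-- One-endedness, uniformly in the domain. -/
theorem exists_farAbove_le (m : ℕ) {ε : ℝ} (hε : 0 < ε) : ∃ R : ℕ, ∀ (D : Finset V4),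
    ∀ x ∈ D, x ∈ boxV m →
      (((forests latNbrs D).filter fun f => FarAbove R x f).card : ℝ) ≤ ε * numF latNbrs D := by
  obtain ⟨J, hJ⟩ := exists_reachCount_le (ε := ε / (17 * 64)) (by positivity)
  refine ⟨m + J, fun D x hx hxm => ?_⟩
  have h1 : (((forests latNbrs (D.erase x)).filter fun f => FarAbove (m + J) x f).card : ℝ) ≤
      8 * (ε / (17 * 64) * numF latNbrs (D.erase x)) := by
    have hsub : (forests latNbrs (D.erase x)).filter (fun f => FarAbove (m + J) x f) ⊆
        Finset.univ.biUnion fun p : Fin 4 × Bool => (forests latNbrs (D.erase x)).filter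
          fun f => Reaches p x (ell p x + J) f := by
      intro f hf
      rw [Finset.mem_filter] at hf
      obtain ⟨z, hz, hl⟩ := hf.2
      obtain ⟨p, hp⟩ := exists_ell_of_notMem_boxV hz
      rw [Finset.mem_biUnion]
      refine ⟨p, Finset.mem_univ _, Finset.mem_filter.2 ⟨hf.1, z, hl, ?_⟩⟩
      have := ell_le_of_mem_boxV hxm p
      push_cast at hp
      linarith
    have h2 := (Finset.card_le_card hsub).trans Finset.card_biUnion_le
    have h3 : (((forests latNbrs (D.erase x)).filter fun f => FarAbove (m + J) x f).card : ℝ) ≤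
        ∑ p : Fin 4 × Bool, reachCount p (ell p x + J) D x := by
      unfold reachCount
      rw [← Nat.cast_sum]
      exact Nat.cast_le.2 h2
    refine h3.trans ((Finset.sum_le_card_nsmul _ _ _ fun p _ => hJ p D x hx).trans (le_of_eq ?_))
    simp
  have h2 : (((forests latNbrs D).filter fun f => FarAbove (m + J) x f).card : ℝ) ≤
      8 * (((forests latNbrs (D.erase x)).filter fun f => FarAbove (m + J) x f).card : ℝ) := by
    rw [Finset.natCast_card_filter, Finset.natCast_card_filter, sum_forests_erase latNbrs hx,
      Finset.mul_sum]
    refine Finset.sum_le_sum fun f _ => ?_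
    have h4 : ∀ w ∈ (latNbrs x).filter (fun w => ¬ Leads f w {x}),
        (if FarAbove (m + J) x (Function.update f x w) then (1 : ℝ) else 0) ≤
          if FarAbove (m + J) x f then 1 else 0 := by
      intro w _
      by_cases h : FarAbove (m + J) x f
      · rw [if_pos h]; split_ifs <;> norm_num
      · rw [if_neg h, if_neg]
        rintro ⟨z, hz, hl⟩
        refine h ⟨z, hz, ?_⟩
        by_contra hn
        exact hn ((leads_update_of_not_leads hn).1 hl)
    refine (Finset.sum_le_card_nsmul _ _ _ h4).trans ?_
    rw [nsmul_eq_mul]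
    refine mul_le_mul_of_nonneg_right ?_ (by split_ifs <;> norm_num)
    have := Finset.card_filter_le (latNbrs x) (fun w => ¬ Leads f w {x})
    rw [card_latNbrs] at this
    exact_mod_cast this
  have h3 : numF latNbrs (D.erase x) ≤ 17 * numF latNbrs D :=
    numF_erase_le symNb_latNbrs (p := (0, true)) hx fun v => Finset.filter_subset _ _
  have h5 : 0 < numF latNbrs D := numF_lat_pos D
  calc _ ≤ 8 * (8 * (ε / (17 * 64) * numF latNbrs (D.erase x))) :=
        h2.trans (by linarith)
    _ ≤ 8 * (8 * (ε / (17 * 64) * (17 * numF latNbrs D))) := by gcongr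
    _ = ε * numF latNbrs D := by ring

end EscapeBound

section Dirichlet

/-- The `ℓ¹` norm on `ℤ⁴`. -/
def onorm (y : V4) : ℕ := ∑ i, (y i).natAbs

theorem exists_nxt_closer {y : V4} (h : y ≠ 0) :
    ∃ q, onorm (nxt y q) < onorm y ∧ ∀ n : ℕ, y ∈ boxV n → nxt y q ∈ boxV n := by
  obtain ⟨i, hi⟩ : ∃ i, y i ≠ 0 := by
    by_contra hcon
    push Not at hcon
    exact h (funext hcon)
  have key : ∀ s : Bool, (y i + if s then 1 else -1).natAbs < (y i).natAbs →
      onorm (nxt y (i, s)) < onorm y ∧ ∀ n : ℕ, y ∈ boxV n → nxt y (i, s) ∈ boxV n := by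
    intro s hs
    constructor
    · unfold onorm
      refine Finset.sum_lt_sum (fun j _ => ?_) ⟨i, Finset.mem_univ _, ?_⟩
      · by_cases hj : j = i
        · subst hj; simp only [nxt, Function.update_self]; exact hs.le
        · simp only [nxt, Function.update_of_ne hj]; exact le_rfl
      · simp only [nxt, Function.update_self]; exact hs
    · intro n hn
      rw [mem_boxV] at hn ⊢
      intro j
      by_cases hj : j = i
      · subst hj
        simp only [nxt, Function.update_self]
        have := hn j
        rw [Int.abs_eq_natAbs] at this ⊢
        omega
      · simp only [nxt, Function.update_of_ne hj]; exact hn j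
  rcases lt_or_gt_of_ne hi with h0 | h0
  · exact ⟨(i, true), key true (by simp only [if_true]; omega)⟩
  · exact ⟨(i, false), key false (by simp only [Bool.false_eq_true, if_false]; omega)⟩

theorem lat_induction {P : V4 → Prop} (h : ∀ x q, P (nxt x q) → P x) (h0 : P 0) (x : V4) : P x := by
  induction hn : onorm x using Nat.strong_induction_on generalizing x with
  | _ n ih =>
    by_cases hx : x = 0
    · rw [hx]; exact h0
    · obtain ⟨q, hq, -⟩ := exists_nxt_closer hx
      exact h x q (ih _ (hn ▸ hq) _ rfl)

theorem nxt_nxt' (y : V4) (i : Fin 4) (s : Bool) : nxt (nxt y (i, !s)) (i, s) = y := by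
  have := nxt_nxt y i (!s)
  rwa [Bool.not_not] at this

/-- Translation by one step, as an equivalence. -/
def nxtEquiv (i : Fin 4) : V4 ≃ V4 where
  toFun x := nxt x (i, true)
  invFun x := nxt x (i, false)
  left_inv x := nxt_nxt x i true
  right_inv x := nxt_nxt' x i true

/-- The gradient of `d`. -/
def grad (d : V4 → ℝ) (q : Fin 4 × Bool) (x : V4) : ℝ := d (nxt x q) - d x

theorem grad_false (d : V4 → ℝ) (i : Fin 4) (x : V4) :
    grad d (i, false) x = - grad d (i, true) (nxt x (i, false)) := by
  have := nxt_nxt' x i true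
  simp only [Bool.not_true] at this
  simp only [grad, this]
  ring

theorem lap_eq_grad (d : V4 → ℝ) (x : V4) :
    lap latNbrs d x = ∑ i : Fin 4, (grad d (i, true) (nxt x (i, false)) - grad d (i, true) x) := by
  rw [lap, sum_latNbrs, Fintype.sum_prod_type]
  refine Finset.sum_congr rfl fun i _ => ?_
  rw [Fintype.sum_bool]
  have := nxt_nxt' x i true
  simp only [Bool.not_true] at this
  simp only [grad, this]
  ring

theorem summable_mul_of_sq {ι : Type*} {a b : ι → ℝ} (ha : Summable fun x => a x ^ 2)
    (hb : Summable fun x => b x ^ 2) : Summable fun x => a x * b x := by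
  refine Summable.of_norm_bounded (ha.add hb) fun x => ?_
  rw [Real.norm_eq_abs, abs_le]
  constructor <;> nlinarith [sq_nonneg (a x + b x), sq_nonneg (a x - b x), sq_nonneg (a x),
    sq_nonneg (b x)]

theorem summable_sq_add {ι : Type*} {a b : ι → ℝ} (ha : Summable fun x => a x ^ 2)
    (hb : Summable fun x => b x ^ 2) : Summable fun x => (a x + b x) ^ 2 := by
  refine Summable.of_nonneg_of_le (fun x => sq_nonneg _) (fun x => ?_) ((ha.add hb).mul_left 2)
  nlinarith [sq_nonneg (a x - b x)]

/-- Summation by parts. -/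
theorem tsum_mul_lap {d φ : V4 → ℝ} (hd : ∀ i, Summable fun x => grad d (i, true) x ^ 2)
    (hφ : Summable fun x => φ x ^ 2) :
    ∑' x, φ x * lap latNbrs d x = ∑ i, ∑' x, grad φ (i, true) x * grad d (i, true) x := by
  have hsh : ∀ i, Summable fun x => grad d (i, true) (nxt x (i, false)) ^ 2 := fun i =>
    ((nxtEquiv i).symm.summable_iff (f := fun x => grad d (i, true) x ^ 2)).2 (hd i)
  have hsφ : ∀ i, Summable fun x => φ (nxt x (i, true)) ^ 2 := fun i =>
    ((nxtEquiv i).summable_iff (f := fun x => φ x ^ 2)).2 hφ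
  have h1 : ∀ x, φ x * lap latNbrs d x = ∑ i : Fin 4,
      (φ x * grad d (i, true) (nxt x (i, false)) - φ x * grad d (i, true) x) := fun x => by
    rw [lap_eq_grad, Finset.mul_sum]
    exact Finset.sum_congr rfl fun i _ => by ring
  simp_rw [h1]
  rw [Summable.tsum_finsetSum fun i _ =>
    (summable_mul_of_sq hφ (hsh i)).sub (summable_mul_of_sq hφ (hd i))]
  refine Finset.sum_congr rfl fun i _ => ?_
  rw [(summable_mul_of_sq hφ (hsh i)).tsum_sub (summable_mul_of_sq hφ (hd i))]
  have h2 : ∑' x, φ x * grad d (i, true) (nxt x (i, false)) =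
      ∑' x, φ (nxt x (i, true)) * grad d (i, true) x := by
    rw [← (nxtEquiv i).tsum_eq]
    refine tsum_congr fun x => ?_
    have : nxt (nxt x (i, true)) (i, false) = x := nxt_nxt x i true
    simp only [nxtEquiv, Equiv.coe_fn_mk, this]
  rw [h2, ← (summable_mul_of_sq (hsφ i) (hd i)).tsum_sub (summable_mul_of_sq hφ (hd i))]
  refine tsum_congr fun x => ?_
  simp only [grad]
  ring

/-- Translation by `-k` in the first coordinate. -/
def shiftE (k : ℕ) : V4 ≃ V4 where
  toFun x := x - Pi.single 0 (k : ℤ)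
  invFun x := x + Pi.single 0 (k : ℤ)
  left_inv x := by simp
  right_inv x := by simp

theorem shiftE_apply (k : ℕ) (x : V4) : shiftE k x = x - Pi.single 0 (k : ℤ) := rfl

theorem nxt_eq_add (x : V4) (q : Fin 4 × Bool) :
    nxt x q = x + Pi.single q.1 (if q.2 then 1 else -1) := by
  funext j
  by_cases hj : j = q.1
  · subst hj; simp [nxt]
  · simp [nxt, Function.update_of_ne hj, hj]

theorem nxt_shiftE (k : ℕ) (x : V4) (q : Fin 4 × Bool) :
    nxt (shiftE k x) q = shiftE k (nxt x q) := by
  rw [nxt_eq_add, nxt_eq_add, shiftE_apply, shiftE_apply]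
  abel

theorem shiftE_succ (k : ℕ) (x : V4) : nxt (shiftE (k + 1) x) (0, true) = shiftE k x := by
  rw [nxt_eq_add, shiftE_apply, shiftE_apply]
  funext j
  by_cases hj : j = 0
  · subst hj; simp; ring
  · simp [hj]

theorem tendsto_shift {G : V4 → ℝ} (hG : Summable fun x => G x ^ 2) (x : V4) :
    Tendsto (fun k => G (shiftE k x)) atTop (𝓝 0) := by
  have h1 : Tendsto G cofinite (𝓝 0) := by
    have := hG.tendsto_cofinite_zero.sqrt
    rw [Real.sqrt_zero] at this
    simp_rw [Real.sqrt_sq_eq_abs] at this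
    exact (tendsto_zero_iff_abs_tendsto_zero _).2 this
  have hinj : Function.Injective fun k : ℕ => shiftE k x := by
    intro k k' h
    have := congrFun h 0
    simp [shiftE_apply] at this
    exact this
  have h2 := hinj.tendsto_cofinite
  rw [Nat.cofinite_eq_atTop] at h2
  exact h1.comp h2

theorem tendsto_corr {G : V4 → ℝ} (hG : Summable fun x => G x ^ 2) :
    Tendsto (fun k => ∑' x, G (shiftE k x) * G x) atTop (𝓝 0) := by
  set Q := ∑' x, G x ^ 2 with hQ
  have hQ0 : 0 ≤ Q := tsum_nonneg fun x => sq_nonneg _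
  have hshift : ∀ k, Summable fun x => G (shiftE k x) ^ 2 := fun k =>
    ((shiftE k).summable_iff (f := fun x => G x ^ 2)).2 hG
  have hshiftQ : ∀ k, ∑' x, G (shiftE k x) ^ 2 = Q := fun k =>
    (shiftE k).tsum_eq (fun x => G x ^ 2)
  rw [Metric.tendsto_atTop]
  intro ε hε
  set l := ε / (2 * (Q + 1)) with hl
  have hl0 : 0 < l := by positivity
  obtain ⟨F, hF⟩ : ∃ F : Finset V4, Q - ∑ x ∈ F, G x ^ 2 < l * ε / 2 := by
    have := (hG.hasSum.eventually (lt_mem_nhds (b := Q) (a := Q - l * ε / 2) (by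
      have : 0 < l * ε / 2 := by positivity
      linarith))).exists
    obtain ⟨F, hF⟩ := this
    exact ⟨F, by linarith⟩
  have hfin : Tendsto (fun k => ∑ x ∈ F, |G (shiftE k x)| * |G x|) atTop (𝓝 0) := by
    have : Tendsto (fun k => ∑ x ∈ F, |G (shiftE k x)| * |G x|) atTop
        (𝓝 (∑ x ∈ F, 0 * |G x|)) :=
      tendsto_finsetSum _ fun x _ => by
        have := (tendsto_shift hG x).abs
        rw [abs_zero] at this
        exact this.mul_const _
    simpa using this
  obtain ⟨K, hK⟩ := Metric.tendsto_atTop.1 hfin (ε / 2) (by positivity)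
  refine ⟨K, fun k hk => ?_⟩
  have h1 := hK k hk
  rw [Real.dist_eq, sub_zero] at h1 ⊢
  have hs := summable_mul_of_sq (hshift k) hG
  have hsa : Summable fun x => |G (shiftE k x) * G x| := hs.abs
  have hb : ∀ x, |G (shiftE k x) * G x| ≤
      (if x ∈ F then |G (shiftE k x)| * |G x| - (1 / (2 * l)) * G x ^ 2 else 0) +
        ((l / 2) * G (shiftE k x) ^ 2 + (1 / (2 * l)) * G x ^ 2) := by
    intro x
    rw [abs_mul]
    split_ifs with hx
    · have : 0 ≤ l / 2 * G (shiftE k x) ^ 2 := by positivity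
      linarith
    · have h3 : 0 ≤ (l * |G (shiftE k x)| - |G x|) ^ 2 / (2 * l) := by positivity
      have h4 : (l * |G (shiftE k x)| - |G x|) ^ 2 / (2 * l) =
          (l / 2) * G (shiftE k x) ^ 2 + (1 / (2 * l)) * G x ^ 2 -
            |G (shiftE k x)| * |G x| := by
        rw [← sq_abs (G (shiftE k x)), ← sq_abs (G x)]
        field_simp
        ring
      linarith
  have hsF : Summable fun x => if x ∈ F then |G (shiftE k x)| * |G x| -
      (1 / (2 * l)) * G x ^ 2 else 0 :=
    summable_of_ne_finset_zero (s := F) fun x hx => if_neg hx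
  have h2 : |∑' x, G (shiftE k x) * G x| ≤ ∑' x, |G (shiftE k x) * G x| := by
    have := norm_tsum_le_tsum_norm hs.norm
    simpa [Real.norm_eq_abs] using this
  refine h2.trans_lt ((hsa.tsum_le_tsum hb (hsF.add (((hshift k).mul_left _).add
    (hG.mul_left _)))).trans_lt ?_)
  rw [hsF.tsum_add (((hshift k).mul_left _).add (hG.mul_left _)),
    ((hshift k).mul_left (l / 2)).tsum_add (hG.mul_left _), tsum_mul_left, tsum_mul_left, hshiftQ,
    tsum_eq_sum (s := F) fun x hx => if_neg hx]
  have h5 : ∑ x ∈ F, (if x ∈ F then |G (shiftE k x)| * |G x| - (1 / (2 * l)) * G x ^ 2 else 0) =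
      ∑ x ∈ F, |G (shiftE k x)| * |G x| - (1 / (2 * l)) * ∑ x ∈ F, G x ^ 2 := by
    rw [Finset.mul_sum, ← Finset.sum_sub_distrib]
    exact Finset.sum_congr rfl fun x hx => if_pos hx
  rw [h5, ← hQ]
  have h6 := (abs_lt.1 h1).2
  have h7 : (1 / (2 * l)) * (Q - ∑ x ∈ F, G x ^ 2) < ε / 4 := by
    have : (1 / (2 * l)) * (l * ε / 2) = ε / 4 := by field_simp; ring
    rw [← this]
    exact mul_lt_mul_of_pos_left hF (by positivity)
  have h8 : l / 2 * Q ≤ ε / 4 := by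
    rw [hl]
    have : ε / (2 * (Q + 1)) / 2 * Q = ε / 4 * (Q / (Q + 1)) := by field_simp; ring
    rw [this]
    have : Q / (Q + 1) ≤ 1 := by rw [div_le_one (by positivity)]; linarith
    nlinarith
  linarith

/-- Uniqueness of finite-energy functions with prescribed values and vanishing total charge. -/
theorem eq_zero_of_energy {d : V4 → ℝ} {S : Finset V4} (hS : S.Nonempty) (h0 : ∀ v ∈ S, d v = 0)
    (hh : ∀ v ∉ S, lap latNbrs d v = 0) (hq : ∑ v ∈ S, lap latNbrs d v = 0) {C : ℝ}
    (hE : ∀ W : Finset V4, dform latNbrs W d d ≤ C) : ∀ v, d v = 0 := by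
  have hsum : ∀ q : Fin 4 × Bool, Summable fun x => grad d q x ^ 2 := by
    intro q
    refine summable_of_sum_le (c := 2 * C) (fun x => sq_nonneg _) fun W => ?_
    have h1 := hE W
    rw [dform] at h1
    have h2 : ∑ x ∈ W, grad d q x ^ 2 ≤
        ∑ v ∈ W, ∑ w ∈ latNbrs v, (d v - d w) * (d v - d w) := by
      refine Finset.sum_le_sum fun v _ => ?_
      rw [sum_latNbrs]
      have := Finset.single_le_sum (f := fun q => (d v - d (nxt v q)) * (d v - d (nxt v q)))
        (fun q _ => mul_self_nonneg _) (Finset.mem_univ q)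
      refine le_trans (le_of_eq ?_) this
      simp only [grad]; ring
    linarith
  have hφ : ∀ k, Summable fun x => (d x - d (shiftE k x)) ^ 2 := by
    intro k
    induction k with
    | zero => simp [shiftE_apply, summable_zero]
    | succ k ih =>
      have hs : Summable fun x => grad d (0, true) (shiftE (k + 1) x) ^ 2 :=
        ((shiftE (k + 1)).summable_iff (f := fun x => grad d (0, true) x ^ 2)).2 (hsum _)
      refine (summable_sq_add ih hs).congr fun x => ?_
      simp only [grad, shiftE_succ]
      ring
  have hparts : ∀ k, ∑ x ∈ S, (d x - d (shiftE k x)) * lap latNbrs d x =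
      ∑ i, (∑' x, grad d (i, true) x ^ 2 -
        ∑' x, grad d (i, true) (shiftE k x) * grad d (i, true) x) := by
    intro k
    have hts : ∑' x, (d x - d (shiftE k x)) * lap latNbrs d x =
        ∑ x ∈ S, (d x - d (shiftE k x)) * lap latNbrs d x :=
      tsum_eq_sum fun x hx => by rw [hh x hx, mul_zero]
    rw [← hts]
    rw [tsum_mul_lap (φ := fun x => d x - d (shiftE k x)) (fun i => hsum _) (hφ k)]
    refine Finset.sum_congr rfl fun i _ => ?_
    have hs : Summable fun x => grad d (i, true) (shiftE k x) ^ 2 :=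
        ((shiftE k).summable_iff (f := fun x => grad d (i, true) x ^ 2)).2 (hsum _)
    rw [← (hsum (i, true)).tsum_sub (summable_mul_of_sq hs (hsum _))]
    refine tsum_congr fun x => ?_
    simp only [grad, nxt_shiftE]
    ring
  obtain ⟨x0, hx0⟩ := hS
  have hdiff : ∀ x, Tendsto (fun k => d (shiftE k x) - d (shiftE k 0)) atTop (𝓝 0) := by
    intro x
    refine lat_induction (P := fun x => Tendsto (fun k => d (shiftE k x) - d (shiftE k 0)) atTop
      (𝓝 0)) (fun y q hy => ?_) (by simp) x
    have := hy.sub (tendsto_shift (hsum q) y)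
    rw [sub_zero] at this
    refine this.congr fun k => ?_
    simp only [grad, nxt_shiftE]
    ring
  have hL : Tendsto (fun k => ∑ x ∈ S, (d x - d (shiftE k x)) * lap latNbrs d x) atTop (𝓝 0) := by
    have h1 : Tendsto (fun k => ∑ x ∈ S, -(d (shiftE k x) - d (shiftE k 0)) * lap latNbrs d x)
        atTop (𝓝 (∑ x ∈ S, -0 * lap latNbrs d x)) :=
      tendsto_finsetSum _ fun x _ => (hdiff x).neg.mul_const _
    simp only [neg_zero, zero_mul, Finset.sum_const_zero] at h1
    refine h1.congr fun k => ?_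
    have h2 : ∑ x ∈ S, -(d (shiftE k x) - d (shiftE k 0)) * lap latNbrs d x =
        ∑ x ∈ S, (d x - d (shiftE k x)) * lap latNbrs d x +
          d (shiftE k 0) * ∑ x ∈ S, lap latNbrs d x := by
      rw [Finset.mul_sum, ← Finset.sum_add_distrib]
      refine Finset.sum_congr rfl fun x hx => ?_
      rw [h0 x hx]; ring
    rw [h2, hq]; ring
  have hRt : Tendsto (fun k => ∑ i, (∑' x, grad d (i, true) x ^ 2 -
        ∑' x, grad d (i, true) (shiftE k x) * grad d (i, true) x)) atTop
      (𝓝 (∑ i : Fin 4, (∑' x, grad d (i, true) x ^ 2 - 0))) :=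
    tendsto_finsetSum _ fun i _ => (tendsto_corr (hsum _)).const_sub _
  have hzero := tendsto_nhds_unique hL (hRt.congr fun k => (hparts k).symm)
  simp only [sub_zero] at hzero
  have hz : ∀ i : Fin 4, ∀ x, grad d (i, true) x = 0 := by
    intro i x
    have h1 := (Finset.sum_eq_zero_iff_of_nonneg (s := Finset.univ)
      (f := fun i : Fin 4 => ∑' x, grad d (i, true) x ^ 2)
      fun i _ => tsum_nonneg fun x => sq_nonneg _).1 hzero.symm i (Finset.mem_univ i)
    have h2 := (hsum (i, true)).le_tsum x (fun y _ => sq_nonneg _)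
    rw [h1] at h2
    exact pow_eq_zero_iff (two_ne_zero) |>.1 (le_antisymm h2 (sq_nonneg _))
  have hconst : ∀ x, d x = d 0 := by
    intro x
    refine lat_induction (P := fun x => d x = d 0) (fun y q hy => ?_) rfl x
    have : grad d q y = 0 := by
      obtain ⟨i, s⟩ := q
      cases s
      · rw [grad_false, hz, neg_zero]
      · exact hz i y
    rw [grad] at this
    linarith
  intro v
  rw [hconst v, ← hconst x0, h0 x0 hx0]

end Dirichlet

section Step
variable {V : Type*} [DecidableEq V]

/-- `f` interpolates between `1` on `A` and `0` at `u`, harmonically with zero total charge inside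
the finite domain `K`. -/
structure StepFn (nb : V → Finset V) (K A : Finset V) (u : V) (f : V → ℝ) : Prop where
  nonneg : ∀ v, 0 ≤ f v
  le_one : ∀ v, f v ≤ 1
  one : ∀ a ∈ A, f a = 1
  zero : f u = 0
  harm : ∀ v ∈ K \ insert u A, lap nb f v = 0
  charge : ∑ v ∈ insert u A, lap nb f v = 0
  const : ∃ θ, ∀ v ∉ K, f v = θ

theorem dform_mono_set (nb : V → Finset V) {W W' : Finset V} (h : W ⊆ W') (φ : V → ℝ) :
    dform nb W φ φ ≤ dform nb W' φ φ := by
  unfold dform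
  refine mul_le_mul_of_nonneg_left ?_ (by norm_num)
  exact Finset.sum_le_sum_of_subset_of_nonneg h fun v _ _ =>
    Finset.sum_nonneg fun w _ => mul_self_nonneg _

theorem StepFn.energy_le {nb : V → Finset V} (hs : SymNb nb) {K A : Finset V} {u : V} {f : V → ℝ}
    (hA : A ⊆ K) (hu : u ∈ K) (huA : u ∉ A) (h : StepFn nb K A u f) (W : Finset V) :
    dform nb W f f ≤ ∑ a ∈ A, ((nb a).card : ℝ) := by
  obtain ⟨θ, hθ⟩ := h.const
  have h1 := sum_mul_lap hs (K := K) (W := nbhd nb K ∪ W)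
    ((subset_nbhd nb K).trans Finset.subset_union_left)
    (fun v hv => (nb_subset_nbhd nb K v hv).trans Finset.subset_union_left)
    (φ := fun v => f v - θ) (fun v hv => by rw [hθ v hv, sub_self]) f
  have h2 : dform nb (nbhd nb K ∪ W) (fun v => f v - θ) f = dform nb (nbhd nb K ∪ W) f f := by
    simp only [dform, sub_sub_sub_cancel_right]
  have hSK : insert u A ⊆ K := Finset.insert_subset hu hA
  have h3 : ∑ v ∈ K, (f v - θ) * lap nb f v = ∑ v ∈ insert u A, (f v - θ) * lap nb f v := by
    refine (Finset.sum_subset hSK fun v hv hv' => ?_).symm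
    rw [h.harm v (Finset.mem_sdiff.2 ⟨hv, hv'⟩), mul_zero]
  have h4 : ∑ v ∈ insert u A, (f v - θ) * lap nb f v = ∑ a ∈ A, lap nb f a := by
    simp only [sub_mul, Finset.sum_sub_distrib, ← Finset.mul_sum]
    rw [h.charge, mul_zero, sub_zero, Finset.sum_insert huA, h.zero, zero_mul, zero_add]
    exact Finset.sum_congr rfl fun a ha => by rw [h.one a ha, one_mul]
  refine (dform_mono_set nb (W' := nbhd nb K ∪ W) Finset.subset_union_right f).trans ?_
  rw [← h2, ← h1, h3, h4]
  refine Finset.sum_le_sum fun a ha => ?_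
  unfold lap
  refine (Finset.sum_le_sum (g := fun _ => (1 : ℝ)) fun w _ => ?_).trans (by simp)
  rw [h.one a ha]; linarith [h.nonneg w]

def capN (nb : V → Finset V) (K A : Finset V) : ℝ :=
  ∑ a ∈ A, ∑ w ∈ nb a, (1 - lpr nb (K \ A) A w)

theorem lpr_insert {nb : V → Finset V} {D A : Finset V} {u : V} (huA : u ∉ A) (hA : ∀ a ∈ A, a ∉ D)
    (hu : u ∉ D) (v : V) :
    lpr nb D (insert u A : Finset V) v = lpr nb D A v + lpr nb D {u} v := by
  unfold lpr
  rw [← add_div, numL_eq_sum, numL_eq_sum, numL_eq_sum, ← Finset.sum_add_distrib]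
  congr 1
  refine Finset.sum_congr rfl fun f hf => ?_
  have hf := mem_forests.1 hf
  have hd : ¬ (Leads f v A ∧ Leads f v {u}) := fun ⟨h1, h2⟩ =>
    leads_absorb hf (S := A) (T := {u}) (fun a ha => hA a ha) (by simpa using hu) (by simp [huA]) h1 h2
  have hi : Leads f v (insert u A : Finset V) ↔ Leads f v A ∨ Leads f v {u} := by
    simp only [Leads, Finset.coe_insert, mem_insert_iff, mem_singleton_iff, exists_or]
    tauto
  by_cases h1 : Leads f v A <;> by_cases h2 : Leads f v {u} <;> simp_all

theorem sum_lap_pair {nb : V → Finset V} (hs : SymNb nb) {K A : Finset V} {u : V} (hA : A ⊆ K)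
    (hu : u ∈ K) (huA : u ∉ A) (hN : 0 < numF nb (K \ insert u A)) :
    ∑ a ∈ A, ∑ w ∈ nb a, lpr nb (K \ insert u A) {u} w =
      ∑ w ∈ nb u, lpr nb (K \ insert u A) A w := by
  set D := K \ insert u A with hD
  have hAD : ∀ a ∈ A, a ∉ D := fun a ha => by simp [hD, ha]
  have huD : u ∉ D := by simp [hD]
  have hSK : insert u A ⊆ K := Finset.insert_subset hu hA
  have h := sum_mul_lap_comm hs (K := K) (φ := lpr nb D A) (χ := lpr nb D {u})
    (fun v hv => lpr_of_notMem (fun h => hv (hA h)) fun h => hv (Finset.mem_sdiff.1 h).1)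
    (fun v hv => lpr_of_notMem (fun h => hv (by rw [mem_singleton_iff.1 h]; exact hu))
      fun h => hv (Finset.mem_sdiff.1 h).1)
  rw [← Finset.sum_subset hSK fun v hv hv' => by
      rw [lap_lpr nb (by simpa using huD) (Finset.mem_sdiff.2 ⟨hv, hv'⟩), mul_zero],
    ← Finset.sum_subset hSK fun v hv hv' => by
      rw [lap_lpr nb (fun a ha => hAD a ha) (Finset.mem_sdiff.2 ⟨hv, hv'⟩), mul_zero],
    Finset.sum_insert huA, Finset.sum_insert huA,
    lpr_of_notMem (S := (A : Set V)) (by simpa using huA) huD, zero_mul, zero_add,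
    lpr_of_mem hN (S := {u}) rfl, one_mul] at h
  have h1 : ∀ a ∈ A, lpr nb D {u} a = 0 := fun a ha =>
    lpr_of_notMem (fun h => huA (mem_singleton_iff.1 h ▸ ha)) (hAD a ha)
  have h2 : ∑ a ∈ A, lpr nb D A a * lap nb (lpr nb D {u}) a =
      - ∑ a ∈ A, ∑ w ∈ nb a, lpr nb D {u} w := by
    rw [← Finset.sum_neg_distrib]
    refine Finset.sum_congr rfl fun a ha => ?_
    rw [lpr_of_mem hN (S := (A : Set V)) ha, one_mul, lap, h1 a ha]
    simp
  have h3 : ∑ a ∈ A, lpr nb D {u} a * lap nb (lpr nb D A) a = 0 :=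
    Finset.sum_eq_zero fun a ha => by rw [h1 a ha, zero_mul]
  have h4 : lap nb (lpr nb D A) u = - ∑ w ∈ nb u, lpr nb D A w := by
    rw [lap, lpr_of_notMem (S := (A : Set V)) (by simpa using huA) huD]; simp
  rw [h2, h3, h4] at h
  linarith

theorem exists_wired_step {nb : V → Finset V} (hs : SymNb nb) {K A : Finset V} {u : V} (hA : A ⊆ K)
    (hu : u ∈ K) (huA : u ∉ A) (hN : 0 < numF nb K) :
    ∃ f, StepFn nb K A u f ∧ numF nb (K \ A) * capN nb K A =
      numF nb (K \ insert u A) * capN nb K (insert u A) * ∑ w ∈ nb u, f w := by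
  have hND : 0 < numF nb (K \ insert u A) := numF_restrict_pos hN _
  have hNA : 0 < numF nb (K \ A) := numF_restrict_pos hN _
  have hsym := sum_lap_pair hs hA hu huA hND
  have hKA : (K \ A).erase u = K \ insert u A := by ext v; simp; tauto
  have hNe := numF_erase' hNA (Finset.mem_sdiff.2 ⟨hu, huA⟩)
  rw [hKA] at hNe
  unfold capN
  set D := K \ insert u A with hD
  have hAD : ∀ a ∈ A, a ∉ D := fun a ha => by simp [hD, ha]
  have huD : u ∉ D := by simp [hD]
  set hh := lpr nb D A with hhh
  set g := lpr nb D {u} with hg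
  set e : V → ℝ := fun v => 1 - hh v - g v with he
  have hS : lpr nb D (insert u A : Finset V) = fun v => hh v + g v :=
    funext fun v => lpr_insert huA hAD huD v
  have hhu : hh u = 0 := lpr_of_notMem (S := (A : Set V)) (by simpa using huA) huD
  have hgu : g u = 1 := lpr_of_mem hND rfl
  have hhA : ∀ a ∈ A, hh a = 1 := fun a ha => lpr_of_mem hND (S := (A : Set V)) ha
  have hgA : ∀ a ∈ A, g a = 0 := fun a ha =>
    lpr_of_notMem (fun h => huA (mem_singleton_iff.1 h ▸ ha)) (hAD a ha)
  have he0 : ∀ v, 0 ≤ e v := fun v => by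
    have := lpr_le_one nb D (insert u A : Finset V) v
    rw [hS] at this
    simp only [he]; linarith
  have hh0 : ∀ v, 0 ≤ hh v := lpr_nonneg nb D A
  have hg0 : ∀ v, 0 ≤ g v := lpr_nonneg nb D {u}
  have hlh : ∀ v ∈ D, lap nb hh v = 0 := fun v hv => lap_lpr nb (fun a ha => hAD a ha) hv
  have hlg : ∀ v ∈ D, lap nb g v = 0 := fun v hv => lap_lpr nb (by simpa using huD) hv
  set α := ∑ w ∈ nb u, e w with hα
  set α' := ∑ a ∈ A, ∑ w ∈ nb a, e w with hα'
  set b := ∑ w ∈ nb u, hh w with hb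
  have hα0 : 0 ≤ α := Finset.sum_nonneg fun w _ => he0 w
  have hα'0 : 0 ≤ α' := Finset.sum_nonneg fun a _ => Finset.sum_nonneg fun w _ => he0 w
  have hb0 : 0 ≤ b := Finset.sum_nonneg fun w _ => hh0 w
  have hαb : ∑ w ∈ nb u, (1 - g w) = α + b := by
    rw [hα, hb, ← Finset.sum_add_distrib]
    exact Finset.sum_congr rfl fun w _ => by simp only [he]; ring
  rw [hαb] at hNe
  have hpos : 0 < α + b := by
    by_contra hc
    nlinarith [hNA, hND]
  -- the wired escape quantities
  have hρ : ∀ v, lpr nb (K \ A) A v = hh v + b / (α + b) * g v := by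
    set ρ := b / (α + b) with hρd
    have hρe : ρ * (α + b) = b := by rw [hρd]; field_simp
    have hlap : ∀ v ∈ K \ A, lap nb (lpr nb (K \ A) A) v = lap nb (fun v => hh v + ρ * g v) v := by
      intro v hv
      rw [lap_lpr nb (fun a ha h => (Finset.mem_sdiff.1 h).2 ha) hv, lap_add, lap_const_mul]
      by_cases hvu : v = u
      · subst hvu
        have h1 : lap nb hh v = - b := by rw [lap, hhu, hb]; simp
        have h2 : lap nb g v = α + b := by rw [← hαb, lap, hgu]
        rw [h1, h2, hρe]; ring
      · have hvD : v ∈ D := by rw [← hKA]; exact Finset.mem_erase.2 ⟨hvu, hv⟩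
        rw [hlh v hvD, hlg v hvD]; ring
    have hbd : ∀ v ∉ K \ A, lpr nb (K \ A) A v = hh v + ρ * g v := by
      intro v hv
      by_cases hvA : v ∈ A
      · rw [lpr_of_mem hNA (S := (A : Set V)) hvA, hhA v hvA, hgA v hvA]; ring
      · have hvK : v ∉ K := fun h => hv (Finset.mem_sdiff.2 ⟨h, hvA⟩)
        have hvD : v ∉ D := fun h => hvK (Finset.mem_sdiff.1 h).1
        have h1 : hh v = 0 := lpr_of_notMem (S := (A : Set V)) (by simpa using hvA) hvD
        have h2 : g v = 0 := lpr_of_notMem (fun h => hvK (by rw [mem_singleton_iff.1 h]; exact hu)) hvD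
        rw [lpr_of_notMem (S := (A : Set V)) (by simpa using hvA) hv, h1, h2]; ring
    intro v
    exact le_antisymm (le_of_lap_le hNA (fun v hv => (hlap v hv).le) (fun v hv => (hbd v hv).le) v)
      (le_of_lap_le hNA (fun v hv => (hlap v hv).ge) (fun v hv => (hbd v hv).ge) v)
  have hcA : ∑ a ∈ A, ∑ w ∈ nb a, (1 - lpr nb (K \ A) A w) = α' + (1 - b / (α + b)) * b := by
    generalize b / (α + b) = ρ at hρ
    rw [hα', ← hsym, Finset.mul_sum, ← Finset.sum_add_distrib]
    refine Finset.sum_congr rfl fun a _ => ?_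
    rw [Finset.mul_sum, ← Finset.sum_add_distrib]
    refine Finset.sum_congr rfl fun w _ => ?_
    rw [hρ w]; simp only [he]; ring
  have hcS : ∑ a ∈ insert u A, ∑ w ∈ nb a, (1 - lpr nb D (insert u A : Finset V) w) = α + α' := by
    rw [Finset.sum_insert huA, hS]
    congr 1
    · exact Finset.sum_congr rfl fun w _ => by simp only [he]; ring
    · exact Finset.sum_congr rfl fun a _ => Finset.sum_congr rfl fun w _ => by simp only [he]; ring
  set θ := α' / (α + α') with hθ
  have hθe : θ * (α + α') = α' := by
    rcases eq_or_lt_of_le (add_nonneg hα0 hα'0) with h0 | h0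
    · have : α' = 0 := by linarith
      rw [← h0, this]; ring
    · rw [hθ]; field_simp
  have hθ0 : 0 ≤ θ := div_nonneg hα'0 (add_nonneg hα0 hα'0)
  have hθ1 : θ ≤ 1 := div_le_one_of_le₀ (by linarith) (add_nonneg hα0 hα'0)
  have hlf : ∀ v, lap nb (fun v => hh v + θ * e v) v =
      lap nb hh v + θ * (- lap nb hh v - lap nb g v) := by
    intro v
    rw [lap_add, lap_const_mul]
    congr 2
    have : e = fun x => (1 - hh x) - g x := rfl
    rw [this, lap_sub, lap_const_sub]
  have hchA : ∑ a ∈ A, lap nb hh a = α' + b := by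
    rw [hα', ← hsym, ← Finset.sum_add_distrib]
    refine Finset.sum_congr rfl fun a ha => ?_
    rw [lap, hhA a ha, ← Finset.sum_add_distrib]
    exact Finset.sum_congr rfl fun w _ => by simp only [he]; ring
  have hcgA : ∑ a ∈ A, lap nb g a = - b := by
    rw [← hsym, ← Finset.sum_neg_distrib]
    refine Finset.sum_congr rfl fun a ha => ?_
    rw [lap, hgA a ha]; simp
  have h1 : lap nb hh u = - b := by rw [lap, hhu, hb]; simp
  have h2 : lap nb g u = α + b := by rw [← hαb, lap, hgu]
  refine ⟨fun v => hh v + θ * e v, ⟨fun v => ?_, fun v => ?_, fun a ha => ?_, ?_, fun v hv => ?_, ?_,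
    ⟨θ, fun v hv => ?_⟩⟩, ?_⟩
  · exact add_nonneg (hh0 v) (mul_nonneg hθ0 (he0 v))
  · have := mul_le_mul_of_nonneg_right hθ1 (he0 v)
    have h3 : e v = 1 - hh v - g v := rfl
    have := hg0 v
    linarith
  · simp only [he, hhA a ha, hgA a ha]; ring
  · simp only [he, hhu, hgu]; ring
  · rw [hlf, hlh v hv, hlg v hv]; ring
  · simp only [hlf, mul_sub, mul_neg, Finset.sum_add_distrib, Finset.sum_sub_distrib,
      Finset.sum_neg_distrib, ← Finset.mul_sum, Finset.sum_insert huA, hchA, hcgA, h1, h2]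
    linear_combination -hθe
  · have hvA : v ∉ A := fun h => hv (hA h)
    have hvD : v ∉ D := fun h => hv (Finset.mem_sdiff.1 h).1
    have h1 : hh v = 0 := lpr_of_notMem (S := (A : Set V)) (by simpa using hvA) hvD
    have h2 : g v = 0 := lpr_of_notMem (fun h => hv (by rw [mem_singleton_iff.1 h]; exact hu)) hvD
    simp only [he, h1, h2]; ring
  · have hsumf : ∑ w ∈ nb u, (hh w + θ * e w) = b + θ * α := by
      rw [Finset.sum_add_distrib, ← Finset.mul_sum]
    rw [hcA, hcS, hsumf, hNe]
    have h3 : (1 - b / (α + b)) * (α + b) = α := by field_simp; ring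
    linear_combination numF nb D * b * h3 - numF nb D * α * hθe

theorem exists_free_step {nb : V → Finset V} (hs : SymNb nb) {K A : Finset V} {u : V} (hA : A ⊆ K)
    (hu : u ∈ K) (huA : u ∉ A) (hN : 0 < numF nb (K \ A)) (hnb : ∀ v, nb v ⊆ K) :
    ∃ f, StepFn nb K A u f ∧ numF nb (K \ A) =
      numF nb (K \ insert u A) * ∑ w ∈ nb u, f w := by
  have hKA : (K \ A).erase u = K \ insert u A := by ext v; simp; tauto
  have hNe := numF_erase' hN (Finset.mem_sdiff.2 ⟨hu, huA⟩)
  have hND := numF_erase_pos hN u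
  rw [hKA] at hNe hND
  set D := K \ insert u A with hD
  have hAD : ∀ a ∈ A, a ∉ D := fun a ha => by simp [hD, ha]
  have huD : u ∉ D := by simp [hD]
  have hS : ∀ v, lpr nb D (insert u A : Finset V) v = lpr nb D A v + lpr nb D {u} v :=
    fun v => lpr_insert huA hAD huD v
  have hone : ∀ v ∈ K, lpr nb D (insert u A : Finset V) v = 1 := by
    intro v hv
    unfold lpr numL
    rw [Finset.filter_true_of_mem, ← numF, div_self hND.ne']
    intro f hf
    have hf := mem_forests.1 hf
    have hK : ∀ k, f^[k] v ∈ K := by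
      intro k
      induction k with
      | zero => exact hv
      | succ k ih =>
        rw [Function.iterate_succ_apply']
        by_cases h : f^[k] v ∈ D
        · exact hnb _ (hf.1 _ h)
        · rw [hf.2.1 _ h]; exact ih
    obtain ⟨k, hk⟩ := hf.2.2 v
    refine ⟨k, ?_⟩
    by_contra hc
    exact hk (Finset.mem_sdiff.2 ⟨hK k, hc⟩)
  refine ⟨lpr nb D A, ⟨lpr_nonneg nb D A, lpr_le_one nb D A, fun a ha =>
    lpr_of_mem hND (S := (A : Set V)) ha, lpr_of_notMem (S := (A : Set V)) (by simpa using huA) huD,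
    fun v hv => lap_lpr nb (fun a ha => hAD a ha) hv, ?_, ⟨0, fun v hv => ?_⟩⟩, ?_⟩
  · have hφ := sum_mul_lap hs (K := K) (W := K) subset_rfl (fun v _ => hnb v)
      (φ := fun v => if v ∈ K then 1 else 0) (fun v hv => if_neg hv) (lpr nb D A)
    have h0 : dform nb K (fun v => if v ∈ K then (1 : ℝ) else 0) (lpr nb D A) = 0 := by
      unfold dform
      rw [Finset.sum_eq_zero fun v hv => Finset.sum_eq_zero fun w hw => ?_, mul_zero]
      simp only [if_pos hv, if_pos (hnb v hw), sub_self, zero_mul]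
    rw [h0] at hφ
    rw [← hφ]
    refine Finset.sum_subset_zero_on_sdiff (Finset.insert_subset hu hA) (fun v hv => ?_)
      fun v hv => ?_
    · rw [lap_lpr nb (fun a ha => hAD a ha) hv, mul_zero]
    · rw [if_pos (Finset.insert_subset hu hA hv), one_mul]
  · exact lpr_of_notMem (S := (A : Set V)) (fun h => hv (hA h)) fun h => hv (Finset.mem_sdiff.1 h).1
  · rw [hNe]
    congr 1
    refine Finset.sum_congr rfl fun w hw => ?_
    have := hS w
    rw [hone w (hnb u hw)] at this
    linarith
end Step

section BoxGraph

/-- Neighbours in the (free) box graph. -/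
def nbB (n : ℕ) (v : V4) : Finset V4 := (latNbrs v).filter fun w => v ∈ boxV n ∧ w ∈ boxV n

theorem mem_nbB {n : ℕ} {v w : V4} : w ∈ nbB n v ↔ w ∈ latNbrs v ∧ v ∈ boxV n ∧ w ∈ boxV n := by
  simp [nbB]

theorem symNb_nbB (n : ℕ) : SymNb (nbB n) := fun x y => by
  rw [mem_nbB, mem_nbB, symNb_latNbrs x y]
  exact ⟨fun h => ⟨h.1, h.2.2, h.2.1⟩, fun h => ⟨h.1, h.2.2, h.2.1⟩⟩

theorem nbB_subset (n : ℕ) (v : V4) : nbB n v ⊆ boxV n := fun _ hw => (mem_nbB.1 hw).2.2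

theorem nbB_subset_lat (n : ℕ) (v : V4) : nbB n v ⊆ latNbrs v := Finset.filter_subset _ _

theorem latNbrs_subset_boxV {m : ℕ} {v : V4} (hv : v ∈ boxV m) : latNbrs v ⊆ boxV (m + 1) := by
  intro w hw
  obtain ⟨q, rfl⟩ := mem_latNbrs.1 hw
  rw [mem_boxV] at hv ⊢
  intro j
  have h := hv j
  rw [abs_le] at h ⊢
  push_cast
  by_cases hj : j = q.1
  · subst hj
    simp only [nxt, Function.update_self]
    split_ifs <;> constructor <;> linarith [h.1, h.2]
  · simp only [nxt, Function.update_of_ne hj]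
    constructor <;> linarith [h.1, h.2]

theorem nbB_eq {m n : ℕ} (h : m < n) {v : V4} (hv : v ∈ boxV m) : nbB n v = latNbrs v := by
  refine Finset.filter_true_of_mem fun w hw => ⟨boxV_mono h.le hv, boxV_mono h
    (latNbrs_subset_boxV hv hw)⟩

theorem eventually_nbB_eq (v : V4) : ∀ᶠ n in atTop, nbB n v = latNbrs v := by
  obtain ⟨m, hm⟩ := exists_mem_boxV v
  filter_upwards [eventually_gt_atTop m] with n hn using nbB_eq hn hm

theorem zero_mem_boxV (n : ℕ) : (0 : V4) ∈ boxV n := by simp [mem_boxV]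

theorem exists_box_forest (n : ℕ) : ∃ f, IsForest (nbB n) ((boxV n).erase 0) f := by
  have h : ∀ y : V4, ∃ w, y ≠ 0 → onorm w < onorm y ∧ w ∈ latNbrs y ∧ ∀ n, y ∈ boxV n → w ∈ boxV n := by
    intro y
    by_cases hy : y = 0
    · exact ⟨0, fun h => absurd hy h⟩
    · obtain ⟨q, h1, h2⟩ := exists_nxt_closer hy
      exact ⟨_, fun _ => ⟨h1, nxt_mem _ _, h2⟩⟩
  choose g hg using h
  refine ⟨fun v => if v ∈ (boxV n).erase 0 then g v else v, fun v hv => ?_, fun v hv => if_neg hv,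
    fun v => ?_⟩
  · simp only [if_pos hv]
    obtain ⟨h1, h2⟩ := Finset.mem_erase.1 hv
    exact mem_nbB.2 ⟨(hg v h1).2.1, h2, (hg v h1).2.2 n h2⟩
  · induction hk : onorm v using Nat.strong_induction_on generalizing v with
    | _ k ih =>
      by_cases hv : v ∈ (boxV n).erase 0
      · obtain ⟨h1, h2⟩ := Finset.mem_erase.1 hv
        obtain ⟨j, hj⟩ := ih _ (hk ▸ (hg v h1).1) (g v) rfl
        exact ⟨j + 1, by rw [Function.iterate_succ_apply, if_pos hv]; exact hj⟩
      · exact ⟨0, hv⟩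

theorem numF_box_pos {n : ℕ} {a : V4} (ha : a ∈ boxV n) : 0 < numF (nbB n) (boxV n \ {a}) := by
  obtain ⟨f, hf⟩ := exists_box_forest n
  have hG := grow_of_leads (symNb_nbB n) hf (Finset.notMem_erase 0 _) (zero_mem_boxV n) subset_rfl
    fun v hv => nbB_subset n v (hf.1 v hv)
  obtain ⟨g, hg⟩ := hG.exists_orients (symNb_nbB n) ha
  rw [numF_pos_iff, Finset.sdiff_singleton_eq_erase]
  exact ⟨g, mem_forests.2 hg.1⟩

theorem numF_box_pos' {n : ℕ} {A : Finset V4} (hA : A ⊆ boxV n) (hne : A.Nonempty) :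
    0 < numF (nbB n) (boxV n \ A) := by
  obtain ⟨a, ha⟩ := hne
  exact numF_restrict_pos' (numF_box_pos (hA ha))
    (Finset.sdiff_subset_sdiff subset_rfl (Finset.singleton_subset_iff.2 ha))

theorem exists_ultra_lim (𝒰 : Ultrafilter ℕ) {g : ℕ → ℝ} (h : ∀ᶠ n in (𝒰 : Filter ℕ), g n ∈ Icc (0 : ℝ) 1) :
    ∃ l, Tendsto g 𝒰 (𝓝 l) := by
  obtain ⟨l, -, hl⟩ := (isCompact_Icc (a := (0 : ℝ)) (b := 1)).ultrafilter_le_nhds (𝒰.map g)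
    (by rw [le_principal_iff]; exact h)
  exact ⟨l, hl⟩

theorem StepFn.limit {𝒰 : Ultrafilter ℕ} (h𝒰 : (𝒰 : Filter ℕ) ≤ atTop) {nb : ℕ → V4 → Finset V4}
    (hs : ∀ n, SymNb (nb n)) (hnl : ∀ n v, nb n v ⊆ latNbrs v)
    (hnb : ∀ v, ∀ᶠ n in atTop, nb n v = latNbrs v)
    {A : Finset V4} {u : V4} (huA : u ∉ A) {f : ℕ → V4 → ℝ}
    (hf : ∀ᶠ n in atTop, StepFn (nb n) (boxV n) A u (f n)) :
    ∃ L : V4 → ℝ, (∀ v, Tendsto (fun n => f n v) 𝒰 (𝓝 (L v))) ∧ (∀ v, 0 ≤ L v) ∧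
      (∀ a ∈ A, L a = 1) ∧ L u = 0 ∧ (∀ v ∉ insert u A, lap latNbrs L v = 0) ∧
      (∑ v ∈ insert u A, lap latNbrs L v = 0) ∧
      ∀ W, dform latNbrs W L L ≤ 8 * A.card := by
  have hf' := h𝒰 hf
  have hlim : ∀ v, ∃ l, Tendsto (fun n => f n v) 𝒰 (𝓝 l) := fun v =>
    exists_ultra_lim 𝒰 (by filter_upwards [hf'] with n hn using ⟨hn.nonneg v, hn.le_one v⟩)
  choose L hL using hlim
  have hlap : ∀ v, Tendsto (fun n => lap (nb n) (f n) v) 𝒰 (𝓝 (lap latNbrs L v)) := by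
    intro v
    have h1 : Tendsto (fun n => lap latNbrs (f n) v) 𝒰 (𝓝 (lap latNbrs L v)) :=
      tendsto_finsetSum _ fun w _ => (hL v).sub (hL w)
    refine h1.congr' ?_
    filter_upwards [h𝒰 (hnb v)] with n hn
    simp only [lap, hn]
  refine ⟨L, hL, fun v => ?_, fun a ha => ?_, ?_, fun v hv => ?_, ?_, fun W => ?_⟩
  · exact ge_of_tendsto (hL v) (by filter_upwards [hf'] with n hn using hn.nonneg v)
  · refine tendsto_nhds_unique (hL a) (tendsto_const_nhds.congr' ?_)
    filter_upwards [hf'] with n hn using (hn.one a ha).symm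
  · refine tendsto_nhds_unique (hL u) (tendsto_const_nhds.congr' ?_)
    filter_upwards [hf'] with n hn using hn.zero.symm
  · refine tendsto_nhds_unique (hlap v) (tendsto_const_nhds.congr' ?_)
    filter_upwards [hf', h𝒰 (eventually_mem_boxV v)] with n hn hv'
    exact (hn.harm v (Finset.mem_sdiff.2 ⟨hv', hv⟩)).symm
  · refine tendsto_nhds_unique (tendsto_finsetSum _ fun v _ => hlap v)
      (tendsto_const_nhds.congr' ?_)
    filter_upwards [hf'] with n hn using hn.charge.symm
  · have h1 : Tendsto (fun n => dform latNbrs W (f n) (f n)) 𝒰 (𝓝 (dform latNbrs W L L)) :=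
      (tendsto_finsetSum _ fun v _ => tendsto_finsetSum _ fun w _ =>
        ((hL v).sub (hL w)).mul ((hL v).sub (hL w))).const_mul _
    refine le_of_tendsto h1 ?_
    have hW : ∀ᶠ n in (𝒰 : Filter ℕ), ∀ v ∈ W, nb n v = latNbrs v :=
      h𝒰 ((Filter.eventually_all_finset W).2 fun v _ => hnb v)
    filter_upwards [hf', hW, h𝒰 (eventually_subset_boxV (insert u A))] with n hn hWn hA
    have h2 := hn.energy_le (hs n) ((Finset.subset_insert u A).trans hA)
      (hA (Finset.mem_insert_self u A)) huA W
    have h3 : dform (nb n) W (f n) (f n) = dform latNbrs W (f n) (f n) := by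
      rw [dform, dform, Finset.sum_congr rfl fun v hv => by rw [hWn v hv]]
    rw [← h3]
    refine h2.trans ?_
    rw [mul_comm, ← nsmul_eq_mul]
    refine Finset.sum_le_card_nsmul _ _ _ fun a _ => ?_
    have := Finset.card_le_card (hnl n a)
    rw [card_latNbrs] at this
    exact_mod_cast this

theorem dform_sub_le {V : Type*} [DecidableEq V] (nb : V → Finset V) (W : Finset V) (φ χ : V → ℝ) :
    dform nb W (fun v => φ v - χ v) (fun v => φ v - χ v) ≤
      2 * dform nb W φ φ + 2 * dform nb W χ χ := by
  have key : ∑ v ∈ W, ∑ w ∈ nb v, (φ v - χ v - (φ w - χ w)) * (φ v - χ v - (φ w - χ w)) ≤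
      2 * ∑ v ∈ W, ∑ w ∈ nb v, (φ v - φ w) * (φ v - φ w) +
        2 * ∑ v ∈ W, ∑ w ∈ nb v, (χ v - χ w) * (χ v - χ w) := by
    simp only [Finset.mul_sum, ← Finset.sum_add_distrib]
    exact Finset.sum_le_sum fun v _ => Finset.sum_le_sum fun w _ => by
      nlinarith [sq_nonneg ((φ v - φ w) + (χ v - χ w))]
  unfold dform
  linarith

def freeProb (a : V4) (A : Finset V4) (n : ℕ) : ℝ :=
  numF (nbB n) (boxV n \ A) / numF (nbB n) (boxV n \ {a})

def wiredProb (A : Finset V4) (n : ℕ) : ℝ :=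
  numF latNbrs (boxV n \ A) * capN latNbrs (boxV n) A / numF latNbrs (boxV n)

theorem wiredProb_singleton {a : V4} {n : ℕ} (ha : a ∈ boxV n) : wiredProb {a} n = 1 := by
  unfold wiredProb capN
  have h := numF_erase' (numF_lat_pos (boxV n)) ha
  rw [Finset.sum_singleton, Finset.sdiff_singleton_eq_erase, Finset.coe_singleton, ← h,
    div_self (numF_lat_pos _).ne']

theorem Grow.exists_ultra_lim {a : V4} {A : Finset V4} {E : Finset (Sym2 V4)}
    (hG : Grow latNbrs a A E) {𝒰 : Ultrafilter ℕ} (h𝒰 : (𝒰 : Filter ℕ) ≤ atTop) :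
    ∃ l, Tendsto (freeProb a A) 𝒰 (𝓝 l) ∧ Tendsto (wiredProb A) 𝒰 (𝓝 l) := by
  induction hG with
  | base =>
    refine ⟨1, tendsto_const_nhds.congr' ?_, tendsto_const_nhds.congr' ?_⟩
    · filter_upwards [h𝒰 (eventually_mem_boxV a)] with n hn
      rw [freeProb, div_self (numF_box_pos hn).ne']
    · filter_upwards [h𝒰 (eventually_mem_boxV a)] with n hn
      rw [wiredProb_singleton hn]
  | @leaf A E p u hG hp huA hup ih =>
    obtain ⟨l, hF, hW⟩ := ih
    have hFn : ∀ n, ∃ f, insert u A ⊆ boxV n → StepFn (nbB n) (boxV n) A u f ∧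
        numF (nbB n) (boxV n \ A) = numF (nbB n) (boxV n \ insert u A) * ∑ w ∈ nbB n u, f w := by
      intro n
      by_cases h : insert u A ⊆ boxV n
      · obtain ⟨f, hf⟩ := exists_free_step (symNb_nbB n) ((Finset.subset_insert u A).trans h)
          (h (Finset.mem_insert_self u A)) huA
          (numF_box_pos' ((Finset.subset_insert u A).trans h) ⟨p, hp⟩) (nbB_subset n)
        exact ⟨f, fun _ => hf⟩
      · exact ⟨0, fun h' => absurd h' h⟩
    have hWn : ∀ n, ∃ f, insert u A ⊆ boxV n → StepFn latNbrs (boxV n) A u f ∧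
        numF latNbrs (boxV n \ A) * capN latNbrs (boxV n) A = numF latNbrs (boxV n \ insert u A) *
          capN latNbrs (boxV n) (insert u A) * ∑ w ∈ latNbrs u, f w := by
      intro n
      by_cases h : insert u A ⊆ boxV n
      · obtain ⟨f, hf⟩ := exists_wired_step symNb_latNbrs ((Finset.subset_insert u A).trans h)
          (h (Finset.mem_insert_self u A)) huA (numF_lat_pos _)
        exact ⟨f, fun _ => hf⟩
      · exact ⟨0, fun h' => absurd h' h⟩
    choose fF hfF using hFn
    choose fW hfW using hWn
    have hev := eventually_subset_boxV (insert u A)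
    obtain ⟨L1, h1, h1n, h1A, h1u, h1h, h1c, h1E⟩ := StepFn.limit h𝒰 symNb_nbB nbB_subset_lat
      eventually_nbB_eq huA (f := fF) (by filter_upwards [hev] with n hn using (hfF n hn).1)
    obtain ⟨L2, h2, h2n, h2A, h2u, h2h, h2c, h2E⟩ := StepFn.limit h𝒰 (nb := fun _ => latNbrs)
      (fun _ => symNb_latNbrs) (fun _ _ => subset_rfl) (fun _ => Eventually.of_forall fun _ => rfl)
      huA (f := fW) (by filter_upwards [hev] with n hn using (hfW n hn).1)
    have hL : ∀ v, L1 v - L2 v = 0 := by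
      refine eq_zero_of_energy (S := insert u A) (C := 4 * (8 * A.card)) ⟨u, Finset.mem_insert_self u A⟩
        (fun v hv => ?_) (fun v hv => ?_) ?_ fun W => ?_
      · rcases Finset.mem_insert.1 hv with rfl | hv
        · rw [h1u, h2u, sub_self]
        · rw [h1A v hv, h2A v hv, sub_self]
      · rw [lap_sub, h1h v hv, h2h v hv, sub_self]
      · simp only [lap_sub, Finset.sum_sub_distrib, h1c, h2c, sub_self]
      · have := dform_sub_le latNbrs W L1 L2
        linarith [h1E W, h2E W]
    have hLL : L1 = L2 := funext fun v => sub_eq_zero.1 (hL v)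
    subst hLL
    have hup' : p ∈ latNbrs u := (symNb_latNbrs p u).2 hup
    have hc : 1 ≤ ∑ w ∈ latNbrs u, L1 w := by
      rw [← h1A p hp]
      exact Finset.single_le_sum (fun w _ => h1n w) hup'
    have hc0 : ∑ w ∈ latNbrs u, L1 w ≠ 0 := (zero_lt_one.trans_le hc).ne'
    have hcF : Tendsto (fun n => ∑ w ∈ nbB n u, fF n w) 𝒰 (𝓝 (∑ w ∈ latNbrs u, L1 w)) := by
      refine (tendsto_finsetSum _ fun w _ => h1 w).congr' ?_
      filter_upwards [h𝒰 (eventually_nbB_eq u)] with n hn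
      rw [hn]
    have hcW : Tendsto (fun n => ∑ w ∈ latNbrs u, fW n w) 𝒰 (𝓝 (∑ w ∈ latNbrs u, L1 w)) :=
      tendsto_finsetSum _ fun w _ => h2 w
    refine ⟨l / ∑ w ∈ latNbrs u, L1 w, (hF.div hcF hc0).congr' ?_, (hW.div hcW hc0).congr' ?_⟩
    · filter_upwards [hcF.eventually_ne hc0, h𝒰 hev] with n hn hn'
      simp only [Pi.div_apply, freeProb]
      rw [(hfF n hn').2]
      field_simp
    · filter_upwards [hcW.eventually_ne hc0, h𝒰 hev] with n hn hn'
      simp only [Pi.div_apply, wiredProb]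
      rw [(hfW n hn').2]
      field_simp

/-- Free and wired limits of a connected cylinder agree. -/
theorem Grow.tendsto_wired {a : V4} {A : Finset V4} {E : Finset (Sym2 V4)}
    (hG : Grow latNbrs a A E) {p : ℝ} (h : Tendsto (freeProb a A) atTop (𝓝 p)) :
    Tendsto (wiredProb A) atTop (𝓝 p) := by
  rw [tendsto_iff_ultrafilter]
  intro 𝒰 h𝒰
  obtain ⟨l, h1, h2⟩ := hG.exists_ultra_lim h𝒰
  rwa [tendsto_nhds_unique (h.mono_left h𝒰) h1]
end BoxGraph

section TreeCount

theorem Grow.card_eq {V : Type*} [DecidableEq V] {nb : V → Finset V} {a : V} {A : Finset V}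
    {E : Finset (Sym2 V)} (h : Grow nb a A E) : E.card + 1 = A.card := by
  induction h with
  | base => simp
  | leaf hG hp hu hup ih =>
    rw [Finset.card_insert_of_notMem hu, Finset.card_insert_of_notMem, ih]
    exact fun h => hu (hG.mem_of_edge h).1

theorem exists_maximal_grow {V : Type*} [DecidableEq V] (nb : V → Finset V) {a : V} {U : Finset V}
    (ha : a ∈ U) (T : Set (Sym2 V)) :
    ∃ A E, Grow nb a A E ∧ (E : Set (Sym2 V)) ⊆ T ∧ A ⊆ U ∧
      ∀ p ∈ A, ∀ u ∈ U, u ∈ nb p → s(u, p) ∈ T → u ∈ A := by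
  by_contra hc
  have key : ∀ k : ℕ, ∃ A E, Grow nb a A E ∧ (E : Set (Sym2 V)) ⊆ T ∧ A ⊆ U ∧ k < A.card := by
    intro k
    induction k with
    | zero => exact ⟨{a}, ∅, Grow.base, by simp, by simpa using ha, by simp⟩
    | succ k ih =>
      obtain ⟨A, E, hG, hE, hA, hk⟩ := ih
      by_contra hc'
      refine hc ⟨A, E, hG, hE, hA, fun p hp u hu hup huT => ?_⟩
      by_contra huA
      refine hc' ⟨_, _, hG.leaf hp huA hup, ?_, Finset.insert_subset hu hA, ?_⟩
      · rw [Finset.coe_insert]; exact Set.insert_subset huT hE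
      · rw [Finset.card_insert_of_notMem huA]; omega
  obtain ⟨A, E, -, -, hA, hk⟩ := key U.card
  exact absurd (Finset.card_le_card hA) (by omega)

theorem connIn_symm {T : Set (Sym2 V4)} {x y : V4} (h : connIn T x y) : connIn T y x := by
  induction h with
  | refl => exact Relation.ReflTransGen.refl
  | tail _ hbc ih => exact Relation.ReflTransGen.head (by rwa [Sym2.eq_swap]) ih

theorem mk_mem_boxEdges {n : ℕ} {x y : V4} : s(x, y) ∈ boxEdges n ↔ y ∈ nbB n x := by
  rw [mem_nbB]
  simp only [boxEdges, Finset.mem_image, Finset.mem_filter, Finset.mem_product, Prod.exists,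
    latAdj_iff]
  constructor
  · rintro ⟨a, b, ⟨⟨ha, hb⟩, hab⟩, h⟩
    rcases Sym2.eq_iff.1 h with ⟨rfl, rfl⟩ | ⟨rfl, rfl⟩
    · exact ⟨hab, ha, hb⟩
    · exact ⟨(symNb_latNbrs _ _).1 hab, hb, ha⟩
  · exact fun ⟨h, hx, hy⟩ => ⟨x, y, ⟨⟨hx, hy⟩, h⟩, rfl⟩

theorem exists_grow_of_spanning {n : ℕ} {T : Finset (Sym2 V4)} (hT : IsBoxSpanningTree n T) {a : V4}
    (ha : a ∈ boxV n) : Grow (nbB n) a (boxV n) T := by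
  obtain ⟨A, E, hG, hE, hA, hmax⟩ := exists_maximal_grow (nbB n) ha (T : Set (Sym2 V4))
  have hconn : ∀ y, connIn (T : Set (Sym2 V4)) a y → y ∈ A := by
    intro y hy
    induction hy with
    | refl => exact hG.root_mem
    | @tail b c _ hbc ih =>
      have h := mk_mem_boxEdges.1 (hT.1 hbc)
      exact hmax b ih c (nbB_subset n b h) h (by rwa [Sym2.eq_swap])
  have hAV : A = boxV n := Finset.Subset.antisymm hA fun y hy => hconn y (hT.2.1 a ha y hy)
  subst hAV
  have h1 := hG.card_eq
  have : E = T := Finset.eq_of_subset_of_card_le (by exact_mod_cast hE) (by have := hT.2.2; omega)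
  rwa [← this]

theorem card_fEdges {V : Type*} [DecidableEq V] {nb : V → Finset V} {D : Finset V} {f : V → V}
    (hf : IsForest nb D f) : (fEdges D f).card = D.card := by
  refine Finset.card_image_of_injOn fun v hv w hw h => ?_
  rcases Sym2.eq_iff.1 h with ⟨h1, -⟩ | ⟨h1, h2⟩
  · exact h1
  · exact absurd ⟨1, show f (f v) ∈ ({v} : Set V) by rw [h2]; exact h1.symm⟩ (hf.not_leads_self hv)

theorem spanning_of_forest {n : ℕ} {a : V4} (ha : a ∈ boxV n) {f : V4 → V4}
    (hf : IsForest (nbB n) ((boxV n).erase a) f) :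
    IsBoxSpanningTree n (fEdges ((boxV n).erase a) f) := by
  have hmem : ∀ v ∈ boxV n, f v ∈ boxV n := by
    intro v hv
    by_cases h : v ∈ (boxV n).erase a
    · exact nbB_subset n v (hf.1 v h)
    · rw [hf.2.1 v h]; exact hv
  have hc : ∀ v ∈ boxV n, connIn (fEdges ((boxV n).erase a) f : Set (Sym2 V4)) v a := by
    intro v hv
    obtain ⟨k, hk⟩ := hf.2.2 v
    induction k generalizing v with
    | zero =>
      have : v = a := by by_contra h; exact hk (Finset.mem_erase.2 ⟨h, hv⟩)
      rw [this]; exact Relation.ReflTransGen.refl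
    | succ k ih =>
      by_cases h : v ∈ (boxV n).erase a
      · exact Relation.ReflTransGen.head (Finset.mem_coe.2 (mk_mem_fEdges.2 (Or.inl ⟨h, rfl⟩)))
          (ih (f v) (hmem v hv) hk)
      · have : v = a := by by_contra h'; exact h (Finset.mem_erase.2 ⟨h', hv⟩)
        rw [this]; exact Relation.ReflTransGen.refl
  refine ⟨fun e he => ?_, fun x hx y hy => (hc x hx).trans (connIn_symm (hc y hy)), ?_⟩
  · obtain ⟨v, hv, rfl⟩ := mem_fEdges.1 he
    exact mk_mem_boxEdges.2 (hf.1 v hv)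
  · rw [card_fEdges hf, Finset.card_erase_of_mem ha]
    have := Finset.card_pos.2 ⟨a, ha⟩
    omega

theorem treeCount_eq {n : ℕ} {a : V4} (ha : a ∈ boxV n) (E : Finset (Sym2 V4)) :
    treeCount n E = ((forests (nbB n) ((boxV n).erase a)).filter
      fun f => E ⊆ fEdges ((boxV n).erase a) f).card := by
  symm
  unfold treeCount
  refine Finset.card_bij (fun f _ => fEdges ((boxV n).erase a) f) (fun f hf => ?_)
    (fun f hf g hg h => ?_) fun T hT => ?_
  · obtain ⟨h1, h2⟩ := Finset.mem_filter.1 hf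
    have h := spanning_of_forest ha (mem_forests.1 h1)
    exact Finset.mem_filter.2 ⟨Finset.mem_powerset.2 h.1, h, h2⟩
  · have h1 := mem_forests.1 (Finset.mem_filter.1 hf).1
    have h2 := mem_forests.1 (Finset.mem_filter.1 hg).1
    have ho : Orients (nbB n) (boxV n) (fEdges ((boxV n).erase a) g) a g := by
      refine ⟨h2, rfl, fun v hv => ?_⟩
      by_cases h : v ∈ (boxV n).erase a
      · exact nbB_subset n v (h2.1 v h)
      · rw [h2.2.1 v h]; exact hv
    funext v
    by_cases hv : v ∈ (boxV n).erase a
    · obtain ⟨hva, hvV⟩ := Finset.mem_erase.1 hv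
      exact (ho.eq_of_subset (le_of_eq h.symm) (fun h => absurd rfl (Finset.mem_erase.1 h).1) hvV hva).1
    · rw [h1.2.1 v hv, h2.2.1 v hv]
  · obtain ⟨-, h1, h2⟩ := Finset.mem_filter.1 hT
    obtain ⟨g, hg⟩ := (exists_grow_of_spanning h1 ha).exists_orients (symNb_nbB n) ha
    exact ⟨g, Finset.mem_filter.2 ⟨mem_forests.2 hg.1, by rw [← hg.2.1]; exact h2⟩, hg.2.1.symm⟩

theorem treeCount_empty {n : ℕ} {a : V4} (ha : a ∈ boxV n) :
    (treeCount n ∅ : ℝ) = numF (nbB n) (boxV n \ {a}) := by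
  rw [treeCount_eq ha, numF, Finset.sdiff_singleton_eq_erase, Finset.filter_true_of_mem]
  exact fun f _ => Finset.empty_subset _

theorem Grow.treeCount_eq {n : ℕ} {a : V4} {A : Finset V4} {E : Finset (Sym2 V4)}
    (hG : Grow latNbrs a A E) (hA : A ⊆ boxV n) :
    (treeCount n E : ℝ) = numF (nbB n) (boxV n \ A) := by
  have hG' : Grow (nbB n) a A E :=
    hG.mono_nb fun u hu v hv h => mem_nbB.2 ⟨h, hA hv, hA hu⟩
  rw [_root_.treeCount_eq (hA hG.root_mem), card_rooted_cylinder (symNb_nbB n) hG'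
    (Finset.erase_subset_erase a hA) (Finset.notMem_erase a _)]
  congr 1
  ext v
  simp only [Finset.mem_sdiff, Finset.mem_erase]
  exact ⟨fun h => ⟨h.1.2, h.2⟩, fun h => ⟨⟨fun h' => h.2 (h' ▸ hG.root_mem), h.1⟩, h.2⟩⟩

theorem Grow.treeCount_insert {n : ℕ} {a : V4} {A : Finset V4} {E : Finset (Sym2 V4)}
    (hG : Grow latNbrs a A E) (hA : A ⊆ boxV n) {x y : V4} (hx : x ∈ A) (hy : y ∈ A)
    (he : s(x, y) ∉ E) : treeCount n (insert s(x, y) E) = 0 := by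
  have hG' : Grow (nbB n) a A E :=
    hG.mono_nb fun u hu v hv h => mem_nbB.2 ⟨h, hA hv, hA hu⟩
  obtain ⟨g, hg⟩ := hG'.exists_orients (symNb_nbB n) hG.root_mem
  rw [_root_.treeCount_eq (hA hG.root_mem), Finset.card_eq_zero, Finset.filter_eq_empty_iff]
  intro f hf hE
  have key : ∀ x ∈ A, ∀ y, x ∈ (boxV n).erase a → f x = y → s(x, y) ∈ E := by
    intro x hx y hxa hxy
    have h := hg.eq_of_subset ((Finset.subset_insert _ _).trans hE)
      (fun h => absurd rfl (Finset.mem_erase.1 h).1) hx (Finset.mem_erase.1 hxa).1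
    rw [hg.2.1]
    exact mk_mem_fEdges.2 (Or.inl ⟨Finset.mem_erase.2 ⟨(Finset.mem_erase.1 hxa).1, hx⟩,
      by rw [← h.1, hxy]⟩)
  rcases mk_mem_fEdges.1 (hE (Finset.mem_insert_self _ _)) with ⟨h1, h2⟩ | ⟨h1, h2⟩
  · exact he (key x hx y h1 h2)
  · exact he (by rw [Sym2.eq_swap]; exact key y hy x h1 h2)

theorem treeCount_eq_zero_of_notMem {n : ℕ} {x y : V4} (h : y ∉ latNbrs x) {E : Finset (Sym2 V4)}
    (hE : s(x, y) ∈ E) : treeCount n E = 0 := by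
  unfold treeCount
  rw [Finset.card_eq_zero, Finset.filter_eq_empty_iff]
  intro T hT hT'
  exact h (mem_nbB.1 (mk_mem_boxEdges.1 (hT'.1.1 (hT'.2 hE)))).1

/-- Expectation under the wired measure (uniform on rooted forests of the box). -/
def En (n : ℕ) (F : (V4 → V4) → ℝ) : ℝ :=
  (∑ f ∈ forests latNbrs (boxV n), F f) / numF latNbrs (boxV n)

def ind (p : Prop) : ℝ := if p then 1 else 0

theorem ind_true {p : Prop} (h : p) : ind p = 1 := if_pos h
theorem ind_false {p : Prop} (h : ¬ p) : ind p = 0 := if_neg h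
theorem ind_nonneg (p : Prop) : 0 ≤ ind p := by unfold ind; split_ifs <;> norm_num
theorem ind_le_one (p : Prop) : ind p ≤ 1 := by unfold ind; split_ifs <;> norm_num
theorem ind_mono {p q : Prop} (h : p → q) : ind p ≤ ind q := by
  by_cases hp : p
  · rw [ind_true hp, ind_true (h hp)]
  · rw [ind_false hp]; exact ind_nonneg q
theorem ind_congr {p q : Prop} (h : p ↔ q) : ind p = ind q := by rw [propext h]
theorem ind_and (p q : Prop) : ind (p ∧ q) = ind p * ind q := by
  by_cases hp : p <;> by_cases hq : q <;> simp [ind, hp, hq]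

theorem En_const (n : ℕ) (c : ℝ) : En n (fun _ => c) = c := by
  have := (numF_lat_pos (boxV n)).ne'
  rw [En, Finset.sum_const, nsmul_eq_mul, ← numF]
  field_simp

theorem En_mono {n : ℕ} {F G : (V4 → V4) → ℝ}
    (h : ∀ f, IsForest latNbrs (boxV n) f → F f ≤ G f) : En n F ≤ En n G :=
  div_le_div_of_nonneg_right (Finset.sum_le_sum fun f hf => h f (mem_forests.1 hf))
    (numF_nonneg _ _)

theorem En_congr {n : ℕ} {F G : (V4 → V4) → ℝ}
    (h : ∀ f, IsForest latNbrs (boxV n) f → F f = G f) : En n F = En n G :=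
  le_antisymm (En_mono fun f hf => (h f hf).le) (En_mono fun f hf => (h f hf).ge)

theorem En_add (n : ℕ) (F G : (V4 → V4) → ℝ) : En n (fun f => F f + G f) = En n F + En n G := by
  simp only [En, Finset.sum_add_distrib, add_div]

theorem En_mul_const (n : ℕ) (F : (V4 → V4) → ℝ) (c : ℝ) :
    En n (fun f => F f * c) = En n F * c := by
  simp only [En, ← Finset.sum_mul]; ring

theorem En_sum {ι : Type*} (n : ℕ) (s : Finset ι) (F : ι → (V4 → V4) → ℝ) :
    En n (fun f => ∑ i ∈ s, F i f) = ∑ i ∈ s, En n (F i) := by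
  have h : ∑ f ∈ forests latNbrs (boxV n), ∑ i ∈ s, F i f =
      ∑ i ∈ s, ∑ f ∈ forests latNbrs (boxV n), F i f := Finset.sum_comm
  unfold En
  rw [h, Finset.sum_div]

theorem En_ind (n : ℕ) (p : (V4 → V4) → Prop) :
    En n (fun f => ind (p f)) =
      ((forests latNbrs (boxV n)).filter p).card / numF latNbrs (boxV n) := by
  rw [En]
  congr 1
  simp [ind]

theorem Grow.En_eq {n : ℕ} {a : V4} {A : Finset V4} {E : Finset (Sym2 V4)}
    (hG : Grow latNbrs a A E) (hA : A ⊆ boxV n) :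
    En n (fun f => ind (E ⊆ fEdges (boxV n) f)) = wiredProb A n := by
  have h := card_cylinder symNb_latNbrs hG hA
  have h0 := (numF_lat_pos (boxV n \ A)).ne'
  have h1 : numF latNbrs (boxV n \ A) * capN latNbrs (boxV n) A = ∑ a ∈ A, ∑ w ∈ latNbrs a,
      (numF latNbrs (boxV n \ A) - numL latNbrs (boxV n \ A) A w) := by
    rw [capN, Finset.mul_sum]
    refine Finset.sum_congr rfl fun a _ => ?_
    rw [Finset.mul_sum]
    refine Finset.sum_congr rfl fun w _ => ?_
    rw [lpr]
    field_simp
  rw [En_ind, wiredProb, h1, ← h]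
  congr!

theorem Grow.exists_exit {n : ℕ} {a : V4} {A : Finset V4} {E : Finset (Sym2 V4)}
    (hG : Grow latNbrs a A E) (hA : A ⊆ boxV n) {f : V4 → V4} (hf : IsForest latNbrs (boxV n) f) :
    ∃ b ∈ A, f b ∉ A := by
  by_contra hc
  push Not at hc
  obtain ⟨k, hk⟩ := hf.2.2 a
  have : ∀ j, f^[j] a ∈ A := by
    intro j
    induction j with
    | zero => exact hG.root_mem
    | succ j ih => rw [Function.iterate_succ_apply']; exact hc _ ih
  exact hk (hA (this k))

theorem Grow.notMem_fEdges {n : ℕ} {a : V4} {A : Finset V4} {E : Finset (Sym2 V4)}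
    (hG : Grow latNbrs a A E) (hA : A ⊆ boxV n) {f : V4 → V4} (hf : IsForest latNbrs (boxV n) f)
    (hE : E ⊆ fEdges (boxV n) f) {x y : V4} (hx : x ∈ A) (hy : y ∈ A) (he : s(x, y) ∉ E) :
    s(x, y) ∉ fEdges (boxV n) f := by
  intro h
  obtain ⟨b, hb, hbA⟩ := hG.exists_exit hA hf
  obtain ⟨g, hg⟩ := hG.exists_orients symNb_latNbrs hb
  have key : ∀ x ∈ A, ∀ y ∈ A, f x = y → s(x, y) ∈ E := by
    intro x hx y hy hxy
    have hxb : x ≠ b := by rintro rfl; exact hbA (hxy ▸ hy)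
    have h := hg.eq_of_subset hE (fun _ => hbA) hx hxb
    rw [hg.2.1]
    exact mk_mem_fEdges.2 (Or.inl ⟨Finset.mem_erase.2 ⟨hxb, hx⟩, by rw [← h.1, hxy]⟩)
  rcases mk_mem_fEdges.1 h with ⟨-, h2⟩ | ⟨-, h2⟩
  · exact he (key x hx y hy h2)
  · exact he (by rw [Sym2.eq_swap]; exact key y hy x hx h2)
end TreeCount

section UST
variable {Ω : Type*} [MeasurableSpace Ω] {P : Measure Ω} {𝔗 : Ω → Set (Sym2 V4)}

theorem measurableSet_subset (hU : IsUST4 P 𝔗) (E : Finset (Sym2 V4)) :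
    MeasurableSet {ω | (E : Set (Sym2 V4)) ⊆ 𝔗 ω} := by
  have : {ω | (E : Set (Sym2 V4)) ⊆ 𝔗 ω} = ⋂ e ∈ E, {ω | e ∈ 𝔗 ω} := by
    ext ω; simp [Set.subset_def]
  rw [this]
  exact E.measurableSet_biInter fun e _ => hU.2.1 e

theorem prob_eq_zero_of_treeCount (hU : IsUST4 P 𝔗) {E : Finset (Sym2 V4)}
    (h : ∀ᶠ n in atTop, treeCount n E = 0) : P {ω | (E : Set (Sym2 V4)) ⊆ 𝔗 ω} = 0 := by
  have := hU.1
  have h1 : (P {ω | (E : Set (Sym2 V4)) ⊆ 𝔗 ω}).toReal = 0 := by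
    refine tendsto_nhds_unique (hU.2.2 E) (tendsto_const_nhds.congr' ?_)
    filter_upwards [h] with n hn
    rw [hn]; simp
  exact ((ENNReal.toReal_eq_zero_iff _).1 h1).resolve_right (measure_ne_top P _)

theorem Grow.tendsto_En (hU : IsUST4 P 𝔗) {a : V4} {A : Finset V4} {E : Finset (Sym2 V4)}
    (hG : Grow latNbrs a A E) :
    Tendsto (fun n => En n fun f => ind (E ⊆ fEdges (boxV n) f)) atTop
      (𝓝 (P {ω | (E : Set (Sym2 V4)) ⊆ 𝔗 ω}).toReal) := by
  have h1 : Tendsto (freeProb a A) atTop (𝓝 (P {ω | (E : Set (Sym2 V4)) ⊆ 𝔗 ω}).toReal) := by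
    refine (hU.2.2 E).congr' ?_
    filter_upwards [eventually_subset_boxV A] with n hn
    rw [hG.treeCount_eq hn, treeCount_empty (hn hG.root_mem), freeProb]
  refine (hG.tendsto_wired h1).congr' ?_
  filter_upwards [eventually_subset_boxV A] with n hn using (hG.En_eq hn).symm
end UST

section Comp

/-- The edges of `T` inside the box `[-R,R]⁴` that are reachable from `a` inside that box. -/
def rootComp (R : ℕ) (a : V4) (T : Set (Sym2 V4)) : Finset (Sym2 V4) :=
  (boxEdges R).filter fun e => e ∈ T ∧ ∃ x ∈ e, connIn (T ∩ boxEdges R) a x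

theorem mem_rootComp {R : ℕ} {a : V4} {T : Set (Sym2 V4)} {e : Sym2 V4} :
    e ∈ rootComp R a T ↔ e ∈ boxEdges R ∧ e ∈ T ∧ ∃ x ∈ e, connIn (T ∩ boxEdges R) a x := by
  simp [rootComp]

theorem rootComp_subset (R : ℕ) (a : V4) (T : Set (Sym2 V4)) :
    (rootComp R a T : Set (Sym2 V4)) ⊆ T := fun _ h => (mem_rootComp.1 h).2.1

theorem rootComp_subset_boxEdges (R : ℕ) (a : V4) (T : Set (Sym2 V4)) :
    rootComp R a T ⊆ boxEdges R := Finset.filter_subset _ _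

theorem connIn_mono {S T : Set (Sym2 V4)} (h : S ⊆ T) {x y : V4} (hc : connIn S x y) :
    connIn T x y := Relation.ReflTransGen.mono (fun _ _ h' => h h') _ _ hc

theorem rootComp_mono (R : ℕ) (a : V4) {S T : Set (Sym2 V4)} (h : S ⊆ T) :
    rootComp R a S ⊆ rootComp R a T := by
  intro e he
  obtain ⟨h1, h2, x, hx, hc⟩ := mem_rootComp.1 he
  exact mem_rootComp.2 ⟨h1, h h2, x, hx, connIn_mono (inter_subset_inter_left _ h) hc⟩

theorem connIn_rootComp {R : ℕ} {a x : V4} {T : Set (Sym2 V4)}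
    (h : connIn (T ∩ boxEdges R) a x) : connIn (rootComp R a T : Set (Sym2 V4)) a x := by
  induction h with
  | refl => exact Relation.ReflTransGen.refl
  | @tail b c hb hbc ih =>
    refine ih.tail (mem_rootComp.2 ⟨hbc.2, hbc.1, b, Sym2.mem_mk_left _ _, hb⟩)

theorem rootComp_idem (R : ℕ) (a : V4) (T : Set (Sym2 V4)) :
    rootComp R a (rootComp R a T) = rootComp R a T := by
  refine Finset.Subset.antisymm (fun e he => rootComp_subset R a _ he) fun e he => ?_
  obtain ⟨h1, h2, x, hx, hc⟩ := mem_rootComp.1 he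
  refine mem_rootComp.2 ⟨h1, he, x, hx, connIn_mono ?_ (connIn_rootComp hc)⟩
  exact fun e' he' => ⟨he', rootComp_subset_boxEdges R a T he'⟩

theorem subset_iff_subset_rootComp {R : ℕ} {a : V4} {E : Finset (Sym2 V4)}
    (hE : rootComp R a E = E) (T : Set (Sym2 V4)) :
    (E : Set (Sym2 V4)) ⊆ T ↔ E ⊆ rootComp R a T := by
  constructor
  · intro h
    rw [← hE]
    exact rootComp_mono R a h
  · exact fun h e he => rootComp_subset R a T (h he)

theorem rootComp_congr (R : ℕ) (a : V4) (T : Set (Sym2 V4)) :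
    rootComp R a (T ∩ boxEdges R) = rootComp R a T := by
  refine Finset.Subset.antisymm (rootComp_mono R a inter_subset_left) fun e he => ?_
  obtain ⟨h1, h2, x, hx, hc⟩ := mem_rootComp.1 he
  exact mem_rootComp.2 ⟨h1, ⟨h2, h1⟩, x, hx, by rwa [inter_assoc, inter_self]⟩

/-- A connected edge set is either a growth (a tree) or contains an edge closing a cycle. -/
theorem exists_grow_of_rootComp {R : ℕ} {a : V4} {E : Finset (Sym2 V4)}
    (hE : rootComp R a E = E) :
    (∃ A, Grow latNbrs a A E) ∨ ∃ A E' x y, Grow latNbrs a A E' ∧ E' ⊆ E ∧ x ∈ A ∧ y ∈ A ∧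
      s(x, y) ∈ E ∧ s(x, y) ∉ E' := by
  obtain ⟨A, E', hG, hE', hA, hmax⟩ := exists_maximal_grow latNbrs
    (U := insert a (boxV R)) (Finset.mem_insert_self _ _) (E : Set (Sym2 V4))
  have hbox : ∀ {x y : V4}, s(x, y) ∈ E → y ∈ latNbrs x ∧ x ∈ boxV R ∧ y ∈ boxV R := by
    intro x y h
    rw [← hE] at h
    exact mem_nbB.1 (mk_mem_boxEdges.1 (rootComp_subset_boxEdges R a _ h))
  have hstep : ∀ {x y : V4}, s(x, y) ∈ E → x ∈ A → y ∈ A := by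
    intro x y h hx
    have := hbox h
    exact hmax x hx y (Finset.mem_insert_of_mem this.2.2) this.1 (by rwa [Sym2.eq_swap])
  have hconn : ∀ {x : V4}, connIn ((E : Set (Sym2 V4)) ∩ boxEdges R) a x → x ∈ A := by
    intro x h
    induction h with
    | refl => exact hG.root_mem
    | @tail b c _ hbc ih => exact hstep hbc.1 ih
  by_cases h : E ⊆ E'
  · left
    exact ⟨A, by rwa [Finset.Subset.antisymm h (by exact_mod_cast hE')]⟩
  · right
    obtain ⟨e, he, he'⟩ := Finset.not_subset.1 h
    have h1 := he
    rw [← hE] at h1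
    obtain ⟨-, -, x, hx, hc⟩ := mem_rootComp.1 h1
    obtain ⟨y, rfl⟩ := hx
    exact ⟨A, E', x, y, hG, by exact_mod_cast hE', hconn hc, hstep he (hconn hc), he, he'⟩

theorem treeCount_anti {n : ℕ} {E E' : Finset (Sym2 V4)} (h : E' ⊆ E) :
    treeCount n E ≤ treeCount n E' := by
  unfold treeCount
  refine Finset.card_le_card fun T hT => ?_
  rw [Finset.mem_filter] at hT ⊢
  exact ⟨hT.1, hT.2.1, h.trans hT.2.2⟩

end Comp

section Transfer

variable {Ω : Type*} [MeasurableSpace Ω] {P : Measure Ω} {𝔗 : Ω → Set (Sym2 V4)}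

theorem tendsto_En_subset (hU : IsUST4 P 𝔗) {R : ℕ} {a : V4} {E : Finset (Sym2 V4)}
    (hE : rootComp R a E = E) :
    Tendsto (fun n => En n fun f => ind (E ⊆ fEdges (boxV n) f)) atTop
      (𝓝 (P {ω | (E : Set (Sym2 V4)) ⊆ 𝔗 ω}).toReal) := by
  rcases exists_grow_of_rootComp hE with ⟨A, hG⟩ | ⟨A, E', x, y, hG, hE', hx, hy, he, he'⟩
  · exact hG.tendsto_En hU
  · have h0 : P {ω | (E : Set (Sym2 V4)) ⊆ 𝔗 ω} = 0 := by
      refine prob_eq_zero_of_treeCount hU ?_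
      filter_upwards [eventually_subset_boxV A] with n hn
      refine Nat.eq_zero_of_le_zero ((treeCount_anti (Finset.insert_subset he hE')).trans ?_)
      rw [hG.treeCount_insert hn hx hy he']
    rw [h0, ENNReal.toReal_zero]
    refine tendsto_const_nhds.congr' ?_
    filter_upwards [eventually_subset_boxV A] with n hn
    rw [← En_const n 0]
    refine En_congr fun f hf => (ind_false fun h => ?_).symm
    exact hG.notMem_fEdges hn hf (hE'.trans h) hx hy he' (h he)

theorem measurableSet_local (hU : IsUST4 P 𝔗) (R : ℕ) (p : Set (Sym2 V4) → Prop)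
    (hp : ∀ T, p T ↔ p (T ∩ boxEdges R)) : MeasurableSet {ω | p (𝔗 ω)} := by
  have h : {ω | p (𝔗 ω)} = ⋃ F ∈ {F : Finset (Sym2 V4) | F ∈ (boxEdges R).powerset ∧ p F},
      ⋂ e ∈ boxEdges R, {ω | e ∈ 𝔗 ω ↔ e ∈ F} := by
    ext ω
    simp only [mem_iUnion, mem_iInter, exists_prop]
    constructor
    · intro h
      refine ⟨(boxEdges R).filter (· ∈ 𝔗 ω), ⟨Finset.mem_powerset.2 (Finset.filter_subset _ _), ?_⟩,
        fun e he => ?_⟩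
      · have h' := (hp _).1 h
        convert h' using 1
        ext e
        simp [and_comm]
      · show e ∈ 𝔗 ω ↔ _
        simp [he]
    · rintro ⟨F, ⟨hF, hpF⟩, h⟩
      refine (hp _).2 ?_
      convert hpF using 1
      ext e
      constructor
      · exact fun he => (h e he.2).1 he.1
      · exact fun he => ⟨(h e (Finset.mem_powerset.1 hF he)).2 he, Finset.mem_powerset.1 hF he⟩
  rw [h]
  refine MeasurableSet.biUnion (Set.to_countable _) fun F _ => ?_
  refine MeasurableSet.biInter (Set.to_countable _) fun e _ => ?_
  by_cases he : e ∈ F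
  · simpa [he] using hU.2.1 e
  · simp only [he, iff_false]
    exact (hU.2.1 e).compl

theorem measurableSet_rootComp (hU : IsUST4 P 𝔗) (R : ℕ) (a : V4)
    (q : Finset (Sym2 V4) → Prop) : MeasurableSet {ω | q (rootComp R a (𝔗 ω))} :=
  measurableSet_local hU R (fun T => q (rootComp R a T)) fun T => by rw [rootComp_congr]

theorem ind_subset_eq_sum {R : ℕ} {a : V4} {E : Finset (Sym2 V4)}
    (hE : rootComp R a E = E) (T : Set (Sym2 V4)) :
    ind ((E : Set (Sym2 V4)) ⊆ T) = ind (rootComp R a T = E) +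
      ∑ E' ∈ (boxEdges R).powerset.filter (E ⊂ ·), ind (rootComp R a T = E') := by
  rw [ind_congr (subset_iff_subset_rootComp hE T)]
  by_cases h : E ⊆ rootComp R a T
  · rw [ind_true h]
    by_cases h' : rootComp R a T = E
    · rw [ind_true h', Finset.sum_eq_zero, add_zero]
      intro E' hE'
      refine ind_false fun h'' => ?_
      have := (Finset.mem_filter.1 hE').2
      rw [← h'', h'] at this
      exact (_root_.ssubset_irrefl _) this
    · rw [ind_false h', zero_add, Finset.sum_eq_single (rootComp R a T)]
      · rw [ind_true rfl]
      · exact fun E' _ hne => ind_false fun h'' => hne h''.symm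
      · intro hn
        refine absurd (Finset.mem_filter.2 ⟨Finset.mem_powerset.2
          (rootComp_subset_boxEdges R a T), ?_⟩) hn
        exact Finset.ssubset_iff_subset_ne.2 ⟨h, fun h'' => h' h''.symm⟩
  · rw [ind_false h, ind_false fun h' => h (by rw [h']), Finset.sum_eq_zero, add_zero]
    intro E' hE'
    refine ind_false fun h'' => h ?_
    rw [h'']
    exact (Finset.mem_filter.1 hE').2.subset

theorem integral_ind {p : Ω → Prop} (hp : MeasurableSet {ω | p ω}) :
    ∫ ω, ind (p ω) ∂P = (P {ω | p ω}).toReal := by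
  have : (fun ω => ind (p ω)) = ({ω | p ω} : Set Ω).indicator fun _ => (1 : ℝ) := by
    funext ω
    simp [ind, Set.indicator]
  rw [this, integral_indicator_const _ hp]
  simp [measureReal_def]

theorem integrable_ind [IsFiniteMeasure P] {p : Ω → Prop} (hp : MeasurableSet {ω | p ω}) :
    Integrable (fun ω => ind (p ω)) P := by
  have : (fun ω => ind (p ω)) = ({ω | p ω} : Set Ω).indicator fun _ => (1 : ℝ) := by
    funext ω
    simp [ind, Set.indicator]
  rw [this]
  exact (integrable_const 1).indicator hp

theorem tendsto_En_rootComp_eq (hU : IsUST4 P 𝔗) (R : ℕ) (a : V4) (E : Finset (Sym2 V4))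
    (hEb : E ⊆ boxEdges R) :
    Tendsto (fun n => En n fun f => ind (rootComp R a (fEdges (boxV n) f) = E)) atTop
      (𝓝 (∫ ω, ind (rootComp R a (𝔗 ω) = E) ∂P)) := by
  have := hU.1
  induction hk : (boxEdges R \ E).card using Nat.strong_induction_on generalizing E with
  | _ k ih =>
  by_cases hE : rootComp R a E = E
  · have hsum : ∀ n, En n (fun f => ind (rootComp R a (fEdges (boxV n) f) = E)) =
        En n (fun f => ind (E ⊆ fEdges (boxV n) f)) -
        ∑ E' ∈ (boxEdges R).powerset.filter (E ⊂ ·),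
          En n fun f => ind (rootComp R a (fEdges (boxV n) f) = E') := by
      intro n
      rw [eq_sub_iff_add_eq, ← En_sum, ← En_add]
      refine En_congr fun f _ => ?_
      rw [← ind_subset_eq_sum hE]
      exact ind_congr (by rw [Finset.coe_subset])
    have hlim : ∫ ω, ind (rootComp R a (𝔗 ω) = E) ∂P =
        (P {ω | (E : Set (Sym2 V4)) ⊆ 𝔗 ω}).toReal -
        ∑ E' ∈ (boxEdges R).powerset.filter (E ⊂ ·), ∫ ω, ind (rootComp R a (𝔗 ω) = E') ∂P := by
      have hi : ∀ E', Integrable (fun ω => ind (rootComp R a (𝔗 ω) = E')) P := fun E' =>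
        integrable_ind (measurableSet_rootComp hU R a (· = E'))
      rw [eq_sub_iff_add_eq, ← integral_finsetSum _ fun E' _ => hi E',
        ← integral_add (hi E) (integrable_finsetSum _ fun E' _ => hi E'),
        ← integral_ind (measurableSet_subset hU E)]
      refine integral_congr_ae (ae_of_all _ fun ω => ?_)
      exact (ind_subset_eq_sum hE (𝔗 ω)).symm
    rw [hlim]
    simp only [hsum]
    refine (tendsto_En_subset hU hE).sub (tendsto_finsetSum _ fun E' hE' => ?_)
    obtain ⟨h1, h2⟩ := Finset.mem_filter.1 hE'
    rw [Finset.mem_powerset] at h1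
    refine ih _ ?_ E' h1 rfl
    rw [← hk]
    refine Finset.card_lt_card (Finset.ssubset_iff_subset_ne.2
      ⟨Finset.sdiff_subset_sdiff le_rfl h2.subset, fun h => ?_⟩)
    obtain ⟨e, he, he'⟩ := Finset.exists_of_ssubset h2
    have : e ∈ boxEdges R \ E' := by
      rw [h]
      exact Finset.mem_sdiff.2 ⟨h1 he, he'⟩
    exact (Finset.mem_sdiff.1 this).2 he
  · have h0 : ∀ T, ind (rootComp R a T = E) = 0 := fun T =>
      ind_false fun h => hE (by rw [← h, rootComp_idem])
    simp only [h0, En_const, integral_zero]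
    exact tendsto_const_nhds

theorem eq_sum_rootComp {R : ℕ} {a : V4} (φ : Finset (Sym2 V4) → ℝ) (T : Set (Sym2 V4)) :
    φ (rootComp R a T) = ∑ E ∈ (boxEdges R).powerset, ind (rootComp R a T = E) * φ E := by
  rw [Finset.sum_eq_single (rootComp R a T)]
  · rw [ind_true rfl, one_mul]
  · intro E _ hne
    rw [ind_false fun h => hne h.symm, zero_mul]
  · exact fun h => absurd (Finset.mem_powerset.2 (rootComp_subset_boxEdges R a T)) h

theorem integrable_rootComp (hU : IsUST4 P 𝔗) (R : ℕ) (a : V4) (φ : Finset (Sym2 V4) → ℝ) :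
    Integrable (fun ω => φ (rootComp R a (𝔗 ω))) P := by
  have := hU.1
  simp only [eq_sum_rootComp φ]
  exact integrable_finsetSum _ fun E _ =>
    (integrable_ind (measurableSet_rootComp hU R a (· = E))).mul_const _

/-- Local weak convergence of the wired forests to the uniform spanning tree, along root
components. -/
theorem tendsto_En_rootComp (hU : IsUST4 P 𝔗) (R : ℕ) (a : V4) (φ : Finset (Sym2 V4) → ℝ) :
    Tendsto (fun n => En n fun f => φ (rootComp R a (fEdges (boxV n) f))) atTop
      (𝓝 (∫ ω, φ (rootComp R a (𝔗 ω)) ∂P)) := by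
  have := hU.1
  simp only [eq_sum_rootComp φ]
  rw [integral_finsetSum _ fun E _ =>
    (integrable_ind (measurableSet_rootComp hU R a (· = E))).mul_const _]
  simp only [En_sum, En_mul_const, integral_mul_const]
  exact tendsto_finsetSum _ fun E hE =>
    (tendsto_En_rootComp_eq hU R a E (Finset.mem_powerset.1 hE)).mul_const _

end Transfer

section Escape

/-- `a` is connected in `T`, inside a box and avoiding `v`, to the complement of `[-R,R]⁴`. -/
def Escapes (T : Set (Sym2 V4)) (R : ℕ) (v a : V4) : Prop :=
  a ≠ v ∧ ∃ z, z ∉ boxV R ∧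
    Relation.ReflTransGen (fun x y => s(x, y) ∈ T ∧ s(x, y) ∈ boxEdges (R + 1) ∧ y ≠ v) a z

theorem Escapes.mono {S T : Set (Sym2 V4)} (h : S ⊆ T) {R : ℕ} {v a : V4}
    (he : Escapes S R v a) : Escapes T R v a := by
  obtain ⟨h1, z, hz, hc⟩ := he
  exact ⟨h1, z, hz, Relation.ReflTransGen.mono (fun _ _ h' => ⟨h h'.1, h'.2⟩) _ _ hc⟩

theorem escapes_of_path {T : Set (Sym2 V4)} {R : ℕ} {v a z : V4} (hav : a ≠ v)
    (h : Relation.ReflTransGen (fun x y => s(x, y) ∈ T ∧ y ∈ latNbrs x ∧ y ≠ v) a z)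
    (hz : z ∉ boxV R) : Escapes T R v a := by
  induction h using Relation.ReflTransGen.head_induction_on with
  | refl => exact ⟨hav, z, hz, Relation.ReflTransGen.refl⟩
  | @head b c hbc _ ih =>
    by_cases hb : b ∈ boxV R
    · obtain ⟨-, z', hz', hc⟩ := ih hbc.2.2
      refine ⟨hav, z', hz', hc.head ⟨hbc.1, ?_, hbc.2.2⟩⟩
      exact mk_mem_boxEdges.2 (mem_nbB.2 ⟨hbc.2.1, boxV_mono (Nat.le_succ R) hb,
        latNbrs_subset_boxV hb hbc.2.1⟩)
    · exact ⟨hav, b, hb, Relation.ReflTransGen.refl⟩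

theorem mem_latNbrs_of_mem_boxEdges {n : ℕ} {x y : V4} (h : s(x, y) ∈ boxEdges n) :
    y ∈ latNbrs x := nbB_subset_lat n x (mk_mem_boxEdges.1 h)

theorem Escapes.anti {T : Set (Sym2 V4)} {R R' : ℕ} (h : R ≤ R') {v a : V4}
    (he : Escapes T R' v a) : Escapes T R v a := by
  obtain ⟨h1, z, hz, hc⟩ := he
  exact escapes_of_path h1 (Relation.ReflTransGen.mono
    (fun _ _ h' => ⟨h'.1, mem_latNbrs_of_mem_boxEdges h'.2.1, h'.2.2⟩) _ _ hc)
    fun hz' => hz (boxV_mono h hz')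

theorem escapes_of_seq {T : Set (Sym2 V4)} {R : ℕ} {v : V4} (p : ℕ → V4) (k : ℕ)
    (hT : ∀ j < k, s(p j, p (j + 1)) ∈ T ∧ p (j + 1) ∈ latNbrs (p j)) (hv : ∀ j ≤ k, p j ≠ v)
    (hk : p k ∉ boxV R) : Escapes T R v (p 0) := by
  refine escapes_of_path (hv 0 (Nat.zero_le k)) (z := p k) ?_ hk
  clear hk
  induction k with
  | zero => exact Relation.ReflTransGen.refl
  | succ k ih =>
    exact (ih (fun j hj => hT j (by omega)) fun j hj => hv j (by omega)).tail
      ⟨(hT k (by omega)).1, (hT k (by omega)).2, hv (k + 1) le_rfl⟩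

theorem Escapes.rootComp {T : Set (Sym2 V4)} {R : ℕ} {o v a : V4} (he : Escapes T R v a)
    (ho : connIn (T ∩ boxEdges (R + 1)) o a) :
    Escapes (rootComp (R + 1) o T : Set (Sym2 V4)) R v a := by
  obtain ⟨h1, z, hz, hc⟩ := he
  refine ⟨h1, z, hz, ?_⟩
  clear h1 hz
  induction hc using Relation.ReflTransGen.head_induction_on with
  | refl => exact Relation.ReflTransGen.refl
  | @head b c hbc _ ih =>
    refine (ih (ho.tail ⟨hbc.1, hbc.2.1⟩)).head ⟨?_, hbc.2⟩
    exact mem_rootComp.2 ⟨hbc.2.1, hbc.1, b, Sym2.mem_mk_left _ _, ho⟩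

theorem IsForest.farAbove_of_escapes {n : ℕ} {f : V4 → V4} {R : ℕ} {v a : V4}
    (hl : Leads f a {v}) (he : Escapes (fEdges (boxV n) f : Set (Sym2 V4)) R v a) :
    FarAbove R v f := by
  obtain ⟨h1, z, hz, hc⟩ := he
  refine ⟨z, hz, ?_⟩
  suffices h : Leads f z {v} ∧ z ≠ v from h.1
  clear hz
  induction hc with
  | refl => exact ⟨hl, h1⟩
  | @tail b c _ hbc ih =>
    refine ⟨?_, hbc.2.2⟩
    rcases mk_mem_fEdges.1 (Finset.mem_coe.1 hbc.1) with ⟨-, h⟩ | ⟨-, h⟩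
    · rcases leads_step.1 ih.1 with h' | h'
      · exact absurd h' ih.2
      · rwa [h] at h'
    · exact leads_step.2 (Or.inr (by rw [h]; exact ih.1))

theorem IsForest.escapes_of_not_leads {n : ℕ} {f : V4 → V4} (hf : IsForest latNbrs (boxV n) f)
    {R : ℕ} (hR : R ≤ n) {v a : V4} (hl : ¬ Leads f a {v}) :
    Escapes (fEdges (boxV n) f : Set (Sym2 V4)) R v a := by
  obtain ⟨k, hk, hmin⟩ := exists_first_of (hf.2.2 a)
  refine escapes_of_seq (fun j => f^[j] a) k (fun j hj => ?_) (fun j _ h => hl ⟨j, h⟩)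
    fun h => hk (boxV_mono hR h)
  have hj' : f^[j] a ∈ boxV n := not_not.1 (hmin j hj)
  rw [Function.iterate_succ_apply']
  exact ⟨Finset.mem_coe.2 (mk_mem_fEdges.2 (Or.inl ⟨hj', rfl⟩)), hf.1 _ hj'⟩

/-- A locally finite forest in which every vertex has exactly one neighbour escaping to
infinity. -/
def OneEnded (T : Set (Sym2 V4)) : Prop :=
  (∀ x y, s(x, y) ∈ T → y ∈ latNbrs x) ∧
  (∀ x R, ∃ w, s(x, w) ∈ T ∧ Escapes T R x w) ∧
  ∀ x, ∃ R, ∀ w w', s(x, w) ∈ T → s(x, w') ∈ T → Escapes T R x w → Escapes T R x w' → w = w'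

variable {Ω : Type*} [MeasurableSpace Ω] {P : Measure Ω} {𝔗 : Ω → Set (Sym2 V4)}

theorem ae_mem_latNbrs (hU : IsUST4 P 𝔗) : ∀ᵐ ω ∂P, ∀ x y, s(x, y) ∈ 𝔗 ω → y ∈ latNbrs x := by
  refine ae_all_iff.2 fun x => ae_all_iff.2 fun y => ?_
  by_cases h : y ∈ latNbrs x
  · exact ae_of_all _ fun _ _ => h
  · have h0 : P {ω | (({s(x, y)} : Finset (Sym2 V4)) : Set (Sym2 V4)) ⊆ 𝔗 ω} = 0 :=
      prob_eq_zero_of_treeCount hU (Eventually.of_forall fun n =>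
        treeCount_eq_zero_of_notMem h (Finset.mem_singleton_self _))
    have := measure_eq_zero_iff_ae_notMem.1 h0
    filter_upwards [this] with ω hω hm
    exact absurd (by simpa using hm) hω

theorem mem_boxEdges_succ {R : ℕ} {x w : V4} (hx : x ∈ boxV R) (hw : w ∈ latNbrs x) :
    s(x, w) ∈ boxEdges (R + 1) :=
  mk_mem_boxEdges.2 (mem_nbB.2 ⟨hw, boxV_mono (Nat.le_succ R) hx, latNbrs_subset_boxV hx hw⟩)

theorem mem_rootComp_of_mem {R : ℕ} {T : Set (Sym2 V4)} {x w : V4} (hx : x ∈ boxV R)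
    (hw : w ∈ latNbrs x) (h : s(x, w) ∈ T) (he : Escapes T R x w) :
    s(x, w) ∈ rootComp (R + 1) x T ∧ Escapes (rootComp (R + 1) x T : Set (Sym2 V4)) R x w := by
  have h1 := mem_boxEdges_succ hx hw
  exact ⟨mem_rootComp.2 ⟨h1, h, x, Sym2.mem_mk_left _ _, Relation.ReflTransGen.refl⟩,
    he.rootComp (Relation.ReflTransGen.single ⟨h, h1⟩)⟩

theorem ae_exists_escapes (hU : IsUST4 P 𝔗) {x : V4} {R : ℕ} (hx : x ∈ boxV R) :
    ∀ᵐ ω ∂P, ∃ w, s(x, w) ∈ 𝔗 ω ∧ Escapes (𝔗 ω) R x w := by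
  have := hU.1
  set p : Finset (Sym2 V4) → Prop := fun E => ∃ w, s(x, w) ∈ E ∧ Escapes (E : Set (Sym2 V4)) R x w
    with hp
  have h1 := tendsto_En_rootComp hU (R + 1) x fun E => ind (p E)
  have h2 : ∀ᶠ n in atTop, En n (fun f => ind (p (rootComp (R + 1) x (fEdges (boxV n) f)))) = 1 := by
    filter_upwards [eventually_ge_atTop R] with n hn
    rw [← En_const n 1]
    refine En_congr fun f hf => ind_true ?_
    have hxn := boxV_mono hn hx
    obtain ⟨h3, h4⟩ := mem_rootComp_of_mem (T := (fEdges (boxV n) f : Set (Sym2 V4))) hx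
      (hf.1 x hxn) (Finset.mem_coe.2 (mk_mem_fEdges.2 (Or.inl ⟨hxn, rfl⟩)))
      (hf.escapes_of_not_leads hn (hf.not_leads_self hxn))
    exact ⟨_, h3, h4⟩
  have h3 := tendsto_nhds_unique (tendsto_const_nhds.congr' (h2.mono fun n h => h.symm)) h1
  have hm := measurableSet_rootComp hU (R + 1) x p
  rw [integral_ind hm] at h3
  have h4 : P {ω | p (rootComp (R + 1) x (𝔗 ω))} = 1 := by
    rw [← ENNReal.toReal_eq_one_iff, ← h3]
  have h5 : ∀ᵐ ω ∂P, p (rootComp (R + 1) x (𝔗 ω)) := (mem_ae_iff_prob_eq_one hm).2 h4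
  filter_upwards [h5] with ω hω
  obtain ⟨w, hw, he⟩ := hω
  exact ⟨w, rootComp_subset _ _ _ hw, he.mono (rootComp_subset _ _ _)⟩

theorem eventually_En_farAbove_le (N : ℕ) {ε : ℝ} (hε : 0 < ε) : ∃ R₀ : ℕ, ∀ R ≥ R₀, ∀ n ≥ N,
    ∀ x ∈ boxV N, En n (fun f => ind (FarAbove R x f)) ≤ ε := by
  obtain ⟨R₀, h⟩ := exists_farAbove_le N hε
  refine ⟨R₀, fun R hR n hn x hx => ?_⟩
  refine (En_mono (G := fun f => ind (FarAbove R₀ x f))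
    fun f _ => ind_mono (farAbove_anti hR)).trans ?_
  rw [En_ind, div_le_iff₀ (numF_lat_pos _)]
  convert h (boxV n) x (boxV_mono hn hx) hx

theorem ae_unique_escapes (hU : IsUST4 P 𝔗) (x : V4) :
    ∀ᵐ ω ∂P, ∃ R, ∀ w w', s(x, w) ∈ 𝔗 ω → s(x, w') ∈ 𝔗 ω →
      Escapes (𝔗 ω) R x w → Escapes (𝔗 ω) R x w' → w = w' := by
  have := hU.1
  obtain ⟨N, hN⟩ := exists_mem_boxV x
  set q : ℕ → Set (Sym2 V4) → Prop := fun R T => ∃ w w', w ≠ w' ∧ s(x, w) ∈ T ∧ s(x, w') ∈ T ∧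
    Escapes T R x w ∧ Escapes T R x w' with hq
  have key : ∀ ε : ℝ, 0 < ε → ∃ R, N ≤ R ∧
      P {ω | q R (rootComp (R + 1) x (𝔗 ω))} ≤ ENNReal.ofReal ε := by
    intro ε hε
    obtain ⟨R₀, h⟩ := eventually_En_farAbove_le N hε
    refine ⟨max R₀ N, le_max_right _ _, ?_⟩
    set R := max R₀ N
    have h1 := tendsto_En_rootComp hU (R + 1) x fun E => ind (q R E)
    have hm := measurableSet_rootComp hU (R + 1) x fun E => q R E
    rw [integral_ind hm] at h1
    refine (ENNReal.le_ofReal_iff_toReal_le (measure_ne_top _ _) hε.le).2 (le_of_tendsto h1 ?_)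
    filter_upwards [eventually_ge_atTop N] with n hn
    refine (En_mono fun f hf => ?_).trans (h R (le_max_left _ _) n hn x hN)
    refine ind_mono ?_
    rintro ⟨w, w', hne, hw, hw', he, he'⟩
    have hxn := boxV_mono hn hN
    have aux : ∀ u, s(x, u) ∈ (rootComp (R + 1) x (fEdges (boxV n) f : Set (Sym2 V4)) :
        Set (Sym2 V4)) → Escapes (rootComp (R + 1) x (fEdges (boxV n) f : Set (Sym2 V4)) :
        Set (Sym2 V4)) R x u → u ≠ f x → FarAbove R x f := by
      intro u hu hue hux
      have hu' := rootComp_subset _ _ _ hu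
      rcases mk_mem_fEdges.1 (Finset.mem_coe.1 hu') with ⟨-, h⟩ | ⟨-, h⟩
      · exact absurd h.symm hux
      · exact IsForest.farAbove_of_escapes ⟨1, h⟩ (hue.mono (rootComp_subset _ _ _))
    by_cases hwf : w = f x
    · exact aux w' hw' he' fun h => hne (hwf.trans h.symm)
    · exact aux w hw he hwf
  have h0 : P {ω | ¬ ((∀ x y, s(x, y) ∈ 𝔗 ω → y ∈ latNbrs x) → ∃ R, ¬ q R (𝔗 ω))} = 0 := by
    refine le_antisymm (le_of_forall_pos_le_add fun ε hε => ?_) bot_le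
    rcases eq_or_ne ε ⊤ with rfl | hne
    · simp
    obtain ⟨R, hNR, hR⟩ := key ε.toReal (ENNReal.toReal_pos hε.ne' hne)
    rw [ENNReal.ofReal_toReal hne] at hR
    refine (measure_mono fun ω hω => ?_).trans (hR.trans (by simp))
    have hω' : ¬ ((∀ x y, s(x, y) ∈ 𝔗 ω → y ∈ latNbrs x) → ∃ R, ¬ q R (𝔗 ω)) := hω
    push Not at hω'
    obtain ⟨w, w', hne, hw, hw', he, he'⟩ := hω'.2 R
    have hx := boxV_mono hNR hN
    obtain ⟨h1, h2⟩ := mem_rootComp_of_mem hx (hω'.1 _ _ hw) hw he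
    obtain ⟨h3, h4⟩ := mem_rootComp_of_mem hx (hω'.1 _ _ hw') hw' he'
    exact ⟨w, w', hne, h1, h3, h2, h4⟩
  have h1 : ∀ᵐ ω ∂P, (∀ x y, s(x, y) ∈ 𝔗 ω → y ∈ latNbrs x) → ∃ R, ¬ q R (𝔗 ω) := h0
  filter_upwards [h1, ae_mem_latNbrs hU] with ω hω hlat
  obtain ⟨R, hR⟩ := hω hlat
  refine ⟨R, fun w w' hw hw' he he' => ?_⟩
  by_contra hne
  exact hR ⟨w, w', hne, hw, hw', he, he'⟩

theorem ae_oneEnded (hU : IsUST4 P 𝔗) : ∀ᵐ ω ∂P, OneEnded (𝔗 ω) := by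
  have h1 : ∀ᵐ ω ∂P, ∀ x : V4, ∀ R, x ∈ boxV R → ∃ w, s(x, w) ∈ 𝔗 ω ∧ Escapes (𝔗 ω) R x w := by
    refine ae_all_iff.2 fun x => ae_all_iff.2 fun R => ?_
    by_cases hx : x ∈ boxV R
    · filter_upwards [ae_exists_escapes hU hx] with ω hω _ using hω
    · exact ae_of_all _ fun _ h => absurd h hx
  filter_upwards [ae_mem_latNbrs hU, h1, ae_all_iff.2 (ae_unique_escapes hU)] with ω h2 h3 h4
  refine ⟨h2, fun x R => ?_, h4⟩
  obtain ⟨N, hN⟩ := exists_mem_boxV x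
  obtain ⟨w, hw, he⟩ := h3 x (max N R) (boxV_mono (le_max_left _ _) hN)
  exact ⟨w, hw, he.anti (le_max_right _ _)⟩

end Escape

section Parent

/-- `π x` is the first vertex on the future of `x` in `T`. -/
structure IsParent (T : Set (Sym2 V4)) (π : V4 → V4) : Prop where
  lat : ∀ x y, s(x, y) ∈ T → y ∈ latNbrs x
  edge : ∀ x, s(x, π x) ∈ T
  escapes : ∀ x R, Escapes T R x (π x)
  unique : ∀ x, ∃ R₀, ∀ R ≥ R₀, ∀ w, s(x, w) ∈ T → Escapes T R x w → w = π x

theorem OneEnded.exists_parent {T : Set (Sym2 V4)} (h : OneEnded T) : ∃ π, IsParent T π := by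
  obtain ⟨h1, h2, h3⟩ := h
  choose R₀ h3 using h3
  choose w hw he using h2
  have key : ∀ x R, R₀ x ≤ R → w x R = w x (R₀ x) := fun x R hR =>
    h3 x _ _ (hw x R) (hw x _) ((he x R).anti hR) (he x _)
  refine ⟨fun x => w x (R₀ x), h1, fun x => hw x _, fun x R => ?_, fun x => ⟨R₀ x, ?_⟩⟩
  · rw [← key x (max (R₀ x) R) (le_max_left _ _)]
    exact (he x _).anti (le_max_right _ _)
  · exact fun R hR u hu hue => h3 x _ _ hu (hw x _) (hue.anti hR) (he x _)

namespace IsParent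

variable {T : Set (Sym2 V4)} {π : V4 → V4}

theorem trap (h : IsParent T π) (O : Finset V4) (v : V4) (hO : ∀ u ∈ O, π u ∈ O ∨ π u = v) :
    ∃ R, ∀ a ∈ O, ¬ Escapes T R v a := by
  choose R₀ hR using h.unique
  obtain ⟨m, hm⟩ := (eventually_subset_boxV O).exists
  set R := max m (O.sup R₀)
  refine ⟨R, fun a ha he => ?_⟩
  obtain ⟨-, z, hz, hc⟩ := he
  suffices hs : a ∉ O ∧ Relation.ReflTransGen (fun x y => s(x, y) ∈ T ∧
      s(x, y) ∈ boxEdges (R + 1) ∧ y ∉ O) a z from hs.1 ha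
  clear ha
  induction hc using Relation.ReflTransGen.head_induction_on with
  | refl => exact ⟨fun hzO => hz (boxV_mono (le_max_left _ _) (hm hzO)),
      Relation.ReflTransGen.refl⟩
  | @head b c hbc _ ih =>
    refine ⟨fun hb => ?_, ih.2.head ⟨hbc.1, hbc.2.1, ih.1⟩⟩
    have hcb : c ≠ b := fun h' => ih.1 (h' ▸ hb)
    have hesc : Escapes T R b c := ⟨hcb, z, hz, Relation.ReflTransGen.mono
      (fun _ _ h' => ⟨h'.1, h'.2.1, fun h'' => h'.2.2 (h'' ▸ hb)⟩) _ _ ih.2⟩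
    have hcπ := hR b R ((Finset.le_sup hb).trans (le_max_right _ _)) c hbc.1 hesc
    rcases hO b hb with h' | h'
    · exact ih.1 (hcπ ▸ h')
    · exact hbc.2.2 (hcπ.trans h')

theorem iterate_ne (h : IsParent T π) (x : V4) {m : ℕ} (hm : 0 < m) : π^[m] x ≠ x := by
  intro hx
  have hO : ∀ u ∈ (Finset.range m).image fun k => π^[k] x,
      π u ∈ ((Finset.range m).image fun k => π^[k] x) := by
    intro u hu
    obtain ⟨k, hk, rfl⟩ := Finset.mem_image.1 hu
    rw [← Function.iterate_succ_apply' π k x]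
    rcases lt_or_eq_of_le (Nat.succ_le_of_lt (Finset.mem_range.1 hk)) with h' | h'
    · exact Finset.mem_image.2 ⟨k + 1, Finset.mem_range.2 h', rfl⟩
    · exact Finset.mem_image.2 ⟨0, Finset.mem_range.2 hm, by
        rw [show k.succ = m from h', hx]; rfl⟩
  obtain ⟨R, hR⟩ := h.trap _ x fun u hu => Or.inl (hO u hu)
  refine hR (π x) (hO x (Finset.mem_image.2 ⟨0, Finset.mem_range.2 hm, rfl⟩)) (h.escapes x R)

theorem iterate_injective (h : IsParent T π) (x : V4) :
    Function.Injective fun k => π^[k] x := by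
  intro i j hij
  wlog hlt : i < j generalizing i j with H
  · rcases Nat.lt_or_ge j i with h' | h'
    · exact (H hij.symm h').symm
    · omega
  refine absurd ?_ (h.iterate_ne (π^[i] x) (Nat.sub_pos_of_lt hlt))
  rw [← Function.iterate_add_apply, Nat.sub_add_cancel hlt.le]
  exact hij.symm

theorem ray (h : IsParent T π) {p : ℕ → V4} (hp : Function.Injective p)
    (he : ∀ n, s(p n, p (n + 1)) ∈ T) (n : ℕ) : p n = π^[n] (p 0) := by
  have key : ∀ n, p (n + 1) = π (p n) := by
    intro n
    obtain ⟨R, hR⟩ := h.unique (p n)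
    refine hR R le_rfl _ (he n) ?_
    obtain ⟨k, hk⟩ : ∃ k, p (n + 1 + k) ∉ boxV R := by
      by_contra hc
      push Not at hc
      exact Set.infinite_of_injective_forall_mem (f := fun k => p (n + 1 + k))
        (fun i j hij => by have := hp hij; omega) hc (boxV R).finite_toSet
    exact escapes_of_seq (fun j => p (n + 1 + j)) k
      (fun j _ => ⟨he _, h.lat _ _ (he _)⟩) (fun j _ hj => by have := hp hj; omega) hk
  induction n with
  | zero => rfl
  | succ n ih => rw [key, ih, Function.iterate_succ_apply']

theorem mem_futureSet (h : IsParent T π) {x y : V4} : y ∈ futureSet T x ↔ ∃ k, π^[k] x = y := by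
  constructor
  · intro hy
    by_contra hc
    push Not at hc
    exact hy ⟨fun k => π^[k] x, h.iterate_injective x, rfl, fun n => by
      show s(π^[n] x, π^[n + 1] x) ∈ T
      rw [Function.iterate_succ_apply']; exact h.edge _, hc⟩
  · rintro ⟨k, rfl⟩ ⟨p, hp, h0, he, hne⟩
    exact hne k (by rw [h.ray hp he k, h0])

theorem mem_futureSet_iff_not_escapes (h : IsParent T π) {x y : V4} :
    y ∈ futureSet T x ↔ ∃ R, ¬ Escapes T R y x := by
  rw [h.mem_futureSet]
  constructor
  · rintro ⟨k, rfl⟩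
    rcases Nat.eq_zero_or_pos k with rfl | hk
    · exact ⟨0, fun h' => h'.1 rfl⟩
    · obtain ⟨R, hR⟩ := h.trap ((Finset.range k).image fun j => π^[j] x) (π^[k] x) (by
        intro u hu
        obtain ⟨j, hj, rfl⟩ := Finset.mem_image.1 hu
        rw [← Function.iterate_succ_apply' π j x]
        rcases lt_or_eq_of_le (Nat.succ_le_of_lt (Finset.mem_range.1 hj)) with h' | h'
        · exact Or.inl (Finset.mem_image.2 ⟨j + 1, Finset.mem_range.2 h', rfl⟩)
        · exact Or.inr (by rw [show j.succ = k from h']))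
      exact ⟨R, hR x (Finset.mem_image.2 ⟨0, Finset.mem_range.2 hk, rfl⟩)⟩
  · rintro ⟨R, hR⟩
    by_contra hc
    push Not at hc
    obtain ⟨k, hk⟩ : ∃ k, π^[k] x ∉ boxV R := by
      by_contra hc'
      push Not at hc'
      exact Set.infinite_of_injective_forall_mem (h.iterate_injective x) hc'
        (boxV R).finite_toSet
    refine hR (escapes_of_seq (fun j => π^[j] x) k (fun j _ => ?_) (fun j _ => hc j) hk)
    rw [Function.iterate_succ_apply']
    exact ⟨h.edge _, h.lat _ _ (h.edge _)⟩

theorem self_mem (h : IsParent T π) (x : V4) : x ∈ futureSet T x := h.mem_futureSet.2 ⟨0, rfl⟩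

theorem map_mem (h : IsParent T π) {x y : V4} (hy : y ∈ futureSet T x) (k : ℕ) :
    π^[k] y ∈ futureSet T x := by
  obtain ⟨j, rfl⟩ := h.mem_futureSet.1 hy
  exact h.mem_futureSet.2 ⟨k + j, Function.iterate_add_apply π k j x⟩

theorem futureSet_injective (h : IsParent T π) : Function.Injective (futureSet T) := by
  intro x y hxy
  obtain ⟨a, ha⟩ := h.mem_futureSet.1 (hxy ▸ h.self_mem x : x ∈ futureSet T y)
  obtain ⟨b, hb⟩ := h.mem_futureSet.1 (hxy ▸ h.self_mem y : y ∈ futureSet T x)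
  rcases Nat.eq_zero_or_pos (b + a) with h0 | h0
  · have : a = 0 := by omega
    subst this
    exact ha.symm
  · refine absurd ?_ (h.iterate_ne y h0)
    rw [Function.iterate_add_apply, ha, hb]

theorem pathToMeet_eq (h : IsParent T π) {y : V4} {k : ℕ} (hk : π^[k] y ∈ futureSet T 0)
    (hmin : ∀ j < k, π^[j] y ∉ futureSet T 0) :
    pathToMeet T y = (fun j => π^[j] y) '' Iic k := by
  have hfut : futureSet T (π^[k] y) = futureSet T 0 ∩ futureSet T y := by
    ext z
    constructor
    · intro hz
      obtain ⟨j, rfl⟩ := h.mem_futureSet.1 hz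
      exact ⟨h.map_mem hk j, h.map_mem (h.mem_futureSet.2 ⟨k, rfl⟩) j⟩
    · rintro ⟨hz, hz'⟩
      obtain ⟨j, rfl⟩ := h.mem_futureSet.1 hz'
      have hj : k ≤ j := by
        by_contra hc
        exact hmin j (by omega) hz
      refine h.mem_futureSet.2 ⟨j - k, ?_⟩
      rw [← Function.iterate_add_apply, Nat.sub_add_cancel hj]
  ext z
  constructor
  · rintro (⟨hz, hz'⟩ | hz)
    · obtain ⟨j, rfl⟩ := h.mem_futureSet.1 hz
      refine ⟨j, ?_, rfl⟩
      by_contra hc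
      have hj : k ≤ j := le_of_not_ge hc
      refine hz' ?_
      rw [← Nat.sub_add_cancel hj, Function.iterate_add_apply]
      exact h.map_mem hk _
    · have hz' : futureSet T z = futureSet T 0 ∩ futureSet T y := hz
      exact ⟨k, Set.mem_Iic.2 le_rfl, h.futureSet_injective (hfut.trans hz'.symm)⟩
  · rintro ⟨j, hj, rfl⟩
    rcases lt_or_eq_of_le (show j ≤ k from hj) with h' | rfl
    · exact Or.inl ⟨h.mem_futureSet.2 ⟨j, rfl⟩, hmin j h'⟩
    · exact Or.inr hfut

theorem pathToMeet_infinite (h : IsParent T π) {y : V4}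
    (hmin : ∀ j, π^[j] y ∉ futureSet T 0) : (pathToMeet T y).Infinite :=
  Set.infinite_of_injective_forall_mem (h.iterate_injective y) fun j =>
    Or.inl ⟨h.mem_futureSet.2 ⟨j, rfl⟩, hmin j⟩

end IsParent

end Parent

section Quasilocal

/-- The box `[-n,n]⁴` minus `A`. -/
def dom (n : ℕ) (A : Set V4) : Finset V4 := (boxV n).filter (· ∉ A)

theorem mem_dom {n : ℕ} {A : Set V4} {v : V4} : v ∈ dom n A ↔ v ∈ boxV n ∧ v ∉ A := by
  simp [dom]

theorem dom_mono {m n : ℕ} (h : m ≤ n) (A : Set V4) : dom m A ⊆ dom n A := fun _ hv =>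
  mem_dom.2 ⟨boxV_mono h (mem_dom.1 hv).1, (mem_dom.1 hv).2⟩

theorem dom_insert (n : ℕ) (A : Set V4) (v : V4) : dom n (insert v A) = dom n A \ {v} := by
  ext w
  simp only [mem_dom, Finset.mem_sdiff, Finset.mem_singleton, mem_insert_iff]
  tauto

/-- The ratio of the numbers of wired forests in the box `[-n,n]⁴` with and without wiring `B`,
given that `A` is already wired: the conditional probability of a path pattern on `B`. -/
def cyl (n : ℕ) (A : Set V4) (B : Finset V4) : ℝ :=
  numF latNbrs (dom n A \ B) / numF latNbrs (dom n A)

theorem cyl_nonneg (n : ℕ) (A : Set V4) (B : Finset V4) : 0 ≤ cyl n A B :=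
  div_nonneg (numF_nonneg _ _) (numF_nonneg _ _)

theorem cyl_insert (n : ℕ) (A : Set V4) (v : V4) (B : Finset V4) :
    cyl n A (insert v B) = cyl n A {v} * cyl n (insert v A) B := by
  have h : dom n A \ insert v B = dom n (insert v A) \ B := by
    rw [dom_insert]
    ext w
    simp only [Finset.mem_sdiff, Finset.mem_insert, Finset.mem_singleton]
    tauto
  have h0 := (numF_lat_pos (dom n A \ {v})).ne'
  rw [cyl, cyl, cyl, h, dom_insert]
  field_simp

theorem cyl_empty (n : ℕ) (A : Set V4) : cyl n A ∅ = 1 := by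
  rw [cyl, Finset.sdiff_empty, div_self (numF_lat_pos _).ne']

theorem cyl_singleton_le (n : ℕ) (A : Set V4) (v : V4) : cyl n A {v} ≤ 17 := by
  rw [cyl, div_le_iff₀ (numF_lat_pos _), Finset.sdiff_singleton_eq_erase]
  by_cases hv : v ∈ dom n A
  · exact numF_erase_le (p := (0, true)) symNb_latNbrs hv (fun w => Finset.filter_subset _ _)
  · rw [Finset.erase_eq_of_notMem hv]
    have := numF_nonneg latNbrs (dom n A)
    linarith

theorem cyl_le (n : ℕ) (A : Set V4) (B : Finset V4) : cyl n A B ≤ 17 ^ B.card := by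
  induction B using Finset.induction_on generalizing A with
  | empty => simp [cyl_empty]
  | @insert v B hv ih =>
    rw [cyl_insert, Finset.card_insert_of_notMem hv, pow_succ, mul_comm]
    exact mul_le_mul (ih _) (cyl_singleton_le n A v) (cyl_nonneg _ _ _) (by positivity)

theorem hitProb_singleton_le (v z : V4) : hitProb {v} z ≤ 16 / (sqd v z + 16) := by
  have h := hitProb_le_super (S := {v}) (s := fun x => 16 * psi 16 v x)
    (fun x => mul_nonneg (by norm_num) (psi_pos (by norm_num) v x).le)
    (fun x hx => by
      rw [mem_singleton_iff.1 hx]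
      simp [psi, sqd])
    (fun x _ => by
      rw [lap_const_mul]
      exact mul_nonneg (by norm_num) (lap_psi_nonneg le_rfl v x)) z
  refine h.trans (le_of_eq ?_)
  simp only [psi]
  ring

theorem exists_hitProb_singleton_le (v : V4) {ε : ℝ} (hε : 0 < ε) :
    ∃ N, ∀ z ∉ boxV N, hitProb {v} z ≤ ε := by
  obtain ⟨m, hm⟩ := exists_mem_boxV v
  obtain ⟨k, hk⟩ := exists_nat_gt (16 / ε)
  refine ⟨m + k, fun z hz => (hitProb_singleton_le v z).trans ?_⟩
  have h0 : ∃ i, ((m + k : ℕ) : ℤ) < |z i| := by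
    by_contra hc
    push Not at hc
    exact hz (mem_boxV.2 hc)
  obtain ⟨i, hi⟩ := h0
  have h1 : (k : ℤ) < |z i - v i| := by
    have := mem_boxV.1 hm i
    have := abs_sub_abs_le_abs_sub (z i) (v i)
    push_cast at hi
    linarith
  have h2 : (k : ℝ) ≤ sqd v z := by
    have h3 : (k : ℝ) < |(z i : ℝ) - v i| := by exact_mod_cast h1
    have h4 : ((z i : ℝ) - v i) ^ 2 ≤ sqd v z := by
      unfold sqd
      exact Finset.single_le_sum (f := fun i => ((z i : ℝ) - v i) ^ 2) (fun i _ => sq_nonneg _)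
        (Finset.mem_univ i)
    have h5 : (k : ℝ) ≤ (k : ℝ) ^ 2 := by exact_mod_cast Nat.le_self_pow two_ne_zero k
    have h6 : (k : ℝ) ^ 2 ≤ |(z i : ℝ) - v i| ^ 2 := pow_le_pow_left₀ (Nat.cast_nonneg k) h3.le 2
    rw [sq_abs] at h6
    linarith
  rw [div_lt_iff₀ hε] at hk
  rw [div_le_iff₀ (by linarith [(Nat.cast_nonneg k : (0 : ℝ) ≤ k)])]
  nlinarith [(Nat.cast_nonneg k : (0 : ℝ) ≤ k)]

theorem cyl_singleton_eq {n : ℕ} {A : Set V4} {v : V4} (hv : v ∈ dom n A) :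
    cyl n A {v} * ∑ w ∈ latNbrs v, (1 - lpr latNbrs ((dom n A).erase v) {v} w) = 1 := by
  have h := numF_erase' (numF_lat_pos (dom n A)) hv
  have h0 := (numF_lat_pos (dom n A)).ne'
  rw [cyl, Finset.sdiff_singleton_eq_erase, div_mul_eq_mul_div, ← h, div_self h0]

theorem sub_le_one_sub_add {a b δ : ℝ} (h : a ≤ b + δ) : 1 - b ≤ 1 - a + δ := by linarith

theorem abs_sub_le_of_reciprocal {q q' c c' δ : ℝ} (h1 : q * c = 1) (h2 : q' * c' = 1)
    (hq : 0 ≤ q) (hq' : 0 ≤ q') (hb : q ≤ 17) (hb' : q' ≤ 17) (h3 : c ≤ c')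
    (h4 : c' ≤ c + 8 * δ) : |q - q'| ≤ 2312 * δ := by
  have heq : q - q' = q * q' * (c' - c) := by
    linear_combination q' * h1 - q * h2
  rw [heq, abs_of_nonneg (mul_nonneg (mul_nonneg hq hq') (by linarith))]
  calc q * q' * (c' - c) ≤ (17 * 17) * (8 * δ) :=
        mul_le_mul (mul_le_mul hb hb' hq' (by norm_num)) (by linarith) (by linarith) (by norm_num)
    _ = 2312 * δ := by ring

theorem cyl_singleton_quasilocal (v : V4) {ε : ℝ} (hε : 0 < ε) : ∃ N₀, ∀ N ≥ N₀, ∀ n ≥ N,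
    ∀ A : Set V4, v ∉ A → |cyl n A {v} - cyl N A {v}| ≤ ε := by
  obtain ⟨m, hm⟩ := exists_mem_boxV v
  set δ := ε / 2312 with hδ
  have hδ0 : 0 < δ := by positivity
  obtain ⟨k, hk⟩ := exists_hitProb_singleton_le v hδ0
  refine ⟨max m k, fun N hN n hn A hv => ?_⟩
  have hvN : v ∈ dom N A := mem_dom.2 ⟨boxV_mono ((le_max_left _ _).trans hN) hm, hv⟩
  have hvn : v ∈ dom n A := dom_mono hn A hvN
  have hoff : ∀ n, ∀ u ∈ ({v} : Set V4), u ∉ (dom n A).erase v := fun n u hu => by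
    rw [mem_singleton_iff.1 hu]; exact Finset.notMem_erase _ _
  have h1 := cyl_singleton_eq hvN
  have h2 := cyl_singleton_eq hvn
  have hsub : (dom N A).erase v ⊆ (dom n A).erase v := Finset.erase_subset_erase _ (dom_mono hn A)
  have hle1 : ∀ w, lpr latNbrs ((dom N A).erase v) {v} w ≤ lpr latNbrs ((dom n A).erase v) {v} w :=
    lpr_mono hsub (numF_lat_pos _) (numF_lat_pos _) (hoff n)
  have hle2 : ∀ w, lpr latNbrs ((dom n A).erase v) {v} w ≤
      lpr latNbrs ((dom N A).erase v) {v} w + δ := by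
    refine le_of_lap_le (numF_lat_pos ((dom N A).erase v)) (fun u hu => ?_) fun u hu => ?_
    · rw [lap_add, lap_lpr _ (hoff N) hu, lap_lpr _ (hoff n) (hsub hu)]
      simp [lap]
    · by_cases huv : u = v
      · subst huv
        rw [lpr_of_mem (numF_lat_pos _) (mem_singleton u), lpr_of_mem (numF_lat_pos _) (mem_singleton u)]
        linarith
      · refine le_add_of_nonneg_of_le (lpr_nonneg _ _ _ _) ?_
        by_cases huN : u ∈ boxV N
        · rw [lpr_of_notMem (show u ∉ ({v} : Set V4) from huv)]
          · exact hδ0.le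
          · intro h'
            exact hu (Finset.mem_erase.2 ⟨huv, mem_dom.2
              ⟨huN, (mem_dom.1 (Finset.mem_of_mem_erase h')).2⟩⟩)
        · exact (lpr_le_hitProb (hoff n) u).trans (hk u fun h' => huN
            (boxV_mono ((le_max_right _ _).trans hN) h'))
  have h3 : ∑ w ∈ latNbrs v, (1 - lpr latNbrs ((dom n A).erase v) {v} w) ≤
      ∑ w ∈ latNbrs v, (1 - lpr latNbrs ((dom N A).erase v) {v} w) :=
    Finset.sum_le_sum fun w _ => sub_le_sub_left (hle1 w) 1
  have h4 : ∑ w ∈ latNbrs v, (1 - lpr latNbrs ((dom N A).erase v) {v} w) ≤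
      ∑ w ∈ latNbrs v, (1 - lpr latNbrs ((dom n A).erase v) {v} w) + 8 * δ := by
    have h5 : ∑ w ∈ latNbrs v, (1 - lpr latNbrs ((dom N A).erase v) {v} w) ≤
        ∑ w ∈ latNbrs v, ((1 - lpr latNbrs ((dom n A).erase v) {v} w) + δ) :=
      Finset.sum_le_sum fun w _ => sub_le_one_sub_add (hle2 w)
    rw [Finset.sum_add_distrib, Finset.sum_const, card_latNbrs, nsmul_eq_mul] at h5
    exact h5
  refine (abs_sub_le_of_reciprocal h2 h1 (cyl_nonneg n A {v}) (cyl_nonneg N A {v})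
    (cyl_singleton_le n A v) (cyl_singleton_le N A v) h3 h4).trans (le_of_eq ?_)
  rw [hδ]
  ring

theorem cyl_quasilocal (B : Finset V4) {ε : ℝ} (hε : 0 < ε) : ∃ N₀, ∀ N ≥ N₀, ∀ n ≥ N,
    ∀ A : Set V4, (∀ v ∈ B, v ∉ A) → |cyl n A B - cyl N A B| ≤ ε := by
  induction B using Finset.induction_on generalizing ε with
  | empty => exact ⟨0, fun N _ n _ A _ => by simp [cyl_empty, hε.le]⟩
  | @insert v B hv ih =>
    obtain ⟨N₁, h1⟩ := cyl_singleton_quasilocal v (ε := ε / (2 * 17 ^ B.card)) (by positivity)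
    obtain ⟨N₂, h2⟩ := ih (ε := ε / 34) (by positivity)
    refine ⟨max N₁ N₂, fun N hN n hn A hA => ?_⟩
    have e1 := h1 N ((le_max_left _ _).trans hN) n hn A (hA v (Finset.mem_insert_self _ _))
    have e2 := h2 N ((le_max_right _ _).trans hN) n hn (insert v A) (fun u hu hu' => by
      rcases hu' with rfl | hu'
      · exact hv hu
      · exact hA u (Finset.mem_insert_of_mem hu) hu')
    rw [cyl_insert, cyl_insert]
    set a := cyl n A {v}
    set a' := cyl N A {v}
    set b := cyl n (insert v A) B
    set b' := cyl N (insert v A) B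
    have ha : |a| ≤ 17 := by
      rw [abs_of_nonneg (cyl_nonneg _ _ _)]; exact cyl_singleton_le n A v
    have hb : |b'| ≤ 17 ^ B.card := by
      rw [abs_of_nonneg (cyl_nonneg _ _ _)]; exact cyl_le _ _ _
    calc |a * b - a' * b'| = |a * (b - b') + (a - a') * b'| := by congr 1; ring
      _ ≤ |a| * |b - b'| + |a - a'| * |b'| := by
        rw [← abs_mul, ← abs_mul]; exact abs_add_le _ _
      _ ≤ 17 * (ε / 34) + ε / (2 * 17 ^ B.card) * 17 ^ B.card :=
        add_le_add (mul_le_mul ha e2 (abs_nonneg _) (by norm_num))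
          (mul_le_mul e1 hb (abs_nonneg _) (by positivity))
      _ = ε := by field_simp; ring

/-- The infinite-volume limit of `cyl`. -/
def cylLim (A : Set V4) (B : Finset V4) : ℝ := limUnder atTop fun n => cyl n A B

theorem tendsto_cyl {A : Set V4} {B : Finset V4} (h : ∀ v ∈ B, v ∉ A) :
    Tendsto (fun n => cyl n A B) atTop (𝓝 (cylLim A B)) := by
  refine CauchySeq.tendsto_limUnder (Metric.cauchySeq_iff'.2 fun ε hε => ?_)
  obtain ⟨N, hN⟩ := cyl_quasilocal B (half_pos hε)
  exact ⟨N, fun n hn => by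
    rw [Real.dist_eq]; linarith [hN N le_rfl n hn A h]⟩

end Quasilocal

section PathLaw

/-- Following `g` from any point of `B`, one stays in `B` until hitting `A`; `B` is disjoint
from `A`. -/
def Att (A : Set V4) (B : Finset V4) (g : V4 → V4) : Prop :=
  (∀ v ∈ B, v ∉ A) ∧ (∀ v ∈ B, g v ∈ latNbrs v) ∧ ∀ v ∈ B, ∃ k, g^[k] v ∈ A ∧ ∀ j < k, g^[j] v ∈ B

/-- The vertices of `[-n,n]⁴` on the `f`-path from the origin. -/
def pathSet (n : ℕ) (f : V4 → V4) : Finset V4 := (boxV n).filter fun v => Leads f 0 {v}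

theorem mem_pathSet {n : ℕ} {f : V4 → V4} {v : V4} :
    v ∈ pathSet n f ↔ v ∈ boxV n ∧ ∃ k, f^[k] 0 = v := by
  simp [pathSet, Leads]

theorem Att.agreeOn_of_edges {A : Set V4} {B : Finset V4} {f g : V4 → V4} (h : Att A B g)
    (hE : ∀ v ∈ B, f v = g v ∨ f (g v) = v) (hA : ∀ a ∈ A, f a ∉ B) : AgreeOn B f g := by
  have key : ∀ k, ∀ v ∈ B, g^[k] v ∈ A → (∀ j < k, g^[j] v ∈ B) → f v = g v := by
    intro k
    induction k with
    | zero => exact fun v hv hk _ => absurd hk (h.1 v hv)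
    | succ k ih =>
      intro v hv hk hj
      rcases hE v hv with h1 | h1
      · exact h1
      · exfalso
        rcases Nat.eq_zero_or_pos k with rfl | hk0
        · exact hA _ hk (by rwa [show g^[0 + 1] v = g v from rfl, h1])
        · have h2 : g v ∈ B := hj 1 (by omega)
          have h3 := ih (g v) h2 (by rwa [← Function.iterate_succ_apply]) fun j hjk => by
            rw [← Function.iterate_succ_apply]; exact hj _ (by omega)
          rw [h1] at h3
          obtain ⟨m, rfl⟩ : ∃ m, k = m + 1 := ⟨k - 1, by omega⟩
          rw [Function.iterate_succ_apply, Function.iterate_succ_apply, ← h3] at hk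
          exact h.1 _ (hj m (by omega)) hk
  intro v hv
  obtain ⟨k, hk, hj⟩ := h.2.2 v hv
  exact key k v hv hk hj

theorem Att.agreeOn_iff {n : ℕ} {f g : V4 → V4} {B : Finset V4}
    (h : Att (pathSet n f) B g) (hB : B ⊆ boxV n) :
    fEdges B g ⊆ fEdges (boxV n) f ↔ AgreeOn B f g := by
  constructor
  · refine fun hE => h.agreeOn_of_edges (fun v hv => ?_) fun a ha haB => ?_
    · have hmem : s(v, g v) ∈ fEdges (boxV n) f := hE (mem_fEdges.2 ⟨v, hv, rfl⟩)
      exact (mk_mem_fEdges.1 hmem).imp (·.2) (·.2)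
    · obtain ⟨-, m, rfl⟩ := mem_pathSet.1 (Finset.mem_coe.1 ha)
      exact h.1 _ haB (Finset.mem_coe.2 (mem_pathSet.2 ⟨hB haB, m + 1,
        Function.iterate_succ_apply' f m 0⟩))
  · intro hA e he
    obtain ⟨v, hv, rfl⟩ := mem_fEdges.1 he
    exact mem_fEdges.2 ⟨v, hB hv, by rw [hA v hv]⟩

theorem Att.exitsIn {n : ℕ} {A : Set V4} {B : Finset V4} {g : V4 → V4} (h : Att A B g)
    (hB : B ⊆ boxV n) : ExitsIn latNbrs (dom n A) B g :=
  ⟨fun v hv => mem_dom.2 ⟨hB hv, h.1 v hv⟩, h.2.1, fun v hv => by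
    obtain ⟨k, hk, hj⟩ := h.2.2 v hv
    exact ⟨k, fun hd => (mem_dom.1 hd).2 hk, hj⟩⟩

/-- Number of wired forests extending an attached path pattern. -/
theorem ExitsIn.card_agreeOn {D B : Finset V4} {g : V4 → V4} (h : ExitsIn latNbrs D B g) :
    (((forests latNbrs D).filter fun f => AgreeOn B f g).card : ℝ) = numF latNbrs (D \ B) := by
  rw [numF_eq_sum, ← sum_forests_piecewise h (fun _ => (1 : ℝ))]
  simp

theorem pathSet_exitsIn {n : ℕ} {f : V4 → V4} (hf : IsForest latNbrs (boxV n) f) :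
    ExitsIn latNbrs (boxV n) (pathSet n f) f := by
  refine ⟨Finset.filter_subset _ _, fun v hv => hf.1 v (mem_pathSet.1 hv).1, fun v hv => ?_⟩
  obtain ⟨k, hk, hj⟩ := exists_first_of (hf.2.2 v)
  obtain ⟨-, m, rfl⟩ := mem_pathSet.1 hv
  exact ⟨k, hk, fun j hjk => mem_pathSet.2 ⟨not_not.1 (hj j hjk), j + m,
    by rw [Function.iterate_add_apply]⟩⟩

theorem trajectory_eq_iff {n : ℕ} {f f' : V4 → V4} (hf : IsForest latNbrs (boxV n) f)
    (hf' : IsForest latNbrs (boxV n) f') :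
    (fun k => f'^[k] 0) = (fun k => f^[k] 0) ↔ AgreeOn (pathSet n f) f' f := by
  constructor
  · intro h v hv
    obtain ⟨-, k, rfl⟩ := mem_pathSet.1 hv
    have h1 := congrFun h k
    have h2 := congrFun h (k + 1)
    simp only [Function.iterate_succ_apply'] at h1 h2
    rw [← h2, h1]
  · intro h
    funext k
    refine iterate_congr_of fun j _ => ?_
    by_cases hj : f^[j] 0 ∈ boxV n
    · exact (h _ (mem_pathSet.2 ⟨hj, j, rfl⟩)).symm
    · rw [hf.2.1 _ hj, hf'.2.1 _ hj]

theorem pathSet_congr {n : ℕ} {f f' : V4 → V4}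
    (h : (fun k => f'^[k] 0) = fun k => f^[k] (0 : V4)) : pathSet n f' = pathSet n f := by
  ext v
  have h' : ∀ k, f'^[k] 0 = f^[k] (0 : V4) := congrFun h
  simp only [mem_pathSet, h']

theorem boxV_sdiff_pathSet (n : ℕ) (f : V4 → V4) :
    boxV n \ pathSet n f = dom n (pathSet n f : Set V4) := by
  ext v; simp [mem_dom]

/-- Conditional law of a path pattern attached to the path from the origin, in a finite box. -/
theorem En_pathSet_eq {n : ℕ} {B : Finset V4} {g : V4 → V4} {p : Set V4 → Prop}
    (hp : ∀ A, p A → Att A B g) (hB : B ⊆ boxV n) :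
    En n (fun f => ind (p (pathSet n f)) * ind (fEdges B g ⊆ fEdges (boxV n) f)) =
      En n (fun f => ind (p (pathSet n f)) * cyl n (pathSet n f) B) := by
  have hmaps : ∀ f ∈ forests latNbrs (boxV n), (fun k => f^[k] (0 : V4)) ∈
      (forests latNbrs (boxV n)).image (fun f k => f^[k] (0 : V4)) :=
    fun f hf => Finset.mem_image_of_mem (fun f k => f^[k] (0 : V4)) hf
  unfold En
  congr 1
  rw [← Finset.sum_fiberwise_of_maps_to hmaps, ← Finset.sum_fiberwise_of_maps_to hmaps]
  refine Finset.sum_congr rfl fun τ hτ => ?_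
  obtain ⟨f, hf, rfl⟩ := Finset.mem_image.1 hτ
  have hf := mem_forests.1 hf
  by_cases hpA : p (pathSet n f)
  swap
  · rw [Finset.sum_eq_zero, Finset.sum_eq_zero] <;>
    · intro f' hf'
      rw [pathSet_congr (Finset.mem_filter.1 hf').2, ind_false hpA, zero_mul]
  have hatt := hp _ hpA
  have hfil : (forests latNbrs (boxV n)).filter (fun f' => (fun k => f'^[k] (0 : V4)) =
      fun k => f^[k] 0) = (forests latNbrs (boxV n)).filter
        (fun f' => AgreeOn (pathSet n f) f' f) :=
    Finset.filter_congr fun f' hf' => trajectory_eq_iff hf (mem_forests.1 hf')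
  have hR : ∀ f' ∈ (forests latNbrs (boxV n)).filter (fun f' => (fun k => f'^[k] (0 : V4)) =
      fun k => f^[k] 0), ind (p (pathSet n f')) * cyl n (pathSet n f') B =
        cyl n (pathSet n f) B := fun f' hf' => by
    rw [pathSet_congr (Finset.mem_filter.1 hf').2, ind_true hpA, one_mul]
  have hL : ∀ f' ∈ (forests latNbrs (boxV n)).filter (fun f' => (fun k => f'^[k] (0 : V4)) =
      fun k => f^[k] 0), ind (p (pathSet n f')) * ind (fEdges B g ⊆ fEdges (boxV n) f') =
        ind (AgreeOn B f' g) := fun f' hf' => by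
    have h1 := pathSet_congr (n := n) (Finset.mem_filter.1 hf').2
    rw [h1, ind_true hpA, one_mul]
    rw [← h1] at hatt
    exact ind_congr (hatt.agreeOn_iff hB)
  rw [Finset.sum_congr rfl hR, Finset.sum_congr rfl hL, hfil, sum_forests_piecewise
    (pathSet_exitsIn hf), Finset.sum_const, nsmul_eq_mul, (pathSet_exitsIn hf).card_agreeOn,
    boxV_sdiff_pathSet]
  have h1 : ∀ f' : V4 → V4, ind (AgreeOn B ((pathSet n f).piecewise f f') g) =
      ind (AgreeOn B f' g) := fun f' => by
    refine ind_congr (forall₂_congr fun v hv => ?_)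
    rw [Finset.piecewise_eq_of_notMem]
    exact fun h => hatt.1 v hv (Finset.mem_coe.2 h)
  simp only [h1]
  have h2 : ∑ f' ∈ forests latNbrs (dom n (pathSet n f : Set V4)), ind (AgreeOn B f' g) =
      numF latNbrs (dom n (pathSet n f : Set V4) \ B) := by
    rw [← (hatt.exitsIn hB).card_agreeOn]
    simp [ind]
  rw [h2, cyl, mul_div_cancel₀ _ (numF_lat_pos _).ne']

end PathLaw

section PatternTransfer

/-- The part of the future of the origin detected within distance `R`. -/
def etaR (R : ℕ) (T : Set (Sym2 V4)) : Set V4 := {v | ¬ Escapes T R v 0}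

theorem etaR_rootComp (R : ℕ) (T : Set (Sym2 V4)) :
    etaR R (rootComp (R + 1) 0 T : Set (Sym2 V4)) = etaR R T := by
  ext v
  exact not_congr ⟨fun h => h.mono (rootComp_subset _ _ _), fun h => h.rootComp .refl⟩

/-- `p` only depends on the intersection with `[-N,N]⁴`. -/
def LocalOn (N : ℕ) (p : Set V4 → Prop) : Prop :=
  ∀ A A' : Set V4, (∀ v ∈ boxV N, v ∈ A ↔ v ∈ A') → (p A ↔ p A')

theorem cyl_congr {N : ℕ} {A A' : Set V4} (h : ∀ v ∈ boxV N, v ∈ A ↔ v ∈ A') (B : Finset V4) :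
    cyl N A B = cyl N A' B := by
  have : dom N A = dom N A' := Finset.filter_congr fun v hv => not_congr (h v hv)
  rw [cyl, cyl, this]

/-- Some point of `[-M,M]⁴` is below a point outside `[-R,R]⁴`. -/
def Bad (M R : ℕ) (f : V4 → V4) : Prop := ∃ v ∈ boxV M, FarAbove R v f

theorem mem_etaR_iff {M R n : ℕ} (hR : R ≤ n) (hM : M ≤ R) {f : V4 → V4}
    (hf : IsForest latNbrs (boxV n) f) (hb : ¬ Bad M R f) {v : V4} (hv : v ∈ boxV M) :
    v ∈ etaR R (fEdges (boxV n) f : Set (Sym2 V4)) ↔ v ∈ (pathSet n f : Set V4) := by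
  constructor
  · intro h
    have hl : Leads f 0 {v} := by
      by_contra hl
      exact h (hf.escapes_of_not_leads hR hl)
    exact Finset.mem_coe.2 (mem_pathSet.2 ⟨boxV_mono (hM.trans hR) hv, hl⟩)
  · intro h he
    exact hb ⟨v, hv, IsForest.farAbove_of_escapes (mem_pathSet.1 (Finset.mem_coe.1 h)).2 he⟩

theorem connIn_of_seq {T : Set (Sym2 V4)} (p : ℕ → V4) (k : ℕ)
    (h : ∀ j < k, s(p j, p (j + 1)) ∈ T) : connIn T (p 0) (p k) := by
  induction k with
  | zero => exact .refl
  | succ k ih => exact (ih fun j hj => h j (by omega)).tail (h k (by omega))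

theorem connIn_pathSet {M R n : ℕ} (hR : R ≤ n) {f : V4 → V4}
    (hf : IsForest latNbrs (boxV n) f) (hb : ¬ Bad M R f) {a : V4}
    (ha : a ∈ (pathSet n f : Set V4)) (haM : a ∈ boxV M) :
    connIn ((fEdges (boxV n) f : Set (Sym2 V4)) ∩ boxEdges (R + 1)) 0 a := by
  obtain ⟨-, k, rfl⟩ := mem_pathSet.1 (Finset.mem_coe.1 ha)
  refine connIn_of_seq (fun j => f^[j] 0) k fun j hj => ?_
  have hjR : f^[j] 0 ∈ boxV R := by
    by_contra hc
    refine hb ⟨_, haM, _, hc, k - j, ?_⟩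
    rw [mem_singleton_iff, ← Function.iterate_add_apply, Nat.sub_add_cancel hj.le]
  rw [Function.iterate_succ_apply']
  exact ⟨Finset.mem_coe.2 (mem_fEdges.2 ⟨_, boxV_mono hR hjR, rfl⟩),
    mem_boxEdges_succ hjR (hf.1 _ (boxV_mono hR hjR))⟩

theorem Att.fEdges_subset_rootComp {A : Set V4} {B : Finset V4} {g : V4 → V4} {M R : ℕ}
    {T : Set (Sym2 V4)} (h : Att A B g) (hM : M ≤ R) (hB : B ⊆ boxV M)
    (hgB : ∀ v ∈ B, g v ∈ boxV M) (hE : (fEdges B g : Set (Sym2 V4)) ⊆ T)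
    (hA : ∀ a ∈ A, a ∈ boxV M → connIn (T ∩ boxEdges (R + 1)) 0 a) :
    fEdges B g ⊆ rootComp (R + 1) 0 T := by
  have hbox : ∀ v ∈ B, s(v, g v) ∈ boxEdges (R + 1) := fun v hv =>
    mem_boxEdges_succ (boxV_mono hM (hB hv)) (h.2.1 v hv)
  have hT : ∀ v ∈ B, s(v, g v) ∈ T := fun v hv => hE (Finset.mem_coe.2 (mem_fEdges.2 ⟨v, hv, rfl⟩))
  have key : ∀ k, ∀ v ∈ boxV M, g^[k] v ∈ A → (∀ j < k, g^[j] v ∈ B) →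
      connIn (T ∩ boxEdges (R + 1)) 0 v := by
    intro k
    induction k with
    | zero => exact fun v hv hk _ => hA v hk hv
    | succ k ih =>
      intro v hv hk hj
      have hvB : v ∈ B := hj 0 (by omega)
      have h1 := ih (g v) (hgB v hvB) (by rwa [← Function.iterate_succ_apply]) fun j hjk => by
        rw [← Function.iterate_succ_apply]; exact hj _ (by omega)
      refine h1.tail ?_
      rw [Sym2.eq_swap]
      exact ⟨hT v hvB, hbox v hvB⟩
  intro e he
  obtain ⟨v, hv, rfl⟩ := mem_fEdges.1 he
  obtain ⟨k, hk, hj⟩ := h.2.2 v hv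
  exact mem_rootComp.2 ⟨hbox v hv, hT v hv, v, Sym2.mem_mk_left _ _, key k v (hB hv) hk hj⟩

theorem abs_En_sub_le {n : ℕ} {F G H : (V4 → V4) → ℝ}
    (h : ∀ f, IsForest latNbrs (boxV n) f → |F f - G f| ≤ H f) : |En n F - En n G| ≤ En n H := by
  have h1 : En n F ≤ En n G + En n H := by
    rw [← En_add]
    exact En_mono fun f hf => by linarith [(abs_le.1 (h f hf)).2]
  have h2 : En n G ≤ En n F + En n H := by
    rw [← En_add]
    exact En_mono fun f hf => by linarith [(abs_le.1 (h f hf)).1]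
  exact abs_le.2 ⟨by linarith, by linarith⟩

theorem eventually_En_bad_le (M : ℕ) {ε : ℝ} (hε : 0 < ε) : ∃ R₀ ≥ M, ∀ R ≥ R₀, ∀ n ≥ R,
    En n (fun f => ind (Bad M R f)) ≤ ε := by
  have hc : (0 : ℝ) < ((boxV M).card : ℝ) + 1 := by positivity
  obtain ⟨R₀, h⟩ := eventually_En_farAbove_le M (div_pos hε hc)
  refine ⟨max R₀ M, le_max_right _ _, fun R hR n hn => ?_⟩
  have hR0 : R₀ ≤ R := (le_max_left _ _).trans hR
  have hnM : M ≤ n := ((le_max_right _ _).trans hR).trans hn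
  calc En n (fun f => ind (Bad M R f))
      ≤ En n (fun f => ∑ x ∈ boxV M, ind (FarAbove R x f)) := En_mono fun f _ => by
        by_cases hb : Bad M R f
        · obtain ⟨v, hv, hf⟩ := hb
          refine (ind_le_one _).trans ?_
          rw [← ind_true hf]
          exact Finset.single_le_sum (f := fun x => ind (FarAbove R x f))
            (fun x _ => ind_nonneg _) hv
        · rw [ind_false hb]
          exact Finset.sum_nonneg fun x _ => ind_nonneg _
    _ = ∑ x ∈ boxV M, En n (fun f => ind (FarAbove R x f)) := En_sum _ _ _
    _ ≤ ∑ x ∈ boxV M, ε / (((boxV M).card : ℝ) + 1) :=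
        Finset.sum_le_sum fun x hx => h R hR0 n hnM x hx
    _ = (boxV M).card * (ε / (((boxV M).card : ℝ) + 1)) := by rw [Finset.sum_const, nsmul_eq_mul]
    _ ≤ ε := by
        rw [mul_div_assoc', div_le_iff₀ hc]
        nlinarith

/-- Finite-range version of the event that `η` satisfies `p` and the pattern `E` is in the tree. -/
def approxX (p : Set V4 → Prop) (E : Finset (Sym2 V4)) (R : ℕ) (C : Finset (Sym2 V4)) : ℝ :=
  ind (p (etaR R (C : Set (Sym2 V4)))) * ind (E ⊆ C)

/-- Finite-range version of the conditional probability of a pattern on `B`. -/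
def approxY (p : Set V4 → Prop) (B : Finset V4) (N R : ℕ) (C : Finset (Sym2 V4)) : ℝ :=
  ind (p (etaR R (C : Set (Sym2 V4)))) * cyl N (etaR R (C : Set (Sym2 V4))) B

theorem ind_mul_mem {q : Prop} {c K : ℝ} (h : 0 ≤ c) (h' : c ≤ K) :
    0 ≤ ind q * c ∧ ind q * c ≤ K :=
  ⟨mul_nonneg (ind_nonneg _) h, (mul_le_of_le_one_left h (ind_le_one _)).trans h'⟩

theorem abs_sub_le_of_mem {a b K : ℝ} (ha : 0 ≤ a ∧ a ≤ K) (hb : 0 ≤ b ∧ b ≤ K) : |a - b| ≤ K :=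
  abs_le.2 ⟨by linarith, by linarith⟩

variable {p : Set V4 → Prop} {B : Finset V4} {g : V4 → V4} {N : ℕ}

theorem abs_approxX_sub_le (hloc : LocalOn N p) (hp : ∀ A, p A → Att A B g) {M R n : ℕ}
    (hNM : N ≤ M) (hB : B ⊆ boxV M) (hgB : ∀ v ∈ B, g v ∈ boxV M) (hM : M ≤ R) (hR : R ≤ n)
    {f : V4 → V4} (hf : IsForest latNbrs (boxV n) f) :
    |approxX p (fEdges B g) R (rootComp (R + 1) 0 (fEdges (boxV n) f : Set (Sym2 V4))) -
      ind (p (pathSet n f)) * ind (fEdges B g ⊆ fEdges (boxV n) f)| ≤ ind (Bad M R f) := by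
  unfold approxX
  rw [etaR_rootComp]
  by_cases hb : Bad M R f
  · rw [ind_true hb]
    exact abs_sub_le_of_mem (ind_mul_mem (ind_nonneg _) (ind_le_one _))
      (ind_mul_mem (ind_nonneg _) (ind_le_one _))
  · rw [ind_false hb]
    have h1 := hloc _ _ fun v hv => mem_etaR_iff hR hM hf hb (boxV_mono hNM hv)
    rw [ind_congr h1]
    by_cases hpA : p (pathSet n f)
    · have h2 : fEdges B g ⊆ rootComp (R + 1) 0 (fEdges (boxV n) f : Set (Sym2 V4)) ↔
          fEdges B g ⊆ fEdges (boxV n) f := by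
        constructor
        · exact fun h => h.trans (Finset.coe_subset.1 (rootComp_subset _ _ _))
        · exact fun h => (hp _ hpA).fEdges_subset_rootComp hM hB hgB (Finset.coe_subset.2 h)
            fun a ha haM => connIn_pathSet hR hf hb ha haM
      rw [ind_congr h2, sub_self, abs_zero]
    · rw [ind_false hpA, zero_mul, zero_mul, sub_self, abs_zero]

theorem abs_approxY_sub_le (hloc : LocalOn N p) (hp : ∀ A, p A → Att A B g) {M R n N' : ℕ}
    (hNM : N ≤ M) (hNM' : N' ≤ M) (hM : M ≤ R) (hR : R ≤ n) {ε : ℝ} (hε : 0 ≤ ε)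
    (hq : ∀ A : Set V4, (∀ v ∈ B, v ∉ A) → |cyl n A B - cyl N' A B| ≤ ε)
    {f : V4 → V4} (hf : IsForest latNbrs (boxV n) f) :
    |ind (p (pathSet n f)) * cyl n (pathSet n f) B -
      approxY p B N' R (rootComp (R + 1) 0 (fEdges (boxV n) f : Set (Sym2 V4)))| ≤
        ε + ind (Bad M R f) * 17 ^ B.card := by
  unfold approxY
  rw [etaR_rootComp]
  by_cases hb : Bad M R f
  · rw [ind_true hb, one_mul]
    exact le_add_of_nonneg_of_le hε (abs_sub_le_of_mem
      (ind_mul_mem (cyl_nonneg _ _ _) (cyl_le _ _ _))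
      (ind_mul_mem (cyl_nonneg _ _ _) (cyl_le _ _ _)))
  · rw [ind_false hb, zero_mul, add_zero]
    have h0 : ∀ v ∈ boxV M, v ∈ etaR R (fEdges (boxV n) f : Set (Sym2 V4)) ↔
      v ∈ (pathSet n f : Set V4) := fun v hv => mem_etaR_iff hR hM hf hb hv
    rw [ind_congr (hloc _ _ fun v hv => h0 v (boxV_mono hNM hv)),
      cyl_congr fun v hv => h0 v (boxV_mono hNM' hv), ← mul_sub, abs_mul,
      abs_of_nonneg (ind_nonneg _)]
    by_cases hpA : p (pathSet n f)
    · rw [ind_true hpA, one_mul]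
      exact hq _ (hp _ hpA).1
    · rw [ind_false hpA, zero_mul]
      exact hε

variable {Ω : Type*} [MeasurableSpace Ω] {P : Measure Ω} {𝔗 : Ω → Set (Sym2 V4)}

theorem exists_boxV_pattern (B : Finset V4) (g : V4 → V4) (N : ℕ) :
    ∃ M ≥ N, B ⊆ boxV M ∧ ∀ v ∈ B, g v ∈ boxV M := by
  have h := (eventually_subset_boxV B).and
    ((eventually_subset_boxV (B.image g)).and (eventually_ge_atTop N))
  obtain ⟨M, h1, h2, h3⟩ := h.exists
  exact ⟨M, h3, h1, fun v hv => h2 (Finset.mem_image_of_mem g hv)⟩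

theorem abs_integral_approx_le (hU : IsUST4 P 𝔗) (hloc : LocalOn N p)
    (hp : ∀ A, p A → Att A B g) {ε : ℝ} (hε : 0 < ε) : ∃ N₀, ∀ N' ≥ N₀, ∃ R₀, ∀ R ≥ R₀,
      |∫ ω, approxX p (fEdges B g) R (rootComp (R + 1) 0 (𝔗 ω)) ∂P -
        ∫ ω, approxY p B N' R (rootComp (R + 1) 0 (𝔗 ω)) ∂P| ≤ ε := by
  have hK : (0 : ℝ) < 1 + 17 ^ B.card := by positivity
  obtain ⟨N₀, hN₀⟩ := cyl_quasilocal B (half_pos hε)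
  refine ⟨N₀, fun N' hN' => ?_⟩
  obtain ⟨M, hM, hB, hgB⟩ := exists_boxV_pattern B g (max N N')
  obtain ⟨R₀, hR₀, hbad⟩ := eventually_En_bad_le M (div_pos (half_pos hε) hK)
  refine ⟨R₀, fun R hR => ?_⟩
  refine le_of_tendsto ((tendsto_En_rootComp hU (R + 1) 0 (approxX p (fEdges B g) R)).sub
    (tendsto_En_rootComp hU (R + 1) 0 (approxY p B N' R))).abs ?_
  filter_upwards [eventually_ge_atTop R] with n hn
  have hMR : M ≤ R := hR₀.trans hR
  have hN'n : N' ≤ n := ((le_max_right _ _).trans hM).trans (hMR.trans hn)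
  have e1 := abs_En_sub_le (n := n) fun f hf =>
    abs_approxX_sub_le hloc hp ((le_max_left _ _).trans hM) hB hgB hMR hn hf
  have e2 := abs_En_sub_le (n := n) fun f hf =>
    abs_approxY_sub_le hloc hp ((le_max_left _ _).trans hM) ((le_max_right _ _).trans hM) hMR hn
      (half_pos hε).le (hN₀ N' hN' n hN'n) hf
  rw [En_pathSet_eq hp (hB.trans (boxV_mono (hMR.trans hn)))] at e1
  rw [En_add, En_const, En_mul_const] at e2
  have e3 := hbad R hR n hn
  rw [le_div_iff₀ hK] at e3
  refine (abs_sub_le _ _ _).trans ((add_le_add e1 e2).trans ?_)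
  linarith

end PatternTransfer

section CondLaw

theorem IsParent.eventually_etaR {T : Set (Sym2 V4)} {π : V4 → V4} (h : IsParent T π) (M : ℕ) :
    ∀ᶠ R in atTop, ∀ v ∈ boxV M, v ∈ etaR R T ↔ v ∈ futureSet T 0 := by
  refine (Finset.eventually_all (boxV M)).2 fun v _ => ?_
  by_cases hv : v ∈ futureSet T 0
  · obtain ⟨R, hR⟩ := h.mem_futureSet_iff_not_escapes.1 hv
    filter_upwards [eventually_ge_atTop R] with R' hR'
    exact iff_of_true (fun he => hR (he.anti hR')) hv
  · filter_upwards with R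
    exact iff_of_false (fun he => hv (h.mem_futureSet_iff_not_escapes.2 ⟨R, he⟩)) hv

theorem eventually_connIn {T : Set (Sym2 V4)} (hT : ∀ x y, s(x, y) ∈ T → y ∈ latNbrs x)
    {x y : V4} (h : connIn T x y) : ∀ᶠ R in atTop, connIn (T ∩ boxEdges R) x y := by
  induction h with
  | refl => exact Eventually.of_forall fun R => .refl
  | @tail b c _ hbc ih =>
    filter_upwards [ih, eventually_mem_boxV b, eventually_mem_boxV c] with R h1 h2 h3
    exact h1.tail ⟨hbc, Finset.mem_coe.2 (mk_mem_boxEdges.2 (mem_nbB.2 ⟨hT _ _ hbc, h2, h3⟩))⟩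

theorem IsParent.connIn {T : Set (Sym2 V4)} {π : V4 → V4} (h : IsParent T π) {x a : V4}
    (ha : a ∈ futureSet T x) : connIn T x a := by
  obtain ⟨k, rfl⟩ := h.mem_futureSet.1 ha
  refine connIn_of_seq (fun j => π^[j] x) k fun j _ => ?_
  rw [Function.iterate_succ_apply']
  exact h.edge _

variable {p : Set V4 → Prop} {B : Finset V4} {g : V4 → V4} {N : ℕ}

theorem IsParent.eventually_approxX {T : Set (Sym2 V4)} {π : V4 → V4} (h : IsParent T π)
    (hloc : LocalOn N p) (hp : ∀ A, p A → Att A B g) :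
    ∀ᶠ R in atTop, approxX p (fEdges B g) R (rootComp (R + 1) 0 T) =
      ind (p (futureSet T 0)) * ind ((fEdges B g : Set (Sym2 V4)) ⊆ T) := by
  obtain ⟨M, hM, hB, hgB⟩ := exists_boxV_pattern B g N
  have hc : ∀ᶠ R in atTop, ∀ a ∈ boxV M, a ∈ futureSet T 0 → _root_.connIn (T ∩ boxEdges R) 0 a := by
    refine (Finset.eventually_all (boxV M)).2 fun a _ => ?_
    by_cases ha : a ∈ futureSet T 0
    · filter_upwards [eventually_connIn h.lat (h.connIn ha)] with R hR _ using hR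
    · exact Eventually.of_forall fun R ha' => absurd ha' ha
  filter_upwards [h.eventually_etaR N, (tendsto_add_atTop_nat 1).eventually hc,
    eventually_ge_atTop M] with R h1 h2 h3
  unfold approxX
  rw [etaR_rootComp, ind_congr (hloc _ _ h1)]
  by_cases hpA : p (futureSet T 0)
  · congr 1
    refine ind_congr ⟨fun hE => (Finset.coe_subset.2 hE).trans (rootComp_subset _ _ _), fun hE => ?_⟩
    exact (hp _ hpA).fEdges_subset_rootComp h3 hB hgB hE fun a ha haM => h2 a haM ha
  · rw [ind_false hpA, zero_mul, zero_mul]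

theorem IsParent.eventually_approxY {T : Set (Sym2 V4)} {π : V4 → V4} (h : IsParent T π)
    (hloc : LocalOn N p) (B : Finset V4) (N' : ℕ) :
    ∀ᶠ R in atTop, approxY p B N' R (rootComp (R + 1) 0 T) =
      ind (p (futureSet T 0)) * cyl N' (futureSet T 0) B := by
  filter_upwards [h.eventually_etaR N, h.eventually_etaR N'] with R h1 h2
  unfold approxY
  rw [etaR_rootComp, ind_congr (hloc _ _ h1), cyl_congr h2]

theorem tendsto_ind_mul_cyl (hp : ∀ A, p A → Att A B g) (A : Set V4) :
    Tendsto (fun n => ind (p A) * cyl n A B) atTop (𝓝 (ind (p A) * cylLim A B)) := by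
  by_cases hpA : p A
  · exact (tendsto_cyl (hp A hpA).1).const_mul _
  · simp only [ind_false hpA, zero_mul]
    exact tendsto_const_nhds

variable {Ω : Type*} [MeasurableSpace Ω] {P : Measure Ω} {𝔗 : Ω → Set (Sym2 V4)}

theorem integrable_and_tendsto_integral [IsProbabilityMeasure P] {F : ℕ → Ω → ℝ} {G : Ω → ℝ}
    {K : ℝ} (hF : ∀ n, AEStronglyMeasurable (F n) P) (hb : ∀ n ω, 0 ≤ F n ω ∧ F n ω ≤ K)
    (h : ∀ᵐ ω ∂P, Tendsto (fun n => F n ω) atTop (𝓝 (G ω))) :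
    Integrable G P ∧ Tendsto (fun n => ∫ ω, F n ω ∂P) atTop (𝓝 (∫ ω, G ω ∂P)) := by
  refine ⟨?_, ?_⟩
  · refine Integrable.of_bound (aestronglyMeasurable_of_tendsto_ae atTop hF h) K ?_
    filter_upwards [h] with ω hω
    refine le_of_tendsto hω.norm (Eventually.of_forall fun n => ?_)
    rw [Real.norm_of_nonneg (hb n ω).1]
    exact (hb n ω).2
  · refine tendsto_integral_of_dominated_convergence (fun _ => K) hF (integrable_const K)
      (fun n => Eventually.of_forall fun ω => ?_) h
    rw [Real.norm_of_nonneg (hb n ω).1]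
    exact (hb n ω).2

/-- The law of a path pattern attached to the future of the origin. -/
theorem integral_pattern_eq (hU : IsUST4 P 𝔗) (hloc : LocalOn N p) (hp : ∀ A, p A → Att A B g) :
    Integrable (fun ω => ind (p (futureSet (𝔗 ω) 0)) *
      ind ((fEdges B g : Set (Sym2 V4)) ⊆ 𝔗 ω)) P ∧
    Integrable (fun ω => ind (p (futureSet (𝔗 ω) 0)) * cylLim (futureSet (𝔗 ω) 0) B) P ∧
    ∫ ω, ind (p (futureSet (𝔗 ω) 0)) * ind ((fEdges B g : Set (Sym2 V4)) ⊆ 𝔗 ω) ∂P =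
      ∫ ω, ind (p (futureSet (𝔗 ω) 0)) * cylLim (futureSet (𝔗 ω) 0) B ∂P := by
  have := hU.1
  have hpar : ∀ᵐ ω ∂P, ∃ π, IsParent (𝔗 ω) π := by
    filter_upwards [ae_oneEnded hU] with ω h using h.exists_parent
  obtain ⟨iX, tX⟩ := integrable_and_tendsto_integral (P := P) (K := 1)
    (F := fun R ω => approxX p (fEdges B g) R (rootComp (R + 1) 0 (𝔗 ω)))
    (G := fun ω => ind (p (futureSet (𝔗 ω) 0)) * ind ((fEdges B g : Set (Sym2 V4)) ⊆ 𝔗 ω))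
    (fun R => (integrable_rootComp hU (R + 1) 0 _).aestronglyMeasurable)
    (fun R ω => ind_mul_mem (ind_nonneg _) (ind_le_one _))
    (by
      filter_upwards [hpar] with ω ⟨π, hπ⟩
      exact tendsto_const_nhds.congr' (EventuallyEq.symm (hπ.eventually_approxX hloc hp)))
  have hY := fun N' => integrable_and_tendsto_integral (P := P) (K := 17 ^ B.card)
    (F := fun R ω => approxY p B N' R (rootComp (R + 1) 0 (𝔗 ω)))
    (G := fun ω => ind (p (futureSet (𝔗 ω) 0)) * cyl N' (futureSet (𝔗 ω) 0) B)
    (fun R => (integrable_rootComp hU (R + 1) 0 _).aestronglyMeasurable)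
    (fun R ω => ind_mul_mem (cyl_nonneg _ _ _) (cyl_le _ _ _))
    (by
      filter_upwards [hpar] with ω ⟨π, hπ⟩
      exact tendsto_const_nhds.congr' (EventuallyEq.symm (hπ.eventually_approxY hloc B N')))
  obtain ⟨iL, tL⟩ := integrable_and_tendsto_integral (P := P) (K := 17 ^ B.card)
    (F := fun N' ω => ind (p (futureSet (𝔗 ω) 0)) * cyl N' (futureSet (𝔗 ω) 0) B)
    (G := fun ω => ind (p (futureSet (𝔗 ω) 0)) * cylLim (futureSet (𝔗 ω) 0) B)
    (fun N' => (hY N').1.aestronglyMeasurable)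
    (fun R ω => ind_mul_mem (cyl_nonneg _ _ _) (cyl_le _ _ _))
    (Eventually.of_forall fun ω => tendsto_ind_mul_cyl hp _)
  refine ⟨iX, iL, tendsto_nhds_unique ?_ tL⟩
  refine Metric.tendsto_atTop.2 fun ε hε => ?_
  obtain ⟨N₀, hN₀⟩ := abs_integral_approx_le hU hloc hp (half_pos hε)
  refine ⟨N₀, fun N' hN' => ?_⟩
  obtain ⟨R₀, hR₀⟩ := hN₀ N' hN'
  have hle := le_of_tendsto (tX.sub (hY N').2).abs
    (by filter_upwards [eventually_ge_atTop R₀] with R hR using hR₀ R hR)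
  rw [dist_comm, Real.dist_eq]
  linarith

theorem LocalOn.measurableSet (hloc : LocalOn N p) : MeasurableSet[vertexSetMS] {A | p A} := by
  have hv : ∀ v : V4, MeasurableSet[vertexSetMS] {A : Set V4 | v ∈ A} := fun v =>
    MeasurableSpace.measurableSet_generateFrom ⟨v, rfl⟩
  have heq : {A | p A} = ⋃ S ∈ ((boxV N).powerset.filter fun S : Finset V4 => p (S : Set V4)),
      ⋂ v ∈ boxV N, {A : Set V4 | v ∈ A ↔ v ∈ S} := by
    ext A
    simp only [mem_ofPred_eq, mem_iUnion, mem_iInter, Finset.mem_filter, Finset.mem_powerset,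
      exists_prop]
    constructor
    · intro hA
      have h1 : ∀ v ∈ boxV N, v ∈ A ↔ v ∈ (boxV N).filter (· ∈ A) := fun v hv => by simp [hv]
      exact ⟨(boxV N).filter (· ∈ A), ⟨Finset.filter_subset _ _,
        (hloc _ _ fun v hv => by simpa using h1 v hv).1 hA⟩, h1⟩
    · rintro ⟨S, ⟨-, hS⟩, h1⟩
      exact (hloc _ _ fun v hv => by simpa using h1 v hv).2 hS
  rw [heq]
  refine @Finset.measurableSet_biUnion _ _ vertexSetMS _ _ fun S _ =>
    @Finset.measurableSet_biInter _ _ vertexSetMS _ _ fun v _ => ?_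
  by_cases hvS : v ∈ S
  · simpa only [hvS, iff_true] using hv v
  · simp only [hvS, iff_false]
    exact @MeasurableSet.compl _ _ vertexSetMS (hv v)

theorem LocalOn.mono {N' : ℕ} (h : N ≤ N') (hloc : LocalOn N p) : LocalOn N' p :=
  fun A A' hA => hloc A A' fun v hv => hA v (boxV_mono h hv)

theorem LocalOn.and {N' : ℕ} {q : Set V4 → Prop} (hp : LocalOn N p) (hq : LocalOn N' q) :
    LocalOn (max N N') fun A => p A ∧ q A := fun A A' hA =>
  and_congr (hp.mono (le_max_left _ _) A A' hA) (hq.mono (le_max_right _ _) A A' hA)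

theorem measurable_of_local {F : Set V4 → ℝ}
    (h : ∀ A A' : Set V4, (∀ v ∈ boxV N, v ∈ A ↔ v ∈ A') → F A = F A') :
    Measurable[vertexSetMS] F := fun s _ =>
  LocalOn.measurableSet (N := N) (p := fun A => F A ∈ s) fun A A' hA => by
    simp only [h A A' hA]

theorem measurable_cylLim (hloc : LocalOn N p) (hp : ∀ A, p A → Att A B g) :
    Measurable[vertexSetMS] fun A => ind (p A) * cylLim A B := by
  refine @measurable_of_tendsto_metrizable _ _ vertexSetMS _ _ _ _ _ _ (fun n => ?_)
    (tendsto_pi_nhds.2 fun A => tendsto_ind_mul_cyl hp A)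
  refine measurable_of_local (N := max N n) fun A A' hA => ?_
  rw [ind_congr (hloc.mono (le_max_left N n) A A' hA),
    cyl_congr fun v hv => hA v (boxV_mono (le_max_right N n) hv)]

theorem vertexSetMS_eq : vertexSetMS =
    MeasurableSpace.generateFrom {t | ∃ N, ∃ q : Set V4 → Prop, LocalOn N q ∧ t = {A | q A}} := by
  refine le_antisymm (MeasurableSpace.generateFrom_le ?_) (MeasurableSpace.generateFrom_le ?_)
  · rintro _ ⟨v, rfl⟩
    obtain ⟨n, hn⟩ := exists_mem_boxV v
    exact MeasurableSpace.measurableSet_generateFrom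
      ⟨n, fun A => v ∈ A, fun A A' hA => hA v hn, rfl⟩
  · rintro _ ⟨N, q, hq, rfl⟩
    exact hq.measurableSet

/-- Conditional probability, given the future of the origin, of a path pattern attached to it. -/
theorem condExp_pattern (hU : IsUST4 P 𝔗) (hm : futureSigma 𝔗 ≤ ‹MeasurableSpace Ω›)
    (hloc : LocalOn N p) (hp : ∀ A, p A → Att A B g) :
    P[fun ω => ind (p (futureSet (𝔗 ω) 0)) * ind ((fEdges B g : Set (Sym2 V4)) ⊆ 𝔗 ω)
      | futureSigma 𝔗] =ᵐ[P]
    fun ω => ind (p (futureSet (𝔗 ω) 0)) * cylLim (futureSet (𝔗 ω) 0) B := by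
  have := hU.1
  obtain ⟨iX, iL, -⟩ := integral_pattern_eq hU hloc hp
  have hmeas : ∀ t, MeasurableSet[vertexSetMS] t →
      MeasurableSet ((fun ω => futureSet (𝔗 ω) 0) ⁻¹' t) := fun t ht => hm _ ⟨t, ht, rfl⟩
  refine (ae_eq_condExp_of_forall_setIntegral_eq hm iX (fun s _ _ => iL.integrableOn)
    ?_ ?_).symm
  · rintro _ ⟨t, ht, rfl⟩ -
    induction t, ht using MeasurableSpace.induction_on_inter vertexSetMS_eq with
    | h_inter =>
      rintro _ ⟨N₁, q₁, h1, rfl⟩ _ ⟨N₂, q₂, h2, rfl⟩ -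
      exact ⟨_, _, h1.and h2, rfl⟩
    | empty => simp
    | basic t ht =>
      obtain ⟨N', q, hq, rfl⟩ := ht
      have hs := hmeas _ hq.measurableSet
      rw [← integral_indicator hs, ← integral_indicator hs]
      obtain ⟨-, -, h3⟩ := integral_pattern_eq hU (hq.and hloc)
        (B := B) (g := g) fun A hA => hp A hA.2
      convert h3.symm using 2
      · funext ω
        by_cases hω : q (futureSet (𝔗 ω) 0)
        · rw [indicator_of_mem (show ω ∈ (fun ω => futureSet (𝔗 ω) 0) ⁻¹' {A | q A} from hω),
            ind_and, ind_true hω, one_mul]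
        · rw [indicator_of_notMem
            (show ω ∉ (fun ω => futureSet (𝔗 ω) 0) ⁻¹' {A | q A} from hω),
            ind_and, ind_false hω, zero_mul, zero_mul]
      · funext ω
        by_cases hω : q (futureSet (𝔗 ω) 0)
        · rw [indicator_of_mem (show ω ∈ (fun ω => futureSet (𝔗 ω) 0) ⁻¹' {A | q A} from hω),
            ind_and, ind_true hω, one_mul]
        · rw [indicator_of_notMem
            (show ω ∉ (fun ω => futureSet (𝔗 ω) 0) ⁻¹' {A | q A} from hω),
            ind_and, ind_false hω, zero_mul, zero_mul]
    | compl t ht ih =>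
      have hs := hmeas t ht
      have e1 := integral_add_compl hs iX
      have e2 := integral_add_compl hs iL
      obtain ⟨-, -, h3⟩ := integral_pattern_eq hU hloc hp
      rw [preimage_compl]
      linarith
    | iUnion f hd hf ih =>
      have hs := fun i => hmeas (f i) (hf i)
      have hd' : Pairwise fun i j => Disjoint ((fun ω => futureSet (𝔗 ω) 0) ⁻¹' f i)
          ((fun ω => futureSet (𝔗 ω) 0) ⁻¹' f j) := fun i j hij => (hd hij).preimage _
      rw [preimage_iUnion, integral_iUnion hs hd' iX.integrableOn,
        integral_iUnion hs hd' iL.integrableOn]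
      exact tsum_congr ih
  · have h1 : Measurable[futureSigma 𝔗] fun ω =>
        ind (p (futureSet (𝔗 ω) 0)) * cylLim (futureSet (𝔗 ω) 0) B := by
      have h2 : Measurable[futureSigma 𝔗, vertexSetMS] fun ω => futureSet (𝔗 ω) 0 :=
        fun t ht => ⟨t, ht, rfl⟩
      exact (measurable_cylLim hloc hp).comp h2
    exact h1.stronglyMeasurable.aestronglyMeasurable

end CondLaw

section Patterns

/-- A candidate for the path from `y` to the future of the origin: the vertices `B` visited before
hitting the future, and the step function `g` along them. -/
structure Pattern where
  y : V4
  B : Finset V4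
  g : V4 → V4

namespace Pattern

/-- The vertices of the path. -/
def orbit (i : Pattern) : Set V4 := range fun j => i.g^[j] i.y

/-- `i` is a genuine finite path. -/
structure Valid (i : Pattern) : Prop where
  forest : IsForest latNbrs i.B i.g
  cover : ∀ v ∈ i.B, ∃ j, i.g^[j] i.y = v

/-- The path `i` ends exactly when it hits `A`. -/
def Hits (i : Pattern) (A : Set V4) : Prop := (∀ v ∈ i.B, v ∉ A) ∧ ∃ k, i.g^[k] i.y ∈ A

/-- `i` and `j` take the same steps from common vertices. -/
def Compat (i j : Pattern) : Prop := ∀ v, v ∈ i.B → v ∈ j.B → i.g v = j.g v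

variable {i j : Pattern} {A : Set V4}

theorem Valid.iterate_eq (hv : i.Valid) {k m : ℕ} (hk : i.g^[k] i.y ∉ i.B)
    (hm : i.g^[m] i.y ∉ i.B) : i.g^[k] i.y = i.g^[m] i.y := by
  rcases le_total k m with h | h
  · exact (hv.forest.fixed_of_notMem hk h).symm
  · exact hv.forest.fixed_of_notMem hm h

theorem Valid.mem_of_notMem (hv : i.Valid) (h : i.Hits A) {m : ℕ} (hm : i.g^[m] i.y ∉ i.B) :
    i.g^[m] i.y ∈ A := by
  obtain ⟨h1, k, hk⟩ := h
  rwa [hv.iterate_eq hm fun h' => h1 _ h' hk]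

theorem Valid.mem_iff (hv : i.Valid) (h : i.Hits A) (m : ℕ) :
    i.g^[m] i.y ∈ i.B ↔ i.g^[m] i.y ∉ A :=
  ⟨fun hm => h.1 _ hm, fun hm => by_contra fun hc => hm (hv.mem_of_notMem h hc)⟩

theorem Valid.att (hv : i.Valid) (h : i.Hits A) : Att A i.B i.g := by
  refine ⟨h.1, hv.forest.1, fun v hvB => ?_⟩
  obtain ⟨j, rfl⟩ := hv.cover v hvB
  obtain ⟨k, hk, hl⟩ := exists_first_of (hv.forest.2.2 (i.g^[j] i.y))
  refine ⟨k, ?_, fun l hlk => not_not.1 (hl l hlk)⟩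
  rw [← Function.iterate_add_apply] at hk ⊢
  exact hv.mem_of_notMem h hk

theorem eq_of_compat (hi : i.Valid) (hj : j.Valid) (hiA : i.Hits A) (hjA : j.Hits A)
    (hy : i.y = j.y) (hc : i.Compat j) : i = j := by
  have key : ∀ m, i.g^[m] i.y = j.g^[m] j.y := by
    intro m
    induction m with
    | zero => exact hy
    | succ m ih =>
      rw [Function.iterate_succ_apply', Function.iterate_succ_apply']
      by_cases hm : i.g^[m] i.y ∈ i.B
      · have hm' : j.g^[m] j.y ∈ j.B := by
          rw [hj.mem_iff hjA, ← ih]; exact (hi.mem_iff hiA m).1 hm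
        rw [hc _ hm (by rwa [ih]), ih]
      · have hm' : j.g^[m] j.y ∉ j.B := by
          rw [hj.mem_iff hjA, ← ih]; exact fun h' => hm ((hi.mem_iff hiA m).2 h')
        rw [hi.forest.2.1 _ hm, hj.forest.2.1 _ hm', ih]
  have hB : i.B = j.B := by
    ext v
    constructor
    · intro hv
      obtain ⟨m, rfl⟩ := hi.cover v hv
      rw [key, hj.mem_iff hjA, ← key]
      exact (hi.mem_iff hiA m).1 hv
    · intro hv
      obtain ⟨m, rfl⟩ := hj.cover v hv
      rw [← key, hi.mem_iff hiA, key]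
      exact (hj.mem_iff hjA m).1 hv
  have hg : i.g = j.g := by
    funext v
    by_cases hv : v ∈ i.B
    · exact hc v hv (hB ▸ hv)
    · rw [hi.forest.2.1 v hv, hj.forest.2.1 v (hB ▸ hv)]
  cases i; cases j
  simp_all

/-- The common step function of two compatible patterns. -/
def join (i j : Pattern) : V4 → V4 := i.B.piecewise i.g j.g

theorem join_left {v : V4} (hv : v ∈ i.B) : join i j v = i.g v :=
  Finset.piecewise_eq_of_mem _ _ _ hv

theorem Compat.join_right (hc : i.Compat j) {v : V4} (hv : v ∈ j.B) : join i j v = j.g v := by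
  by_cases h : v ∈ i.B
  · rw [join_left h, hc v h hv]
  · exact Finset.piecewise_eq_of_notMem _ _ _ h

theorem _root_.Att.extend {B B' : Finset V4} {g h : V4 → V4} (ha : Att A B g) (hB : B ⊆ B')
    (hg : ∀ v ∈ B, h v = g v) {v : V4} (hv : v ∈ B) :
    v ∉ A ∧ h v ∈ latNbrs v ∧ ∃ k, h^[k] v ∈ A ∧ ∀ j < k, h^[j] v ∈ B' := by
  refine ⟨ha.1 v hv, by rw [hg v hv]; exact ha.2.1 v hv, ?_⟩
  obtain ⟨k, hk, hj⟩ := ha.2.2 v hv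
  have hit : ∀ m ≤ k, h^[m] v = g^[m] v := fun m hm =>
    iterate_congr_of fun l hl => (hg _ (hj l (by omega))).symm
  exact ⟨k, by rwa [hit k le_rfl], fun l hl => by rw [hit l hl.le]; exact hB (hj l hl)⟩

theorem Compat.att (hc : i.Compat j) (hi : Att A i.B i.g) (hj : Att A j.B j.g) :
    Att A (i.B ∪ j.B) (join i j) := by
  have h : ∀ v ∈ i.B ∪ j.B, v ∉ A ∧ join i j v ∈ latNbrs v ∧
      ∃ k, (join i j)^[k] v ∈ A ∧ ∀ l < k, (join i j)^[l] v ∈ i.B ∪ j.B := by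
    intro v hv
    rcases Finset.mem_union.1 hv with hv | hv
    · exact hi.extend Finset.subset_union_left (fun v hv => join_left hv) hv
    · exact hj.extend Finset.subset_union_right (fun v hv => hc.join_right hv) hv
  exact ⟨fun v hv => (h v hv).1, fun v hv => (h v hv).2.1, fun v hv => (h v hv).2.2⟩

theorem Compat.fEdges_join (hc : i.Compat j) :
    fEdges (i.B ∪ j.B) (join i j) = fEdges i.B i.g ∪ fEdges j.B j.g := by
  unfold fEdges
  rw [Finset.image_union]
  congr 1
  · exact Finset.image_congr fun v hv => by
      simp only [join_left (Finset.mem_coe.1 hv)]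
  · exact Finset.image_congr fun v hv => by
      simp only [hc.join_right (Finset.mem_coe.1 hv)]

/-- Extensions of distinct patterns from the same starting point are disjoint. -/
theorem sum_numF_le_numL {n : ℕ} {z : V4} {B₀ : Finset V4} {g₀ : V4 → V4} {S : Set V4}
    (J : Finset Pattern) (hz : ∀ j ∈ J, j.y = z) (hv : ∀ j ∈ J, j.Valid) (hA : ∀ j ∈ J, j.Hits A)
    (hB : ∀ j ∈ J, j.B ⊆ boxV n) (hc : ∀ j ∈ J, ∀ v ∈ j.B, v ∈ B₀ → j.g v = g₀ v)
    (hS : ∀ j ∈ J, ∀ f, AgreeOn (j.B \ B₀) f j.g → Leads f z S) :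
    ∑ j ∈ J, numF latNbrs (dom n A \ (B₀ ∪ j.B)) ≤ numL latNbrs (dom n A \ B₀) S z := by
  have h1 : ∀ j ∈ J, numF latNbrs (dom n A \ (B₀ ∪ j.B)) =
      (((forests latNbrs (dom n A \ B₀)).filter fun f => AgreeOn (j.B \ B₀) f j.g).card : ℝ) := by
    intro j hj
    have hatt := (hv j hj).att (hA j hj)
    have hex : ExitsIn latNbrs (dom n A \ B₀) (j.B \ B₀) j.g := by
      refine ⟨fun v hv => ?_, fun v hv => hatt.2.1 v (Finset.mem_sdiff.1 hv).1, fun v hv => ?_⟩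
      · obtain ⟨h1, h2⟩ := Finset.mem_sdiff.1 hv
        exact Finset.mem_sdiff.2 ⟨mem_dom.2 ⟨hB j hj h1, hatt.1 v h1⟩, h2⟩
      · obtain ⟨k, hk, hl⟩ := hatt.2.2 v (Finset.mem_sdiff.1 hv).1
        have hk' : j.g^[k] v ∉ dom n A \ B₀ := fun h =>
          (mem_dom.1 (Finset.mem_sdiff.1 h).1).2 hk
        obtain ⟨m, hm, hlt⟩ := exists_first_of (p := fun k => j.g^[k] v ∉ dom n A \ B₀) ⟨k, hk'⟩
        refine ⟨m, hm, fun l hlm => ?_⟩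
        have h3 := not_not.1 (hlt l hlm)
        refine Finset.mem_sdiff.2 ⟨hl l ?_, (Finset.mem_sdiff.1 h3).2⟩
        by_contra hkl
        exact hlt k (by omega) hk'
    rw [hex.card_agreeOn]
    congr 1
    ext v
    simp only [Finset.mem_sdiff, Finset.mem_union]
    tauto
  rw [Finset.sum_congr rfl h1, ← Nat.cast_sum, numL, ← Finset.card_biUnion]
  · refine Nat.cast_le.2 (Finset.card_le_card fun f hf => ?_)
    obtain ⟨j, hj, hf⟩ := Finset.mem_biUnion.1 hf
    obtain ⟨h2, h3⟩ := Finset.mem_filter.1 hf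
    exact Finset.mem_filter.2 ⟨h2, hS j hj f h3⟩
  · intro j hj j' hj' hne
    refine Finset.disjoint_left.2 fun f hf hf' => hne ?_
    have h2 := (Finset.mem_filter.1 hf).2
    have h3 := (Finset.mem_filter.1 hf').2
    refine eq_of_compat (hv j hj) (hv j' hj') (hA j hj) (hA j' hj') ?_ fun v hvj hvj' => ?_
    · rw [hz j hj, hz j' hj']
    · by_cases hv0 : v ∈ B₀
      · rw [hc j hj v hvj hv0, hc j' hj' v hvj' hv0]
      · rw [← h2 v (Finset.mem_sdiff.2 ⟨hvj, hv0⟩), ← h3 v (Finset.mem_sdiff.2 ⟨hvj', hv0⟩)]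

theorem cyl_union_le {n : ℕ} {B B' : Finset V4} (hB' : B' ⊆ dom n A) (h : Disjoint B B') :
    cyl n A (B ∪ B') ≤ cyl n A B * cyl n A B' := by
  have hD := numF_lat_pos (dom n A)
  have h1 := numF_ratio_mono (nb := latNbrs) (D := dom n A) (D' := dom n A \ B) (B := B')
    Finset.sdiff_subset (fun v hv => Finset.mem_sdiff.2 ⟨hB' hv, Finset.disjoint_right.1 h hv⟩) hD
  have h2 : dom n A \ (B ∪ B') = (dom n A \ B) \ B' := by
    ext v; simp only [Finset.mem_sdiff, Finset.mem_union]; tauto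
  rw [cyl, cyl, cyl, h2, div_mul_div_comm, div_le_div_iff₀ hD (mul_pos hD hD)]
  calc numF latNbrs ((dom n A \ B) \ B') * (numF latNbrs (dom n A) * numF latNbrs (dom n A))
      = numF latNbrs ((dom n A \ B) \ B') * numF latNbrs (dom n A) * numF latNbrs (dom n A) := by
        ring
    _ ≤ numF latNbrs (dom n A \ B') * numF latNbrs (dom n A \ B) * numF latNbrs (dom n A) :=
        mul_le_mul_of_nonneg_right h1 hD.le
    _ = _ := by ring

theorem Valid.leads_of_agreeOn (hj : j.Valid) {B₀ : Finset V4} (h : ¬ Disjoint B₀ j.B)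
    {f : V4 → V4} (hf : AgreeOn (j.B \ B₀) f j.g) : Leads f j.y B₀ := by
  obtain ⟨v, hv0, hv⟩ := Finset.not_disjoint_iff.1 h
  obtain ⟨k, rfl⟩ := hj.cover v hv
  obtain ⟨m, hm, hl⟩ := exists_first_of (p := fun k => j.g^[k] j.y ∈ B₀) ⟨k, hv0⟩
  have hmk : m ≤ k := by
    by_contra hc
    exact hl k (by omega) hv0
  refine ⟨m, ?_⟩
  rw [iterate_congr_of (f := j.g) (g := f)]
  · exact Finset.mem_coe.2 hm
  · intro l hlm
    refine (hf _ (Finset.mem_sdiff.2 ⟨?_, hl l hlm⟩)).symm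
    by_contra hc
    rw [hj.forest.fixed_of_notMem hc (by omega : l ≤ k)] at hv
    exact hc hv

theorem Valid.leads_of_agreeOn_empty (hj : j.Valid) (h : j.Hits A) {S : Set V4}
    (hS : ∀ v ∈ j.orbit, v ∈ A → v ∈ S) {f : V4 → V4} (hf : AgreeOn (j.B \ ∅) f j.g) :
    Leads f j.y S := by
  obtain ⟨k, hk, hl⟩ := exists_first_of h.2
  refine ⟨k, ?_⟩
  rw [iterate_congr_of (f := j.g) (g := f)]
  · exact hS _ ⟨k, rfl⟩ hk
  · intro l hlk
    exact (hf _ (by rw [Finset.sdiff_empty]; exact (hj.mem_iff h l).2 (hl l hlk))).symm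

end Pattern

end Patterns

section Variance

/-- The box around `y` of twice the radius contains every box of radius `R` that contains `y`. -/
theorem boxSet_subset {x y : V4} {R R' : ℕ} (hR : 2 * R ≤ R') (hy : y ∈ boxSet x R) :
    boxSet x R ⊆ boxSet y R' := by
  intro z hz i
  have h1 := abs_le.1 (hz i)
  have h2 := abs_le.1 (hy i)
  have h3 : (2 * R : ℤ) ≤ R' := by exact_mod_cast hR
  rw [abs_le]
  constructor <;> linarith [h1.1, h1.2, h2.1, h2.2]

namespace Pattern

/-- The patterns that are paths allowed in the definition of `Mset`. -/
structure Admissible (α : ℝ) (x : V4) (r : ℕ) (i : Pattern) : Prop where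
  start_mem : i.y ∈ boxSet x (3 * r)
  valid : i.Valid
  orbit_subset : i.orbit ⊆ boxSet x (3 * r)
  card_le : (i.B.card : ℝ) ≤ (r : ℝ) ^ 2 / Real.log r ^ ((1:ℝ)/3)
  good : ∑ z ∈ boxFinset i.y (6 * r), hitProb (i.orbit ∩ boxSet i.y (6 * r)) z ≤
    α * (r : ℝ) ^ 4 / Real.log r

variable {α : ℝ} {x : V4} {r : ℕ} {i j : Pattern} {A : Set V4}

theorem Valid.coe_subset_orbit (hv : i.Valid) : (i.B : Set V4) ⊆ i.orbit := fun v h =>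
  hv.cover v h

theorem Admissible.subset_boxFinset (h : i.Admissible α x r) : i.B ⊆ boxFinset x (3 * r) :=
  fun _ hv => mem_boxFinset.2 (h.orbit_subset (h.valid.coe_subset_orbit hv))

theorem finite_admissible (α : ℝ) (x : V4) (r : ℕ) : {i : Pattern | i.Admissible α x r}.Finite := by
  refine (Set.Finite.biUnion (boxFinset x (3 * r)).finite_toSet fun y _ =>
    Set.Finite.biUnion (boxFinset x (3 * r)).powerset.finite_toSet fun B _ =>
      (forests latNbrs B).finite_toSet.image fun g => Pattern.mk y B g).subset ?_
  rintro i hi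
  refine Set.mem_biUnion (x := i.y) (mem_boxFinset.2 hi.start_mem)
    (Set.mem_biUnion (x := i.B) (Finset.mem_powerset.2 hi.subset_boxFinset) ⟨i.g, ?_, rfl⟩)
  exact mem_forests.2 hi.valid.forest

/-- All admissible patterns. -/
def adm (α : ℝ) (x : V4) (r : ℕ) : Finset Pattern := (finite_admissible α x r).toFinset

theorem mem_adm : i ∈ adm α x r ↔ i.Admissible α x r := by simp [adm]

/-- `i` and `j` can both be branches of the same tree attached to `A`. -/
def Pair (i j : Pattern) (A : Set V4) : Prop := (i.Hits A ∧ j.Hits A) ∧ i.Compat j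

theorem Admissible.sum_hitProb_le (h : i.Admissible α x r) :
    ∑ z ∈ boxFinset x (3 * r), hitProb i.B z ≤ α * (r : ℝ) ^ 4 / Real.log r := by
  have hsub : boxSet x (3 * r) ⊆ boxSet i.y (6 * r) := boxSet_subset (by omega) h.start_mem
  refine le_trans ?_ h.good
  refine (Finset.sum_le_sum fun z _ => hitProb_mono (T := i.orbit ∩ boxSet i.y (6 * r)) ?_ z).trans
    (Finset.sum_le_sum_of_subset_of_nonneg ?_ fun z _ _ => hitProb_nonneg _ _)
  · exact fun v hv => ⟨h.valid.coe_subset_orbit hv, hsub (h.orbit_subset (h.valid.coe_subset_orbit hv))⟩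
  · exact fun v hv => mem_boxFinset.2 (hsub (mem_boxFinset.1 hv))

theorem Hits.subset_dom {n : ℕ} (hi : i.Hits A) (hB : i.B ⊆ boxV n) : i.B ⊆ dom n A :=
  fun v hv => mem_dom.2 ⟨hB hv, hi.1 v hv⟩

theorem sum_overlap_le {n : ℕ} (hn : boxFinset x (3 * r) ⊆ boxV n) (hi : i.Admissible α x r)
    {J : Finset Pattern} (hJ : ∀ j ∈ J, j.Admissible α x r)
    (hp : ∀ j ∈ J, i.Pair j A ∧ ¬ Disjoint i.B j.B) :
    ∑ j ∈ J, cyl n A (i.B ∪ j.B) ≤ cyl n A i.B * (α * (r : ℝ) ^ 4 / Real.log r) := by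
  rw [← Finset.sum_fiberwise_of_maps_to (s := J) (t := boxFinset x (3 * r)) (g := Pattern.y)
    fun j hj => mem_boxFinset.2 (hJ j hj).start_mem]
  refine le_trans ?_ (mul_le_mul_of_nonneg_left hi.sum_hitProb_le (cyl_nonneg n A i.B))
  rw [Finset.mul_sum]
  refine Finset.sum_le_sum fun z _ => ?_
  have hle := sum_numF_le_numL (A := A) (n := n) (z := z) (B₀ := i.B) (g₀ := i.g) (S := i.B)
    (J.filter fun j => j.y = z) (fun j hj => (Finset.mem_filter.1 hj).2)
    (fun j hj => (hJ j (Finset.mem_filter.1 hj).1).valid)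
    (fun j hj => (hp j (Finset.mem_filter.1 hj).1).1.1.2)
    (fun j hj => (hJ j (Finset.mem_filter.1 hj).1).subset_boxFinset.trans hn)
    (fun j hj v hv hv0 => ((hp j (Finset.mem_filter.1 hj).1).1.2 v hv0 hv).symm)
    (fun j hj f hf => by
      obtain ⟨h1, rfl⟩ := Finset.mem_filter.1 hj
      exact (hJ j h1).valid.leads_of_agreeOn (hp j h1).2 hf)
  have hlpr := lpr_le_hitProb (D := dom n A \ i.B) (S := i.B)
    (fun v hv h => (Finset.mem_sdiff.1 h).2 hv) z
  have h0 := numF_lat_pos (dom n A \ i.B)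
  calc ∑ j ∈ J.filter (fun j => j.y = z), cyl n A (i.B ∪ j.B)
      = (∑ j ∈ J.filter (fun j => j.y = z), numF latNbrs (dom n A \ (i.B ∪ j.B))) /
          numF latNbrs (dom n A) := by rw [Finset.sum_div]; rfl
    _ ≤ numL latNbrs (dom n A \ i.B) i.B z / numF latNbrs (dom n A) :=
        div_le_div_of_nonneg_right hle (numF_nonneg _ _)
    _ = cyl n A i.B * lpr latNbrs (dom n A \ i.B) i.B z := by
        rw [cyl, lpr, div_mul_div_comm, mul_comm (numF latNbrs (dom n A)),
          mul_div_mul_left _ _ h0.ne']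
    _ ≤ _ := mul_le_mul_of_nonneg_left hlpr (cyl_nonneg n A i.B)

theorem sum_row_le {n : ℕ} (hα : 0 < α) (hr : 2 ≤ r) (hn : boxFinset x (3 * r) ⊆ boxV n)
    (hi : i.Admissible α x r) :
    ∑ j ∈ adm α x r, (ind (i.Pair j A) * cyl n A (i.B ∪ j.B) -
      ind (i.Hits A) * cyl n A i.B * (ind (j.Hits A) * cyl n A j.B)) ≤
      ind (i.Hits A) * cyl n A i.B * (α * (r : ℝ) ^ 4 / Real.log r) := by
  by_cases hiA : i.Hits A
  swap
  · rw [ind_false hiA, Finset.sum_eq_zero]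
    · simp
    · intro j _
      rw [ind_false fun h : i.Pair j A => hiA h.1.1]
      ring
  rw [ind_true hiA, one_mul]
  refine le_trans ?_ (sum_overlap_le (A := A) hn hi
    (J := (adm α x r).filter fun j => i.Pair j A ∧ ¬ Disjoint i.B j.B)
    (fun j hj => mem_adm.1 (Finset.mem_filter.1 hj).1) fun j hj => (Finset.mem_filter.1 hj).2)
  rw [Finset.sum_filter]
  refine Finset.sum_le_sum fun j hj => ?_
  have hj' := (mem_adm.1 hj).subset_boxFinset.trans hn
  have h1 : 0 ≤ cyl n A i.B * (ind (j.Hits A) * cyl n A j.B) :=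
    mul_nonneg (cyl_nonneg _ _ _) (mul_nonneg (ind_nonneg _) (cyl_nonneg _ _ _))
  by_cases hp : i.Pair j A
  · by_cases hd : Disjoint i.B j.B
    · rw [if_neg fun h => h.2 hd, ind_true hp, ind_true hp.1.2, one_mul, one_mul, sub_nonpos]
      exact cyl_union_le (hp.1.2.subset_dom hj') hd
    · rw [if_pos ⟨hp, hd⟩, ind_true hp, one_mul]
      linarith
  · rw [if_neg fun h => hp h.1, ind_false hp, zero_mul]
    linarith

theorem sum_ind_mul_cyl_le {n : ℕ} (hr : 2 ≤ r) (hn : boxFinset x (3 * r) ⊆ boxV n) (A : Set V4) :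
    ∑ i ∈ adm α x r, ind (i.Hits A) * cyl n A i.B ≤
      (53 ^ 3 / 1024) * r ^ 2 * cap4 (A ∩ boxSet x (3 * r)) := by
  have hS : A ∩ boxSet x (3 * r) = ((boxFinset x (3 * r)).filter (· ∈ A) : Finset V4) := by
    ext v
    simp only [Finset.coe_filter, mem_boxFinset, Set.mem_inter_iff, Set.mem_ofPred_eq]
    tauto
  rw [hS]
  refine le_trans ?_ (sum_hitProb_le_cap (x := x) (by omega : 1 ≤ r))
  rw [← hS]
  have hf : ∑ i ∈ adm α x r, ind (i.Hits A) * cyl n A i.B =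
      ∑ i ∈ (adm α x r).filter (fun i => i.Hits A), cyl n A i.B := by
    rw [Finset.sum_filter]
    refine Finset.sum_congr rfl fun i _ => ?_
    by_cases h : i.Hits A
    · rw [ind_true h, if_pos h, one_mul]
    · rw [ind_false h, if_neg h, zero_mul]
  rw [hf, ← Finset.sum_fiberwise_of_maps_to (t := boxFinset x (3 * r)) (g := Pattern.y)
    fun i hi => mem_boxFinset.2 (mem_adm.1 (Finset.mem_filter.1 hi).1).start_mem]
  refine Finset.sum_le_sum fun z _ => ?_
  set J := ((adm α x r).filter fun i => i.Hits A).filter fun i => i.y = z with hJ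
  have hJ' : ∀ j ∈ J, j.Admissible α x r ∧ j.Hits A ∧ j.y = z := fun j hj => by
    obtain ⟨h1, h2⟩ := Finset.mem_filter.1 hj
    exact ⟨mem_adm.1 (Finset.mem_filter.1 h1).1, (Finset.mem_filter.1 h1).2, h2⟩
  have hle := sum_numF_le_numL (A := A) (n := n) (z := z) (B₀ := ∅) (g₀ := id)
    (S := A ∩ boxSet x (3 * r)) J (fun j hj => (hJ' j hj).2.2)
    (fun j hj => (hJ' j hj).1.valid) (fun j hj => (hJ' j hj).2.1)
    (fun j hj => (hJ' j hj).1.subset_boxFinset.trans hn)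
    (fun j hj v hv hv0 => absurd hv0 (Finset.notMem_empty v))
    (fun j hj f hf => by
      rw [← (hJ' j hj).2.2]
      exact (hJ' j hj).1.valid.leads_of_agreeOn_empty (S := A ∩ boxSet x (3 * r)) (hJ' j hj).2.1
        (fun v hv hvA => ⟨hvA, (hJ' j hj).1.orbit_subset hv⟩) hf)
  have hlpr := lpr_le_hitProb (D := dom n A) (S := A ∩ boxSet x (3 * r))
    (fun v hv h => (mem_dom.1 h).2 hv.1) z
  calc ∑ j ∈ J, cyl n A j.B
      = (∑ j ∈ J, numF latNbrs (dom n A \ (∅ ∪ j.B))) / numF latNbrs (dom n A) := by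
        rw [Finset.sum_div]
        refine Finset.sum_congr rfl fun j _ => ?_
        rw [Finset.empty_union]; rfl
    _ ≤ numL latNbrs (dom n A \ ∅) (A ∩ boxSet x (3 * r)) z / numF latNbrs (dom n A) :=
        div_le_div_of_nonneg_right hle (numF_nonneg _ _)
    _ ≤ _ := by rw [Finset.sdiff_empty]; exact hlpr

theorem sum_covariance_le {n : ℕ} (hα : 0 < α) (hr : 2 ≤ r) (hn : boxFinset x (3 * r) ⊆ boxV n)
    (A : Set V4) :
    (∑ i ∈ adm α x r, ∑ j ∈ adm α x r, ind (i.Pair j A) * cyl n A (i.B ∪ j.B)) -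
      (∑ i ∈ adm α x r, ind (i.Hits A) * cyl n A i.B) ^ 2 ≤
      53 ^ 3 / 1024 * α * ((r : ℝ) ^ 6 / Real.log r) * cap4 (A ∩ boxSet x (3 * r)) := by
  have hK : 0 ≤ α * (r : ℝ) ^ 4 / Real.log r :=
    div_nonneg (by positivity) (Real.log_natCast_nonneg r)
  rw [sq, Finset.sum_mul_sum, ← Finset.sum_sub_distrib]
  simp only [← Finset.sum_sub_distrib]
  calc _ ≤ ∑ i ∈ adm α x r, ind (i.Hits A) * cyl n A i.B * (α * (r : ℝ) ^ 4 / Real.log r) :=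
        Finset.sum_le_sum fun i hi => sum_row_le hα hr hn (mem_adm.1 hi)
    _ = (∑ i ∈ adm α x r, ind (i.Hits A) * cyl n A i.B) * (α * (r : ℝ) ^ 4 / Real.log r) := by
        rw [Finset.sum_mul]
    _ ≤ (53 ^ 3 / 1024) * r ^ 2 * cap4 (A ∩ boxSet x (3 * r)) * (α * (r : ℝ) ^ 4 / Real.log r) :=
        mul_le_mul_of_nonneg_right (sum_ind_mul_cyl_le hr hn A) hK
    _ = _ := by ring

theorem Admissible.att_hits (hi : i.Admissible α x r) (A : Set V4) (h : i.Hits A) :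
    Att A i.B i.g := hi.valid.att h

theorem Admissible.att_pair (hi : i.Admissible α x r) (hj : j.Admissible α x r) (A : Set V4)
    (h : i.Pair j A) : Att A (i.B ∪ j.B) (join i j) :=
  h.2.att (hi.valid.att h.1.1) (hj.valid.att h.1.2)

theorem sum_covariance_cylLim_le (hα : 0 < α) (hr : 2 ≤ r) (A : Set V4) :
    (∑ i ∈ adm α x r, ∑ j ∈ adm α x r, ind (i.Pair j A) * cylLim A (i.B ∪ j.B)) -
      (∑ i ∈ adm α x r, ind (i.Hits A) * cylLim A i.B) ^ 2 ≤
      53 ^ 3 / 1024 * α * ((r : ℝ) ^ 6 / Real.log r) * cap4 (A ∩ boxSet x (3 * r)) := by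
  refine le_of_tendsto (x := atTop) (f := fun n =>
    (∑ i ∈ adm α x r, ∑ j ∈ adm α x r, ind (i.Pair j A) * cyl n A (i.B ∪ j.B)) -
      (∑ i ∈ adm α x r, ind (i.Hits A) * cyl n A i.B) ^ 2) (Tendsto.sub ?_ (Tendsto.pow ?_ 2)) ?_
  · exact tendsto_finsetSum _ fun i hi => tendsto_finsetSum _ fun j hj =>
      tendsto_ind_mul_cyl ((mem_adm.1 hi).att_pair (mem_adm.1 hj)) A
  · exact tendsto_finsetSum _ fun i hi => tendsto_ind_mul_cyl (mem_adm.1 hi).att_hits A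
  · filter_upwards [eventually_subset_boxV (boxFinset x (3 * r))] with n hn
    exact sum_covariance_le hα hr hn A

theorem Admissible.localOn_hits {N : ℕ} (hi : i.Admissible α x r)
    (hN : boxFinset x (3 * r) ⊆ boxV N) : LocalOn N i.Hits := by
  intro A A' h
  have h' : ∀ v ∈ i.orbit, v ∈ A ↔ v ∈ A' := fun v hv =>
    h v (hN (mem_boxFinset.2 (hi.orbit_subset hv)))
  refine and_congr (forall₂_congr fun v hv => ?_) (exists_congr fun k => h' _ ⟨k, rfl⟩)
  rw [h' v (hi.valid.coe_subset_orbit hv)]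

theorem Admissible.localOn_pair {N : ℕ} (hi : i.Admissible α x r) (hj : j.Admissible α x r)
    (hN : boxFinset x (3 * r) ⊆ boxV N) : LocalOn N (i.Pair j) := fun A A' h =>
  and_congr (and_congr (hi.localOn_hits hN A A' h) (hj.localOn_hits hN A A' h)) Iff.rfl

end Pattern

end Variance

section TreeBranches

namespace IsParent

variable {T : Set (Sym2 V4)} {π : V4 → V4}

theorem eq_or_eq_of_edge (h : IsParent T π) {x y : V4} (hxy : s(x, y) ∈ T) :
    π x = y ∨ π y = x := by
  have hne : y ≠ x := by
    rintro rfl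
    exact ne_of_mem_latNbrs (h.lat _ _ hxy) rfl
  have key : ∀ a b : V4, s(a, b) ∈ T → (∀ n, π^[n] b ≠ a) → π a = b := by
    intro a b hab hn
    let p : ℕ → V4 := fun n => n.casesOn a fun m => π^[m] b
    have hp : Function.Injective p := by
      rintro (_ | m) (_ | n) hmn
      · rfl
      · exact absurd hmn.symm (hn n)
      · exact absurd hmn (hn m)
      · rw [h.iterate_injective b hmn]
    have he : ∀ n, s(p n, p (n + 1)) ∈ T := by
      rintro (_ | n)
      · exact hab
      · show s(π^[n] b, π^[n + 1] b) ∈ T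
        rw [Function.iterate_succ_apply']
        exact h.edge _
    exact (h.ray hp he 1).symm
  by_cases hc : ∀ n, π^[n] x ≠ y
  · exact Or.inr (key y x (by rwa [Sym2.eq_swap]) hc)
  · push Not at hc
    obtain ⟨m, rfl⟩ := hc
    have hm : 0 < m := Nat.pos_of_ne_zero fun h0 => hne (by rw [h0]; rfl)
    refine Or.inl (key _ _ hxy fun n hn => ?_)
    rw [← Function.iterate_add_apply] at hn
    exact h.iterate_ne x (by omega) hn

theorem agreeOn_iff (h : IsParent T π) {B : Finset V4} {g : V4 → V4}
    (ha : Att (futureSet T 0) B g) : AgreeOn B π g ↔ (fEdges B g : Set (Sym2 V4)) ⊆ T := by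
  constructor
  · intro hB e he
    obtain ⟨v, hv, rfl⟩ := mem_fEdges.1 (Finset.mem_coe.1 he)
    rw [← hB v hv]
    exact h.edge v
  · intro hE
    refine ha.agreeOn_of_edges (fun v hv => (h.eq_or_eq_of_edge (hE ?_))) fun a hA hB =>
      ha.1 _ hB (h.map_mem hA 1)
    exact Finset.mem_coe.2 (mem_fEdges.2 ⟨v, hv, rfl⟩)

end IsParent

namespace Pattern

variable {T : Set (Sym2 V4)} {π : V4 → V4} {α : ℝ} {x : V4} {r : ℕ} {i j : Pattern}

/-- `i` is the branch of `T` from its starting point to the future of the origin. -/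
def IsBranch (T : Set (Sym2 V4)) (i : Pattern) : Prop :=
  i.Hits (futureSet T 0) ∧ (fEdges i.B i.g : Set (Sym2 V4)) ⊆ T

theorem Hits.orbit_eq {A : Set V4} (hv : i.Valid) (h : i.Hits A) :
    ∃ k, i.g^[k] i.y ∈ A ∧ (∀ l < k, i.g^[l] i.y ∉ A) ∧
      i.orbit = (fun l => i.g^[l] i.y) '' Iic k ∧ i.orbit.ncard = i.B.card + 1 := by
  obtain ⟨k, hk, hl⟩ := exists_first_of h.2
  have hkB : i.g^[k] i.y ∉ i.B := fun h' => h.1 _ h' hk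
  refine ⟨k, hk, hl, ?_, ?_⟩
  · ext v
    constructor
    · rintro ⟨m, rfl⟩
      rcases le_total m k with hm | hm
      · exact ⟨m, hm, rfl⟩
      · exact ⟨k, le_refl k, (hv.forest.fixed_of_notMem hkB hm).symm⟩
    · rintro ⟨m, -, rfl⟩
      exact ⟨m, rfl⟩
  · have : i.orbit = insert (i.g^[k] i.y) (i.B : Set V4) := by
      ext v
      constructor
      · rintro ⟨m, rfl⟩
        by_cases hm : i.g^[m] i.y ∈ i.B
        · exact Or.inr hm
        · exact Or.inl (hv.iterate_eq hm hkB)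
      · rintro (rfl | hv')
        · exact ⟨k, rfl⟩
        · exact hv.cover v hv'
    rw [this, Set.ncard_insert_of_notMem (by exact hkB), Set.ncard_coe_finset]

theorem IsBranch.pathToMeet_eq (hb : i.IsBranch T) (h : IsParent T π) (hv : i.Valid) :
    pathToMeet T i.y = i.orbit ∧ (pathToMeet T i.y).ncard = i.B.card + 1 := by
  have hag := (h.agreeOn_iff (hv.att hb.1)).2 hb.2
  obtain ⟨k, hk, hl, ho, hc⟩ := hb.1.orbit_eq hv
  have hit : ∀ m ≤ k, π^[m] i.y = i.g^[m] i.y := fun m hm =>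
    iterate_congr_of fun l hlm => (hag _ ((hv.mem_iff hb.1 l).2 (hl l (by omega)))).symm
  have : pathToMeet T i.y = i.orbit := by
    rw [h.pathToMeet_eq (k := k) (by rwa [hit k le_rfl])
      (fun l hlk => by rw [hit l hlk.le]; exact hl l hlk), ho]
    exact Set.image_congr fun m hm => hit m hm
  exact ⟨this, by rw [this, hc]⟩

theorem IsBranch.admissible_iff (hb : i.IsBranch T) (h : IsParent T π) (hv : i.Valid) :
    i.Admissible α x r ↔ i.y ∈ Mset T α x r := by
  obtain ⟨h1, h2⟩ := hb.pathToMeet_eq h hv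
  have h3 : ((pathToMeet T i.y).ncard : ℝ) - 1 = i.B.card := by rw [h2]; push_cast; ring
  constructor
  · intro ha
    refine ⟨ha.start_mem, by rw [h1]; exact ha.orbit_subset, by rw [h3]; exact ha.card_le, ?_⟩
    rw [isGood, h1]
    exact ha.good
  · rintro ⟨m1, m2, m3, m4⟩
    rw [isGood, h1] at m4
    exact ⟨m1, hv, by rwa [h1] at m2, by rwa [h3] at m3, m4⟩

theorem exists_isBranch (h : IsParent T π) {y : V4} {k : ℕ} (hk : π^[k] y ∈ futureSet T 0)
    (hl : ∀ l < k, π^[l] y ∉ futureSet T 0) : ∃ i : Pattern, i.y = y ∧ i.Valid ∧ i.IsBranch T := by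
  let B : Finset V4 := (Finset.range k).image fun l => π^[l] y
  let g : V4 → V4 := B.piecewise π id
  have hB : ∀ l < k, π^[l] y ∈ B := fun l hlk =>
    Finset.mem_image.2 ⟨l, Finset.mem_range.2 hlk, rfl⟩
  have hB' : ∀ v ∈ B, ∃ l < k, π^[l] y = v := fun v hv => by
    obtain ⟨l, hl, rfl⟩ := Finset.mem_image.1 hv
    exact ⟨l, Finset.mem_range.1 hl, rfl⟩
  have hg : ∀ v ∈ B, g v = π v := fun v hv => Finset.piecewise_eq_of_mem _ _ _ hv
  have hit : ∀ m ≤ k, g^[m] y = π^[m] y := fun m hm =>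
    iterate_congr_of fun l hlm => (hg _ (hB l (by omega))).symm
  have hBη : ∀ v ∈ B, v ∉ futureSet T 0 := fun v hv => by
    obtain ⟨l, hlk, rfl⟩ := hB' v hv
    exact hl l hlk
  have hforest : IsForest latNbrs B g := by
    refine ⟨fun v hv => ?_, fun v hv => Finset.piecewise_eq_of_notMem _ _ _ hv, fun v => ?_⟩
    · rw [hg v hv]
      exact h.lat _ _ (h.edge v)
    · by_cases hv : v ∈ B
      · obtain ⟨l, hlk, rfl⟩ := hB' v hv
        refine ⟨k - l, fun hc => hBη _ hc ?_⟩
        rwa [← hit l hlk.le, ← Function.iterate_add_apply, Nat.sub_add_cancel hlk.le, hit k le_rfl]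
      · exact ⟨0, hv⟩
  refine ⟨⟨y, B, g⟩, rfl, ⟨hforest, fun v hv => ?_⟩, ⟨hBη, k, ?_⟩, fun e he => ?_⟩
  · obtain ⟨l, hlk, rfl⟩ := hB' v hv
    exact ⟨l, hit l hlk.le⟩
  · show g^[k] y ∈ _
    rwa [hit k le_rfl]
  · obtain ⟨v, hv, rfl⟩ := mem_fEdges.1 (Finset.mem_coe.1 he)
    show s(v, g v) ∈ T
    rw [hg v hv]
    exact h.edge v

theorem exists_isBranch_of_mem_Mset (h : IsParent T π) {y : V4} (hy : y ∈ Mset T α x r) :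
    ∃ i ∈ adm α x r, i.IsBranch T ∧ i.y = y := by
  have hm : ∃ k, π^[k] y ∈ futureSet T 0 := by
    by_contra hc
    push Not at hc
    refine h.pathToMeet_infinite hc (Set.Finite.subset (boxFinset x (3 * r)).finite_toSet ?_)
    exact fun v hv => mem_boxFinset.2 (hy.2.1 hv)
  obtain ⟨k, hk, hl⟩ := exists_first_of hm
  obtain ⟨i, rfl, hv, hb⟩ := exists_isBranch h hk hl
  exact ⟨i, mem_adm.2 ((hb.admissible_iff h hv).2 hy), hb, rfl⟩

theorem IsBranch.compat (h : IsParent T π) (hi : i.Valid) (hj : j.Valid) (hbi : i.IsBranch T)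
    (hbj : j.IsBranch T) : i.Compat j := fun v hvi hvj => by
  rw [← (h.agreeOn_iff (hi.att hbi.1)).2 hbi.2 v hvi, (h.agreeOn_iff (hj.att hbj.1)).2 hbj.2 v hvj]

theorem ncard_Mset_eq (h : IsParent T π) :
    ((Mset T α x r).ncard : ℝ) = ∑ i ∈ adm α x r,
      ind (i.Hits (futureSet T 0)) * ind ((fEdges i.B i.g : Set (Sym2 V4)) ⊆ T) := by
  have hM : Mset T α x r = (((adm α x r).filter (IsBranch T)).image Pattern.y : Finset V4) := by
    ext y
    simp only [Finset.coe_image, Finset.coe_filter, Set.mem_image, Set.mem_ofPred_eq]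
    constructor
    · intro hy
      obtain ⟨i, hi, hb, hiy⟩ := exists_isBranch_of_mem_Mset h hy
      exact ⟨i, ⟨hi, hb⟩, hiy⟩
    · rintro ⟨i, ⟨hi, hb⟩, rfl⟩
      exact (hb.admissible_iff h (mem_adm.1 hi).valid).1 (mem_adm.1 hi)
  rw [hM, Set.ncard_coe_finset, Finset.card_image_of_injOn, Finset.card_filter, Nat.cast_sum]
  · refine Finset.sum_congr rfl fun i _ => ?_
    rw [← ind_and]
    change _ = ind (i.IsBranch T)
    unfold ind
    split_ifs <;> simp
  · intro i hi j hj hij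
    obtain ⟨hi, hbi⟩ := Finset.mem_filter.1 (Finset.mem_coe.1 hi)
    obtain ⟨hj, hbj⟩ := Finset.mem_filter.1 (Finset.mem_coe.1 hj)
    have hvi := (mem_adm.1 hi).valid
    have hvj := (mem_adm.1 hj).valid
    exact eq_of_compat hvi hvj hbi.1 hbj.1 hij (IsBranch.compat h hvi hvj hbi hbj)

theorem ind_mul_ind_eq (h : IsParent T π) (hi : i.Valid) (hj : j.Valid) :
    ind (i.Hits (futureSet T 0)) * ind ((fEdges i.B i.g : Set (Sym2 V4)) ⊆ T) *
      (ind (j.Hits (futureSet T 0)) * ind ((fEdges j.B j.g : Set (Sym2 V4)) ⊆ T)) =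
    ind (i.Pair j (futureSet T 0)) *
      ind ((fEdges (i.B ∪ j.B) (join i j) : Set (Sym2 V4)) ⊆ T) := by
  simp only [← ind_and]
  refine ind_congr ⟨fun ⟨hbi, hbj⟩ => ?_, fun ⟨⟨h1, hc⟩, h2⟩ => ?_⟩
  · have hc := IsBranch.compat h hi hj hbi hbj
    refine ⟨⟨⟨hbi.1, hbj.1⟩, hc⟩, ?_⟩
    rw [hc.fEdges_join, Finset.coe_union]
    exact Set.union_subset hbi.2 hbj.2
  · rw [hc.fEdges_join, Finset.coe_union, Set.union_subset_iff] at h2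
    exact ⟨⟨h1.1, h2.1⟩, h1.2, h2.2⟩

theorem sq_ncard_Mset_eq (h : IsParent T π) :
    ((Mset T α x r).ncard : ℝ) ^ 2 = ∑ i ∈ adm α x r, ∑ j ∈ adm α x r,
      ind (i.Pair j (futureSet T 0)) *
        ind ((fEdges (i.B ∪ j.B) (join i j) : Set (Sym2 V4)) ⊆ T) := by
  rw [ncard_Mset_eq h, sq, Finset.sum_mul_sum]
  exact Finset.sum_congr rfl fun i hi => Finset.sum_congr rfl fun j hj =>
    ind_mul_ind_eq h (mem_adm.1 hi).valid (mem_adm.1 hj).valid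

end Pattern

end TreeBranches

section ConditionalVariance

open Pattern

variable {Ω : Type*} [MeasurableSpace Ω] {P : Measure Ω} {𝔗 : Ω → Set (Sym2 V4)}

theorem condExp_sum_pattern {ι : Type*} (hU : IsUST4 P 𝔗)
    (hm : futureSigma 𝔗 ≤ ‹MeasurableSpace Ω›) (s : Finset ι) {p : ι → Set V4 → Prop}
    {B : ι → Finset V4} {g : ι → V4 → V4} {N : ℕ} (hloc : ∀ a ∈ s, LocalOn N (p a))
    (hp : ∀ a ∈ s, ∀ A, p a A → Att A (B a) (g a)) {F : Ω → ℝ}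
    (hF : ∀ᵐ ω ∂P, F ω = ∑ a ∈ s, ind (p a (futureSet (𝔗 ω) 0)) *
      ind ((fEdges (B a) (g a) : Set (Sym2 V4)) ⊆ 𝔗 ω)) :
    P[F | futureSigma 𝔗] =ᵐ[P] fun ω =>
      ∑ a ∈ s, ind (p a (futureSet (𝔗 ω) 0)) * cylLim (futureSet (𝔗 ω) 0) (B a) := by
  have hF' : F =ᵐ[P] ∑ a ∈ s, fun ω => ind (p a (futureSet (𝔗 ω) 0)) *
      ind ((fEdges (B a) (g a) : Set (Sym2 V4)) ⊆ 𝔗 ω) := by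
    filter_upwards [hF] with ω hω
    rw [hω, Finset.sum_apply]
  refine (condExp_congr_ae hF').trans ((condExp_finsetSum (fun a ha =>
    (integral_pattern_eq hU (hloc a ha) (hp a ha)).1) _).trans ?_)
  have := (Finset.eventually_all s).2 fun a ha => condExp_pattern hU hm (hloc a ha) (hp a ha)
  filter_upwards [this] with ω hω
  rw [Finset.sum_apply]
  exact Finset.sum_congr rfl hω

theorem condExp_ncard_Mset (hU : IsUST4 P 𝔗) (hm : futureSigma 𝔗 ≤ ‹MeasurableSpace Ω›)
    (α : ℝ) (x : V4) (r : ℕ) :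
    P[fun ω => ((Mset (𝔗 ω) α x r).ncard : ℝ) | futureSigma 𝔗] =ᵐ[P] fun ω =>
      ∑ i ∈ adm α x r, ind (i.Hits (futureSet (𝔗 ω) 0)) * cylLim (futureSet (𝔗 ω) 0) i.B := by
  obtain ⟨N, hN⟩ := (eventually_subset_boxV (boxFinset x (3 * r))).exists
  refine condExp_sum_pattern hU hm (adm α x r) (g := Pattern.g)
    (fun i hi => (mem_adm.1 hi).localOn_hits hN) (fun i hi => (mem_adm.1 hi).att_hits) ?_
  filter_upwards [ae_oneEnded hU] with ω hω
  obtain ⟨π, h⟩ := hω.exists_parent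
  exact ncard_Mset_eq h

theorem condExp_sq_ncard_Mset (hU : IsUST4 P 𝔗) (hm : futureSigma 𝔗 ≤ ‹MeasurableSpace Ω›)
    (α : ℝ) (x : V4) (r : ℕ) :
    P[fun ω => ((Mset (𝔗 ω) α x r).ncard : ℝ) ^ 2 | futureSigma 𝔗] =ᵐ[P] fun ω =>
      ∑ i ∈ adm α x r, ∑ j ∈ adm α x r,
        ind (i.Pair j (futureSet (𝔗 ω) 0)) * cylLim (futureSet (𝔗 ω) 0) (i.B ∪ j.B) := by
  obtain ⟨N, hN⟩ := (eventually_subset_boxV (boxFinset x (3 * r))).exists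
  simp only [← Finset.sum_product']
  refine condExp_sum_pattern hU hm (adm α x r ×ˢ adm α x r)
    (N := N) (p := fun a => a.1.Pair a.2) (g := fun a => join a.1 a.2)
    (fun a ha => ?_) (fun a ha => ?_) ?_
  · obtain ⟨h1, h2⟩ := Finset.mem_product.1 ha
    exact (mem_adm.1 h1).localOn_pair (mem_adm.1 h2) hN
  · obtain ⟨h1, h2⟩ := Finset.mem_product.1 ha
    exact (mem_adm.1 h1).att_pair (mem_adm.1 h2)
  · filter_upwards [ae_oneEnded hU] with ω hω
    obtain ⟨π, h⟩ := hω.exists_parent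
    rw [sq_ncard_Mset_eq h, Finset.sum_product]

end ConditionalVariance

/-- **Conditional variance upper bound for `M_α(x,r)`** (Proposition 2.8): there is a
universal constant `C` such that for every `α > 0`, `x ∈ ℤ⁴` and `r ≥ 2`, almost surely
`Var^η(|M_α(x,r)|) ≤ C α (r⁶/log r) Cap(η ∩ Λ(x,3r))`, where `η = Γ(0,∞)`. -/
theorem Mset_conditional_variance_upper
    {Ω : Type*} [MeasurableSpace Ω] (P : Measure Ω) (𝔗 : Ω → Set (Sym2 V4))
    (hUST : IsUST4 P 𝔗) :
    ∃ C : ℝ, 0 < C ∧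
      ∀ (α : ℝ), 0 < α → ∀ (x : V4) (r : ℕ), 2 ≤ r →
        ∀ᵐ ω ∂P,
          (P[(fun ω' => ((Mset (𝔗 ω') α x r).ncard : ℝ) ^ 2) | futureSigma 𝔗]) ω -
              ((P[(fun ω' => ((Mset (𝔗 ω') α x r).ncard : ℝ)) | futureSigma 𝔗]) ω) ^ 2 ≤
            C * α * ((r : ℝ) ^ 6 / Real.log r) *
              cap4 (futureSet (𝔗 ω) 0 ∩ boxSet x (3 * r)) := by
  refine ⟨53 ^ 3 / 1024, by norm_num, fun α hα x r hr => ?_⟩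
  by_cases hm : futureSigma 𝔗 ≤ ‹MeasurableSpace Ω›
  · filter_upwards [condExp_ncard_Mset hUST hm α x r, condExp_sq_ncard_Mset hUST hm α x r]
      with ω h1 h2
    rw [h1, h2]
    exact Pattern.sum_covariance_cylLim_le hα hr _
  · refine .of_forall fun ω => ?_
    have h0 : 0 ≤ Real.log r := Real.log_natCast_nonneg r
    rw [condExp_of_not_le hm, condExp_of_not_le hm]
    refine le_of_eq_of_le (b := 0) (by simp) (mul_nonneg ?_ (cap4_nonneg _))
    positivity
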